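/- Let f : ℝⁿ → ℝ be a smooth strictly convex function with positive definite Hessian whose Hessian matrix x ↦ Hess f(x) is ℤⁿ-periodic, and let A : ℝⁿ → ℝ be a smooth ℤⁿ-periodic function with ∫_{[0,1]ⁿ} A dx = 0. Then there exists a smooth ℤⁿ-periodic function φ : ℝⁿ → ℝ such that u(x) = f(x) + φ(x) has positive definite Hessian and satisfies Abreu's equation Σ_{i,j} ∂²u^{ij}/∂x_i∂x_j = A on ℝⁿ. -/

import Mathlib

open MeasureTheory Matrix

/-- Partial derivative in the `i`-th coordinate direction. -/
noncomputable def pd {n : ℕ} (i : Fin n) (f : (Fin n → ℝ) → ℝ) (x : Fin n → ℝ) : ℝ :=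
  fderiv ℝ f x (Pi.single i 1)

/-- Hessian matrix `(u_{ij})` of `u` at `x`. -/
noncomputable def hess {n : ℕ} (u : (Fin n → ℝ) → ℝ) (x : Fin n → ℝ) :
    Matrix (Fin n) (Fin n) ℝ :=
  Matrix.of fun i j => pd i (pd j u) x

/-- `f : ℝⁿ → ℝ` is ℤⁿ-periodic. -/
def ZPer {n : ℕ} (f : (Fin n → ℝ) → ℝ) : Prop :=
  ∀ (x : Fin n → ℝ) (k : Fin n → ℤ), f (x + fun i => (k i : ℝ)) = f x

/-- Abreu's operator `∑_{i,j} ∂²u^{ij}/∂x_i∂x_j`, where `(u^{ij})` is the inverse Hessian. -/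
noncomputable def abreuOp {n : ℕ} (u : (Fin n → ℝ) → ℝ) (x : Fin n → ℝ) : ℝ :=
  ∑ i, ∑ j, pd i (pd j (fun z => (hess u z)⁻¹ i j)) x

namespace Abreu
noncomputable section

section

/-- The ring of families, indexed by `ι`, of smooth functions on `ℝⁿ`. -/
def smoothFamilies (ι : Type) (n : ℕ) : Subalgebra ℝ (ι → (Fin n → ℝ) → ℝ) where
  carrier := {f | ∀ i, ContDiff ℝ (⊤ : ℕ∞) (f i)}
  mul_mem' {f g} hf hg i := ContDiff.mul (hf i) (hg i)
  add_mem' {f g} hf hg i := ContDiff.add (hf i) (hg i)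
  algebraMap_mem' c i := by
    show ContDiff ℝ (⊤ : ℕ∞) (fun _ => c)
    exact contDiff_const

/-- The type of families, indexed by `ι`, of smooth functions on `ℝⁿ`. -/
def SF (ι : Type) (n : ℕ) : Type := smoothFamilies ι n

instance (ι : Type) (n : ℕ) : CommRing (SF ι n) := inferInstanceAs (CommRing (smoothFamilies ι n))

instance (ι : Type) (n : ℕ) : Algebra ℝ (SF ι n) :=
  inferInstanceAs (Algebra ℝ (smoothFamilies ι n))

variable {ι : Type} {n : ℕ}

/-- Evaluation at an index and a point, a ring homomorphism. -/
def ev (p : ι × (Fin n → ℝ)) : SF ι n →ₐ[ℝ] ℝ :=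
  ((Pi.evalAlgHom ℝ (fun _ => ℝ) p.2).comp
    (Pi.evalAlgHom ℝ (fun _ : ι => (Fin n → ℝ) → ℝ) p.1)).comp (smoothFamilies ι n).val

/-- The member of a family at an index, as a function. -/
def SF.fn (f : SF ι n) (i : ι) : (Fin n → ℝ) → ℝ := f.1 i

lemma SF.smooth (f : SF ι n) (i : ι) : ContDiff ℝ (⊤ : ℕ∞) (f.fn i) := f.2 i

lemma SF.diff (f : SF ι n) (i : ι) : Differentiable ℝ (f.fn i) :=
  (f.smooth i).differentiable (by simp)

lemma ev_eq (p : ι × (Fin n → ℝ)) (f : SF ι n) : ev p f = f.fn p.1 p.2 := rfl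

lemma SF.ext_ev {f g : SF ι n} (h : ∀ p, ev p f = ev p g) : f = g := by
  apply Subtype.ext
  funext i x
  exact h (i, x)

lemma contDiff_dir {f : (Fin n → ℝ) → ℝ} (hf : ContDiff ℝ (⊤ : ℕ∞) f) (v : Fin n → ℝ) :
    ContDiff ℝ (⊤ : ℕ∞) fun x => fderiv ℝ f x v :=
  (hf.fderiv_right (m := (⊤ : ℕ∞)) (by simp)).clm_apply contDiff_const

/-- Derivation along a constant vector field. -/
def dv (v : Fin n → ℝ) : Derivation ℝ (SF ι n) (SF ι n) where
  toFun f := ⟨fun i x => fderiv ℝ (f.fn i) x v, fun i => contDiff_dir (f.smooth i) v⟩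
  map_add' f g := by
    apply SF.ext_ev
    intro p
    show fderiv ℝ (f.fn p.1 + g.fn p.1) p.2 v = _
    rw [fderiv_add (f.diff p.1 p.2) (g.diff p.1 p.2)]
    rfl
  map_smul' c f := by
    apply SF.ext_ev
    intro p
    show fderiv ℝ (c • f.fn p.1) p.2 v = _
    rw [fderiv_const_smul (f.diff p.1 p.2)]
    rfl
  map_one_eq_zero' := by
    apply SF.ext_ev
    intro p
    show fderiv ℝ (fun _ => (1 : ℝ)) p.2 v = 0
    simp
  leibniz' f g := by
    apply SF.ext_ev
    intro p
    show fderiv ℝ (f.fn p.1 * g.fn p.1) p.2 v = _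
    rw [fderiv_mul (f.diff p.1 p.2) (g.diff p.1 p.2)]
    rfl

lemma ev_dv (v : Fin n → ℝ) (f : SF ι n) (p : ι × (Fin n → ℝ)) :
    ev p (dv v f) = fderiv ℝ (f.fn p.1) p.2 v := rfl

lemma dv_comm (v w : Fin n → ℝ) (f : SF ι n) : dv v (dv w f) = dv w (dv v f) := by
  apply SF.ext_ev
  intro p
  have hs : IsSymmSndFDerivAt ℝ (f.fn p.1) p.2 :=
    ((f.smooth p.1).contDiffAt).isSymmSndFDerivAt (by
      rw [minSmoothness_of_isRCLikeNormedField]; exact WithTop.coe_le_coe.2 (le_top : (2 : ℕ∞) ≤ ⊤))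
  have key : ∀ a b : Fin n → ℝ, ev p (dv a (dv b f)) = fderiv ℝ (fderiv ℝ (f.fn p.1)) p.2 a b := by
    intro a b
    show fderiv ℝ (fun y => fderiv ℝ (f.fn p.1) y b) p.2 a = _
    have hd : DifferentiableAt ℝ (fderiv ℝ (f.fn p.1)) p.2 :=
      (((f.smooth p.1).fderiv_right (m := (⊤ : ℕ∞)) (by simp)).differentiable (by simp)) p.2
    rw [fderiv_clm_apply hd (differentiableAt_const _)]
    simp
  rw [key, key]
  exact hs v w

/-- Coordinate derivation. -/
def dd (i : Fin n) : Derivation ℝ (SF ι n) (SF ι n) := dv (Pi.single i 1)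

lemma dd_comm (i j : Fin n) (f : SF ι n) : dd i (dd j f) = dd j (dd i f) := dv_comm _ _ f

lemma dv_eq_sum (v : Fin n → ℝ) (f : SF ι n) : dv v f = ∑ i, v i • dd i f := by
  apply SF.ext_ev
  intro p
  have : v = ∑ i, v i • (Pi.single i (1 : ℝ) : Fin n → ℝ) := by
    ext j; simp [Finset.sum_apply, Pi.single_apply]
  rw [map_sum]
  simp only [map_smul]
  rw [ev_dv]
  conv_lhs => rw [this]
  rw [map_sum]
  simp only [map_smul]
  rfl

/-- Periodicity of every member of a family. -/
def Per (f : SF ι n) : Prop := ∀ i, ZPer (f.fn i)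

lemma ZPer.exists_max {f : (Fin n → ℝ) → ℝ} (hf : ZPer f) (hc : Continuous f) :
    ∃ x₀, ∀ x, f x ≤ f x₀ := by
  obtain ⟨x₀, -, h⟩ := (isCompact_Icc (a := (0 : Fin n → ℝ)) (b := 1)).exists_isMaxOn
    ⟨0, by simp⟩ hc.continuousOn
  refine ⟨x₀, fun x => ?_⟩
  have h1 : f x = f (fun i => Int.fract (x i)) := by
    rw [← hf x (fun i => -⌊x i⌋)]
    congr 1
    ext i
    simp [Int.fract, sub_eq_add_neg]
  rw [h1]
  refine h ⟨fun i => Int.fract_nonneg _, fun i => (Int.fract_lt_one _).le⟩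

lemma Per.dir {f : SF ι n} (hf : Per f) (v : Fin n → ℝ) : Per (dv v f) := by
  intro i x k
  have : f.fn i = fun y => f.fn i (y + fun j => (k j : ℝ)) := by
    funext y; exact (hf i y k).symm
  show fderiv ℝ (f.fn i) (x + _) v = fderiv ℝ (f.fn i) x v
  conv_rhs => rw [this]
  rw [fderiv_comp_add_right]

lemma deriv2_nonpos_of_max {g : ℝ → ℝ} (hg : ContDiff ℝ (⊤ : ℕ∞) g) (h : ∀ t, g t ≤ g 0) :
    deriv (deriv g) 0 ≤ 0 := by
  by_contra hpos
  push Not at hpos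
  have hm : IsLocalMax g 0 := Filter.Eventually.of_forall h
  have h0 : deriv g 0 = 0 := hm.deriv_eq_zero
  have hmin : IsLocalMin g 0 := isLocalMin_of_deriv_deriv_pos hpos h0 hg.continuous.continuousAt
  have hc : g =ᶠ[nhds 0] fun _ => g 0 := by
    filter_upwards [hmin] with t ht
    exact le_antisymm (h t) ht
  have : deriv (deriv g) 0 = 0 := by
    have h1 : deriv g =ᶠ[nhds 0] fun _ => 0 := by
      have := hc.deriv
      simpa using this
    rw [h1.deriv_eq]; simp
  linarith

lemma max_principle {f : SF ι n} {i : ι} {x₀ : Fin n → ℝ} (h : ∀ x, f.fn i x ≤ f.fn i x₀)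
    (v : Fin n → ℝ) : ev (i, x₀) (dv v f) = 0 ∧ ev (i, x₀) (dv v (dv v f)) ≤ 0 := by
  constructor
  · have : IsLocalMax (f.fn i) x₀ := Filter.Eventually.of_forall h
    rw [ev_dv, this.fderiv_eq_zero]; rfl
  · set γ : ℝ → Fin n → ℝ := fun t => x₀ + t • v
    have hγ : ∀ t, HasDerivAt γ v t := fun t => by
      have := ((hasDerivAt_id t).smul_const v).const_add x₀
      rw [one_smul] at this
      exact this
    have hd : ∀ (k : SF ι n) t, HasDerivAt (fun t => k.fn i (γ t)) ((dv v k).fn i (γ t)) t := by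
      intro k t
      exact ((k.diff i (γ t)).hasFDerivAt).comp_hasDerivAt t (hγ t)
    have h1 : deriv (fun t => f.fn i (γ t)) = fun t => (dv v f).fn i (γ t) := by
      funext t; exact (hd f t).deriv
    have h2 : deriv (deriv (fun t => f.fn i (γ t))) 0 = (dv v (dv v f)).fn i (γ 0) := by
      rw [h1]; exact (hd _ 0).deriv
    have hγ0 : γ 0 = x₀ := by simp [γ]
    have h3 := deriv2_nonpos_of_max (g := fun t => f.fn i (γ t)) ?_ ?_
    · rw [h2, hγ0] at h3; exact h3
    · exact (f.smooth i).comp (contDiff_const.add (contDiff_id.smul contDiff_const))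
    · intro t
      simp only [hγ0]; exact h _

end

section

section Alg
variable {n : ℕ} {R : Type*} [CommRing R] [Algebra ℝ R] (D : Derivation ℝ R R)

lemma map_deriv_mul (M N : Matrix (Fin n) (Fin n) R) :
    (M * N).map D = M.map D * N + M * N.map D := by
  ext i j
  simp only [Matrix.map_apply, Matrix.mul_apply, Matrix.add_apply, map_sum, Derivation.leibniz,
    smul_eq_mul, Finset.sum_add_distrib]
  rw [add_comm]
  congr 1
  exact Finset.sum_congr rfl fun k _ => mul_comm _ _

lemma map_deriv_inv {a G : Matrix (Fin n) (Fin n) R} (h : a * G = 1) :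
    a.map D = -(a * G.map D * a) := by
  have h' : G * a = 1 := mul_eq_one_comm.1 h
  have h1 : (a * G).map D = 0 := by
    rw [h]
    ext i j
    by_cases hij : i = j
    · subst hij; simp
    · simp [Matrix.one_apply_ne hij]
  rw [map_deriv_mul] at h1
  have h2 : (a.map D * G + a * G.map D) * a = 0 := by rw [h1, Matrix.zero_mul]
  rw [Matrix.add_mul, Matrix.mul_assoc, h', Matrix.mul_one] at h2
  exact eq_neg_of_add_eq_zero_left h2

lemma deriv_prod {α : Type*} [DecidableEq α] (s : Finset α) (f : α → R) :
    D (∏ i ∈ s, f i) = ∑ k ∈ s, ∏ i ∈ s, (if i = k then D (f i) else f i) := by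
  induction s using Finset.induction_on with
  | empty => simp
  | insert b s hb ih =>
    rw [Finset.prod_insert hb, Derivation.leibniz, ih, Finset.sum_insert hb,
      Finset.prod_insert hb, if_pos rfl]
    have h1 : ∏ i ∈ s, (if i = b then D (f i) else f i) = ∏ i ∈ s, f i := by
      refine Finset.prod_congr rfl fun i hi => ?_
      rw [if_neg]; rintro rfl; exact hb hi
    have h2 : ∀ k ∈ s, ∏ i ∈ insert b s, (if i = k then D (f i) else f i)
        = f b * ∏ i ∈ s, (if i = k then D (f i) else f i) := by
      intro k hk
      rw [Finset.prod_insert hb, if_neg]; rintro rfl; exact hb hk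
    rw [h1, Finset.sum_congr rfl h2, smul_eq_mul, smul_eq_mul, Finset.mul_sum]
    ring

lemma deriv_det (M : Matrix (Fin n) (Fin n) R) :
    D M.det = trace (M.adjugate * M.map D) := by
  have h1 : D M.det = ∑ k, (M.updateCol k (fun i => D (M i k))).det := by
    simp only [Matrix.det_apply']
    rw [map_sum, Finset.sum_comm]
    refine Finset.sum_congr rfl fun σ _ => ?_
    rw [Derivation.leibniz, deriv_prod]
    have : D ((Equiv.Perm.sign σ : ℤ) : R) = 0 := by
      rcases Int.units_eq_one_or (Equiv.Perm.sign σ) with h | h <;> simp [h]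
    rw [this, smul_zero, add_zero, smul_eq_mul, Finset.mul_sum]
    refine Finset.sum_congr rfl fun k _ => ?_
    congr 1
    refine Finset.prod_congr rfl fun i _ => ?_
    rw [Matrix.updateCol_apply]
    by_cases h : i = k
    · subst h; simp
    · simp [h]
  rw [h1, Matrix.trace]
  refine Finset.sum_congr rfl fun k _ => ?_
  have : (M.updateCol k (fun i => D (M i k))).det = M.cramer (fun i => D (M i k)) k := by
    rw [Matrix.cramer_apply]
  rw [this, Matrix.cramer_eq_adjugate_mulVec, Matrix.diag_apply, Matrix.mul_apply]
  rfl

end Alg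

end

section

variable {ι : Type} {n : ℕ}

/-- Real matrices as constant matrices of families of functions. -/
def cm (M : Matrix (Fin n) (Fin n) ℝ) : Matrix (Fin n) (Fin n) (SF ι n) :=
  M.map (algebraMap ℝ (SF ι n))

lemma cm_mul (M N : Matrix (Fin n) (Fin n) ℝ) : (cm (M * N) : Matrix _ _ (SF ι n)) = cm M * cm N :=
  Matrix.map_mul

lemma cm_one : (cm (1 : Matrix (Fin n) (Fin n) ℝ) : Matrix _ _ (SF ι n)) = 1 :=
  Matrix.map_one _ (map_zero _) (map_one _)

lemma cm_transpose (M : Matrix (Fin n) (Fin n) ℝ) : (cm Mᵀ : Matrix _ _ (SF ι n)) = (cm M)ᵀ := rfl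

lemma deriv_cm (D : Derivation ℝ (SF ι n) (SF ι n)) (M : Matrix (Fin n) (Fin n) ℝ) :
    (cm M).map D = 0 := by
  ext1 i j
  simp [cm]

/-- A family of solutions of Abreu's equation in the form `Δ' L = N - A`, expressed in a linear
frame `vec` of `ℝⁿ`. -/
structure Data (ι : Type) (n : ℕ) where
  vec : Fin n → Fin n → ℝ
  φ : SF ι n
  A : SF ι n
  L : SF ι n
  a : Matrix (Fin n) (Fin n) (SF ι n)
  Q : Matrix (Fin n) (Fin n) ℝ
  Θ : Matrix (Fin n) (Fin n) ℝ
  Qsymm : Qᵀ = Q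
  QΘ : Q * Θ = 1
  inv : a * (cm Q + Matrix.of fun i j => dv (vec i) (dv (vec j) φ)) = 1
  E1 : ∀ k, dv (vec k) L = ∑ i, ∑ j, a i j * dv (vec k) (dv (vec i) (dv (vec j) φ))
  E2 : ∑ i, ∑ j, a i j * dv (vec i) (dv (vec j) L)
    = ∑ i, ∑ j, a i j * (dv (vec i) L * dv (vec j) L) - A

namespace Data
variable (d : Data ι n)

/-- Frame derivations. -/
def D (i : Fin n) : Derivation ℝ (SF ι n) (SF ι n) := dv (d.vec i)

lemma comm (i j : Fin n) (f : SF ι n) : d.D i (d.D j f) = d.D j (d.D i f) := dv_comm _ _ f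

/-- Hessian in the frame. -/
def hes (f : SF ι n) : Matrix (Fin n) (Fin n) (SF ι n) := Matrix.of fun i j => d.D i (d.D j f)

/-- Hessian of the potential. -/
def G : Matrix (Fin n) (Fin n) (SF ι n) := cm d.Q + d.hes d.φ

lemma aG : d.a * d.G = 1 := d.inv

lemma Ga : d.G * d.a = 1 := mul_eq_one_comm.1 d.inv

lemma hes_symm (f : SF ι n) : (d.hes f)ᵀ = d.hes f := by
  ext1 i j; exact d.comm j i f

lemma G_symm : d.Gᵀ = d.G := by
  rw [G, Matrix.transpose_add, hes_symm, ← cm_transpose, d.Qsymm]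

lemma a_symm : d.aᵀ = d.a := by
  have h : d.aᵀ * d.G = 1 := by
    rw [← d.G_symm, ← Matrix.transpose_mul, d.Ga, Matrix.transpose_one]
  calc d.aᵀ = d.aᵀ * (d.G * d.a) := by rw [d.Ga, Matrix.mul_one]
    _ = d.a := by rw [← Matrix.mul_assoc, h, Matrix.one_mul]

lemma ΘQ : d.Θ * d.Q = 1 := mul_eq_one_comm.1 d.QΘ

lemma Θsymm : d.Θᵀ = d.Θ := by
  have h : d.Θᵀ * d.Q = 1 := by
    rw [← d.Qsymm, ← Matrix.transpose_mul, d.QΘ, Matrix.transpose_one]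
  calc d.Θᵀ = d.Θᵀ * (d.Q * d.Θ) := by rw [d.QΘ, Matrix.mul_one]
    _ = d.Θ := by rw [← Matrix.mul_assoc, h, Matrix.one_mul]

/-- The operator `Δ' f = ∑ a i j ∂ᵢ∂ⱼ f`. -/
def lap (f : SF ι n) : SF ι n := trace (d.a * d.hes f)

/-- The metric pairing of gradients. -/
def gam (f g : SF ι n) : SF ι n := ∑ i, ∑ j, d.a i j * (d.D i f * d.D j g)

lemma lap_eq (f : SF ι n) : d.lap f = ∑ i, ∑ j, d.a i j * d.D i (d.D j f) := by
  simp only [lap, Matrix.trace, Matrix.diag_apply, Matrix.mul_apply]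
  refine Finset.sum_congr rfl fun i _ => Finset.sum_congr rfl fun j _ => ?_
  congr 1; exact d.comm j i f

lemma lap_L : d.lap d.L = d.gam d.L d.L - d.A := by
  rw [lap_eq]; exact d.E2

/-- Derivative of the Hessian of the potential. -/
def G1 (k : Fin n) : Matrix (Fin n) (Fin n) (SF ι n) := d.G.map (d.D k)

lemma G1_apply (k i j : Fin n) : d.G1 k i j = d.D k (d.D i (d.D j d.φ)) := by
  simp [G1, G, cm, hes]

lemma D_L (k : Fin n) : d.D k d.L = trace (d.a * d.G1 k) := by
  refine (d.E1 k).trans ?_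
  simp only [Matrix.trace, Matrix.diag_apply, Matrix.mul_apply]
  refine Finset.sum_congr rfl fun i _ => Finset.sum_congr rfl fun j _ => ?_
  rw [G1_apply]
  congr 1
  show d.D k (d.D i (d.D j d.φ)) = _
  rw [d.comm i j]

lemma map_D_a (k : Fin n) : d.a.map (d.D k) = -(d.a * d.G1 k * d.a) :=
  map_deriv_inv _ d.aG

/-- Frame vectors after a change of frame. -/
def fv (P : Matrix (Fin n) (Fin n) ℝ) (k : Fin n) : Fin n → ℝ := fun l => ∑ j, P j k * d.vec j l

lemma dv_fv (P : Matrix (Fin n) (Fin n) ℝ) (k : Fin n) (f : SF ι n) :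
    dv (d.fv P k) f = ∑ j, P j k • d.D j f := by
  apply SF.ext_ev
  intro p
  have : d.fv P k = ∑ j, P j k • d.vec j := by
    ext l; simp [fv]
  rw [ev_dv, this, map_sum, map_sum]
  simp only [map_smul]
  rfl

lemma hes_fv (P : Matrix (Fin n) (Fin n) ℝ) (f : SF ι n) :
    (Matrix.of fun i j => dv (d.fv P i) (dv (d.fv P j) f)) = (cm P)ᵀ * d.hes f * cm P := by
  ext1 i j
  rw [Matrix.of_apply, dv_fv, dv_fv]
  simp only [map_sum, Derivation.map_smul, Matrix.mul_apply, cm, Matrix.transpose_apply,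
    Matrix.map_apply, hes, Matrix.of_apply, Finset.smul_sum, Finset.sum_mul]
  rw [Finset.sum_comm]
  refine Finset.sum_congr rfl fun k _ => Finset.sum_congr rfl fun l _ => ?_
  rw [Algebra.smul_def, Algebra.smul_def]; ring

lemma outer_fv (P : Matrix (Fin n) (Fin n) ℝ) (f g : SF ι n) :
    (Matrix.of fun i j => dv (d.fv P i) f * dv (d.fv P j) g)
      = (cm P)ᵀ * (Matrix.of fun i j => d.D i f * d.D j g) * cm P := by
  ext1 i j
  rw [Matrix.of_apply, dv_fv, dv_fv]
  simp only [Matrix.mul_apply, cm, Matrix.transpose_apply,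
    Matrix.map_apply, Matrix.of_apply, Finset.sum_mul, Finset.mul_sum]
  refine Finset.sum_congr rfl fun k _ => Finset.sum_congr rfl fun l _ => ?_
  rw [Algebra.smul_def, Algebra.smul_def]; ring

lemma cm_mul_cm {P P' : Matrix (Fin n) (Fin n) ℝ} (h : P * P' = 1) :
    (cm P * cm P' : Matrix _ _ (SF ι n)) = 1 := by rw [← cm_mul, h, cm_one]

/-- The matrix `a` after a change of frame with inverse `P'`. -/
def fa (P' : Matrix (Fin n) (Fin n) ℝ) : Matrix (Fin n) (Fin n) (SF ι n) := cm P' * d.a * (cm P')ᵀ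

lemma fa_mul {P P' : Matrix (Fin n) (Fin n) ℝ} (h : P * P' = 1)
    (M : Matrix (Fin n) (Fin n) (SF ι n)) :
    d.fa P' * ((cm P)ᵀ * M * cm P) = cm P' * (d.a * M) * cm P := by
  have e : d.fa P' * ((cm P)ᵀ * M * cm P) = cm P' * (d.a * ((cm P * cm P')ᵀ) * M) * cm P := by
    rw [Matrix.transpose_mul, fa]; simp only [Matrix.mul_assoc]
  rw [e, cm_mul_cm h, Matrix.transpose_one, Matrix.mul_one]

lemma trace_conj {P P' : Matrix (Fin n) (Fin n) ℝ} (h : P * P' = 1)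
    (M : Matrix (Fin n) (Fin n) (SF ι n)) : trace (cm P' * M * cm P) = trace M := by
  rw [Matrix.trace_mul_comm, ← Matrix.mul_assoc, cm_mul_cm h, Matrix.one_mul]

lemma trace_fa {P P' : Matrix (Fin n) (Fin n) ℝ} (h : P * P' = 1)
    (M : Matrix (Fin n) (Fin n) (SF ι n)) :
    trace (d.fa P' * ((cm P)ᵀ * M * cm P)) = trace (d.a * M) := by
  rw [fa_mul d h, trace_conj h]

lemma gam_eq_trace (f g : SF ι n) :
    d.gam f g = trace (d.a * Matrix.of fun i j => d.D i g * d.D j f) := by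
  simp only [gam, Matrix.trace, Matrix.diag_apply, Matrix.mul_apply, Matrix.of_apply]
  exact Finset.sum_congr rfl fun i _ => Finset.sum_congr rfl fun j _ => by ring

lemma map_deriv_conj (D : Derivation ℝ (SF ι n) (SF ι n)) (P : Matrix (Fin n) (Fin n) ℝ)
    (M : Matrix (Fin n) (Fin n) (SF ι n)) :
    ((cm P)ᵀ * M * cm P).map D = (cm P)ᵀ * M.map D * cm P := by
  rw [map_deriv_mul, map_deriv_mul, ← cm_transpose, deriv_cm, deriv_cm]; simp

lemma map_dv_fv (P : Matrix (Fin n) (Fin n) ℝ) (k : Fin n)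
    (M : Matrix (Fin n) (Fin n) (SF ι n)) :
    M.map (dv (d.fv P k)) = ∑ m, P m k • M.map (d.D m) := by
  ext1 i j
  rw [Matrix.map_apply, dv_fv, Matrix.sum_apply]
  rfl

lemma G1_eq_map_hes (k : Fin n) : d.G1 k = (d.hes d.φ).map (d.D k) := by
  ext1 i j; rw [G1_apply]; rfl

/-- Change of frame. -/
def frame (P P' : Matrix (Fin n) (Fin n) ℝ) (h : P * P' = 1) : Data ι n where
  vec := d.fv P
  φ := d.φ
  A := d.A
  L := d.L
  a := d.fa P'
  Q := Pᵀ * d.Q * P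
  Θ := P' * d.Θ * P'ᵀ
  Qsymm := by
    rw [Matrix.transpose_mul, Matrix.transpose_mul, d.Qsymm, Matrix.transpose_transpose,
      Matrix.mul_assoc]
  QΘ := by
    have hP : P' * P = 1 := mul_eq_one_comm.1 h
    calc Pᵀ * d.Q * P * (P' * d.Θ * P'ᵀ) = Pᵀ * (d.Q * (P * P') * d.Θ) * P'ᵀ := by
          simp only [Matrix.mul_assoc]
      _ = 1 := by
          rw [h, Matrix.mul_one, d.QΘ, Matrix.mul_one, ← Matrix.transpose_mul, hP,
            Matrix.transpose_one]
  inv := by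
    rw [hes_fv, cm_mul, cm_mul, cm_transpose, ← Matrix.add_mul, ← Matrix.mul_add]
    have := d.aG
    rw [G] at this
    rw [fa_mul d h, this, Matrix.mul_one, cm_mul_cm (mul_eq_one_comm.1 h)]
  E1 := by
    intro k
    have e : ∑ i, ∑ j, d.fa P' i j * dv (d.fv P k) (dv (d.fv P i) (dv (d.fv P j) d.φ))
        = trace (d.fa P' * ((cm P)ᵀ * (d.hes d.φ).map (dv (d.fv P k)) * cm P)) := by
      rw [← map_deriv_conj, ← hes_fv]
      simp only [Matrix.trace, Matrix.diag_apply, Matrix.mul_apply (M := d.fa P'),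
        Matrix.map_apply, Matrix.of_apply]
      refine Finset.sum_congr rfl fun i _ => Finset.sum_congr rfl fun j _ => ?_
      rw [dv_comm (d.fv P i)]
    rw [e, trace_fa d h, map_dv_fv, Matrix.mul_sum, Matrix.trace_sum, dv_fv]
    refine Finset.sum_congr rfl fun m _ => ?_
    rw [Matrix.mul_smul, Matrix.trace_smul, D_L, G1_eq_map_hes]
  E2 := by
    have g : ∑ i, ∑ j, d.fa P' i j * dv (d.fv P i) (dv (d.fv P j) d.L) = d.lap d.L := by
      rw [lap, ← trace_fa d h, ← hes_fv]
      simp only [Matrix.trace, Matrix.diag_apply, Matrix.mul_apply (M := d.fa P'),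
        Matrix.of_apply]
      refine Finset.sum_congr rfl fun i _ => Finset.sum_congr rfl fun j _ => ?_
      rw [dv_comm (d.fv P i)]
    rw [g, d.lap_L]
    congr 1
    rw [gam_eq_trace, ← trace_fa d h, ← outer_fv]
    simp only [Matrix.trace, Matrix.diag_apply, Matrix.mul_apply (M := d.fa P'), Matrix.of_apply]
    exact Finset.sum_congr rfl fun i _ => Finset.sum_congr rfl fun j _ => by ring

/-- Symmetric pairing of Hessian type. -/
def R : SF ι n := trace (d.a * d.hes d.L * (d.a * d.hes d.L))

/-- Squared length of the third derivatives. -/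
def S : SF ι n := ∑ k, ∑ l, d.a k l * trace (d.a * d.G1 k * (d.a * d.G1 l))

/-- Trace of the Hessian of the potential. -/
def T : SF ι n := trace (cm d.Θ * d.G)

/-- Trace of the inverse Hessian. -/
def τ : SF ι n := trace (d.a * cm d.Q)

section frame
variable (P P' : Matrix (Fin n) (Fin n) ℝ) (h : P * P' = 1)

lemma frame_D (k : Fin n) (f : SF ι n) : (d.frame P P' h).D k f = ∑ j, P j k • d.D j f :=
  d.dv_fv P k f

lemma frame_hes (f : SF ι n) : (d.frame P P' h).hes f = (cm P)ᵀ * d.hes f * cm P := d.hes_fv P f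

lemma frame_G : (d.frame P P' h).G = (cm P)ᵀ * d.G * cm P := by
  rw [G, frame_hes, G, Matrix.mul_add, Matrix.add_mul]
  congr 1
  show cm (Pᵀ * d.Q * P) = _
  rw [cm_mul, cm_mul, cm_transpose]

lemma frame_lap (f : SF ι n) : (d.frame P P' h).lap f = d.lap f := by
  rw [lap, frame_hes]; exact d.trace_fa h _

lemma frame_gam (f g : SF ι n) : (d.frame P P' h).gam f g = d.gam f g := by
  rw [gam_eq_trace, gam_eq_trace, ← d.trace_fa h, ← outer_fv]
  rfl

lemma frame_G1 (k : Fin n) : (d.frame P P' h).G1 k = ∑ m, P m k • ((cm P)ᵀ * d.G1 m * cm P) := by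
  rw [G1, frame_G]
  show ((cm P)ᵀ * d.G * cm P).map (dv (d.fv P k)) = _
  rw [map_deriv_conj, map_dv_fv, Matrix.mul_sum, Matrix.sum_mul]
  refine Finset.sum_congr rfl fun m _ => ?_
  rw [Matrix.mul_smul, Matrix.smul_mul]; rfl

lemma frame_R : (d.frame P P' h).R = d.R := by
  rw [R, frame_hes]
  show trace (d.fa P' * _ * (d.fa P' * _)) = _
  rw [d.fa_mul h]
  have : cm P' * (d.a * d.hes d.L) * cm P * (cm P' * (d.a * d.hes d.L) * cm P)
      = cm P' * (d.a * d.hes d.L * (cm P * cm P') * (d.a * d.hes d.L)) * cm P := by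
    simp only [Matrix.mul_assoc]
  show trace (cm P' * (d.a * d.hes d.L) * cm P * (cm P' * (d.a * d.hes d.L) * cm P)) = _
  rw [this, trace_conj h, cm_mul_cm h, Matrix.mul_one]; rfl

lemma frame_T : (d.frame P P' h).T = d.T := by
  rw [T, frame_G]
  show trace (cm (P' * d.Θ * P'ᵀ) * _) = _
  rw [cm_mul, cm_mul, cm_transpose]
  have e : cm P' * cm d.Θ * (cm P')ᵀ * ((cm P)ᵀ * d.G * cm P)
    = cm P' * (cm d.Θ * ((cm P * cm P')ᵀ) * d.G) * cm P := by
    rw [Matrix.transpose_mul]; simp only [Matrix.mul_assoc]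
  rw [e, trace_conj h, cm_mul_cm h, Matrix.transpose_one, Matrix.mul_one]; rfl

lemma frame_τ : (d.frame P P' h).τ = d.τ := by
  show trace (d.fa P' * cm (Pᵀ * d.Q * P)) = _
  rw [cm_mul, cm_mul, cm_transpose, d.trace_fa h]; rfl

lemma frame_S : (d.frame P P' h).S = d.S := by
  have e : ∀ k l, trace (d.fa P' * (d.frame P P' h).G1 k * (d.fa P' * (d.frame P P' h).G1 l))
      = ∑ m, ∑ q, (P m k * P q l) • trace (d.a * d.G1 m * (d.a * d.G1 q)) := by
    intro k l
    have e1 : ∀ k, d.fa P' * (d.frame P P' h).G1 k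
        = ∑ m, P m k • (cm P' * (d.a * d.G1 m) * cm P) := by
      intro k
      rw [frame_G1, Matrix.mul_sum]
      refine Finset.sum_congr rfl fun m _ => ?_
      rw [Matrix.mul_smul, d.fa_mul h]
    rw [e1, e1, Matrix.sum_mul, Matrix.trace_sum]
    refine Finset.sum_congr rfl fun m _ => ?_
    rw [Matrix.mul_sum, Matrix.trace_sum]
    refine Finset.sum_congr rfl fun q _ => ?_
    rw [Matrix.smul_mul, Matrix.mul_smul, smul_smul, Matrix.trace_smul]
    have : cm P' * (d.a * d.G1 m) * cm P * (cm P' * (d.a * d.G1 q) * cm P)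
      = cm P' * (d.a * d.G1 m * (cm P * cm P') * (d.a * d.G1 q)) * cm P := by
      simp only [Matrix.mul_assoc]
    rw [this, trace_conj h, cm_mul_cm h, Matrix.mul_one]
  set Z : Matrix (Fin n) (Fin n) (SF ι n) :=
    Matrix.of fun m q => trace (d.a * d.G1 m * (d.a * d.G1 q)) with hZ
  have hZs : Zᵀ = Z := by
    ext1 m q
    show trace (d.a * d.G1 q * (d.a * d.G1 m)) = trace (d.a * d.G1 m * (d.a * d.G1 q))
    exact Matrix.trace_mul_comm _ _
  have e2 : ∀ k l, trace (d.fa P' * (d.frame P P' h).G1 k * (d.fa P' * (d.frame P P' h).G1 l))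
      = ((cm P)ᵀ * Z * cm P : Matrix (Fin n) (Fin n) (SF ι n)) k l := by
    intro k l
    rw [e]
    simp only [Matrix.mul_apply, cm, Matrix.transpose_apply, Matrix.map_apply, hZ, Matrix.of_apply,
      Finset.sum_mul]
    rw [Finset.sum_comm]
    refine Finset.sum_congr rfl fun q _ => Finset.sum_congr rfl fun m _ => ?_
    rw [Algebra.smul_def, map_mul]; ring
  have e3 : ∀ (a' M : Matrix (Fin n) (Fin n) (SF ι n)), Mᵀ = M →
      ∑ k, ∑ l, a' k l * M k l = trace (a' * M) := by
    intro a' M hM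
    simp only [Matrix.trace, Matrix.diag_apply, Matrix.mul_apply]
    refine Finset.sum_congr rfl fun i _ => Finset.sum_congr rfl fun j _ => ?_
    rw [← Matrix.transpose_apply M, hM]
  show ∑ k, ∑ l, d.fa P' k l *
    trace (d.fa P' * (d.frame P P' h).G1 k * (d.fa P' * (d.frame P P' h).G1 l)) = _
  simp only [e2]
  rw [e3, d.trace_fa h, ← e3 _ _ hZs]
  · rfl
  · rw [Matrix.transpose_mul, Matrix.transpose_mul, hZs, Matrix.transpose_transpose,
      Matrix.mul_assoc]

end frame
end Data

end

section

variable {ι : Type} {n : ℕ}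

namespace Data
variable (d : Data ι n)

lemma lap_mul (f g : SF ι n) : d.lap (f * g) = f * d.lap g + g * d.lap f + 2 * d.gam f g := by
  have hs : ∀ i j, d.a j i = d.a i j := fun i j => congrFun (congrFun d.a_symm i) j
  have h2 : 2 * d.gam f g = d.gam f g + ∑ i, ∑ j, d.a i j * (d.D i g * d.D j f) := by
    rw [two_mul]; congr 1
    rw [gam, Finset.sum_comm]
    refine Finset.sum_congr rfl fun i _ => Finset.sum_congr rfl fun j _ => ?_
    rw [hs]; ring
  rw [h2, lap_eq, lap_eq, lap_eq, gam]
  simp only [Finset.mul_sum, ← Finset.sum_add_distrib]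
  refine Finset.sum_congr rfl fun i _ => Finset.sum_congr rfl fun j _ => ?_
  simp only [Derivation.leibniz, map_add, smul_eq_mul]
  ring

lemma gam_comm (f g : SF ι n) : d.gam f g = d.gam g f := by
  have hs : ∀ i j, d.a j i = d.a i j := fun i j => congrFun (congrFun d.a_symm i) j
  rw [gam, gam, Finset.sum_comm]
  refine Finset.sum_congr rfl fun i _ => Finset.sum_congr rfl fun j _ => ?_
  rw [hs]; ring

/-- Linear combinations. -/
lemma lap_add (f g : SF ι n) : d.lap (f + g) = d.lap f + d.lap g := by
  simp only [lap_eq, map_add, mul_add, Finset.sum_add_distrib]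

lemma lap_smul (c : ℝ) (f : SF ι n) : d.lap (c • f) = c • d.lap f := by
  simp only [lap_eq, Derivation.map_smul, mul_smul_comm, Finset.smul_sum]

lemma gam_smul (c : ℝ) (f g : SF ι n) : d.gam f (c • g) = c • d.gam f g := by
  simp only [gam, Derivation.map_smul, mul_smul_comm, Finset.smul_sum]

lemma lap_phi : d.lap d.φ = n - d.τ := by
  have : d.hes d.φ = d.G - cm d.Q := by rw [G]; simp
  rw [lap, this, Matrix.mul_sub, Matrix.trace_sub, aG, τ]
  simp

lemma lap_D_phi (k : Fin n) : d.lap (d.D k d.φ) = d.D k d.L := by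
  rw [lap_eq]
  refine Eq.trans ?_ (d.E1 k).symm
  refine Finset.sum_congr rfl fun i _ => Finset.sum_congr rfl fun j _ => ?_
  show _ * d.D i (d.D j (d.D k d.φ)) = _ * d.D k (d.D i (d.D j d.φ))
  rw [d.comm j k, d.comm i k]

/-- Legendre-type dual potential. -/
def ψ : SF ι n :=
  -d.φ - (1 / 2 : ℝ) • ∑ r : Fin n, ∑ s : Fin n, d.Θ r s • (d.D r d.φ * d.D s d.φ)

lemma ψ_eq : d.ψ = -d.φ - (1 / 2 : ℝ) •
    trace (cm d.Θ * Matrix.of fun i j => d.D i d.φ * d.D j d.φ) := by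
  rw [ψ]
  congr 2
  simp only [Matrix.trace, Matrix.diag_apply, Matrix.mul_apply, Matrix.of_apply, cm,
    Matrix.map_apply]
  refine Finset.sum_congr rfl fun i _ => Finset.sum_congr rfl fun j _ => ?_
  rw [Algebra.smul_def]; ring

lemma frame_ψ (P P' : Matrix (Fin n) (Fin n) ℝ) (h : P * P' = 1) :
    (d.frame P P' h).ψ = d.ψ := by
  rw [ψ_eq, ψ_eq]
  congr 2
  have e0 := d.outer_fv P d.φ d.φ
  have e1 : (Matrix.of fun i j => (d.frame P P' h).D i (d.frame P P' h).φ *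
      (d.frame P P' h).D j (d.frame P P' h).φ)
      = (cm P)ᵀ * (Matrix.of fun i j => d.D i d.φ * d.D j d.φ) * cm P := e0
  rw [e1]
  show trace (cm (P' * d.Θ * P'ᵀ) * _) = _
  rw [cm_mul, cm_mul, cm_transpose]
  set M : Matrix (Fin n) (Fin n) (SF ι n) := Matrix.of fun i j => d.D i d.φ * d.D j d.φ
  have e : cm P' * cm d.Θ * (cm P')ᵀ * ((cm P)ᵀ * M * cm P)
    = cm P' * (cm d.Θ * ((cm P * cm P')ᵀ) * M) * cm P := by
    rw [Matrix.transpose_mul]; simp only [Matrix.mul_assoc]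
  rw [e, trace_conj h, cm_mul_cm h, Matrix.transpose_one, Matrix.mul_one]

lemma D_ψ (i : Fin n) : d.D i d.ψ = -∑ r : Fin n, ∑ s : Fin n, d.Θ r s • (d.D r d.φ * d.G s i) := by
  have hG : ∀ s i, d.G s i = algebraMap ℝ _ (d.Q s i) + d.D i (d.D s d.φ) := by
    intro s i
    rw [d.comm]; rfl
  have h1 : ∑ r : Fin n, ∑ s : Fin n, d.Θ r s • (d.D r d.φ * algebraMap ℝ (SF ι n) (d.Q s i)) = d.D i d.φ := by
    have h2 : ∀ r, ∑ s, d.Θ r s • (d.D r d.φ * algebraMap ℝ (SF ι n) (d.Q s i))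
        = (∑ s, d.Θ r s * d.Q s i) • d.D r d.φ := by
      intro r
      rw [Finset.sum_smul]
      refine Finset.sum_congr rfl fun s _ => ?_
      rw [mul_smul, Algebra.smul_def (d.Q s i), mul_comm]
    simp only [h2, ← Matrix.mul_apply, d.ΘQ, Matrix.one_apply]
    simp
  have h3 : ∑ r : Fin n, ∑ s : Fin n, d.Θ r s • (d.D i (d.D r d.φ) * d.D s d.φ)
      = ∑ r : Fin n, ∑ s : Fin n, d.Θ r s • (d.D r d.φ * d.D i (d.D s d.φ)) := by
    rw [Finset.sum_comm]
    refine Finset.sum_congr rfl fun r _ => Finset.sum_congr rfl fun s _ => ?_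
    have : d.Θ s r = d.Θ r s := congrFun (congrFun d.Θsymm r) s
    rw [this, mul_comm]
  have h4 : d.D i (∑ r : Fin n, ∑ s : Fin n, d.Θ r s • (d.D r d.φ * d.D s d.φ))
      = (2 : ℝ) • ∑ r : Fin n, ∑ s : Fin n, d.Θ r s • (d.D r d.φ * d.D i (d.D s d.φ)) := by
    rw [two_smul]
    nth_rw 1 [← h3]
    simp only [map_sum, Derivation.map_smul, Derivation.leibniz, ← Finset.sum_add_distrib,
      ← smul_add, smul_eq_mul]
    refine Finset.sum_congr rfl fun r _ => Finset.sum_congr rfl fun s _ => ?_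
    congr 1; ring
  rw [ψ, map_sub, map_neg, Derivation.map_smul, h4, smul_smul]
  norm_num
  simp only [hG, mul_add, smul_add, Finset.sum_add_distrib, h1]
  ring

/-- `Δ' ψ - ⟨L', ψ'⟩ = n - T`. -/
lemma lap_ψ : d.lap d.ψ - d.gam d.L d.ψ = n - d.T := by
  have hs : ∀ i j, d.a j i = d.a i j := fun i j => congrFun (congrFun d.a_symm i) j
  have hgam : ∀ f, d.gam d.ψ f = -∑ r : Fin n, ∑ s : Fin n, d.Θ r s • (d.D r d.φ * d.D s f) := by
    intro f
    have h1 : ∀ s, ∑ i, ∑ j, d.a i j * (d.G s i * d.D j f) = d.D s f := by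
      intro s
      have : ∀ j, ∑ i, d.a i j * (d.G s i * d.D j f) = (d.G * d.a) s j * d.D j f := by
        intro j
        rw [Matrix.mul_apply, Finset.sum_mul]
        exact Finset.sum_congr rfl fun i _ => by ring
      rw [Finset.sum_comm]
      simp only [this, d.Ga, Matrix.one_apply]
      simp
    rw [gam]
    simp only [D_ψ]
    have h2 : ∀ i j, d.a i j * ((-∑ r : Fin n, ∑ s : Fin n, d.Θ r s • (d.D r d.φ * d.G s i)) * d.D j f)
      = -∑ r : Fin n, ∑ s : Fin n, d.Θ r s • (d.D r d.φ * (d.a i j * (d.G s i * d.D j f))) := by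
      intro i j
      rw [neg_mul, mul_neg]
      congr 1
      simp only [Finset.sum_mul, Finset.mul_sum]
      refine Finset.sum_congr rfl fun r _ => Finset.sum_congr rfl fun s _ => ?_
      simp only [Algebra.smul_def]; ring
    simp only [h2, Finset.sum_neg_distrib]
    congr 1
    have h3 : ∀ i, ∑ j, ∑ r : Fin n, ∑ s : Fin n, d.Θ r s • (d.D r d.φ * (d.a i j * (d.G s i * d.D j f)))
      = ∑ r : Fin n, ∑ s : Fin n, ∑ j : Fin n, d.Θ r s • (d.D r d.φ * (d.a i j * (d.G s i * d.D j f))) := by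
      intro i
      rw [Finset.sum_comm]
      exact Finset.sum_congr rfl fun r _ => Finset.sum_comm
    simp only [h3]
    rw [Finset.sum_comm]
    refine Finset.sum_congr rfl fun r _ => ?_
    rw [Finset.sum_comm]
    refine Finset.sum_congr rfl fun s _ => ?_
    rw [← h1 s]
    simp only [Finset.smul_sum, Finset.mul_sum]
  have hlap : d.lap d.ψ = (n : SF ι n) - d.T - ∑ r : Fin n, ∑ s : Fin n, d.Θ r s • (d.D r d.φ * d.D s d.L) := by
    have hd : ∀ f, d.lap f = ∑ i, ∑ j, d.a i j * d.D j (d.D i f) := by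
      intro f; rw [lap_eq]
      exact Finset.sum_congr rfl fun i _ => Finset.sum_congr rfl fun j _ => by rw [d.comm]
    have h2 : ∀ i j, d.a i j * d.D j (d.D i d.ψ)
      = -∑ r : Fin n, ∑ s : Fin n, d.Θ r s • (d.D r d.φ * (d.a i j * d.D j (d.G s i)))
        -∑ r : Fin n, ∑ s : Fin n, d.Θ r s • (d.D j (d.D r d.φ) * (d.a i j * d.G s i)) := by
      intro i j
      rw [D_ψ, map_neg, mul_neg, ← neg_add', ← Finset.sum_add_distrib]
      congr 1
      simp only [map_sum, Finset.mul_sum, Derivation.map_smul, Derivation.leibniz,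
        ← Finset.sum_add_distrib, smul_eq_mul]
      refine Finset.sum_congr rfl fun r _ => Finset.sum_congr rfl fun s _ => ?_
      simp only [Algebra.smul_def]; ring
    have sw : ∀ F : Fin n → Fin n → Fin n → Fin n → SF ι n,
        ∑ i, ∑ j, ∑ r, ∑ s, F i j r s = ∑ r, ∑ s, ∑ i, ∑ j, F i j r s := by
      intro F
      calc _ = ∑ i, ∑ r, ∑ j, ∑ s, F i j r s := by
            exact Finset.sum_congr rfl fun i _ => Finset.sum_comm
        _ = ∑ r, ∑ i, ∑ j, ∑ s, F i j r s := Finset.sum_comm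
        _ = ∑ r, ∑ i, ∑ s, ∑ j, F i j r s := by
            exact Finset.sum_congr rfl fun r _ => Finset.sum_congr rfl fun i _ => Finset.sum_comm
        _ = _ := Finset.sum_congr rfl fun r _ => Finset.sum_comm
    rw [hd]
    simp only [h2, Finset.sum_sub_distrib, Finset.sum_neg_distrib]
    rw [sw fun i j r s => d.Θ r s • (d.D r d.φ * (d.a i j * d.D j (d.G s i))),
      sw fun i j r s => d.Θ r s • (d.D j (d.D r d.φ) * (d.a i j * d.G s i))]
    have h3 : ∀ s, ∑ i, ∑ j, d.a i j * d.D j (d.G s i) = d.D s d.L := by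
      intro s
      rw [← lap_D_phi, hd]
      refine Finset.sum_congr rfl fun i _ => Finset.sum_congr rfl fun j _ => ?_
      have := d.G1_apply j s i
      rw [G1, Matrix.map_apply] at this
      rw [this, d.comm s i]
    have h4 : ∀ r s, ∑ i, ∑ j, d.D j (d.D r d.φ) * (d.a i j * d.G s i)
        = d.D s (d.D r d.φ) := by
      intro r s
      have : ∀ j, ∑ i, d.D j (d.D r d.φ) * (d.a i j * d.G s i)
          = (d.G * d.a) s j * d.D j (d.D r d.φ) := by
        intro j
        rw [Matrix.mul_apply, Finset.sum_mul]
        exact Finset.sum_congr rfl fun i _ => by ring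
      rw [Finset.sum_comm]
      simp only [this, d.Ga, Matrix.one_apply]
      simp
    have h6 : ∀ r s, ∑ i, ∑ j, d.Θ r s • (d.D r d.φ * (d.a i j * d.D j (d.G s i)))
        = d.Θ r s • (d.D r d.φ * d.D s d.L) := by
      intro r s
      rw [← h3]; simp only [Finset.smul_sum, Finset.mul_sum]
    have h7 : ∀ r s, ∑ i, ∑ j, d.Θ r s • (d.D j (d.D r d.φ) * (d.a i j * d.G s i))
        = d.Θ r s • d.D s (d.D r d.φ) := by
      intro r s
      rw [← h4]; simp only [Finset.smul_sum]
    simp only [h6]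
    simp only [h7]
    have h5 : ∑ r : Fin n, ∑ s : Fin n, d.Θ r s • d.D s (d.D r d.φ) = d.T - n := by
      have : d.hes d.φ = d.G - cm d.Q := by rw [G]; simp
      have e : ∑ r : Fin n, ∑ s : Fin n, d.Θ r s • d.D s (d.D r d.φ) = trace (cm d.Θ * d.hes d.φ) := by
        simp only [Matrix.trace, Matrix.diag_apply, Matrix.mul_apply, cm, Matrix.map_apply]
        refine Finset.sum_congr rfl fun i _ => Finset.sum_congr rfl fun j _ => ?_
        rw [Algebra.smul_def]; rfl
      rw [e, this, Matrix.mul_sub, Matrix.trace_sub, ← cm_mul, d.ΘQ, cm_one, T]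
      simp
    rw [h5]
    ring
  rw [gam_comm, hgam, hlap]
  ring

end Data

end

section

variable {ι : Type} {n : ℕ}

/-- Pointwise exponential. -/
def SF.exp (f : SF ι n) : SF ι n :=
  ⟨fun i x => Real.exp (f.fn i x), fun i => (f.smooth i).exp⟩

lemma ev_exp (p : ι × (Fin n → ℝ)) (f : SF ι n) : ev p f.exp = Real.exp (ev p f) := rfl

lemma dv_exp (v : Fin n → ℝ) (f : SF ι n) : dv v f.exp = f.exp * dv v f := by
  apply SF.ext_ev
  intro p
  rw [ev_dv, map_mul, ev_exp, ev_dv]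
  show fderiv ℝ (fun x => Real.exp (f.fn p.1 x)) p.2 v = _
  rw [fderiv_exp (f.diff p.1 p.2)]
  rfl

namespace Data
variable (d : Data ι n)

/-- Third derivatives of the potential at a point. -/
def j3 (p : ι × (Fin n → ℝ)) (i j k : Fin n) : ℝ := ev p (d.D i (d.D j (d.D k d.φ)))
/-- Fourth derivatives of the potential at a point. -/
def j4 (p : ι × (Fin n → ℝ)) (i j k l : Fin n) : ℝ := ev p (d.D i (d.D j (d.D k (d.D l d.φ))))
/-- Fifth derivatives of the potential at a point. -/
def j5 (p : ι × (Fin n → ℝ)) (i j k l m : Fin n) : ℝ :=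
  ev p (d.D i (d.D j (d.D k (d.D l (d.D m d.φ)))))
/-- First derivatives of `L` at a point. -/
def l1 (p : ι × (Fin n → ℝ)) (i : Fin n) : ℝ := ev p (d.D i d.L)
/-- Second derivatives of `L` at a point. -/
def l2 (p : ι × (Fin n → ℝ)) (i j : Fin n) : ℝ := ev p (d.D i (d.D j d.L))
/-- Third derivatives of `L` at a point. -/
def l3 (p : ι × (Fin n → ℝ)) (i j k : Fin n) : ℝ := ev p (d.D i (d.D j (d.D k d.L)))

section refold
variable (p : ι × (Fin n → ℝ)) (i j k l m : Fin n)
lemma ev_j3 : ev p (d.D i (d.D j (d.D k d.φ))) = d.j3 p i j k := rfl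
lemma ev_j4 : ev p (d.D i (d.D j (d.D k (d.D l d.φ)))) = d.j4 p i j k l := rfl
lemma ev_j5 : ev p (d.D i (d.D j (d.D k (d.D l (d.D m d.φ))))) = d.j5 p i j k l m := rfl
lemma ev_l1 : ev p (d.D i d.L) = d.l1 p i := rfl
lemma ev_l2 : ev p (d.D i (d.D j d.L)) = d.l2 p i j := rfl
lemma ev_l3 : ev p (d.D i (d.D j (d.D k d.L))) = d.l3 p i j k := rfl
end refold

section symm
variable (p : ι × (Fin n → ℝ)) (i j k l m : Fin n)
lemma j3_12 : d.j3 p i j k = d.j3 p j i k := by simp only [j3, d.comm i]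
lemma j3_23 : d.j3 p i j k = d.j3 p i k j := by simp only [j3, d.comm j]
lemma j4_12 : d.j4 p i j k l = d.j4 p j i k l := by simp only [j4, d.comm i]
lemma j4_23 : d.j4 p i j k l = d.j4 p i k j l := by simp only [j4, d.comm j]
lemma j4_34 : d.j4 p i j k l = d.j4 p i j l k := by simp only [j4, d.comm k]
lemma j5_12 : d.j5 p i j k l m = d.j5 p j i k l m := by simp only [j5, d.comm i]
lemma j5_23 : d.j5 p i j k l m = d.j5 p i k j l m := by simp only [j5, d.comm j]
lemma j5_34 : d.j5 p i j k l m = d.j5 p i j l k m := by simp only [j5, d.comm k]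
lemma j5_45 : d.j5 p i j k l m = d.j5 p i j k m l := by simp only [j5, d.comm l]
lemma l3_12 : d.l3 p i j k = d.l3 p j i k := by simp only [l3, d.comm i]
lemma l3_23 : d.l3 p i j k = d.l3 p i k j := by simp only [l3, d.comm j]
end symm

/-- The metric is the identity at a point. -/
def Normal (p : ι × (Fin n → ℝ)) : Prop := ∀ i j, ev p (d.a i j) = if i = j then 1 else 0

lemma _root_.Matrix.PosSemidef.exists_sq {M : Matrix (Fin n) (Fin n) ℝ} (h : M.PosSemidef) :
    ∃ B : Matrix (Fin n) (Fin n) ℝ, Bᵀ = B ∧ M = B * B := by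
  open scoped MatrixOrder in
  obtain ⟨X, hX, -, rfl⟩ :=
    CFC.exists_sqrt_of_isSelfAdjoint_of_quasispectrumRestricts h.isHermitian
      (QuasispectrumRestricts.nnreal_of_nonneg h.nonneg)
  refine ⟨X, ?_, rfl⟩
  have := hX.star_eq
  rwa [Matrix.star_eq_conjTranspose, Matrix.conjTranspose_eq_transpose_of_trivial] at this

lemma exists_normal {p : ι × (Fin n → ℝ)} (h : (d.a.map (ev p)).PosDef) :
    ∃ (P P' : Matrix (Fin n) (Fin n) ℝ) (hP : P * P' = 1), (d.frame P P' hP).Normal p ∧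
      d.a.map (ev p) = P * Pᵀ := by
  obtain ⟨B, hB, hM⟩ := h.posSemidef.exists_sq
  have hu : IsUnit B.det := by
    have := h.det_pos
    rw [hM, Matrix.det_mul] at this
    exact isUnit_iff_ne_zero.2 fun h0 => by simp [h0] at this
  refine ⟨B, B⁻¹, Matrix.mul_nonsing_inv B hu, ?_, by rw [hB, hM]⟩
  have e : ((d.frame B B⁻¹ (Matrix.mul_nonsing_inv B hu)).a).map (ev p) = 1 := by
    show (cm B⁻¹ * d.a * (cm B⁻¹)ᵀ).map (ev p) = 1
    have hc : ∀ M : Matrix (Fin n) (Fin n) ℝ, (cm M : Matrix _ _ (SF ι n)).map (ev p) = M := by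
      intro M; ext i j
      simp [cm]
    rw [Matrix.map_mul, Matrix.map_mul, ← cm_transpose, hc, hc, hM, Matrix.transpose_nonsing_inv, hB]
    rw [← Matrix.mul_assoc, Matrix.nonsing_inv_mul B hu, Matrix.one_mul,
      Matrix.mul_nonsing_inv B hu]
  intro i j
  have := congrFun (congrFun e i) j
  rw [Matrix.one_apply] at this
  exact this

variable {d} {p : ι × (Fin n → ℝ)} (h : d.Normal p)
include h

lemma Normal.lap (f : SF ι n) : ev p (d.lap f) = ∑ i, ev p (d.D i (d.D i f)) := by
  rw [lap_eq]
  simp only [map_sum, map_mul, h _ _, ite_mul, one_mul, zero_mul, Finset.sum_ite_eq,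
    Finset.mem_univ, if_true]

lemma Normal.gam (f g : SF ι n) : ev p (d.gam f g) = ∑ i, ev p (d.D i f) * ev p (d.D i g) := by
  rw [Data.gam]
  simp only [map_sum, map_mul, h _ _, ite_mul, one_mul, zero_mul, Finset.sum_ite_eq,
    Finset.mem_univ, if_true]

lemma Normal.a_map : d.a.map (ev p) = 1 := by
  ext i j
  rw [Matrix.map_apply, h, Matrix.one_apply]

lemma Normal.G (i j : Fin n) : ev p (d.G i j) = if i = j then 1 else 0 := by
  have h1 : (d.a * d.G).map (ev p) = (1 : Matrix (Fin n) (Fin n) ℝ) := by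
    rw [d.aG]; exact Matrix.map_one _ (map_zero _) (map_one _)
  rw [Matrix.map_mul, h.a_map, Matrix.one_mul] at h1
  have := congrFun (congrFun h1 i) j
  rw [Matrix.one_apply] at this
  exact this

omit h in
lemma D_a (k i j : Fin n) : d.D k (d.a i j)
    = -∑ r, ∑ q, d.a i r * d.D k (d.D r (d.D q d.φ)) * d.a q j := by
  have := congrFun (congrFun (d.map_D_a k) i) j
  rw [Matrix.map_apply] at this
  rw [this, Matrix.neg_apply, Matrix.mul_assoc]
  simp only [Matrix.mul_apply, G1_apply, Finset.mul_sum, mul_assoc]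

lemma Normal.D_a (k i j : Fin n) : ev p (d.D k (d.a i j)) = -d.j3 p k i j := by
  rw [Data.D_a]
  simp [h _ _, j3]

lemma Normal.DD_a (l k i j : Fin n) : ev p (d.D l (d.D k (d.a i j))) =
    ∑ q, (d.j3 p l i q * d.j3 p k q j + d.j3 p k i q * d.j3 p l q j) - d.j4 p l k i j := by
  rw [Data.D_a]
  simp [h _ _, h.D_a, Derivation.leibniz, Finset.sum_add_distrib]
  simp only [ev_j4, ev_j3, mul_comm]
  ring

lemma Normal.l2 (l k : Fin n) : d.l2 p l k
    = ∑ i, d.j4 p l k i i - ∑ i, ∑ j, d.j3 p l i j * d.j3 p k i j := by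
  have : d.D k d.L = ∑ i, ∑ j, d.a i j * d.D k (d.D i (d.D j d.φ)) := d.E1 k
  rw [Data.l2, this]
  simp [h _ _, h.D_a, Derivation.leibniz, Finset.sum_add_distrib]
  simp only [ev_j4, ev_j3, mul_comm]
  ring

lemma Normal.l3 (m l k : Fin n) : d.l3 p m l k
    = ∑ i, d.j5 p m l k i i
      - ∑ i, ∑ j, (d.j4 p m l i j * d.j3 p k i j + d.j3 p l i j * d.j4 p m k i j
        + d.j3 p m i j * d.j4 p l k i j)
      + ∑ i, ∑ j, ∑ q, (d.j3 p m i q * d.j3 p l q j + d.j3 p l i q * d.j3 p m q j)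
        * d.j3 p k i j := by
  have : d.D k d.L = ∑ i, ∑ j, d.a i j * d.D k (d.D i (d.D j d.φ)) := d.E1 k
  rw [Data.l3, this]
  simp [h _ _, h.D_a, h.DD_a, Derivation.leibniz, Finset.sum_add_distrib]
  simp only [ev_j5, ev_j4, ev_j3, mul_add, add_mul, mul_sub, Finset.sum_add_distrib,
    Finset.sum_sub_distrib, Finset.mul_sum]
  simp only [mul_comm]
  ring

/-- The equation at a normal point. -/
lemma Normal.trace_l2 : ∑ i, d.l2 p i i = ∑ i, d.l1 p i ^ 2 - ev p d.A := by
  have := congrArg (ev p) d.lap_L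
  rw [h.lap, map_sub, h.gam] at this
  simp only [ev_l2, ev_l1, ← sq] at this
  exact this

lemma Normal.trace_l3 (k : Fin n) : ∑ i, d.l3 p k i i = ∑ i, ∑ j, d.j3 p k i j * d.l2 p i j
    + 2 * ∑ i, d.l2 p k i * d.l1 p i - ∑ i, ∑ j, d.j3 p k i j * (d.l1 p i * d.l1 p j)
    - ev p (d.D k d.A) := by
  have e := congrArg (fun f => ev p (d.D k f)) d.lap_L
  rw [lap_eq, Data.gam] at e
  simp [h _ _, h.D_a, Derivation.leibniz, Finset.sum_add_distrib] at e
  simp only [ev_l3, ev_l2, ev_l1] at e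
  simp only [mul_comm] at e ⊢
  linarith

end Data

end

section

variable {ι : Type} {n : ℕ}

/-- The algebra of periodic families. -/
def perAlg (ι : Type) (n : ℕ) : Subalgebra ℝ (SF ι n) where
  carrier := {f | Per f}
  mul_mem' := fun hf hg i x k => congrArg₂ (· * ·) (hf i x k) (hg i x k)
  add_mem' := fun hf hg i x k => congrArg₂ (· + ·) (hf i x k) (hg i x k)
  algebraMap_mem' := fun _ _ _ _ => rfl

lemma perAlg_dv {f : SF ι n} (hf : f ∈ perAlg ι n) (v : Fin n → ℝ) : dv v f ∈ perAlg ι n :=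
  Per.dir hf v

lemma perAlg_exp {f : SF ι n} (hf : f ∈ perAlg ι n) : f.exp ∈ perAlg ι n :=
  fun i x k => congrArg Real.exp (hf i x k)

lemma _root_.Matrix.PosSemidef.det_le_trace_pow {M : Matrix (Fin n) (Fin n) ℝ}
    (h : M.PosSemidef) : M.det ≤ M.trace ^ n := by
  have e1 := h.isHermitian.det_eq_prod_eigenvalues
  have e2 := h.isHermitian.trace_eq_sum_eigenvalues
  simp only [RCLike.ofReal_real_eq_id, id] at e1 e2
  rw [e1, e2]
  calc ∏ i, h.isHermitian.eigenvalues i ≤ ∏ _i : Fin n, ∑ j, h.isHermitian.eigenvalues j :=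
        Finset.prod_le_prod (fun i _ => h.eigenvalues_nonneg i)
          (fun i _ => Finset.single_le_sum (fun j _ => h.eigenvalues_nonneg j) (Finset.mem_univ i))
    _ = _ := by simp

namespace Data
variable (d : Data ι n)

/-- Gradient bounds, in a form that does not depend on the frame. -/
structure Bd (C₀ CA : ℝ) : Prop where
  Qpos : d.Q.PosDef
  Hφ : ∀ p (v : Fin n → ℝ), (∑ i, v i * ev p (d.D i d.φ)) ^ 2 ≤ C₀ * (v ⬝ᵥ d.Q *ᵥ v)
  HA : ∀ p (v : Fin n → ℝ), (∑ i, v i * ev p (d.D i d.A)) ^ 2 ≤ CA * (v ⬝ᵥ d.Q *ᵥ v)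

variable {d} {C₀ CA : ℝ}

lemma sum_frame (P P' : Matrix (Fin n) (Fin n) ℝ) (h : P * P' = 1) (p : ι × (Fin n → ℝ))
    (v : Fin n → ℝ) (f : SF ι n) : ∑ i, v i * ev p ((d.frame P P' h).D i f)
      = ∑ i, (P *ᵥ v) i * ev p (d.D i f) := by
  simp only [frame_D, map_sum, map_smul, smul_eq_mul, Finset.mul_sum, Matrix.mulVec, dotProduct,
    Finset.sum_mul]
  rw [Finset.sum_comm]
  exact Finset.sum_congr rfl fun _ _ => Finset.sum_congr rfl fun _ _ => by ring

lemma Bd.frame (hd : d.Bd C₀ CA) (P P' : Matrix (Fin n) (Fin n) ℝ) (h : P * P' = 1) :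
    (d.frame P P' h).Bd C₀ CA := by
  have hu : IsUnit P := IsUnit.of_mul_eq_one P' h
  have hq : ∀ v : Fin n → ℝ, v ⬝ᵥ (d.frame P P' h).Q *ᵥ v = (P *ᵥ v) ⬝ᵥ d.Q *ᵥ (P *ᵥ v) := by
    intro v
    show v ⬝ᵥ (Pᵀ * d.Q * P) *ᵥ v = _
    rw [← Matrix.mulVec_mulVec, ← Matrix.mulVec_mulVec, Matrix.dotProduct_mulVec,
      Matrix.vecMul_transpose]
  refine ⟨?_, fun p v => ?_, fun p v => ?_⟩
  · have := hd.Qpos.conjTranspose_mul_mul_same (B := P) (Matrix.mulVec_injective_of_isUnit hu)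
    rwa [Matrix.conjTranspose_eq_transpose_of_trivial] at this
  · rw [hq, sum_frame]; exact hd.Hφ p _
  · rw [hq, sum_frame]; exact hd.HA p _

lemma Bd.Θpos (hd : d.Bd C₀ CA) : d.Θ.PosDef := by
  have : d.Θ = d.Q⁻¹ := (Matrix.inv_eq_right_inv d.QΘ).symm
  rw [this]; exact hd.Qpos.inv

variable {p : ι × (Fin n → ℝ)}

lemma sum_sq_le {C : ℝ} {w : Fin n → ℝ} {Q : Matrix (Fin n) (Fin n) ℝ}
    (h : ∀ v : Fin n → ℝ, (∑ i, v i * w i) ^ 2 ≤ C * (v ⬝ᵥ Q *ᵥ v)) :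
    ∑ i, w i ^ 2 ≤ C * Q.trace := by
  rw [Matrix.trace, Finset.mul_sum]
  refine Finset.sum_le_sum fun k _ => ?_
  have := h (Pi.single k 1)
  simpa [Pi.single_apply] using this

lemma Normal.τ (h : d.Normal p) : ev p d.τ = d.Q.trace := by
  simp [Data.τ, Matrix.trace, Matrix.mul_apply, h _ _, cm]

lemma Normal.T (h : d.Normal p) : ev p d.T = d.Θ.trace := by
  simp [Data.T, Matrix.trace, Matrix.mul_apply, h.G, cm]

lemma Bd.sq_φ (hd : d.Bd C₀ CA) (h : d.Normal p) :
    ∑ k, ev p (d.D k d.φ) ^ 2 ≤ C₀ * ev p d.τ := by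
  rw [h.τ]; exact sum_sq_le (hd.Hφ p)

lemma Bd.sq_A (hd : d.Bd C₀ CA) (h : d.Normal p) :
    ∑ k, ev p (d.D k d.A) ^ 2 ≤ CA * ev p d.τ := by
  rw [h.τ]; exact sum_sq_le (hd.HA p)

lemma Bd.T_nonneg (hd : d.Bd C₀ CA) (h : d.Normal p) : 0 ≤ ev p d.T := by
  rw [h.T]; exact hd.Θpos.posSemidef.trace_nonneg

lemma Bd.τ_nonneg (hd : d.Bd C₀ CA) (h : d.Normal p) : 0 ≤ ev p d.τ := by
  rw [h.τ]; exact hd.Qpos.posSemidef.trace_nonneg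

lemma Bd.quad_φ (hd : d.Bd C₀ CA) (hC : 0 ≤ C₀) (p : ι × (Fin n → ℝ)) :
    let w : Fin n → ℝ := fun i => ev p (d.D i d.φ)
    0 ≤ w ⬝ᵥ d.Θ *ᵥ w ∧ w ⬝ᵥ d.Θ *ᵥ w ≤ C₀ := by
  intro w
  have h0 : 0 ≤ w ⬝ᵥ d.Θ *ᵥ w := by
    have := hd.Θpos.posSemidef.dotProduct_mulVec_nonneg w
    simpa using this
  refine ⟨h0, ?_⟩
  have h1 := hd.Hφ p (d.Θ *ᵥ w)
  have e1 : ∑ i, (d.Θ *ᵥ w) i * ev p (d.D i d.φ) = w ⬝ᵥ d.Θ *ᵥ w := by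
    rw [dotProduct]; exact Finset.sum_congr rfl fun _ _ => mul_comm _ _
  have e2 : (d.Θ *ᵥ w) ⬝ᵥ d.Q *ᵥ (d.Θ *ᵥ w) = w ⬝ᵥ d.Θ *ᵥ w := by
    rw [Matrix.mulVec_mulVec, d.QΘ, Matrix.one_mulVec, dotProduct_comm]
  rw [e1, e2] at h1
  by_contra hlt
  push Not at hlt
  nlinarith

lemma ev_ψ (p : ι × (Fin n → ℝ)) : ev p d.ψ = -ev p d.φ - 1 / 2 *
    ((fun i => ev p (d.D i d.φ)) ⬝ᵥ d.Θ *ᵥ fun i => ev p (d.D i d.φ)) := by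
  simp only [ψ, map_sub, map_neg, map_smul, map_sum, map_mul, smul_eq_mul, dotProduct, mulVec,
    Finset.mul_sum]
  congr 1
  exact Finset.sum_congr rfl fun _ _ => Finset.sum_congr rfl fun _ _ => by ring

lemma Bd.abs_ψ (hd : d.Bd C₀ CA) (hC : 0 ≤ C₀) (p : ι × (Fin n → ℝ)) :
    |ev p d.ψ| ≤ |ev p d.φ| + C₀ := by
  have := hd.quad_φ hC p
  simp only at this
  rw [ev_ψ, abs_le]
  constructor <;> linarith [neg_abs_le (ev p d.φ), le_abs_self (ev p d.φ)]

lemma Normal.D_ψ (h : d.Normal p) (i : Fin n) :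
    ev p (d.D i d.ψ) = -(d.Θ *ᵥ fun i => ev p (d.D i d.φ)) i := by
  rw [Data.D_ψ]
  have hs : ∀ i j, d.Θ j i = d.Θ i j := fun i j => congrFun (congrFun d.Θsymm i) j
  simp [h.G, mulVec, dotProduct, hs i]

lemma Bd.sq_ψ (hd : d.Bd C₀ CA) (h : d.Normal p) :
    ∑ k, ev p (d.D k d.ψ) ^ 2 ≤ C₀ * ev p d.T := by
  rw [h.T]
  refine sum_sq_le fun v => ?_
  have h1 := hd.Hφ p (d.Θ *ᵥ v)
  have hsym : ∀ x y : Fin n → ℝ, (d.Θ *ᵥ x) ⬝ᵥ y = x ⬝ᵥ d.Θ *ᵥ y := by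
    intro x y
    rw [Matrix.dotProduct_mulVec, ← Matrix.mulVec_transpose, d.Θsymm]
  have e1 : ∑ i, v i * ev p (d.D i d.ψ) = -∑ i, (d.Θ *ᵥ v) i * ev p (d.D i d.φ) := by
    simp only [h.D_ψ, mul_neg, Finset.sum_neg_distrib]
    exact congrArg Neg.neg (hsym v _).symm
  rw [Matrix.mulVec_mulVec, d.QΘ, Matrix.one_mulVec, hsym] at h1
  rw [e1, neg_sq]; exact h1

/-- The determinant of `a` in terms of the normal frame. -/
lemma Bd.det_a_le (hd : d.Bd C₀ CA) {P P' : Matrix (Fin n) (Fin n) ℝ} (hP : P * P' = 1)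
    (h : (d.frame P P' hP).Normal p) (ha : d.a.map (ev p) = P * Pᵀ) :
    (d.a.map (ev p)).det * d.Q.det ≤ ev p d.τ ^ n := by
  have h1 := (hd.frame P P' hP).Qpos.posSemidef.det_le_trace_pow
  rw [← h.τ, frame_τ] at h1
  refine le_trans (le_of_eq ?_) h1
  show _ = (Pᵀ * d.Q * P).det
  rw [ha, det_mul, det_mul, det_mul, det_transpose]; ring

/-- The determinant of the metric in terms of the normal frame. -/
lemma Bd.det_G_le (hd : d.Bd C₀ CA) {P P' : Matrix (Fin n) (Fin n) ℝ} (hP : P * P' = 1)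
    (h : (d.frame P P' hP).Normal p) (ha : d.a.map (ev p) = P * Pᵀ) :
    (d.G.map (ev p)).det * d.Θ.det ≤ ev p d.T ^ n := by
  have h1 := (hd.frame P P' hP).Θpos.posSemidef.det_le_trace_pow
  rw [← h.T, frame_T] at h1
  refine le_trans (le_of_eq ?_) h1
  show _ = (P' * d.Θ * P'ᵀ).det
  have hG : (d.G.map (ev p)).det * (P.det * P.det) = 1 := by
    have : (d.G * d.a).map (ev p) = (1 : Matrix (Fin n) (Fin n) ℝ) := by
      rw [d.Ga]; exact Matrix.map_one _ (map_zero _) (map_one _)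
    have := congrArg Matrix.det this
    rwa [Matrix.map_mul, ha, det_mul, det_mul, det_transpose, det_one] at this
  have hPP : P.det * P'.det = 1 := by rw [← det_mul, hP, det_one]
  have hG' : (d.G.map (ev p)).det = P'.det * P'.det := by
    linear_combination (P'.det * P'.det) * hG
      - (d.G.map (ev p)).det * (P.det * P'.det + 1) * hPP
  rw [hG', det_mul, det_mul, det_transpose]; ring

variable (d)

/-- Standing assumptions on a family of periodic solutions. -/
structure Adm (C₀ CA A₀ Cφ : ℝ) : Prop extends d.Bd C₀ CA where
  C₀_pos : 0 < C₀
  CA_nonneg : 0 ≤ CA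
  A₀_nonneg : 0 ≤ A₀
  perφ : d.φ ∈ perAlg ι n
  perA : d.A ∈ perAlg ι n
  perL : d.L ∈ perAlg ι n
  pera : ∀ i j, d.a i j ∈ perAlg ι n
  apos : ∀ p, (d.a.map (ev p)).PosDef
  hL : ∀ p, Real.exp (ev p d.L) = (d.G.map (ev p)).det
  hA : ∀ p, |ev p d.A| ≤ A₀
  hφ : ∀ p, |ev p d.φ| ≤ Cφ

/-- Conclusion of the maximum principle for `f`, at the point `p` and in the frame `e`. -/
structure MaxAt (p : ι × (Fin n → ℝ)) (f : SF ι n) (P P' : Matrix (Fin n) (Fin n) ℝ)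
    (hP : P * P' = 1) : Prop where
  normal : (d.frame P P' hP).Normal p
  a_eq : d.a.map (ev p) = P * Pᵀ
  le : ∀ x, ev (p.1, x) f ≤ ev p f
  grad : ∀ k, ev p ((d.frame P P' hP).D k f) = 0
  hess : ev p ((d.frame P P' hP).lap f) ≤ 0

variable {d} {A₀ Cφ : ℝ}

lemma Adm.exists_max (hd : d.Adm C₀ CA A₀ Cφ) {f : SF ι n} (hf : f ∈ perAlg ι n) (i : ι) :
    ∃ (p : ι × (Fin n → ℝ)) (P P' : Matrix (Fin n) (Fin n) ℝ) (hP : P * P' = 1),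
      p.1 = i ∧ d.MaxAt p f P P' hP := by
  obtain ⟨x₀, hx⟩ := ZPer.exists_max (hf i) (f.smooth i).continuous
  obtain ⟨P, P', hP, hn, ha⟩ := d.exists_normal (hd.apos (i, x₀))
  refine ⟨(i, x₀), P, P', hP, rfl, hn, ha, hx, fun k => (max_principle hx _).1, ?_⟩
  rw [hn.lap]
  exact Finset.sum_nonpos fun k _ => (max_principle hx _).2

lemma Adm.per_ψ (hd : d.Adm C₀ CA A₀ Cφ) : d.ψ ∈ perAlg ι n := by
  refine sub_mem (neg_mem hd.perφ) (Subalgebra.smul_mem _ (sum_mem fun _ _ => sum_mem fun _ _ =>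
    Subalgebra.smul_mem _ (mul_mem (perAlg_dv hd.perφ _) (perAlg_dv hd.perφ _)) _) _)

lemma Adm.det_a (hd : d.Adm C₀ CA A₀ Cφ) (p : ι × (Fin n → ℝ)) :
    (d.a.map (ev p)).det = Real.exp (-ev p d.L) := by
  have : (d.a * d.G).map (ev p) = (1 : Matrix (Fin n) (Fin n) ℝ) := by
    rw [d.aG]; exact Matrix.map_one _ (map_zero _) (map_one _)
  have := congrArg Matrix.det this
  rw [Matrix.map_mul, det_mul, det_one, ← hd.hL] at this
  rw [Real.exp_neg]; exact eq_inv_of_mul_eq_one_left this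

/-- Uniform lower bound for the logarithm of the determinant. -/
lemma Adm.L_lower (hd : d.Adm C₀ CA A₀ Cφ) : ∃ C, ∀ p, -C ≤ ev p d.L := by
  set c : ℝ := 1 / (2 * C₀) with hc
  have hcpos : 0 < c := by have := hd.C₀_pos; positivity
  have hcC : c * C₀ = 1 / 2 := by rw [hc]; field_simp [hd.C₀_pos.ne']
  set K : ℝ := (2 * n + 2 * A₀ / c) ^ n / d.Q.det with hK
  have hKpos : 0 ≤ K := by
    have := hd.A₀_nonneg
    have := hd.Qpos.det_pos
    positivity
  refine ⟨Real.log (K + 1) + 2 * c * Cφ, fun q => ?_⟩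
  have hper : -(d.L + c • d.φ) ∈ perAlg ι n :=
    neg_mem (add_mem hd.perL (Subalgebra.smul_mem _ hd.perφ _))
  obtain ⟨p, P, P', hP, hp1, hm⟩ := hd.exists_max hper q.1
  have hg : ∀ k, ev p ((d.frame P P' hP).D k d.L) = -c * ev p ((d.frame P P' hP).D k d.φ) := by
    intro k
    have := hm.grad k
    simp only [map_neg, map_add, Derivation.map_smul, map_smul, smul_eq_mul] at this
    linarith
  have hh := hm.hess
  have e1 : (d.frame P P' hP).lap d.L = (d.frame P P' hP).gam d.L d.L - d.A :=
    (d.frame P P' hP).lap_L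
  have e2 : (d.frame P P' hP).lap d.φ = n - (d.frame P P' hP).τ := (d.frame P P' hP).lap_phi
  rw [show -(d.L + c • d.φ) = (-1 : ℝ) • (d.L + c • d.φ) from (neg_one_smul ℝ _).symm, lap_smul, lap_add, lap_smul, e1,
    e2, frame_τ] at hh
  simp only [map_smul, map_add, map_sub, map_natCast, smul_eq_mul, hm.normal.gam, hg] at hh
  have hN : ∑ k, -c * ev p ((d.frame P P' hP).D k d.φ) * (-c * ev p ((d.frame P P' hP).D k d.φ))
      = c ^ 2 * ∑ k, ev p ((d.frame P P' hP).D k d.φ) ^ 2 := by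
    rw [Finset.mul_sum]; exact Finset.sum_congr rfl fun _ _ => by ring
  have hs := (hd.toBd.frame P P' hP).sq_φ hm.normal
  rw [frame_τ] at hs
  change ∑ k, ev p ((d.frame P P' hP).D k d.φ) ^ 2 ≤ _ at hs
  rw [hN] at hh
  have hτ : ev p d.τ ≤ 2 * n + 2 * A₀ / c := by
    have hAp := (abs_le.1 (hd.hA p)).1
    have h3 : c ^ 2 * ∑ k, ev p ((d.frame P P' hP).D k d.φ) ^ 2 ≤ c ^ 2 * (C₀ * ev p d.τ) :=
      mul_le_mul_of_nonneg_left hs (by positivity)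
    have h4 : c ^ 2 * (C₀ * ev p d.τ) = c * (1 / 2) * ev p d.τ := by rw [← hcC]; ring
    have h5 : c * ev p d.τ ≤ 2 * c * n + 2 * A₀ := by linarith
    rw [← mul_le_mul_iff_right₀ hcpos]
    calc _ ≤ _ := h5
      _ = _ := by field_simp
  have hτ0 : 0 ≤ ev p d.τ := by
    have := (hd.toBd.frame P P' hP).τ_nonneg hm.normal
    rwa [frame_τ] at this
  have hdet := hd.toBd.det_a_le hP hm.normal hm.a_eq
  rw [hd.det_a] at hdet
  have hexp : Real.exp (-ev p d.L) ≤ K := by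
    rw [hK, le_div_iff₀ hd.Qpos.det_pos]
    exact hdet.trans (pow_le_pow_left₀ hτ0 hτ n)
  have hLp : -ev p d.L ≤ Real.log (K + 1) := by
    rw [Real.le_log_iff_exp_le (by linarith)]; linarith
  have hle := hm.le q.2
  rw [hp1] at hle
  simp only [map_neg, map_add, map_smul, smul_eq_mul] at hle
  have := abs_le.1 (hd.hφ q)
  have := abs_le.1 (hd.hφ p)
  change -(ev q d.L + c * ev q d.φ) ≤ _ at hle
  nlinarith

/-- Uniform upper bound for the logarithm of the determinant. -/
lemma Adm.L_upper (hd : d.Adm C₀ CA A₀ Cφ) : ∃ C, ∀ p, ev p d.L ≤ C := by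
  set K : ℝ := (n + A₀) ^ n / d.Θ.det with hK
  have hKpos : 0 ≤ K := by
    have := hd.A₀_nonneg
    have := hd.toBd.Θpos.det_pos
    positivity
  refine ⟨Real.log (K + 1) + 2 * (Cφ + C₀), fun q => ?_⟩
  have hper : d.L + (-1 : ℝ) • d.ψ ∈ perAlg ι n :=
    add_mem hd.perL (Subalgebra.smul_mem _ hd.per_ψ _)
  obtain ⟨p, P, P', hP, hp1, hm⟩ := hd.exists_max hper q.1
  have hg : ∀ k, ev p ((d.frame P P' hP).D k d.L) = ev p ((d.frame P P' hP).D k d.ψ) := by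
    intro k
    have := hm.grad k
    simp only [map_add, Derivation.map_smul, map_smul, smul_eq_mul] at this
    linarith
  have hh := hm.hess
  have e1 : (d.frame P P' hP).lap d.L = (d.frame P P' hP).gam d.L d.L - d.A :=
    (d.frame P P' hP).lap_L
  have e2 := (d.frame P P' hP).lap_ψ
  rw [frame_ψ, frame_T] at e2
  have e3 := congrArg (ev p) e2
  simp only [map_sub, map_natCast, hm.normal.gam] at e3
  rw [lap_add, lap_smul, e1] at hh
  simp only [map_smul, map_add, map_sub, smul_eq_mul, hm.normal.gam] at hh
  change _ - ∑ i, ev p ((d.frame P P' hP).D i d.L) * _ = _ at e3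
  simp only [hg] at hh e3
  have hT : ev p d.T ≤ n + A₀ := by
    have hAp := (abs_le.1 (hd.hA p)).2
    linarith
  have hT0 : 0 ≤ ev p d.T := by
    have := (hd.toBd.frame P P' hP).T_nonneg hm.normal
    rwa [frame_T] at this
  have hdet := hd.toBd.det_G_le hP hm.normal hm.a_eq
  rw [← hd.hL] at hdet
  have hexp : Real.exp (ev p d.L) ≤ K := by
    rw [hK, le_div_iff₀ hd.toBd.Θpos.det_pos]
    exact hdet.trans (pow_le_pow_left₀ hT0 hT n)
  have hLp : ev p d.L ≤ Real.log (K + 1) := by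
    rw [Real.le_log_iff_exp_le (by linarith)]; linarith
  have hle := hm.le q.2
  rw [hp1] at hle
  simp only [map_add, map_smul, smul_eq_mul] at hle
  change ev q d.L + -1 * ev q d.ψ ≤ _ at hle
  have h1 := abs_le.1 ((hd.toBd.abs_ψ hd.C₀_pos.le q).trans (add_le_add_left (hd.hφ q) _))
  have h2 := abs_le.1 ((hd.toBd.abs_ψ hd.C₀_pos.le p).trans (add_le_add_left (hd.hφ p) _))
  linarith

end Data

end

section

variable {α : Type} [Fintype α]

lemma sum_fin_cons {k : ℕ} (f : (Fin (k + 1) → α) → ℝ) :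
    ∑ c, f c = ∑ a, ∑ c : Fin k → α, f (Fin.cons a c) := by
  rw [← Fintype.sum_prod_type']
  exact (Fintype.sum_equiv (Fin.consEquiv fun _ => α) _ _ fun _ => rfl).symm

lemma sum_comp_perm {k : ℕ} {σ : Fin k → Fin k} (hσ : Function.Bijective σ)
    (f : (Fin k → α) → ℝ) : ∑ c, f c = ∑ c : Fin k → α, f (c ∘ σ) :=
  (Fintype.sum_equiv ((Equiv.ofBijective σ hσ).symm.arrowCongr (Equiv.refl α)) _ _
    fun _ => rfl).symm

lemma sum_perm3 (σ : Fin 3 → Fin 3) (hσ : Function.Bijective σ) {F G : α → α → α → ℝ}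
    (h : ∀ c : Fin 3 → α, F (c 0) (c 1) (c 2) = G (c (σ 0)) (c (σ 1)) (c (σ 2))) :
    ∑ i, ∑ j, ∑ k, F i j k = ∑ i, ∑ j, ∑ k, G i j k := by
  have e : ∀ F : α → α → α → ℝ, ∑ i, ∑ j, ∑ k, F i j k
      = ∑ c : Fin 3 → α, F (c 0) (c 1) (c 2) := by
    intro F; simp only [sum_fin_cons, Fintype.sum_unique]; rfl
  rw [e, e, sum_comp_perm hσ fun c => G (c 0) (c 1) (c 2)]
  exact Finset.sum_congr rfl fun c _ => h c

lemma sum_perm4 (σ : Fin 4 → Fin 4) (hσ : Function.Bijective σ) {F G : α → α → α → α → ℝ}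
    (h : ∀ c : Fin 4 → α, F (c 0) (c 1) (c 2) (c 3)
      = G (c (σ 0)) (c (σ 1)) (c (σ 2)) (c (σ 3))) :
    ∑ i, ∑ j, ∑ k, ∑ l, F i j k l = ∑ i, ∑ j, ∑ k, ∑ l, G i j k l := by
  have e : ∀ F : α → α → α → α → ℝ, ∑ i, ∑ j, ∑ k, ∑ l, F i j k l
      = ∑ c : Fin 4 → α, F (c 0) (c 1) (c 2) (c 3) := by
    intro F; simp only [sum_fin_cons, Fintype.sum_unique]; rfl
  rw [e, e, sum_comp_perm hσ fun c => G (c 0) (c 1) (c 2) (c 3)]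
  exact Finset.sum_congr rfl fun c _ => h c

lemma sum_perm5 (σ : Fin 5 → Fin 5) (hσ : Function.Bijective σ) {F G : α → α → α → α → α → ℝ}
    (h : ∀ c : Fin 5 → α, F (c 0) (c 1) (c 2) (c 3) (c 4)
      = G (c (σ 0)) (c (σ 1)) (c (σ 2)) (c (σ 3)) (c (σ 4))) :
    ∑ i, ∑ j, ∑ k, ∑ l, ∑ m, F i j k l m = ∑ i, ∑ j, ∑ k, ∑ l, ∑ m, G i j k l m := by
  have e : ∀ F : α → α → α → α → α → ℝ, ∑ i, ∑ j, ∑ k, ∑ l, ∑ m, F i j k l m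
      = ∑ c : Fin 5 → α, F (c 0) (c 1) (c 2) (c 3) (c 4) := by
    intro F; simp only [sum_fin_cons, Fintype.sum_unique]; rfl
  rw [e, e, sum_comp_perm hσ fun c => G (c 0) (c 1) (c 2) (c 3) (c 4)]
  exact Finset.sum_congr rfl fun c _ => h c

lemma sum_perm6 (σ : Fin 6 → Fin 6) (hσ : Function.Bijective σ)
    {F G : α → α → α → α → α → α → ℝ}
    (h : ∀ c : Fin 6 → α, F (c 0) (c 1) (c 2) (c 3) (c 4) (c 5)
      = G (c (σ 0)) (c (σ 1)) (c (σ 2)) (c (σ 3)) (c (σ 4)) (c (σ 5))) :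
    ∑ i, ∑ j, ∑ k, ∑ l, ∑ m, ∑ q, F i j k l m q
      = ∑ i, ∑ j, ∑ k, ∑ l, ∑ m, ∑ q, G i j k l m q := by
  have e : ∀ F : α → α → α → α → α → α → ℝ, ∑ i, ∑ j, ∑ k, ∑ l, ∑ m, ∑ q, F i j k l m q
      = ∑ c : Fin 6 → α, F (c 0) (c 1) (c 2) (c 3) (c 4) (c 5) := by
    intro F; simp only [sum_fin_cons, Fintype.sum_unique]; rfl
  rw [e, e, sum_comp_perm hσ fun c => G (c 0) (c 1) (c 2) (c 3) (c 4) (c 5)]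
  exact Finset.sum_congr rfl fun c _ => h c

end

section

variable {ι : Type} {n : ℕ}
namespace Data
variable {d : Data ι n} {p : ι × (Fin n → ℝ)}

/-- Contraction of third derivatives with the gradient of `L`. -/
def V (d : Data ι n) (p : ι × (Fin n → ℝ)) (i j : Fin n) : ℝ := ∑ k, d.j3 p i j k * d.l1 p k

/-- The modified Hessian of `L`. -/
def H (d : Data ι n) (p : ι × (Fin n → ℝ)) (i j : Fin n) : ℝ := d.l2 p i j - d.V p i j

/-- Squared third derivatives. -/
def M (d : Data ι n) (p : ι × (Fin n → ℝ)) (i j : Fin n) : ℝ :=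
  ∑ k, ∑ l, d.j3 p i k l * d.j3 p j k l

/-- Gradient of the squared length of the gradient of `L`. -/
def N1 (d : Data ι n) (p : ι × (Fin n → ℝ)) (k : Fin n) : ℝ :=
  2 * ∑ i, d.l2 p k i * d.l1 p i - ∑ i, d.V p k i * d.l1 p i

lemma Normal.D_N (h : d.Normal p) (k : Fin n) : ev p (d.D k (d.gam d.L d.L)) = d.N1 p k := by
  have e : ev p (d.D k (d.gam d.L d.L)) = ∑ i, ∑ j, (-d.j3 p k i j * (d.l1 p i * d.l1 p j)
      + (if i = j then 1 else 0) * (d.l2 p k i * d.l1 p j + d.l1 p i * d.l2 p k j)) := by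
    simp only [Data.gam, map_sum]
    refine Finset.sum_congr rfl fun i _ => Finset.sum_congr rfl fun j _ => ?_
    simp only [Derivation.leibniz, smul_eq_mul, map_add, map_mul, h.D_a, h i j, ev_l2, ev_l1]
    ring
  rw [e, N1]
  simp only [Finset.sum_add_distrib, ite_mul, one_mul, zero_mul, Finset.sum_ite_eq,
    Finset.mem_univ, if_true, V, Finset.sum_mul, neg_mul, Finset.sum_neg_distrib]
  have e1 : ∀ i j, d.j3 p k i j * (d.l1 p i * d.l1 p j) = d.j3 p k i j * d.l1 p j * d.l1 p i :=
    fun i j => by ring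
  have e2 : ∀ i, d.l1 p i * d.l2 p k i = d.l2 p k i * d.l1 p i := fun i => mul_comm _ _
  simp only [e1, e2]
  ring

lemma Normal.sum_j4 (h : d.Normal p) (i j : Fin n) :
    ∑ k, d.j4 p k k i j = d.l2 p i j + d.M p i j := by
  rw [h.l2, M]
  have : ∀ k, d.j4 p k k i j = d.j4 p i j k k := by
    intro k
    rw [d.j4_23, d.j4_12, d.j4_34, d.j4_23]
  simp only [this]; ring

/-- The Laplacian of the squared gradient of `L`. -/
lemma Normal.lap_N (h : d.Normal p) : ev p (d.lap (d.gam d.L d.L)) =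
    ∑ i, ∑ j, d.l2 p i j ^ 2 + ∑ i, ∑ j, d.H p i j ^ 2
      - ∑ i, ∑ j, d.l2 p i j * (d.l1 p i * d.l1 p j) + 2 * ∑ k, d.l1 p k * d.N1 p k
      - 2 * ∑ k, ev p (d.D k d.A) * d.l1 p k := by
  have e1 : ev p (d.lap (d.gam d.L d.L)) = ∑ k, ∑ i, ∑ j,
      ((2 * ∑ q, d.j3 p k i q * d.j3 p k q j) * (d.l1 p i * d.l1 p j)
        - d.j4 p k k i j * (d.l1 p i * d.l1 p j)
        - 2 * d.j3 p k i j * (d.l2 p k i * d.l1 p j + d.l1 p i * d.l2 p k j)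
      + (if i = j then 1 else 0) *
        (d.l3 p k k i * d.l1 p j + 2 * d.l2 p k i * d.l2 p k j + d.l1 p i * d.l3 p k k j)) := by
    rw [h.lap]
    simp only [Data.gam, map_sum]
    refine Finset.sum_congr rfl fun k _ => Finset.sum_congr rfl fun i _ =>
      Finset.sum_congr rfl fun j _ => ?_
    simp only [Derivation.leibniz, smul_eq_mul, map_add, map_mul, h.D_a, h.DD_a, h i j, ev_l3,
      ev_l2, ev_l1, Finset.sum_add_distrib]
    ring
  have t0 : ∑ k, ∑ i, ∑ j, (2 * ∑ q, d.j3 p k i q * d.j3 p k q j) * (d.l1 p i * d.l1 p j)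
      = 2 * ∑ i, ∑ j, d.V p i j ^ 2 := by
    have : ∀ k q, d.V p k q ^ 2 = ∑ i, ∑ j, d.j3 p k i q * d.j3 p k q j * (d.l1 p i * d.l1 p j) := by
      intro k q
      rw [sq, V, Finset.sum_mul_sum]
      refine Finset.sum_congr rfl fun i _ => Finset.sum_congr rfl fun j _ => ?_
      rw [d.j3_23 p k i q]; ring
    simp only [this, Finset.mul_sum, Finset.sum_mul]
    exact sum_perm4 ![0, 3, 1, 2] (by decide) fun c => by simp only [Matrix.cons_val]; ring
  have t1 : ∑ k, ∑ i, ∑ j, d.j4 p k k i j * (d.l1 p i * d.l1 p j)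
      = ∑ i, ∑ j, d.l2 p i j * (d.l1 p i * d.l1 p j) + ∑ i, ∑ j, d.V p i j ^ 2 := by
    have e : ∀ i j, ∑ k, d.j4 p k k i j * (d.l1 p i * d.l1 p j)
        = d.l2 p i j * (d.l1 p i * d.l1 p j) + d.M p i j * (d.l1 p i * d.l1 p j) := by
      intro i j; rw [← Finset.sum_mul, h.sum_j4, add_mul]
    have e' : ∑ k, ∑ i, ∑ j, d.j4 p k k i j * (d.l1 p i * d.l1 p j)
        = ∑ i, ∑ j, ∑ k, d.j4 p k k i j * (d.l1 p i * d.l1 p j) :=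
      sum_perm3 ![1, 2, 0] (by decide) fun c => by simp only [Matrix.cons_val]
    rw [e']
    simp only [e, Finset.sum_add_distrib, V, sq, Finset.sum_mul_sum]
    simp only [M, Finset.sum_mul]
    congr 1
    exact sum_perm4 ![2, 3, 0, 1] (by decide) fun c => by
      simp only [Matrix.cons_val, d.j3_12 p, d.j3_23 p]; ring
  have t2 : ∑ k, ∑ i, ∑ j, 2 * d.j3 p k i j * (d.l2 p k i * d.l1 p j + d.l1 p i * d.l2 p k j)
      = 4 * ∑ i, ∑ j, d.l2 p i j * d.V p i j := by
    simp only [mul_add, Finset.sum_add_distrib, V, Finset.mul_sum]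
    have e1 : ∑ k, ∑ i, ∑ j, 2 * d.j3 p k i j * (d.l2 p k i * d.l1 p j)
        = ∑ i, ∑ j, ∑ k, 2 * (d.l2 p i j * (d.j3 p i j k * d.l1 p k)) :=
      sum_perm3 ![0, 1, 2] (by decide) fun c => by simp only [Matrix.cons_val]; ring
    have e2 : ∑ k, ∑ i, ∑ j, 2 * d.j3 p k i j * (d.l1 p i * d.l2 p k j)
        = ∑ i, ∑ j, ∑ k, 2 * (d.l2 p i j * (d.j3 p i j k * d.l1 p k)) :=
      sum_perm3 ![0, 2, 1] (by decide) fun c => by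
        simp only [Matrix.cons_val, d.j3_23 p]; ring
    rw [e1, e2]
    simp only [← Finset.mul_sum]; ring
  have t3 : ∑ k, ∑ i, ∑ j, (if i = j then 1 else 0) *
        (d.l3 p k k i * d.l1 p j + 2 * d.l2 p k i * d.l2 p k j + d.l1 p i * d.l3 p k k j)
      = 2 * ∑ i, ∑ j, d.l2 p i j ^ 2 + 2 * ∑ i, ∑ j, d.l2 p i j * d.V p i j
        + 4 * ∑ i, ∑ j, d.l2 p i j * (d.l1 p i * d.l1 p j)
        - 2 * ∑ i, ∑ j, d.V p i j * (d.l1 p i * d.l1 p j)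
        - 2 * ∑ k, ev p (d.D k d.A) * d.l1 p k := by
    simp only [ite_mul, one_mul, zero_mul, Finset.sum_ite_eq, Finset.mem_univ, if_true]
    have e0 : ∀ k i, d.l3 p k k i * d.l1 p i + 2 * d.l2 p k i * d.l2 p k i
        + d.l1 p i * d.l3 p k k i = 2 * (d.l3 p i k k * d.l1 p i) + 2 * d.l2 p k i ^ 2 := by
      intro k i
      rw [d.l3_23 p k k i, d.l3_12 p k i k]; ring
    have e1 : ∑ k, ∑ i, d.l3 p i k k * d.l1 p i = ∑ i, (∑ k, d.l3 p i k k) * d.l1 p i := by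
      rw [Finset.sum_comm]
      exact Finset.sum_congr rfl fun _ _ => (Finset.sum_mul _ _ _).symm
    simp only [e0, Finset.sum_add_distrib, ← Finset.mul_sum, e1, h.trace_l3]
    simp only [add_mul, sub_mul, Finset.sum_add_distrib, Finset.sum_sub_distrib]
    have e2 : ∑ i, (∑ j, ∑ k, d.j3 p i j k * d.l2 p j k) * d.l1 p i
        = ∑ i, ∑ j, d.l2 p i j * d.V p i j := by
      simp only [Finset.sum_mul, V, Finset.mul_sum]
      exact sum_perm3 ![1, 2, 0] (by decide) fun c => by
        simp only [Matrix.cons_val, d.j3_12 p, d.j3_23 p]; ring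
    have e3 : ∑ i, (2 * ∑ j, d.l2 p i j * d.l1 p j) * d.l1 p i
        = 2 * ∑ i, ∑ j, d.l2 p i j * (d.l1 p i * d.l1 p j) := by
      simp only [Finset.sum_mul, Finset.mul_sum]
      exact Finset.sum_congr rfl fun _ _ => Finset.sum_congr rfl fun _ _ => by ring
    have e4 : ∑ i, (∑ j, ∑ k, d.j3 p i j k * (d.l1 p j * d.l1 p k)) * d.l1 p i
        = ∑ i, ∑ j, d.V p i j * (d.l1 p i * d.l1 p j) := by
      simp only [Finset.sum_mul, V]
      exact Finset.sum_congr rfl fun _ _ => Finset.sum_congr rfl fun _ _ =>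
        Finset.sum_congr rfl fun _ _ => by ring
    rw [e2, e3, e4]; ring
  have t4 : ∑ i, ∑ j, d.H p i j ^ 2 = ∑ i, ∑ j, d.l2 p i j ^ 2
      - 2 * ∑ i, ∑ j, d.l2 p i j * d.V p i j + ∑ i, ∑ j, d.V p i j ^ 2 := by
    simp only [H, Finset.mul_sum, ← Finset.sum_sub_distrib, ← Finset.sum_add_distrib]
    exact Finset.sum_congr rfl fun _ _ => Finset.sum_congr rfl fun _ _ => by ring
  have t5 : 2 * ∑ k, d.l1 p k * d.N1 p k = 4 * ∑ i, ∑ j, d.l2 p i j * (d.l1 p i * d.l1 p j)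
        - 2 * ∑ i, ∑ j, d.V p i j * (d.l1 p i * d.l1 p j) := by
    simp only [N1, Finset.mul_sum, mul_sub, ← Finset.sum_sub_distrib]
    exact Finset.sum_congr rfl fun _ _ => Finset.sum_congr rfl fun _ _ => by ring
  rw [e1]
  simp only [Finset.sum_add_distrib, Finset.sum_sub_distrib] at t0 t1 t2 t3 t4 t5 ⊢
  linarith

end Data

end

section

variable {ι : Type} {n : ℕ}

lemma _root_.Matrix.PosSemidef.sum_sq_le {M : Matrix (Fin n) (Fin n) ℝ} (h : M.PosSemidef) :
    ∑ i, ∑ j, M i j ^ 2 ≤ M.trace ^ 2 := by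
  obtain ⟨B, hB, rfl⟩ := h.exists_sq
  have hs : ∀ i j, B i j = B j i := fun i j => congrFun (congrFun hB j) i
  rw [sq (trace _), Matrix.trace, Finset.sum_mul_sum]
  refine Finset.sum_le_sum fun i _ => Finset.sum_le_sum fun j _ => ?_
  simp only [Matrix.diag_apply, Matrix.mul_apply]
  have e1 : ∀ i, ∑ k, B i k * B k i = ∑ k, B i k ^ 2 := fun i =>
    Finset.sum_congr rfl fun k _ => by rw [hs k i, sq]
  have e2 : ∑ k, B i k * B k j = ∑ k, B i k * B j k :=
    Finset.sum_congr rfl fun k _ => by rw [hs k j]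
  rw [e1, e1, e2]
  exact Finset.sum_mul_sq_le_sq_mul_sq _ _ _

namespace Data
variable {d : Data ι n} {p : ι × (Fin n → ℝ)} {C₀ CA : ℝ}

lemma Normal.weighted (h : d.Normal p) {η X : SF ι n} (hg : ∀ k, ev p (d.D k (η.exp * X)) = 0)
    (hh : ev p (d.lap (η.exp * X)) ≤ 0) :
    (∀ k, ev p (d.D k X) = -(ev p X * ev p (d.D k η))) ∧
      ev p (d.lap X) + ev p X * ev p (d.lap η) - ev p X * ∑ k, ev p (d.D k η) ^ 2 ≤ 0 := by
  have hE : ∀ k, d.D k η.exp = η.exp * d.D k η := fun k => dv_exp _ _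
  have hpos : 0 < ev p η.exp := by rw [ev_exp]; exact Real.exp_pos _
  have h1 : ∀ k, ev p (d.D k X) = -(ev p X * ev p (d.D k η)) := by
    intro k
    have := hg k
    simp only [Derivation.leibniz, smul_eq_mul, hE, map_add, map_mul] at this
    have h2 : ev p η.exp * (ev p (d.D k X) + ev p X * ev p (d.D k η)) = 0 := by linarith
    rcases mul_eq_zero.1 h2 with h3 | h3
    · exact absurd h3 hpos.ne'
    · linarith
  refine ⟨h1, ?_⟩
  rw [lap_mul] at hh
  simp only [map_add, map_mul, h.gam, hE, Derivation.leibniz, smul_eq_mul, h1,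
    Finset.sum_add_distrib, map_ofNat, h.lap] at hh
  have e1 : ∑ k, ev p η.exp * ev p (d.D k η) * -(ev p X * ev p (d.D k η))
      = -(ev p η.exp * ev p X * ∑ k, ev p (d.D k η) ^ 2) := by
    rw [Finset.mul_sum, ← Finset.sum_neg_distrib]
    exact Finset.sum_congr rfl fun _ _ => by ring
  have e2 : ∑ k, ev p (d.D k η) * (ev p η.exp * ev p (d.D k η))
      = ev p η.exp * ∑ k, ev p (d.D k η) ^ 2 := by
    rw [Finset.mul_sum]; exact Finset.sum_congr rfl fun _ _ => by ring
  rw [e1, e2, ← Finset.mul_sum] at hh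
  simp only [h.lap]
  refine nonpos_of_mul_nonpos_right (a := ev p η.exp) ?_ hpos
  linarith

/-- The linearised operator applied to the weighted squared gradient of `L`. -/
lemma Normal.LL_N (h : d.Normal p) :
    ev p (d.lap ((-(1 / 2 : ℝ) • d.L).exp * d.gam d.L d.L))
      - ∑ k, d.l1 p k * ev p (d.D k ((-(1 / 2 : ℝ) • d.L).exp * d.gam d.L d.L))
    = Real.exp (-(1 / 2) * ev p d.L) * (∑ i, ∑ j, d.H p i j ^ 2
      + ∑ i, ∑ j, (d.l2 p i j - d.l1 p i * d.l1 p j / 2) ^ 2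
      + ev p d.A * ev p (d.gam d.L d.L) / 2 - 2 * ∑ k, ev p (d.D k d.A) * d.l1 p k) := by
  set E := (-(1 / 2 : ℝ) • d.L).exp with hEdef
  have hE : ∀ k, d.D k E = -(1 / 2 : ℝ) • (E * d.D k d.L) := by
    intro k
    have : d.D k E = E * d.D k (-(1 / 2 : ℝ) • d.L) := dv_exp _ _
    rw [this, Derivation.map_smul, mul_smul_comm]
  have hEv : ev p E = Real.exp (-(1 / 2) * ev p d.L) := by
    rw [hEdef, ev_exp, map_smul, smul_eq_mul]
  have hNv : ev p (d.gam d.L d.L) = ∑ k, d.l1 p k ^ 2 := by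
    rw [h.gam]; exact Finset.sum_congr rfl fun _ _ => (sq _).symm
  rw [← hEv, lap_mul]
  simp only [map_add, map_mul, h.gam E, h.lap_N, h.D_N, Derivation.leibniz, smul_eq_mul, hE,
    map_smul, h.lap E, Derivation.map_smul, map_ofNat, ev_l1, ev_l2]
  have hY : ∑ i, ∑ j, (d.l2 p i j - d.l1 p i * d.l1 p j / 2) ^ 2 = ∑ i, ∑ j, d.l2 p i j ^ 2
      - ∑ i, ∑ j, d.l2 p i j * (d.l1 p i * d.l1 p j)
      + 1 / 4 * (ev p (d.gam d.L d.L)) ^ 2 := by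
    rw [hNv, sq (∑ k, _), Finset.sum_mul_sum, Finset.mul_sum, ← Finset.sum_sub_distrib,
      ← Finset.sum_add_distrib]
    refine Finset.sum_congr rfl fun i _ => ?_
    rw [Finset.mul_sum, ← Finset.sum_sub_distrib, ← Finset.sum_add_distrib]
    exact Finset.sum_congr rfl fun _ _ => by ring
  rw [hY]
  have e1 : ∑ x, -(1 / 2) * (ev p E * d.l2 p x x + d.l1 p x * (-(1 / 2) * (ev p E * d.l1 p x)))
      = -(1 / 2) * ev p E * ∑ x, d.l2 p x x + 1 / 4 * ev p E * ev p (d.gam d.L d.L) := by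
    rw [hNv, Finset.mul_sum, Finset.mul_sum, ← Finset.sum_add_distrib]
    exact Finset.sum_congr rfl fun _ _ => by ring
  have e2 : ∑ x, -(1 / 2) * (ev p E * d.l1 p x) * d.N1 p x
      = -(1 / 2) * ev p E * ∑ x, d.l1 p x * d.N1 p x := by
    rw [Finset.mul_sum]; exact Finset.sum_congr rfl fun _ _ => by ring
  have e3 : ∑ x, d.l1 p x * (ev p E * d.N1 p x
        + ev p (d.gam d.L d.L) * (-(1 / 2) * (ev p E * d.l1 p x)))
      = ev p E * ∑ x, d.l1 p x * d.N1 p x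
        - 1 / 2 * ev p E * ev p (d.gam d.L d.L) * ∑ x, d.l1 p x ^ 2 := by
    rw [Finset.mul_sum, Finset.mul_sum, ← Finset.sum_sub_distrib]
    exact Finset.sum_congr rfl fun _ _ => by ring
  rw [e1, e2, e3, h.trace_l2, ← hNv]
  ring

/-- The linearised operator applied to the trace of the Hessian. -/
lemma Normal.LL_T (h : d.Normal p) :
    ev p (d.lap d.T) - ∑ k, d.l1 p k * ev p (d.D k d.T)
      = ∑ r, ∑ s, d.Θ r s * (d.H p r s + d.M p r s) := by
  have hT : d.T = ∑ r, ∑ s, d.Θ r s • d.G s r := by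
    rw [Data.T, Matrix.trace]
    simp only [Matrix.diag_apply, Matrix.mul_apply, cm, Matrix.map_apply, ← Algebra.smul_def]
  have hG : ∀ k r s, d.D k (d.G r s) = d.D k (d.D r (d.D s d.φ)) := fun k r s => by
    rw [← G1_apply]; rfl
  rw [h.lap, hT]
  simp only [map_sum, Derivation.map_smul, map_smul, hG, smul_eq_mul, ev_j3, ev_j4]
  have e1 : ∑ k, ∑ r, ∑ s, d.Θ r s * d.j4 p k k s r
      = ∑ r, ∑ s, d.Θ r s * (d.l2 p r s + d.M p r s) := by
    have : ∀ r s, d.Θ r s * (d.l2 p r s + d.M p r s) = ∑ k, d.Θ r s * d.j4 p k k s r := by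
      intro r s
      rw [← h.sum_j4, Finset.mul_sum]
      exact Finset.sum_congr rfl fun k _ => by rw [d.j4_34]
    simp only [this]
    exact sum_perm3 ![1, 2, 0] (by decide) fun c => by simp only [Matrix.cons_val]
  have e2 : ∑ k, d.l1 p k * ∑ r, ∑ s, d.Θ r s * d.j3 p k s r
      = ∑ r, ∑ s, d.Θ r s * d.V p r s := by
    simp only [V, Finset.mul_sum]
    exact sum_perm3 ![1, 2, 0] (by decide) fun c => by
      simp only [Matrix.cons_val, d.j3_12 p, d.j3_23 p]; ring
  rw [e1, e2]
  simp only [← Finset.sum_sub_distrib, H]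
  exact Finset.sum_congr rfl fun _ _ => Finset.sum_congr rfl fun _ _ => by ring

lemma Bd.LL_T_lower (hd : d.Bd C₀ CA) (h : d.Normal p) :
    -(ev p d.T * Real.sqrt (∑ i, ∑ j, d.H p i j ^ 2))
      ≤ ev p (d.lap d.T) - ∑ k, d.l1 p k * ev p (d.D k d.T) := by
  rw [h.LL_T]
  have h1 : 0 ≤ ∑ r, ∑ s, d.Θ r s * d.M p r s := by
    have : ∑ r, ∑ s, d.Θ r s * d.M p r s
        = ∑ k, ∑ l, ∑ r, ∑ s, d.j3 p r k l * (d.Θ r s * d.j3 p s k l) := by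
      simp only [M, Finset.mul_sum]
      exact sum_perm4 ![2, 3, 0, 1] (by decide) fun c => by simp only [Matrix.cons_val]; ring
    rw [this]
    refine Finset.sum_nonneg fun k _ => Finset.sum_nonneg fun l _ => ?_
    have := hd.Θpos.posSemidef.dotProduct_mulVec_nonneg fun r => d.j3 p r k l
    simpa [dotProduct, mulVec, Finset.mul_sum] using this
  have h2 : (∑ r, ∑ s, d.Θ r s * d.H p r s) ^ 2
      ≤ (∑ r, ∑ s, d.Θ r s ^ 2) * ∑ r, ∑ s, d.H p r s ^ 2 := by
    simp only [← Fintype.sum_prod_type']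
    exact Finset.sum_mul_sq_le_sq_mul_sq _ _ _
  have h3 := hd.Θpos.posSemidef.sum_sq_le
  rw [← h.T] at h3
  have hH : 0 ≤ ∑ r, ∑ s, d.H p r s ^ 2 := by positivity
  have h4 : (∑ r, ∑ s, d.Θ r s * d.H p r s) ^ 2
      ≤ (ev p d.T * Real.sqrt (∑ i, ∑ j, d.H p i j ^ 2)) ^ 2 := by
    rw [mul_pow, Real.sq_sqrt hH]
    exact h2.trans (mul_le_mul_of_nonneg_right h3 hH)
  have h5 := (abs_le_of_sq_le_sq' h4 (mul_nonneg (hd.T_nonneg h) (Real.sqrt_nonneg _))).1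
  simp only [mul_add, Finset.sum_add_distrib]
  linarith

end Data

end

section

variable {ι : Type} {n : ℕ}

lemma add_le_of_quadratic {α β γ δ ε x y : ℝ} (hα : 0 < α) (hβ : 0 < β)
    (h : α * x ^ 2 + β * y ^ 2 ≤ γ + δ * x + ε * y) :
    x + y ≤ γ + (δ + 1) ^ 2 / (4 * α) + (ε + 1) ^ 2 / (4 * β) := by
  have h1 : ∀ {a c z : ℝ}, 0 < a → (c + 1) * z ≤ a * z ^ 2 + (c + 1) ^ 2 / (4 * a) := by
    intro a c z ha
    have : a * z ^ 2 + (c + 1) ^ 2 / (4 * a) - (c + 1) * z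
      = (2 * a * z - (c + 1)) ^ 2 / (4 * a) := by field_simp; ring
    have : 0 ≤ (2 * a * z - (c + 1)) ^ 2 / (4 * a) := by positivity
    linarith
  have := h1 (c := δ) (z := x) hα
  have := h1 (c := ε) (z := y) hβ
  linarith

/-- Scalar inequality behind the first order estimate. -/
lemma first_order_scalar {m C₀ CA A₀ B c E E₀ E₁ K N T τ h Y A Al φl η2 LT : ℝ}
    (hm : 1 ≤ m) (hC₀ : 0 < C₀) (hB : B = 1 / (4 * C₀)) (hc : c = 1 / (16 * m * C₀))
    (hE₀ : 0 < E₀) (hE : E₀ ≤ E) (hE₁ : E ≤ E₁) (hK : K = B * E₀) (hN : 0 ≤ N) (hT : 0 ≤ T)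
    (hτ : 0 ≤ τ) (hh : 0 ≤ h) (hCA : 0 ≤ CA) (hA : |A| ≤ A₀)
    (hY : (N / 2 - A) ^ 2 / m ≤ Y) (hAl : Al ^ 2 ≤ CA * τ * N) (hφl : φl ^ 2 ≤ C₀ * τ * N)
    (hη2 : η2 ≤ 2 * B ^ 2 * (C₀ * T) + 2 * c ^ 2 * (C₀ * τ))
    (hLT : -(T * Real.sqrt h) ≤ LT)
    (hmain : E * (h + Y + A * N / 2 - 2 * Al) + K * LT
      + (E * N + K * T) * (-B * (m - 1 - T) - c * (m - 1 - τ - φl))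
      - (E * N + K * T) * η2 ≤ 0) :
    E₀ / (16 * m) * N ^ 2 + K * B / 4 * T ^ 2 ≤ E₁ * (A₀ ^ 2 / m + 2 * CA / c)
      + E₁ * (A₀ / 2 + (B + c) * m) * N + K * (B + c) * m * T := by
  have hBpos : 0 < B := by rw [hB]; positivity
  have hcpos : 0 < c := by rw [hc]; positivity
  have hEpos : 0 < E := hE₀.trans_le hE
  have hKpos : 0 < K := by rw [hK]; positivity
  have hBC : B * C₀ = 1 / 4 := by rw [hB]; field_simp
  have hcC : c * C₀ = 1 / (16 * m) := by rw [hc]; field_simp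
  have hcC' : c * C₀ ≤ 1 / 16 := by
    rw [hcC]; exact one_div_le_one_div_of_le (by norm_num) (by linarith)
  have hX : 0 ≤ E * N + K * T := by positivity
  obtain ⟨hA1, hA2⟩ := abs_le.1 hA
  -- bound on the weight
  have hη : η2 ≤ B / 2 * T + c / 4 * τ := by
    have : 2 * B ^ 2 * (C₀ * T) = B / 2 * T := by linear_combination (2 * B * T) * hBC
    have : 2 * c ^ 2 * (C₀ * τ) ≤ c / 4 * τ := by
      have := mul_le_mul_of_nonneg_right hcC' (mul_nonneg hcpos.le hτ)
      linarith [mul_nonneg hcpos.le hτ]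
    linarith
  have hφ : -φl ≤ τ / 4 + C₀ * N := by
    have : φl ^ 2 ≤ (τ / 4 + C₀ * N) ^ 2 := by linarith [sq_nonneg (τ / 4 - C₀ * N)]
    linarith [(abs_le_of_sq_le_sq' this (by positivity)).1]
  have hAA : 2 * Al ≤ c / 2 * τ * N + 2 * CA / c := by
    have h0 : 0 ≤ c / 2 * τ * N + 2 * CA / c := by positivity
    have h1 : (2 * Al) ^ 2 ≤ (c / 2 * τ * N + 2 * CA / c) ^ 2 := by
      have e : (c / 2 * τ * N + 2 * CA / c) ^ 2
        = (c / 2 * τ * N - 2 * CA / c) ^ 2 + 4 * (CA * τ * N) := by field_simp; ring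
      rw [e]; linarith [sq_nonneg (c / 2 * τ * N - 2 * CA / c)]
    exact (abs_le_of_sq_le_sq' h1 h0).2
  have hHT : -(B * E * K * T ^ 2 / 4) ≤ E * (E * h) - E * (K * (T * Real.sqrt h)) := by
    have hs := Real.sq_sqrt hh
    have e : E * (E * h) - E * (K * (T * Real.sqrt h)) = (E * Real.sqrt h - K * T / 2) ^ 2
      - K ^ 2 * T ^ 2 / 4 := by rw [← hs]; rw [Real.sqrt_sq (Real.sqrt_nonneg _)]; ring
    have : K ^ 2 * T ^ 2 / 4 ≤ B * E * K * T ^ 2 / 4 := by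
      have : K ≤ B * E := by rw [hK]; exact mul_le_mul_of_nonneg_left hE hBpos.le
      have := mul_le_mul_of_nonneg_right this (show 0 ≤ K * T ^ 2 / 4 by positivity)
      linarith
    rw [e]; linarith [sq_nonneg (E * Real.sqrt h - K * T / 2)]
  have hHT' : -(B * K * T ^ 2 / 4) ≤ E * h - K * (T * Real.sqrt h) := by
    have : E * -(B * K * T ^ 2 / 4) ≤ E * (E * h - K * (T * Real.sqrt h)) := by linarith
    exact le_of_mul_le_mul_left this hEpos
  have hYE : E * ((N ^ 2 / 8 - A₀ ^ 2) / m) ≤ E * Y := by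
    refine mul_le_mul_of_nonneg_left (le_trans ?_ hY) hEpos.le
    refine div_le_div_of_nonneg_right ?_ (by linarith)
    have : A ^ 2 ≤ A₀ ^ 2 := sq_le_sq' hA1 hA2
    linarith [sq_nonneg (N / 2 - 2 * A)]
  have hW : (E * N + K * T) * (B / 2 * T + c / 2 * τ - (B + c) * m - c * C₀ * N)
      ≤ (E * N + K * T) * (-B * (m - 1 - T) - c * (m - 1 - τ - φl))
        - (E * N + K * T) * η2 := by
    rw [← mul_sub]
    refine mul_le_mul_of_nonneg_left ?_ hX
    have := mul_le_mul_of_nonneg_left hφ hcpos.le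
    linarith
  have hcross : K * T * (c * C₀ * N) ≤ E * N * (B / 2 * T) := by
    have h1 : K * (c * C₀) ≤ E * (B / 2) := by
      have : K * (c * C₀) ≤ K * (1 / 16) := mul_le_mul_of_nonneg_left hcC' hKpos.le
      have : K ≤ B * E := by rw [hK]; exact mul_le_mul_of_nonneg_left hE hBpos.le
      linarith [mul_pos hBpos hEpos]
    have := mul_le_mul_of_nonneg_right h1 (mul_nonneg hT hN)
    linarith
  have hNN : E * N * (c * C₀ * N) = E * N ^ 2 / (16 * m) := by rw [hcC]; field_simp
  have hLTK := mul_le_mul_of_nonneg_left hLT hKpos.le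
  have hAN : -(E * (A₀ * N / 2)) ≤ E * (A * N / 2) := by
    have := mul_nonneg hEpos.le (mul_nonneg (show 0 ≤ A + A₀ by linarith) hN)
    linarith
  have hAAE := mul_le_mul_of_nonneg_left hAA hEpos.le
  have hKcτ : 0 ≤ K * T * (c / 2 * τ) := by positivity
  have hfin : E / (16 * m) * N ^ 2 + K * B / 4 * T ^ 2
      ≤ E * (A₀ ^ 2 / m + 2 * CA / c) + E * (A₀ / 2 + (B + c) * m) * N + K * (B + c) * m * T := by
    have e8 : E * ((N ^ 2 / 8 - A₀ ^ 2) / m) = 2 * (E * N ^ 2 / (16 * m)) - E * (A₀ ^ 2 / m) := by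
      field_simp; ring
    have e9 : E / (16 * m) * N ^ 2 = E * N ^ 2 / (16 * m) := by ring
    rw [e9]
    linarith
  have hm0 : 0 < m := by linarith
  have hA₀ : 0 ≤ A₀ := (abs_nonneg A).trans hA
  calc _ ≤ E / (16 * m) * N ^ 2 + K * B / 4 * T ^ 2 := by gcongr
    _ ≤ _ := hfin
    _ ≤ _ := by gcongr

end

section

variable {ι : Type} {n : ℕ}
namespace Data
variable {d : Data ι n} {p : ι × (Fin n → ℝ)} {C₀ CA A₀ Cφ : ℝ}

lemma Normal.N_eq (h : d.Normal p) : ev p (d.gam d.L d.L) = ∑ k, d.l1 p k ^ 2 := by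
  rw [h.gam]; exact Finset.sum_congr rfl fun _ _ => (sq _).symm

lemma Adm.perN (hd : d.Adm C₀ CA A₀ Cφ) : d.gam d.L d.L ∈ perAlg ι n :=
  sum_mem fun _ _ => sum_mem fun _ _ =>
    mul_mem (hd.pera _ _) (mul_mem (perAlg_dv hd.perL _) (perAlg_dv hd.perL _))

lemma perAlg_cm (M : Matrix (Fin n) (Fin n) ℝ) (i j : Fin n) : (cm M i j : SF ι n) ∈ perAlg ι n :=
  Subalgebra.algebraMap_mem _ _

lemma Adm.perG (hd : d.Adm C₀ CA A₀ Cφ) (i j : Fin n) : d.G i j ∈ perAlg ι n :=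
  add_mem (perAlg_cm _ _ _) (perAlg_dv (perAlg_dv hd.perφ _) _)

lemma Adm.perT (hd : d.Adm C₀ CA A₀ Cφ) : d.T ∈ perAlg ι n := by
  show ∑ i, (cm d.Θ * d.G).diag i ∈ perAlg ι n
  refine sum_mem fun i _ => ?_
  rw [Matrix.diag_apply, Matrix.mul_apply]
  exact sum_mem fun j _ => mul_mem (perAlg_cm _ _ _) (hd.perG _ _)

/-- The first order inequality at a maximum point. -/
lemma Bd.first_order (hd : d.Bd C₀ CA) (h : d.Normal p) {m B c E₀ E₁ K : ℝ} (hm : m = n + 1)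
    (hC₀ : 0 < C₀) (hCA : 0 ≤ CA) (hA : |ev p d.A| ≤ A₀) (hB : B = 1 / (4 * C₀))
    (hc : c = 1 / (16 * m * C₀)) (hE₀ : 0 < E₀) (hE : E₀ ≤ Real.exp (-(1 / 2) * ev p d.L))
    (hE₁ : Real.exp (-(1 / 2) * ev p d.L) ≤ E₁) (hK : K = B * E₀)
    (hg : ∀ k, ev p (d.D k ((-B • d.ψ + -c • d.φ).exp *
      ((-(1 / 2 : ℝ) • d.L).exp * d.gam d.L d.L + K • d.T))) = 0)
    (hh : ev p (d.lap ((-B • d.ψ + -c • d.φ).exp *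
      ((-(1 / 2 : ℝ) • d.L).exp * d.gam d.L d.L + K • d.T))) ≤ 0) :
    E₀ / (16 * m) * ev p (d.gam d.L d.L) ^ 2 + K * B / 4 * ev p d.T ^ 2
      ≤ E₁ * (A₀ ^ 2 / m + 2 * CA / c)
      + E₁ * (A₀ / 2 + (B + c) * m) * ev p (d.gam d.L d.L) + K * (B + c) * m * ev p d.T := by
  obtain ⟨h1, h2⟩ := h.weighted hg hh
  have hN0 : 0 ≤ ev p (d.gam d.L d.L) := by rw [h.N_eq]; positivity
  have hm1 : (1 : ℝ) ≤ m := by rw [hm]; linarith [Nat.cast_nonneg (α := ℝ) n]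
  refine first_order_scalar (m := m) (h := ∑ i, ∑ j, d.H p i j ^ 2)
    (Y := ∑ i, ∑ j, (d.l2 p i j - d.l1 p i * d.l1 p j / 2) ^ 2)
    (E := Real.exp (-(1 / 2) * ev p d.L)) (A := ev p d.A)
    (Al := ∑ k, ev p (d.D k d.A) * d.l1 p k) (φl := ∑ k, d.l1 p k * ev p (d.D k d.φ))
    (η2 := ∑ k, ev p (d.D k (-B • d.ψ + -c • d.φ)) ^ 2) (τ := ev p d.τ)
    (LT := ev p (d.lap d.T) - ∑ k, d.l1 p k * ev p (d.D k d.T))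
    hm1 hC₀ hB hc hE₀ hE hE₁ hK hN0 (hd.T_nonneg h)
    (hd.τ_nonneg h) (by positivity) hCA hA ?_ ?_ ?_ ?_ (hd.LL_T_lower h) ?_
  · have e : ev p (d.gam d.L d.L) / 2 - ev p d.A = ∑ i, (d.l2 p i i - d.l1 p i * d.l1 p i / 2) := by
      rw [Finset.sum_sub_distrib, h.trace_l2, h.N_eq, ← Finset.sum_div]
      simp only [sq]; ring
    rw [e, div_le_iff₀ (by linarith)]
    have h3 := Finset.sum_mul_sq_le_sq_mul_sq Finset.univ (fun _ : Fin n => (1 : ℝ))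
      (fun i => d.l2 p i i - d.l1 p i * d.l1 p i / 2)
    simp only [one_mul, one_pow, Finset.sum_const, Finset.card_univ, Fintype.card_fin,
      nsmul_eq_mul, mul_one] at h3
    have h4 : ∑ i, (d.l2 p i i - d.l1 p i * d.l1 p i / 2) ^ 2
        ≤ ∑ i, ∑ j, (d.l2 p i j - d.l1 p i * d.l1 p j / 2) ^ 2 :=
      Finset.sum_le_sum fun i _ => Finset.single_le_sum
        (f := fun j => (d.l2 p i j - d.l1 p i * d.l1 p j / 2) ^ 2)
        (fun j _ => sq_nonneg _) (Finset.mem_univ i)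
    rw [mul_comm]
    calc _ ≤ _ := h3
      _ ≤ m * _ := by
          rw [hm]
          exact mul_le_mul (by linarith) h4 (Finset.sum_nonneg fun _ _ => sq_nonneg _)
            (by linarith [Nat.cast_nonneg (α := ℝ) n])
  · rw [h.N_eq]
    exact (Finset.sum_mul_sq_le_sq_mul_sq _ _ _).trans
      (mul_le_mul_of_nonneg_right (hd.sq_A h) (by positivity))
  · rw [h.N_eq, mul_comm]
    exact (Finset.sum_mul_sq_le_sq_mul_sq _ _ _).trans
      (mul_le_mul_of_nonneg_left (hd.sq_φ h) (by positivity))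
  · have h5 := hd.sq_ψ h
    have h6 := hd.sq_φ h
    have h7 : ∑ k, ev p (d.D k (-B • d.ψ + -c • d.φ)) ^ 2
        ≤ 2 * B ^ 2 * ∑ k, ev p (d.D k d.ψ) ^ 2 + 2 * c ^ 2 * ∑ k, ev p (d.D k d.φ) ^ 2 := by
      rw [Finset.mul_sum, Finset.mul_sum, ← Finset.sum_add_distrib]
      refine Finset.sum_le_sum fun k _ => ?_
      simp only [map_add, Derivation.map_smul, map_smul, smul_eq_mul]
      linarith [sq_nonneg (B * ev p (d.D k d.ψ) - c * ev p (d.D k d.φ))]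
    have := mul_le_mul_of_nonneg_left h5 (show 0 ≤ 2 * B ^ 2 by positivity)
    have := mul_le_mul_of_nonneg_left h6 (show 0 ≤ 2 * c ^ 2 by positivity)
    linarith
  · have e1 := h.LL_N
    have e2 := congrArg (ev p) d.lap_ψ
    have e3 := congrArg (ev p) d.lap_phi
    simp only [map_sub, map_natCast, h.gam, ev_l1] at e2 e3
    simp only [lap_add, lap_smul, map_add, map_smul, smul_eq_mul, map_mul, ev_exp] at h1 h2 ⊢
    have e4 : ∑ k, d.l1 p k * ev p (d.D k ((-(1 / 2 : ℝ) • d.L).exp * d.gam d.L d.L))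
        + K * ∑ k, d.l1 p k * ev p (d.D k d.T)
        = -((Real.exp (-(1 / 2) * ev p d.L) * ev p (d.gam d.L d.L) + K * ev p d.T) *
          (-B * ∑ k, d.l1 p k * ev p (d.D k d.ψ) + -c * ∑ k, d.l1 p k * ev p (d.D k d.φ))) := by
      simp only [Finset.mul_sum, ← Finset.sum_add_distrib, ← Finset.sum_neg_distrib]
      refine Finset.sum_congr rfl fun k _ => ?_
      have := h1 k
      simp only [Derivation.map_smul, map_smul, smul_eq_mul] at this
      linear_combination d.l1 p k * this
    rw [← e1]
    have e5 : ev p (d.lap d.ψ) = m - 1 - ev p d.T + ∑ k, d.l1 p k * ev p (d.D k d.ψ) := by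
      rw [hm]; linarith
    have e6 : ev p (d.lap d.φ) = m - 1 - ev p d.τ := by rw [hm]; linarith
    rw [e5, e6] at h2
    refine le_trans (le_of_eq ?_) h2
    linear_combination -e4

/-- Uniform first order estimate. -/
lemma Adm.first_order (hd : d.Adm C₀ CA A₀ Cφ) :
    ∃ C, ∀ p, ev p (d.gam d.L d.L) ≤ C ∧ ev p d.T ≤ C := by
  obtain ⟨a₀, ha₀⟩ := hd.L_lower
  obtain ⟨a₁, ha₁⟩ := hd.L_upper
  set m : ℝ := n + 1 with hm
  set B : ℝ := 1 / (4 * C₀) with hB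
  set c : ℝ := 1 / (16 * m * C₀) with hc
  set E₀ : ℝ := Real.exp (-(1 / 2) * a₁) with hE₀
  set E₁ : ℝ := Real.exp (1 / 2 * a₀) with hE₁
  set K : ℝ := B * E₀ with hK
  have hC₀ := hd.C₀_pos
  have hmpos : 0 < m := by positivity
  have hBpos : 0 < B := by positivity
  have hcpos : 0 < c := by positivity
  have hE₀pos : 0 < E₀ := Real.exp_pos _
  have hE₁pos : 0 < E₁ := Real.exp_pos _
  have hKpos : 0 < K := by positivity
  have hEl : ∀ p, E₀ ≤ Real.exp (-(1 / 2) * ev p d.L) := fun p =>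
    Real.exp_le_exp.2 (by linarith [ha₁ p])
  have hEu : ∀ p, Real.exp (-(1 / 2) * ev p d.L) ≤ E₁ := fun p =>
    Real.exp_le_exp.2 (by linarith [ha₀ p])
  set Z : ℝ := E₁ * (A₀ ^ 2 / m + 2 * CA / c)
    + (E₁ * (A₀ / 2 + (B + c) * m) + 1) ^ 2 / (4 * (E₀ / (16 * m)))
    + (K * (B + c) * m + 1) ^ 2 / (4 * (K * B / 4)) with hZ
  have hZ0 : 0 ≤ Z := by
    have := hd.CA_nonneg
    positivity
  set η : SF ι n := -B • d.ψ + -c • d.φ with hη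
  set X : SF ι n := (-(1 / 2 : ℝ) • d.L).exp * d.gam d.L d.L + K • d.T with hX
  set Cη : ℝ := B * (Cφ + C₀) + c * Cφ with hCη
  have hηb : ∀ p, |ev p η| ≤ Cη := by
    intro p
    have h1 := hd.toBd.abs_ψ hC₀.le p
    have h2 := hd.hφ p
    simp only [hη, map_add, map_smul, smul_eq_mul]
    refine (abs_add_le _ _).trans ?_
    rw [abs_mul, abs_mul, abs_neg, abs_neg, abs_of_pos hBpos, abs_of_pos hcpos]
    have := mul_le_mul_of_nonneg_left (h1.trans (add_le_add_left h2 C₀)) hBpos.le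
    have := mul_le_mul_of_nonneg_left h2 hcpos.le
    linarith
  have hXv : ∀ p, ev p X = Real.exp (-(1 / 2) * ev p d.L) * ev p (d.gam d.L d.L)
      + K * ev p d.T := by
    intro p
    simp only [hX, map_add, map_mul, map_smul, smul_eq_mul, ev_exp]
  have hnn : ∀ p, 0 ≤ ev p (d.gam d.L d.L) ∧ 0 ≤ ev p d.T := by
    intro p
    obtain ⟨P, P', hP, hn, -⟩ := d.exists_normal (hd.apos p)
    have h1 := hn.N_eq
    have h2 := (hd.toBd.frame P P' hP).T_nonneg hn
    rw [frame_T] at h2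
    rw [frame_gam] at h1
    refine ⟨?_, h2⟩
    change ev p (d.gam d.L d.L) = _ at h1
    rw [h1]; positivity
  have hper : η.exp * X ∈ perAlg ι n :=
    mul_mem (perAlg_exp (add_mem (Subalgebra.smul_mem _ hd.per_ψ _)
        (Subalgebra.smul_mem _ hd.perφ _)))
      (add_mem (mul_mem (perAlg_exp (Subalgebra.smul_mem _ hd.perL _)) hd.perN)
        (Subalgebra.smul_mem _ hd.perT _))
  have key : ∀ q, ev q X ≤ Real.exp (2 * Cη) * ((E₁ + K) * Z) := by
    intro q
    obtain ⟨p, P, P', hP, hp1, hmax⟩ := hd.exists_max hper q.1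
    have hb := hd.toBd.frame P P' hP
    have hineq := hb.first_order (A₀ := A₀) (m := m) (B := B) (c := c) (E₀ := E₀) (E₁ := E₁)
      (K := K) hmax.normal hm hC₀ hd.CA_nonneg (hd.hA p) hB hc hE₀pos (hEl p) (hEu p) hK
      (by
        intro k
        have := hmax.grad k
        rw [frame_ψ, frame_gam, frame_T]; exact this)
      (by
        have := hmax.hess
        rw [frame_ψ, frame_gam, frame_T]; exact this)
    rw [frame_gam, frame_T] at hineq
    have hsum := add_le_of_quadratic (by positivity) (by positivity) hineq
    obtain ⟨n1, n2⟩ := hnn p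
    have hXp : ev p X ≤ (E₁ + K) * Z := by
      rw [hXv]
      have h1 := mul_le_mul_of_nonneg_right (hEu p) n1
      change ev p (d.gam d.L d.L) + ev p d.T ≤ Z at hsum
      have h2 := mul_le_mul_of_nonneg_left (show ev p (d.gam d.L d.L) ≤ Z by linarith) hE₁pos.le
      have h3 := mul_le_mul_of_nonneg_left (show ev p d.T ≤ Z by linarith) hKpos.le
      linarith
    have hle := hmax.le q.2
    rw [hp1] at hle
    simp only [map_mul, ev_exp] at hle
    change Real.exp (ev q η) * ev q X ≤ _ at hle
    have h3 : ev q X ≤ Real.exp (ev p η - ev q η) * ev p X := by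
      rw [sub_eq_add_neg, Real.exp_add, Real.exp_neg]
      have hpos := Real.exp_pos (ev q η)
      rw [← mul_le_mul_iff_right₀ hpos]
      calc _ ≤ _ := hle
        _ = _ := by field_simp
    refine h3.trans ?_
    have := abs_le.1 (hηb p)
    have := abs_le.1 (hηb q)
    calc _ ≤ Real.exp (ev p η - ev q η) * ((E₁ + K) * Z) :=
          mul_le_mul_of_nonneg_left hXp (Real.exp_pos _).le
      _ ≤ _ := mul_le_mul_of_nonneg_right (Real.exp_le_exp.2 (by linarith)) (by positivity)
  refine ⟨Real.exp (2 * Cη) * ((E₁ + K) * Z) / E₀ + Real.exp (2 * Cη) * ((E₁ + K) * Z) / K,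
    fun q => ?_⟩
  have h1 := key q
  rw [hXv] at h1
  obtain ⟨n1, n2⟩ := hnn q
  have p1 : 0 ≤ Real.exp (2 * Cη) * ((E₁ + K) * Z) / E₀ := by positivity
  have p2 : 0 ≤ Real.exp (2 * Cη) * ((E₁ + K) * Z) / K := by positivity
  have h2 := mul_le_mul_of_nonneg_right (hEl q) n1
  constructor
  · have : ev q (d.gam d.L d.L) ≤ Real.exp (2 * Cη) * ((E₁ + K) * Z) / E₀ := by
      rw [le_div_iff₀ hE₀pos]
      linarith [mul_nonneg hKpos.le n2]
    linarith
  · have : ev q d.T ≤ Real.exp (2 * Cη) * ((E₁ + K) * Z) / K := by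
      rw [le_div_iff₀ hKpos]
      linarith [mul_nonneg hE₀pos.le n1]
    linarith

end Data

end

section

variable {ι : Type} {n : ℕ}
namespace Data
variable {d : Data ι n} {p : ι × (Fin n → ℝ)}

/-- Pairing of Hessians. -/
def pair (d : Data ι n) (f g : SF ι n) : SF ι n := trace (d.a * d.hes f * (d.a * d.hes g))

lemma R_eq_pair : d.R = d.pair d.L d.L := rfl

lemma G1_eq_hes (k : Fin n) : d.G1 k = d.hes (d.D k d.φ) := by
  ext1 i j
  rw [G1_apply, hes, Matrix.of_apply, d.comm k i, d.comm k j]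

lemma S_eq_pair : d.S = ∑ k, ∑ l, d.a k l * d.pair (d.D k d.φ) (d.D l d.φ) := by
  simp only [S, G1_eq_hes, pair]

lemma pair_eq (f g : SF ι n) :
    d.pair f g = ∑ i, ∑ j, (d.a * d.hes f) i j * (d.a * d.hes g) j i := by
  simp only [pair, Matrix.trace, Matrix.diag_apply, Matrix.mul_apply]

/-- Derivative of `a * hes f` at a normal point. -/
def Y1 (d : Data ι n) (p : ι × (Fin n → ℝ)) (f : SF ι n) (q i j : Fin n) : ℝ :=
  ev p (d.D q (d.D i (d.D j f))) - ∑ r, d.j3 p q i r * ev p (d.D r (d.D j f))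

/-- Second derivative of `a * hes f` at a normal point. -/
def Y2 (d : Data ι n) (p : ι × (Fin n → ℝ)) (f : SF ι n) (q i j : Fin n) : ℝ :=
  ev p (d.D q (d.D q (d.D i (d.D j f)))) - 2 * ∑ r, d.j3 p q i r * ev p (d.D q (d.D r (d.D j f)))
    + ∑ r, (2 * ∑ s, d.j3 p q i s * d.j3 p q s r - d.j4 p q q i r) * ev p (d.D r (d.D j f))

lemma Normal.ev_ah (h : d.Normal p) (f : SF ι n) (i j : Fin n) :
    ev p ((d.a * d.hes f) i j) = ev p (d.D i (d.D j f)) := by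
  simp [Matrix.mul_apply, hes, h _ _]

lemma Normal.D_ah (h : d.Normal p) (f : SF ι n) (q i j : Fin n) :
    ev p (d.D q ((d.a * d.hes f) i j)) = d.Y1 p f q i j := by
  simp [Matrix.mul_apply, hes, h _ _, h.D_a, Derivation.leibniz, Finset.sum_add_distrib, Data.Y1]
  simp only [mul_comm]
  ring

lemma Normal.DD_ah (h : d.Normal p) (f : SF ι n) (q i j : Fin n) :
    ev p (d.D q (d.D q ((d.a * d.hes f) i j))) = d.Y2 p f q i j := by
  have e : ev p (d.D q (d.D q ((d.a * d.hes f) i j))) = ∑ r,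
      ((if i = r then 1 else 0) * ev p (d.D q (d.D q (d.D r (d.D j f))))
        - 2 * (d.j3 p q i r * ev p (d.D q (d.D r (d.D j f))))
        + (2 * ∑ s, d.j3 p q i s * d.j3 p q s r - d.j4 p q q i r) * ev p (d.D r (d.D j f))) := by
    simp only [Matrix.mul_apply, hes, map_sum, Matrix.of_apply]
    refine Finset.sum_congr rfl fun r _ => ?_
    simp only [Derivation.leibniz, smul_eq_mul, map_add, map_mul, h.D_a, h.DD_a, h i r,
      Finset.sum_add_distrib]
    ring
  rw [e, Data.Y2]
  simp only [Finset.sum_add_distrib, Finset.sum_sub_distrib, ite_mul, one_mul, zero_mul,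
    Finset.sum_ite_eq, Finset.mem_univ, if_true, Finset.mul_sum]

lemma Normal.ev_pair (h : d.Normal p) (f g : SF ι n) : ev p (d.pair f g)
    = ∑ i, ∑ j, ev p (d.D i (d.D j f)) * ev p (d.D i (d.D j g)) := by
  rw [pair_eq]
  simp only [map_sum, map_mul, h.ev_ah]
  exact Finset.sum_congr rfl fun i _ => Finset.sum_congr rfl fun j _ => by rw [d.comm j i]

lemma Normal.D_pair (h : d.Normal p) (f g : SF ι n) (q : Fin n) : ev p (d.D q (d.pair f g))
    = ∑ i, ∑ j, (d.Y1 p f q i j * ev p (d.D i (d.D j g))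
      + ev p (d.D i (d.D j f)) * d.Y1 p g q i j) := by
  rw [pair_eq]
  simp only [map_sum, map_mul, h.ev_ah, Derivation.leibniz, smul_eq_mul, map_add, h.D_ah,
    Finset.sum_add_distrib]
  rw [add_comm]
  congr 1
  · exact Finset.sum_congr rfl fun i _ => Finset.sum_congr rfl fun j _ => by rw [d.comm j i, mul_comm]
  · rw [Finset.sum_comm]
    exact Finset.sum_congr rfl fun i _ => Finset.sum_congr rfl fun j _ => by rw [d.comm j i]

lemma Normal.DD_pair (h : d.Normal p) (f g : SF ι n) (q : Fin n) : ev p (d.D q (d.D q (d.pair f g)))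
    = ∑ i, ∑ j, (d.Y2 p f q i j * ev p (d.D i (d.D j g))
      + ev p (d.D i (d.D j f)) * d.Y2 p g q i j + 2 * (d.Y1 p f q i j * d.Y1 p g q j i)) := by
  rw [pair_eq]
  simp only [map_sum, map_mul, h.ev_ah, Derivation.leibniz, smul_eq_mul, map_add, h.D_ah, h.DD_ah,
    Finset.sum_add_distrib]
  have e1 : ∑ i, ∑ j, ev p (d.D j (d.D i g)) * d.Y2 p f q i j
      = ∑ i, ∑ j, d.Y2 p f q i j * ev p (d.D i (d.D j g)) :=
    Finset.sum_congr rfl fun i _ => Finset.sum_congr rfl fun j _ => by rw [d.comm j i, mul_comm]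
  have e2 : ∑ i, ∑ j, ev p (d.D i (d.D j f)) * d.Y2 p g q j i
      = ∑ i, ∑ j, ev p (d.D i (d.D j f)) * d.Y2 p g q i j := by
    rw [Finset.sum_comm]
    exact Finset.sum_congr rfl fun i _ => Finset.sum_congr rfl fun j _ => by rw [d.comm j i]
  have e3 : ∑ i, ∑ j, d.Y1 p g q j i * d.Y1 p f q i j
      = ∑ i, ∑ j, d.Y1 p f q i j * d.Y1 p g q j i :=
    Finset.sum_congr rfl fun i _ => Finset.sum_congr rfl fun j _ => mul_comm _ _
  rw [e1, e2, e3]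
  simp only [← Finset.mul_sum]
  ring

/-- The expression `f_{ijpq} s_{ijk} s_{pqk}`. -/
def X4 (d : Data ι n) (p : ι × (Fin n → ℝ)) : ℝ :=
  ∑ i, ∑ j, ∑ r, ∑ s, ∑ k, d.j4 p i j r s * (d.j3 p i j k * d.j3 p r s k)

/-- The tetrahedral contraction of the third derivatives. -/
def q4 (d : Data ι n) (p : ι × (Fin n → ℝ)) : ℝ :=
  ∑ i, ∑ j, ∑ r, ∑ s, ∑ k, ∑ l,
    d.j3 p i j r * d.j3 p i s k * (d.j3 p j s l * d.j3 p r k l)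

lemma Y1_D (d : Data ι n) (p : ι × (Fin n → ℝ)) (k q i j : Fin n) : d.Y1 p (d.D k d.φ) q i j
    = d.j4 p q k i j - ∑ r, d.j3 p q i r * d.j3 p k r j := by
  simp only [Y1, ev_j4, ev_j3]
  rw [d.j4_34 p q i j k, d.j4_23 p q i k j]
  congr 1
  exact Finset.sum_congr rfl fun r _ => by rw [d.j3_23 p r, d.j3_12 p r]

lemma Y2_D (d : Data ι n) (p : ι × (Fin n → ℝ)) (k q i j : Fin n) : d.Y2 p (d.D k d.φ) q i j = d.j5 p k i j q q
    - 2 * ∑ r, d.j3 p q i r * d.j4 p q r k j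
    + ∑ r, (2 * ∑ s, d.j3 p q i s * d.j3 p q s r - d.j4 p q q i r) * d.j3 p k r j := by
  simp only [Y2, ev_j5, ev_j4, ev_j3, d.j3_23 p _ _ k, d.j3_12 p _ k, d.j4_34 p _ _ _ k]
  congr 2
  simp only [d.j5_45 p q q i j k, d.j5_34 p q q i k j, d.j5_23 p q q k i j, d.j5_12 p q k,
    d.j5_34 p k q q, d.j5_23 p k q i]
  rw [d.j5_45 p k i q q, d.j5_34 p k i q j]

lemma sum_mul_M (d : Data ι n) (p : ι × (Fin n → ℝ)) (f : Fin n → Fin n → Fin n → ℝ) : ∑ q, ∑ k, ∑ l, f q k l * d.M p k l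
    = ∑ k, ∑ l, (∑ q, f q k l) * d.M p k l := by
  simp only [Finset.sum_mul]
  exact sum_perm3 ![1, 2, 0] (by decide) fun c => by simp only [Matrix.cons_val]

lemma sum_j3_j3 (d : Data ι n) (p : ι × (Fin n → ℝ)) (k l : Fin n) : ∑ q, (2 * ∑ r, d.j3 p q k r * d.j3 p q r l) = 2 * d.M p k l := by
  rw [← Finset.mul_sum, M]
  simp only [d.j3_23 p _ _ l, d.j3_12 p _ l, d.j3_12 p _ k]

lemma sum_j3_Y1 (d : Data ι n) (p : ι × (Fin n → ℝ)) : ∑ q, ∑ k, ∑ l, 2 * d.j3 p q k l * (∑ i, ∑ j, (d.Y1 p (d.D k d.φ) q i j * d.j3 p l i j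
        + d.j3 p k i j * d.Y1 p (d.D l d.φ) q i j)) = 4 * d.X4 p - 4 * d.q4 p := by
  have tC1 : ∑ q, ∑ k, ∑ l, ∑ i, ∑ j, d.j3 p q k l * (d.j4 p q k i j * d.j3 p l i j) = d.X4 p :=
    sum_perm5 ![0, 1, 3, 4, 2] (by decide) fun c => by
      simp only [Matrix.cons_val, d.j3_12 p, d.j3_23 p]; ring
  have tC2 : ∑ q, ∑ k, ∑ l, ∑ i, ∑ j, ∑ r, d.j3 p q k l *
      (d.j3 p q i r * d.j3 p k r j * d.j3 p l i j) = d.q4 p :=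
    sum_perm6 ![0, 1, 2, 5, 3, 4] (by decide) fun c => by
      simp only [Matrix.cons_val, d.j3_23 p]; ring
  have tC3 : ∑ q, ∑ k, ∑ l, ∑ i, ∑ j, d.j3 p q k l * (d.j4 p q l i j * d.j3 p k i j) = d.X4 p :=
    sum_perm5 ![0, 2, 3, 4, 1] (by decide) fun c => by
      simp only [Matrix.cons_val, d.j3_12 p, d.j3_23 p]; ring
  have tC4 : ∑ q, ∑ k, ∑ l, ∑ i, ∑ j, ∑ r, d.j3 p q k l *
      (d.j3 p q i r * d.j3 p l r j * d.j3 p k i j) = d.q4 p :=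
    sum_perm6 ![0, 2, 1, 5, 3, 4] (by decide) fun c => by
      simp only [Matrix.cons_val, d.j3_23 p]; ring
  have : ∑ q, ∑ k, ∑ l, 2 * d.j3 p q k l * (∑ i, ∑ j, (d.Y1 p (d.D k d.φ) q i j * d.j3 p l i j
        + d.j3 p k i j * d.Y1 p (d.D l d.φ) q i j))
      = ∑ q, ∑ k, ∑ l, ∑ i, ∑ j, (2 * (d.j3 p q k l * (d.j4 p q k i j * d.j3 p l i j))
        + 2 * (d.j3 p q k l * (d.j4 p q l i j * d.j3 p k i j))
        - 2 * (∑ r, d.j3 p q k l * (d.j3 p q i r * d.j3 p k r j * d.j3 p l i j))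
        - 2 * (∑ r, d.j3 p q k l * (d.j3 p q i r * d.j3 p l r j * d.j3 p k i j))) := by
    refine Finset.sum_congr rfl fun q _ => Finset.sum_congr rfl fun k _ =>
      Finset.sum_congr rfl fun l _ => ?_
    simp only [Finset.mul_sum (a := 2 * d.j3 p q k l), d.Y1_D p]
    refine Finset.sum_congr rfl fun i _ => Finset.sum_congr rfl fun j _ => ?_
    simp only [← Finset.mul_sum, ← Finset.sum_mul]
    ring
  rw [this]
  simp only [Finset.sum_add_distrib, Finset.sum_sub_distrib, ← Finset.mul_sum (a := (2:ℝ)),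
    tC1, tC2, tC3, tC4]
  ring

lemma Normal.sum_j5_j3 (h : d.Normal p) : ∑ q, ∑ k, ∑ i, ∑ j, d.j5 p k i j q q * d.j3 p k i j
    = ∑ k, ∑ i, ∑ j, d.l3 p k i j * d.j3 p k i j + 3 * d.X4 p - 2 * d.q4 p := by
  have e : ∀ k i j, ∑ q, d.j5 p k i j q q = d.l3 p k i j
      + (∑ r, ∑ s, (d.j4 p k i r s * d.j3 p j r s + d.j3 p i r s * d.j4 p k j r s
      + d.j3 p k r s * d.j4 p i j r s))
    - ∑ r, ∑ s, ∑ q, (d.j3 p k r q * d.j3 p i q s + d.j3 p i r q * d.j3 p k q s)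
      * d.j3 p j r s := by
    intro k i j
    rw [h.l3]; ring
  have e1 : ∑ q, ∑ k, ∑ i, ∑ j, d.j5 p k i j q q * d.j3 p k i j
      = ∑ k, ∑ i, ∑ j, (∑ q, d.j5 p k i j q q) * d.j3 p k i j := by
    simp only [Finset.sum_mul]
    exact sum_perm4 ![1, 2, 3, 0] (by decide) fun c => by simp only [Matrix.cons_val]
  rw [e1]
  simp only [e, add_mul, sub_mul, Finset.sum_mul, Finset.sum_add_distrib, Finset.sum_sub_distrib]
  have x1 : ∑ k, ∑ i, ∑ j, ∑ r, ∑ s, d.j4 p k i r s * d.j3 p j r s * d.j3 p k i j = d.X4 p :=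
    sum_perm5 ![0, 1, 3, 4, 2] (by decide) fun c => by
      simp only [Matrix.cons_val, d.j3_12 p, d.j3_23 p]; ring
  have x2 : ∑ k, ∑ i, ∑ j, ∑ r, ∑ s, d.j3 p i r s * d.j4 p k j r s * d.j3 p k i j = d.X4 p :=
    sum_perm5 ![0, 2, 3, 4, 1] (by decide) fun c => by
      simp only [Matrix.cons_val, d.j3_12 p, d.j3_23 p]; ring
  have x3 : ∑ k, ∑ i, ∑ j, ∑ r, ∑ s, d.j3 p k r s * d.j4 p i j r s * d.j3 p k i j = d.X4 p :=
    sum_perm5 ![1, 2, 3, 4, 0] (by decide) fun c => by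
      simp only [Matrix.cons_val, d.j3_12 p, d.j3_23 p]; ring
  have x4 : ∑ k, ∑ i, ∑ j, ∑ r, ∑ s, ∑ q,
      d.j3 p k r q * d.j3 p i q s * d.j3 p j r s * d.j3 p k i j = d.q4 p :=
    sum_perm6 ![0, 1, 2, 5, 3, 4] (by decide) fun c => by
      simp only [Matrix.cons_val, d.j3_23 p]; ring
  have x5 : ∑ k, ∑ i, ∑ j, ∑ r, ∑ s, ∑ q,
      d.j3 p i r q * d.j3 p k q s * d.j3 p j r s * d.j3 p k i j = d.q4 p :=
    sum_perm6 ![1, 0, 2, 5, 3, 4] (by decide) fun c => by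
      simp only [Matrix.cons_val, d.j3_12 p, d.j3_23 p]; ring
  rw [x1, x2, x3, x4, x5]; ring

lemma Normal.sum_j4_j3 (h : d.Normal p) : ∑ q, ∑ k, ∑ i, ∑ j, ∑ r, (2 * ∑ s, d.j3 p q i s * d.j3 p q s r - d.j4 p q q i r)
    * d.j3 p k r j * d.j3 p k i j
    = ∑ i, ∑ j, d.M p i j ^ 2 - ∑ i, ∑ j, d.l2 p i j * d.M p i j := by
  have e1 : ∀ c : Fin n → Fin n → Fin n → ℝ,
      ∑ q, ∑ k, ∑ i, ∑ j, ∑ r, c q i r * d.j3 p k r j * d.j3 p k i j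
      = ∑ q, ∑ i, ∑ r, c q i r * d.M p i r := by
    intro c
    simp only [M, Finset.mul_sum]
    exact sum_perm5 ![0, 2, 4, 1, 3] (by decide) fun c => by
      simp only [Matrix.cons_val, d.j3_12 p, d.j3_23 p]; ring
  rw [e1 fun q i r => 2 * ∑ s, d.j3 p q i s * d.j3 p q s r - d.j4 p q q i r, d.sum_mul_M p]
  simp only [Finset.sum_sub_distrib, d.sum_j3_j3 p, h.sum_j4, sub_mul, add_mul, Finset.sum_add_distrib,
    mul_assoc, ← Finset.mul_sum, sq]
  ring

lemma sum_Y1_Y1 (d : Data ι n) (p : ι × (Fin n → ℝ)) : ∑ q, ∑ k, ∑ i, ∑ j, d.Y1 p (d.D k d.φ) q i j * d.Y1 p (d.D k d.φ) q j i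
    = ∑ i, ∑ j, ∑ k, ∑ l, d.j4 p i j k l ^ 2 - 2 * d.X4 p + d.q4 p := by
  have e1 : ∑ q, ∑ k, ∑ i, ∑ j, d.Y1 p (d.D k d.φ) q i j * d.Y1 p (d.D k d.φ) q j i
      = ∑ q, ∑ k, ∑ i, ∑ j, (d.j4 p q k i j ^ 2
        - ∑ r, d.j4 p q k i j * d.j3 p q i r * d.j3 p k r j
        - ∑ r, d.j4 p q k i j * d.j3 p q j r * d.j3 p k r i
        + ∑ r, ∑ s, d.j3 p q i r * d.j3 p k r j * (d.j3 p q j s * d.j3 p k s i)) := by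
    refine Finset.sum_congr rfl fun q _ => Finset.sum_congr rfl fun k _ =>
      Finset.sum_congr rfl fun i _ => Finset.sum_congr rfl fun j _ => ?_
    rw [d.Y1_D p, d.Y1_D p, d.j4_34 p q k j i]
    rw [← Finset.sum_mul_sum]
    simp only [mul_assoc, ← Finset.mul_sum]
    ring
  have x1 : ∑ q, ∑ k, ∑ i, ∑ j, ∑ r, d.j4 p q k i j * d.j3 p q i r * d.j3 p k r j = d.X4 p := by
    refine sum_perm5 ![0, 2, 1, 3, 4] (by decide) fun c => ?_
    simp only [Matrix.cons_val]
    rw [d.j4_23, d.j3_23 p (c 1)]; ring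
  have x2 : ∑ q, ∑ k, ∑ i, ∑ j, ∑ r, d.j4 p q k i j * d.j3 p q j r * d.j3 p k r i = d.X4 p := by
    refine sum_perm5 ![0, 3, 1, 2, 4] (by decide) fun c => ?_
    simp only [Matrix.cons_val]
    rw [d.j4_34, d.j4_23, d.j3_23 p (c 1)]; ring
  have x3 : ∑ q, ∑ k, ∑ i, ∑ j, ∑ r, ∑ s,
      d.j3 p q i r * d.j3 p k r j * (d.j3 p q j s * d.j3 p k s i) = d.q4 p := by
    refine sum_perm6 ![0, 4, 2, 3, 5, 1] (by decide) fun c => ?_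
    simp only [Matrix.cons_val, d.j3_12 p, d.j3_23 p]; ring
  rw [e1]
  simp only [Finset.sum_add_distrib, Finset.sum_sub_distrib, x1, x2, x3]
  ring

lemma Normal.sum_Y2 (h : d.Normal p) : ∑ q, ∑ k, ∑ l, (if k = l then 1 else 0) *
      (∑ i, ∑ j, (d.Y2 p (d.D k d.φ) q i j * d.j3 p l i j + d.j3 p k i j * d.Y2 p (d.D l d.φ) q i j
        + 2 * (d.Y1 p (d.D k d.φ) q i j * d.Y1 p (d.D l d.φ) q j i)))
    = 2 * ∑ k, ∑ i, ∑ j, d.l3 p k i j * d.j3 p k i j + 6 * d.X4 p - 4 * d.q4 p - 4 * d.X4 p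
      + 2 * (∑ i, ∑ j, d.M p i j ^ 2 - ∑ i, ∑ j, d.l2 p i j * d.M p i j)
      + 2 * (∑ i, ∑ j, ∑ k, ∑ l, d.j4 p i j k l ^ 2 - 2 * d.X4 p + d.q4 p) := by
  have tD2 : ∑ q, ∑ k, ∑ i, ∑ j, ∑ r, d.j3 p q i r * d.j4 p q r k j * d.j3 p k i j = d.X4 p :=
    sum_perm5 ![0, 4, 1, 3, 2] (by decide) fun c => by
      simp only [Matrix.cons_val, d.j3_23 p]; ring
  simp only [ite_mul, one_mul, zero_mul, Finset.sum_ite_eq, Finset.mem_univ, if_true]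
  have e : ∀ q k i j, d.Y2 p (d.D k d.φ) q i j * d.j3 p k i j
      + d.j3 p k i j * d.Y2 p (d.D k d.φ) q i j
        + 2 * (d.Y1 p (d.D k d.φ) q i j * d.Y1 p (d.D k d.φ) q j i)
      = 2 * (d.j5 p k i j q q * d.j3 p k i j)
        - 4 * (∑ r, d.j3 p q i r * d.j4 p q r k j * d.j3 p k i j)
        + 2 * (∑ r, (2 * ∑ s, d.j3 p q i s * d.j3 p q s r - d.j4 p q q i r)
          * d.j3 p k r j * d.j3 p k i j)
        + 2 * (d.Y1 p (d.D k d.φ) q i j * d.Y1 p (d.D k d.φ) q j i) := by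
    intro q k i j
    rw [d.Y2_D p, ← Finset.sum_mul, ← Finset.sum_mul]; ring
  simp only [e, Finset.sum_add_distrib, Finset.sum_sub_distrib, ← Finset.mul_sum (a := (2:ℝ)),
    ← Finset.mul_sum (a := (4:ℝ)), h.sum_j5_j3, tD2, h.sum_j4_j3, d.sum_Y1_Y1 p]
  ring

lemma Normal.lap_S (h : d.Normal p) : ev p (d.lap d.S) =
    2 * ∑ i, ∑ j, ∑ k, ∑ l, d.j4 p i j k l ^ 2 - 6 * d.X4 p + 3 * ∑ i, ∑ j, d.M p i j ^ 2
      + 2 * d.q4 p - 3 * ∑ i, ∑ j, d.l2 p i j * d.M p i j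
      + 2 * ∑ i, ∑ j, ∑ k, d.l3 p i j k * d.j3 p i j k := by
  have e1 : ev p (d.lap d.S) = ∑ q, ∑ k, ∑ l,
      ((2 * ∑ r, d.j3 p q k r * d.j3 p q r l) * d.M p k l - d.j4 p q q k l * d.M p k l
        - 2 * d.j3 p q k l * (∑ i, ∑ j, (d.Y1 p (d.D k d.φ) q i j * d.j3 p l i j
          + d.j3 p k i j * d.Y1 p (d.D l d.φ) q i j))
      + (if k = l then 1 else 0) *
        (∑ i, ∑ j, (d.Y2 p (d.D k d.φ) q i j * d.j3 p l i j + d.j3 p k i j * d.Y2 p (d.D l d.φ) q i j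
          + 2 * (d.Y1 p (d.D k d.φ) q i j * d.Y1 p (d.D l d.φ) q j i)))) := by
    have e0 : ∀ k i j, ev p (d.D i (d.D j (d.D k d.φ))) = d.j3 p k i j := by
      intro k i j; rw [ev_j3, d.j3_23, d.j3_12]
    rw [h.lap]
    simp only [S_eq_pair, map_sum]
    refine Finset.sum_congr rfl fun q _ => Finset.sum_congr rfl fun k _ =>
      Finset.sum_congr rfl fun l _ => ?_
    simp only [Derivation.leibniz, smul_eq_mul, map_add, map_mul, h.D_a, h.DD_a, h k l, h.ev_pair,
      h.D_pair, h.DD_pair, e0, M]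
    simp only [Finset.sum_add_distrib]
    ring
  have tA : ∑ q, ∑ k, ∑ l, (2 * ∑ r, d.j3 p q k r * d.j3 p q r l) * d.M p k l
      = 2 * ∑ k, ∑ l, d.M p k l ^ 2 := by
    rw [d.sum_mul_M p]
    simp only [d.sum_j3_j3 p, sq, mul_assoc, ← Finset.mul_sum]
  have tB : ∑ q, ∑ k, ∑ l, d.j4 p q q k l * d.M p k l
      = ∑ k, ∑ l, d.l2 p k l * d.M p k l + ∑ k, ∑ l, d.M p k l ^ 2 := by
    rw [d.sum_mul_M p]
    simp only [h.sum_j4, ← Finset.sum_add_distrib]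
    exact Finset.sum_congr rfl fun k _ => Finset.sum_congr rfl fun l _ => by ring
  have tC := d.sum_j3_Y1 p
  have tD := h.sum_Y2
  rw [e1]
  simp only [Finset.sum_add_distrib, Finset.sum_sub_distrib] at tA tB tC tD ⊢
  rw [tA, tB, tC, tD]
  ring

end Data

end

section

variable {ι : Type} {n : ℕ}

lemma abs_mul_le' {x y X Y : ℝ} (hx : |x| ≤ X) (hy : |y| ≤ Y) : |x * y| ≤ X * Y := by
  rw [abs_mul]; exact mul_le_mul hx hy (abs_nonneg _) ((abs_nonneg _).trans hx)

lemma abs_add_le' {x y X Y : ℝ} (hx : |x| ≤ X) (hy : |y| ≤ Y) : |x + y| ≤ X + Y :=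
  (abs_add_le _ _).trans (add_le_add hx hy)

lemma abs_sub_le' {x y X Y : ℝ} (hx : |x| ≤ X) (hy : |y| ≤ Y) : |x - y| ≤ X + Y :=
  (abs_sub _ _).trans (add_le_add hx hy)

lemma abs_sum_le' {f : Fin n → ℝ} {C : ℝ} (h : ∀ i, |f i| ≤ C) : |∑ i, f i| ≤ n * C := by
  refine (Finset.abs_sum_le_sum_abs _ _).trans ((Finset.sum_le_sum fun i _ => h i).trans ?_)
  simp

lemma abs_two_mul_le {x X : ℝ} (hx : |x| ≤ X) : |2 * x| ≤ 2 * X := by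
  rw [abs_mul, abs_two]; linarith

namespace Data
variable {d : Data ι n} {p : ι × (Fin n → ℝ)}

/-- The contraction of two third derivatives. -/
def Z (d : Data ι n) (p : ι × (Fin n → ℝ)) (i j k l : Fin n) : ℝ :=
  ∑ r, d.j3 p i j r * d.j3 p r k l

lemma sum_Z_sq (d : Data ι n) (p : ι × (Fin n → ℝ)) :
    ∑ i, ∑ j, ∑ k, ∑ l, d.Z p i j k l ^ 2 = ∑ i, ∑ j, d.M p i j ^ 2 := by
  simp only [Z, M, sq, Finset.sum_mul_sum]
  exact sum_perm6 ![4, 5, 0, 2, 1, 3] (by decide) fun c => by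
    simp only [Matrix.cons_val, d.j3_12 p, d.j3_23 p]; ring

lemma sum_Z_Z (d : Data ι n) (p : ι × (Fin n → ℝ)) :
    ∑ i, ∑ j, ∑ k, ∑ l, d.Z p i j k l * d.Z p i k j l = d.q4 p := by
  simp only [Z, Finset.sum_mul_sum]
  refine sum_perm6 ![0, 1, 4, 5, 2, 3] (by decide) fun c => ?_
  simp only [Matrix.cons_val, d.j3_12 p, d.j3_23 p]; ring

lemma sum_Z_j4 (d : Data ι n) (p : ι × (Fin n → ℝ)) :
    ∑ i, ∑ j, ∑ k, ∑ l, d.j4 p i j k l * d.Z p i j k l = d.X4 p := by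
  simp only [Z, Finset.mul_sum]
  refine sum_perm5 ![0, 1, 2, 3, 4] (by decide) fun c => ?_
  simp only [Matrix.cons_val, d.j3_12 p, d.j3_23 p]

lemma Z_34 (i j k l : Fin n) : d.Z p i j k l = d.Z p i j l k := by
  simp only [Z, d.j3_23 p _ k l]

lemma q4_le (d : Data ι n) (p : ι × (Fin n → ℝ)) : d.q4 p ≤ ∑ i, ∑ j, d.M p i j ^ 2 := by
  have h0 : 0 ≤ ∑ i, ∑ j, ∑ k, ∑ l, (d.Z p i j k l - d.Z p i k j l) ^ 2 := by positivity
  have e : ∀ i j k l, (d.Z p i j k l - d.Z p i k j l) ^ 2 = d.Z p i j k l ^ 2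
      - 2 * (d.Z p i j k l * d.Z p i k j l) + d.Z p i k j l ^ 2 := fun i j k l => by ring
  have e2 : ∑ i, ∑ j, ∑ k, ∑ l, d.Z p i k j l ^ 2 = ∑ i, ∑ j, ∑ k, ∑ l, d.Z p i j k l ^ 2 :=
    sum_perm4 ![0, 2, 1, 3] (by decide) fun c => by simp only [Matrix.cons_val]
  simp only [e, Finset.sum_add_distrib, Finset.sum_sub_distrib, ← Finset.mul_sum] at h0
  rw [e2, sum_Z_sq, sum_Z_Z] at h0
  linarith

lemma calabi (d : Data ι n) (p : ι × (Fin n → ℝ)) (y : ℝ) :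
    0 ≤ ∑ i, ∑ j, ∑ k, ∑ l, d.j4 p i j k l ^ 2 - 6 * y * d.X4 p
      + y ^ 2 * (3 * ∑ i, ∑ j, d.M p i j ^ 2 + 6 * d.q4 p) := by
  have h0 : 0 ≤ ∑ i, ∑ j, ∑ k, ∑ l,
    (d.j4 p i j k l - y * (d.Z p i j k l + d.Z p i k j l + d.Z p i l k j)) ^ 2 := by positivity
  have e : ∀ i j k l, (d.j4 p i j k l - y * (d.Z p i j k l + d.Z p i k j l + d.Z p i l k j)) ^ 2
      = d.j4 p i j k l ^ 2 - 2 * y * (d.j4 p i j k l * d.Z p i j k l)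
        - 2 * y * (d.j4 p i j k l * d.Z p i k j l) - 2 * y * (d.j4 p i j k l * d.Z p i l k j)
        + y ^ 2 * d.Z p i j k l ^ 2 + y ^ 2 * d.Z p i k j l ^ 2 + y ^ 2 * d.Z p i l k j ^ 2
        + 2 * y ^ 2 * (d.Z p i j k l * d.Z p i k j l) + 2 * y ^ 2 * (d.Z p i j k l * d.Z p i l k j)
        + 2 * y ^ 2 * (d.Z p i k j l * d.Z p i l k j) := fun i j k l => by ring
  have s1 : ∑ i, ∑ j, ∑ k, ∑ l, d.Z p i k j l ^ 2 = ∑ i, ∑ j, ∑ k, ∑ l, d.Z p i j k l ^ 2 :=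
    sum_perm4 ![0, 2, 1, 3] (by decide) fun c => by simp only [Matrix.cons_val]
  have s2 : ∑ i, ∑ j, ∑ k, ∑ l, d.Z p i l k j ^ 2 = ∑ i, ∑ j, ∑ k, ∑ l, d.Z p i j k l ^ 2 :=
    sum_perm4 ![0, 3, 2, 1] (by decide) fun c => by simp only [Matrix.cons_val]
  have s3 : ∑ i, ∑ j, ∑ k, ∑ l, d.j4 p i j k l * d.Z p i k j l = d.X4 p := by
    rw [← d.sum_Z_j4 p]
    refine sum_perm4 ![0, 2, 1, 3] (by decide) fun c => ?_
    simp only [Matrix.cons_val]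
    rw [d.j4_23]
  have s4 : ∑ i, ∑ j, ∑ k, ∑ l, d.j4 p i j k l * d.Z p i l k j = d.X4 p := by
    rw [← d.sum_Z_j4 p]
    refine sum_perm4 ![0, 3, 2, 1] (by decide) fun c => ?_
    simp only [Matrix.cons_val]
    rw [d.j4_34, d.j4_23, d.j4_34]
  have s5 : ∑ i, ∑ j, ∑ k, ∑ l, d.Z p i j k l * d.Z p i l k j = d.q4 p := by
    rw [← d.sum_Z_Z p]
    refine sum_perm4 ![0, 1, 3, 2] (by decide) fun c => ?_
    simp only [Matrix.cons_val]
    rw [d.Z_34, d.Z_34 _ (c 3)]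
  have s6 : ∑ i, ∑ j, ∑ k, ∑ l, d.Z p i k j l * d.Z p i l k j = d.q4 p := by
    rw [← d.sum_Z_Z p]
    refine sum_perm4 ![0, 2, 3, 1] (by decide) fun c => ?_
    simp only [Matrix.cons_val]
    rw [d.Z_34]
  simp only [e, Finset.sum_add_distrib, Finset.sum_sub_distrib, ← Finset.mul_sum] at h0
  rw [s1, s2, s3, s4, s5, s6, sum_Z_Z, sum_Z_sq, sum_Z_j4] at h0
  linarith

lemma Normal.ev_S (h : d.Normal p) : ev p d.S = ∑ k, ∑ i, ∑ j, d.j3 p k i j ^ 2 := by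
  rw [S_eq_pair]
  simp only [map_sum, map_mul, h _ _, ite_mul, one_mul, zero_mul, Finset.sum_ite_eq,
    Finset.mem_univ, if_true, h.ev_pair]
  refine Finset.sum_congr rfl fun k _ => Finset.sum_congr rfl fun i _ =>
    Finset.sum_congr rfl fun j _ => ?_
  rw [ev_j3, d.j3_23, d.j3_12, sq]

lemma Normal.ev_R (h : d.Normal p) : ev p d.R = ∑ i, ∑ j, d.l2 p i j ^ 2 := by
  rw [R_eq_pair, h.ev_pair]
  exact Finset.sum_congr rfl fun i _ => Finset.sum_congr rfl fun j _ => by rw [ev_l2, sq]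

lemma Normal.S_sq_le (h : d.Normal p) :
    ev p d.S ^ 2 / (n + 1) ≤ ∑ i, ∑ j, d.M p i j ^ 2 := by
  have e : ev p d.S = ∑ i, d.M p i i := by
    rw [h.ev_S]; simp only [M, sq]
  rw [e, div_le_iff₀ (by positivity)]
  have h3 := Finset.sum_mul_sq_le_sq_mul_sq Finset.univ (fun _ : Fin n => (1 : ℝ))
    (fun i => d.M p i i)
  simp only [one_mul, one_pow, Finset.sum_const, Finset.card_univ, Fintype.card_fin,
    nsmul_eq_mul, mul_one] at h3
  have h4 : ∑ i, d.M p i i ^ 2 ≤ ∑ i, ∑ j, d.M p i j ^ 2 :=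
    Finset.sum_le_sum fun i _ => Finset.single_le_sum (f := fun j => d.M p i j ^ 2)
      (fun _ _ => sq_nonneg _) (Finset.mem_univ i)
  have h5 : 0 ≤ ∑ i, d.M p i i ^ 2 := by positivity
  have := mul_le_mul_of_nonneg_left h4 (Nat.cast_nonneg (α := ℝ) n)
  linarith

lemma Normal.lap_S_lower (h : d.Normal p) {σ β l : ℝ} (hσ : ∀ i j k, |d.j3 p i j k| ≤ σ)
    (hβ : ∀ i j, |d.l2 p i j| ≤ β) (hl : ∀ i j k, |d.l3 p i j k| ≤ l) :
    1 / 10 * ∑ i, ∑ j, ∑ k, ∑ l, d.j4 p i j k l ^ 2 + 5 / 19 * (ev p d.S ^ 2 / (n + 1))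
      - 3 * (n ^ 4 * (β * σ ^ 2)) - 2 * (n ^ 3 * (l * σ)) ≤ ev p (d.lap d.S) := by
  have h1 := d.calabi p (10 / 19)
  have h2 := d.q4_le p
  have h3 := h.S_sq_le
  have h4 : |∑ i, ∑ j, d.l2 p i j * d.M p i j| ≤ n * (n * (β * (n * (n * (σ * σ))))) :=
    abs_sum_le' fun i => abs_sum_le' fun j => abs_mul_le' (hβ i j)
      (abs_sum_le' fun k => abs_sum_le' fun l => abs_mul_le' (hσ _ _ _) (hσ _ _ _))
  have h5 : |∑ i, ∑ j, ∑ k, d.l3 p i j k * d.j3 p i j k| ≤ n * (n * (n * (l * σ))) :=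
    abs_sum_le' fun i => abs_sum_le' fun j => abs_sum_le' fun k =>
      abs_mul_le' (hl _ _ _) (hσ _ _ _)
  rw [h.lap_S]
  have h6 := (abs_le.1 h4).2
  have h7 := (abs_le.1 h5).1
  linarith

/-- Fourth derivatives of `L` at a point. -/
def l4 (d : Data ι n) (p : ι × (Fin n → ℝ)) (i j k l : Fin n) : ℝ :=
  ev p (d.D i (d.D j (d.D k (d.D l d.L))))

lemma ev_l4 (d : Data ι n) (p : ι × (Fin n → ℝ)) (i j k l : Fin n) :
  ev p (d.D i (d.D j (d.D k (d.D l d.L)))) = d.l4 p i j k l := rfl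

/-- Second derivative of the metric at a normal point. -/
def a2 (d : Data ι n) (p : ι × (Fin n → ℝ)) (l k i j : Fin n) : ℝ :=
  ∑ q, (d.j3 p l i q * d.j3 p k q j + d.j3 p k i q * d.j3 p l q j) - d.j4 p l k i j

lemma Normal.trace_l4 (h : d.Normal p) (i j : Fin n) : ∑ q, d.l4 p q q i j =
    ∑ r, ∑ s, (d.j3 p j r s * d.l3 p i r s + d.j3 p i r s * d.l3 p j r s
      - d.a2 p i j r s * d.l2 p r s + d.a2 p i j r s * (d.l1 p r * d.l1 p s)
      - d.j3 p j r s * (d.l2 p i r * d.l1 p s + d.l1 p r * d.l2 p i s)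
      - d.j3 p i r s * (d.l2 p j r * d.l1 p s + d.l1 p r * d.l2 p j s))
    + ∑ r, (2 * (d.l3 p i j r * d.l1 p r) + 2 * (d.l2 p i r * d.l2 p j r))
    - ev p (d.D i (d.D j d.A)) := by
  have e := congrArg (fun f => ev p (d.D i (d.D j f))) d.lap_L
  have e1 : ev p (d.D i (d.D j (d.lap d.L))) = ∑ r, ∑ s, (d.a2 p i j r s * d.l2 p r s
      - d.j3 p j r s * d.l3 p i r s - d.j3 p i r s * d.l3 p j r s
      + (if r = s then 1 else 0) * d.l4 p i j r s) := by
    rw [lap_eq]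
    simp only [map_sum]
    refine Finset.sum_congr rfl fun r _ => Finset.sum_congr rfl fun s _ => ?_
    simp only [Derivation.leibniz, smul_eq_mul, map_add, map_mul, h.D_a, h.DD_a, h r s, ev_l4,
      ev_l3, ev_l2, a2]
    ring
  have e2 : ev p (d.D i (d.D j (d.gam d.L d.L))) = ∑ r, ∑ s,
      (d.a2 p i j r s * (d.l1 p r * d.l1 p s)
      - d.j3 p j r s * (d.l2 p i r * d.l1 p s + d.l1 p r * d.l2 p i s)
      - d.j3 p i r s * (d.l2 p j r * d.l1 p s + d.l1 p r * d.l2 p j s)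
      + (if r = s then 1 else 0) * (d.l3 p i j r * d.l1 p s + d.l2 p j r * d.l2 p i s
        + d.l2 p i r * d.l2 p j s + d.l1 p r * d.l3 p i j s)) := by
    rw [Data.gam]
    simp only [map_sum]
    refine Finset.sum_congr rfl fun r _ => Finset.sum_congr rfl fun s _ => ?_
    simp only [Derivation.leibniz, smul_eq_mul, map_add, map_mul, h.D_a, h.DD_a, h r s,
      ev_l3, ev_l2, ev_l1, a2]
    ring
  simp only [map_sub] at e
  rw [e1, e2] at e
  have e3 : ∀ q, d.l4 p q q i j = d.l4 p i j q q := by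
    intro q
    simp only [l4]
    rw [d.comm q i, d.comm q j, d.comm q i, d.comm q j]
  have e4 : ∀ r, d.l3 p i j r * d.l1 p r + d.l2 p j r * d.l2 p i r
        + d.l2 p i r * d.l2 p j r + d.l1 p r * d.l3 p i j r
      = 2 * (d.l3 p i j r * d.l1 p r) + 2 * (d.l2 p i r * d.l2 p j r) := fun r => by ring
  simp only [Finset.sum_add_distrib (f := fun s => _ - _ - _), Finset.sum_add_distrib,
    Finset.sum_sub_distrib, ite_mul, one_mul, zero_mul, Finset.sum_ite_eq, Finset.mem_univ,
    if_true, e4] at e ⊢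
  simp only [e3]
  linarith

end Data

end

section

variable {ι : Type} {n : ℕ}

lemma coeff_le {m c x : ℝ} (hm : 1 ≤ m) (hc : 1 ≤ c) (a b : ℕ) (ha : a ≤ 5) (hb : b ≤ 2)
    (hx : 0 ≤ x) : m ^ a * c ^ b * x ≤ m ^ 5 * c ^ 2 * x :=
  mul_le_mul_of_nonneg_right (mul_le_mul (pow_le_pow_right₀ hm ha) (pow_le_pow_right₀ hc hb)
    (by positivity) (by positivity)) hx

lemma second_order_scalar {C c₀ : ℝ} (hC : 1 ≤ C) (hc : 0 < c₀) (hc1 : c₀ ≤ 1) :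
    ∃ b K D : ℝ, 0 < b ∧ 1 ≤ K ∧ ∀ l f s β T lR lS lN N2 : ℝ, 0 ≤ l → 0 ≤ f → 0 ≤ s → 0 ≤ β →
      1 ≤ T → s ≤ T → β ≤ T → T ^ 4 ≤ 8 + 32 * (l ^ 2 + f ^ 2 + s ^ 4 + β ^ 4) →
      2 * l ^ 2 - C * (s * l * β + s ^ 2 * β ^ 2 + f * β ^ 2) - C * T ^ 3 ≤ lR →
      f ^ 2 / 10 + c₀ * s ^ 4 - C * T ^ 3 ≤ lS → β ^ 2 / 2 - C * T ≤ lN →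
      N2 ≤ C * (β ^ 2 + s ^ 2) →
      lR + K * lS + (β ^ 2 + K * s ^ 2) * (b * lN) - (β ^ 2 + K * s ^ 2) * (b ^ 2 * N2) ≤ 0 →
      T ≤ D := by
  set b := c₀ / (8 * C) with hb
  have hbpos : 0 < b := by positivity
  have hbC : b * C = c₀ / 8 := by rw [hb]; field_simp
  have hb1 : b ≤ 1 / 8 := by
    rw [hb, div_le_iff₀ (by positivity)]; linarith
  set K := 100 * C ^ 2 / b with hK
  have hKb : K * b = 100 * C ^ 2 := by rw [hK]; field_simp
  have hK100 : 100 ≤ K := by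
    rw [hK, le_div_iff₀ hbpos]
    have : 1 ≤ C ^ 2 := one_le_pow₀ hC
    linarith
  set D₀ := C + K * C + b * C * (1 + K) with hD₀
  have hD₀pos : 0 ≤ D₀ := by positivity
  refine ⟨b, K, 8 + 128 * D₀ / b, hbpos, by linarith, ?_⟩
  intro l f s β T lR lS lN N2 hl hf hs hβ hT hsT hβT hT4 hR hS hN hN2 hmain
  have hX : 0 ≤ β ^ 2 + K * s ^ 2 := by positivity
  have hX2 : β ^ 2 + K * s ^ 2 ≤ (1 + K) * T ^ 2 := by
    have := pow_le_pow_left₀ hs hsT 2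
    have := pow_le_pow_left₀ hβ hβT 2
    have := mul_le_mul_of_nonneg_left (pow_le_pow_left₀ hs hsT 2) (show 0 ≤ K by linarith)
    linarith
  have h1 := mul_le_mul_of_nonneg_left (mul_le_mul_of_nonneg_left hN hbpos.le) hX
  have h2 := mul_le_mul_of_nonneg_left (mul_le_mul_of_nonneg_left hN2 (sq_nonneg b)) hX
  have h3 := mul_le_mul_of_nonneg_right hX2 (show 0 ≤ b * (C * T) by positivity)
  have h4 := mul_le_mul_of_nonneg_left hS (show 0 ≤ K by linarith)
  have hw : b / 4 * (l ^ 2 + f ^ 2 + s ^ 4 + β ^ 4) ≤ D₀ * T ^ 3 := by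
    have e1 : (β ^ 2 + K * s ^ 2) * (b ^ 2 * (C * (β ^ 2 + s ^ 2)))
        = c₀ / 8 * (b * β ^ 4 + (b + K * b) * (s ^ 2 * β ^ 2) + K * b * s ^ 4) := by
      linear_combination (b * (β ^ 2 + K * s ^ 2) * (β ^ 2 + s ^ 2)) * hbC
    have e2 : c₀ / 8 * (b * β ^ 4 + (b + K * b) * (s ^ 2 * β ^ 2)) ≤
        1 / 8 * (b * β ^ 4 + (b + K * b) * (s ^ 2 * β ^ 2)) :=
      mul_le_mul_of_nonneg_right (by linarith) (by positivity)
    have e3 : c₀ / 8 * (K * b * s ^ 4) ≤ c₀ / 64 * (K * s ^ 4) := by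
      have := mul_le_mul_of_nonneg_left hb1 (show 0 ≤ c₀ / 8 * (K * s ^ 4) by positivity)
      linarith
    have e4 : C * (s * l * β) ≤ l ^ 2 / 2 + C ^ 2 * (s ^ 2 * β ^ 2) / 2 := by
      linarith [sq_nonneg (l - C * (s * β))]
    have e5 : C * (f * β ^ 2) ≤ K * f ^ 2 / 20 + b * β ^ 4 / 20 := by
      have : 0 ≤ K / 20 * (f - b / (10 * C) * β ^ 2) ^ 2 := by positivity
      have e : K / 20 * (f - b / (10 * C) * β ^ 2) ^ 2
          = K * f ^ 2 / 20 - C * (f * β ^ 2) + b * β ^ 4 / 20 := by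
        rw [hK]; field_simp; ring
      linarith
    have e6 : C * (s ^ 2 * β ^ 2) ≤ C ^ 2 * (s ^ 2 * β ^ 2) := by
      refine mul_le_mul_of_nonneg_right ?_ (by positivity)
      rw [sq]; exact le_mul_of_one_le_left (by linarith) hC
    have e7 : K * b * (s ^ 2 * β ^ 2) = 100 * (C ^ 2 * (s ^ 2 * β ^ 2)) := by rw [hKb]; ring
    have e8 : b * (s ^ 2 * β ^ 2) ≤ K * b * (s ^ 2 * β ^ 2) :=
      mul_le_mul_of_nonneg_right (le_mul_of_one_le_left hbpos.le (by linarith)) (by positivity)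
    have e9 : 0 ≤ C ^ 2 * (s ^ 2 * β ^ 2) := by positivity
    have e10 : b * l ^ 2 ≤ l ^ 2 := mul_le_of_le_one_left (by positivity) (by linarith)
    have e11 : b * f ^ 2 ≤ f ^ 2 := mul_le_of_le_one_left (by positivity) (by linarith)
    have e12 : 100 * f ^ 2 ≤ K * f ^ 2 := mul_le_mul_of_nonneg_right hK100 (by positivity)
    have e13 : b * s ^ 4 ≤ K * c₀ * s ^ 4 := by
      refine mul_le_mul_of_nonneg_right ?_ (by positivity)
      have : b ≤ c₀ := by
        rw [hb]; exact div_le_self hc.le (by linarith)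
      have := le_mul_of_one_le_left hc.le (show 1 ≤ K by linarith)
      linarith
    have e14 : 0 ≤ b * β ^ 4 := by positivity
    have e15 : 0 ≤ K * f ^ 2 := by positivity
    have e16 : 0 ≤ K * c₀ * s ^ 4 := by positivity
    have e17 : 0 ≤ f ^ 2 := by positivity
    have e18 : 0 ≤ l ^ 2 := by positivity
    rw [hD₀]
    linarith
  have hfin : T ^ 4 ≤ (8 + 128 * D₀ / b) * T ^ 3 := by
    have h5 : l ^ 2 + f ^ 2 + s ^ 4 + β ^ 4 ≤ 4 * (D₀ / b) * T ^ 3 := by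
      have : 4 * (D₀ / b) * T ^ 3 = (D₀ * T ^ 3) / (b / 4) := by field_simp
      rw [this, le_div_iff₀ (by positivity)]; linarith
    have h6 : 1 ≤ T ^ 3 := one_le_pow₀ hT
    have : (8 + 128 * D₀ / b) * T ^ 3 = 8 * T ^ 3 + 32 * (4 * (D₀ / b) * T ^ 3) := by ring
    linarith
  have h7 : 0 < T ^ 3 := by positivity
  have : T * T ^ 3 ≤ (8 + 128 * D₀ / b) * T ^ 3 := by linarith
  exact le_of_mul_le_mul_right this h7

namespace Data
variable {d : Data ι n} {p : ι × (Fin n → ℝ)}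

lemma Normal.lap_R (h : d.Normal p) : ev p (d.lap d.R) =
    2 * ∑ i, ∑ j, (∑ q, d.Y2 p d.L q i j) * d.l2 p i j
      + 2 * ∑ q, ∑ i, ∑ j, d.Y1 p d.L q i j * d.Y1 p d.L q j i := by
  rw [h.lap]
  simp only [R_eq_pair, h.DD_pair, ev_l2, Finset.sum_add_distrib, ← Finset.mul_sum]
  congr 1
  have e : ∑ i, ∑ j, (∑ q, d.Y2 p d.L q i j) * d.l2 p i j
      = ∑ q, ∑ i, ∑ j, d.Y2 p d.L q i j * d.l2 p i j := by
    simp only [Finset.sum_mul]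
    exact sum_perm3 ![2, 0, 1] (by decide) fun c => by simp only [Matrix.cons_val]
  rw [e, two_mul]
  congr 1
  simp only [mul_comm]

lemma Normal.abs_sum_Y2 (h : d.Normal p) {σ β l f c : ℝ} (hσ : ∀ i j k, |d.j3 p i j k| ≤ σ)
    (hβ : ∀ i j, |d.l2 p i j| ≤ β) (hl : ∀ i j k, |d.l3 p i j k| ≤ l)
    (hf : ∀ i j k l, |d.j4 p i j k l| ≤ f) (hc : ∀ i, |d.l1 p i| ≤ c)
    (hA : ∀ i j, |ev p (d.D i (d.D j d.A))| ≤ c) (i j : Fin n) :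
    |∑ q, d.Y2 p d.L q i j| ≤
      n * (n * (σ * l + σ * l + (n * (σ * σ + σ * σ) + f) * β + (n * (σ * σ + σ * σ) + f) * (c * c)
        + σ * (β * c + c * β) + σ * (β * c + c * β)))
      + n * (2 * (l * c) + 2 * (β * β)) + c
      + n * (2 * (n * (σ * l)) + n * ((2 * (n * (σ * σ)) + f) * β)) := by
  have ha2 : ∀ r s, |d.a2 p i j r s| ≤ n * (σ * σ + σ * σ) + f := fun r s =>
    abs_sub_le' (abs_sum_le' fun q => abs_add_le' (abs_mul_le' (hσ _ _ _) (hσ _ _ _))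
      (abs_mul_le' (hσ _ _ _) (hσ _ _ _))) (hf _ _ _ _)
  have e : ∑ q, d.Y2 p d.L q i j = ∑ q, d.l4 p q q i j
      - ∑ q, (2 * ∑ r, d.j3 p q i r * d.l3 p q r j
        - ∑ r, (2 * ∑ s, d.j3 p q i s * d.j3 p q s r - d.j4 p q q i r) * d.l2 p r j) := by
    rw [← Finset.sum_sub_distrib]
    refine Finset.sum_congr rfl fun q _ => ?_
    simp only [Y2, ev_l4, ev_l3, ev_l2]; ring
  rw [e, h.trace_l4]
  refine abs_sub_le' (abs_sub_le' (abs_add_le' (abs_sum_le' fun r => abs_sum_le' fun s => ?_)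
    (abs_sum_le' fun r => ?_)) (hA i j)) (abs_sum_le' fun q => ?_)
  · exact abs_sub_le' (abs_sub_le' (abs_add_le' (abs_sub_le' (abs_add_le'
      (abs_mul_le' (hσ _ _ _) (hl _ _ _)) (abs_mul_le' (hσ _ _ _) (hl _ _ _)))
      (abs_mul_le' (ha2 _ _) (hβ _ _))) (abs_mul_le' (ha2 _ _) (abs_mul_le' (hc _) (hc _))))
      (abs_mul_le' (hσ _ _ _) (abs_add_le' (abs_mul_le' (hβ _ _) (hc _))
        (abs_mul_le' (hc _) (hβ _ _)))))
      (abs_mul_le' (hσ _ _ _) (abs_add_le' (abs_mul_le' (hβ _ _) (hc _))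
        (abs_mul_le' (hc _) (hβ _ _))))
  · exact abs_add_le' (abs_two_mul_le (abs_mul_le' (hl _ _ _) (hc _)))
      (abs_two_mul_le (abs_mul_le' (hβ _ _) (hβ _ _)))
  · exact abs_sub_le' (abs_two_mul_le (abs_sum_le' fun r => abs_mul_le' (hσ _ _ _) (hl _ _ _)))
      (abs_sum_le' fun r => abs_mul_le' (abs_sub_le' (abs_two_mul_le (abs_sum_le' fun s =>
        abs_mul_le' (hσ _ _ _) (hσ _ _ _))) (hf _ _ _ _)) (hβ _ _))

lemma sum_Y1_lower {σ β l : ℝ} (hσ : ∀ i j k, |d.j3 p i j k| ≤ σ)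
    (hβ : ∀ i j, |d.l2 p i j| ≤ β) (hl : ∀ i j k, |d.l3 p i j k| ≤ l) :
    ∑ q, ∑ i, ∑ j, d.l3 p q i j ^ 2 - n * (n * (n * (l * (n * (σ * β)) + l * (n * (σ * β))
      + (n * (σ * β)) * (n * (σ * β))))) ≤ ∑ q, ∑ i, ∑ j, d.Y1 p d.L q i j * d.Y1 p d.L q j i := by
  have hy : ∀ q i j, |∑ r, d.j3 p q i r * d.l2 p r j| ≤ n * (σ * β) := fun q i j =>
    abs_sum_le' fun r => abs_mul_le' (hσ _ _ _) (hβ _ _)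
  have e : ∑ q, ∑ i, ∑ j, d.Y1 p d.L q i j * d.Y1 p d.L q j i
      = ∑ q, ∑ i, ∑ j, d.l3 p q i j ^ 2 - ∑ q, ∑ i, ∑ j,
        (d.l3 p q i j * (∑ r, d.j3 p q j r * d.l2 p r i)
          + d.l3 p q i j * (∑ r, d.j3 p q i r * d.l2 p r j)
          - (∑ r, d.j3 p q i r * d.l2 p r j) * ∑ r, d.j3 p q j r * d.l2 p r i) := by
    simp only [← Finset.sum_sub_distrib]
    refine Finset.sum_congr rfl fun q _ => Finset.sum_congr rfl fun i _ =>
      Finset.sum_congr rfl fun j _ => ?_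
    simp only [Y1, ev_l3, ev_l2, d.l3_23 p q j i]; ring
  rw [e]
  refine sub_le_sub_left ((le_abs_self _).trans ?_) _
  exact abs_sum_le' fun q => abs_sum_le' fun i => abs_sum_le' fun j => abs_sub_le'
    (abs_add_le' (abs_mul_le' (hl _ _ _) (hy _ _ _)) (abs_mul_le' (hl _ _ _) (hy _ _ _)))
    (abs_mul_le' (hy _ _ _) (hy _ _ _))

lemma Normal.lap_R_lower (h : d.Normal p) {m σ β l f c T : ℝ} (hm : m = n + 1) (hc1 : 1 ≤ c)
    (hσ : ∀ i j k, |d.j3 p i j k| ≤ σ)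
    (hβ : ∀ i j, |d.l2 p i j| ≤ β) (hl : ∀ i j k, |d.l3 p i j k| ≤ l)
    (hf : ∀ i j k l, |d.j4 p i j k l| ≤ f) (hc : ∀ i, |d.l1 p i| ≤ c)
    (hA : ∀ i j, |ev p (d.D i (d.D j d.A))| ≤ c)
    (hσ0 : 0 ≤ σ) (hβ0 : 0 ≤ β) (hl0 : 0 ≤ l) (hf0 : 0 ≤ f)
    (hT : 1 ≤ T) (hσT : σ ≤ T) (hβT : β ≤ T) (hlT : l ≤ T ^ 2) (hfT : f ≤ T ^ 2) :
    2 * ∑ q, ∑ i, ∑ j, d.l3 p q i j ^ 2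
      - 100 * (m ^ 5 * c ^ 2) * (σ * l * β + σ ^ 2 * β ^ 2 + f * β ^ 2)
      - 100 * (m ^ 5 * c ^ 2) * T ^ 3 ≤ ev p (d.lap d.R) := by
  have hm1 : (1 : ℝ) ≤ m := by rw [hm]; linarith [Nat.cast_nonneg (α := ℝ) n]
  have hnm : (n : ℝ) ≤ m := by linarith
  have hn0 : (0 : ℝ) ≤ n := Nat.cast_nonneg _
  have h1 := sum_Y1_lower hσ hβ hl
  have h2 := fun i j => abs_mul_le' (h.abs_sum_Y2 hσ hβ hl hf hc hA i j) (hβ i j)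
  have h3 := (abs_le.1 (abs_sum_le' fun i => abs_sum_le' fun j => h2 i j)).1
  rw [h.lap_R]
  have t1 : β * σ ^ 2 ≤ T ^ 3 := by
    calc β * σ ^ 2 ≤ T * T ^ 2 := mul_le_mul hβT (pow_le_pow_left₀ hσ0 hσT 2) (by positivity)
          (by linarith)
      _ = T ^ 3 := by ring
  have t2 : β * f ≤ T ^ 3 := by
    calc β * f ≤ T * T ^ 2 := mul_le_mul hβT hfT (by positivity) (by linarith)
      _ = T ^ 3 := by ring
  have t3 : σ * β ^ 2 ≤ T ^ 3 := by
    calc σ * β ^ 2 ≤ T * T ^ 2 := mul_le_mul hσT (pow_le_pow_left₀ hβ0 hβT 2) (by positivity)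
          (by linarith)
      _ = T ^ 3 := by ring
  have t4 : β * l ≤ T ^ 3 := by
    calc β * l ≤ T * T ^ 2 := mul_le_mul hβT hlT (by positivity) (by linarith)
      _ = T ^ 3 := by ring
  have t5 : β ^ 3 ≤ T ^ 3 := pow_le_pow_left₀ hβ0 hβT 3
  have t6 : β ≤ T ^ 3 := hβT.trans (le_self_pow₀ hT (by norm_num))
  generalize ∑ q, ∑ i, ∑ j, d.Y1 p d.L q i j * d.Y1 p d.L q j i = y1 at *
  generalize ∑ i, ∑ j, (∑ q, d.Y2 p d.L q i j) * d.l2 p i j = y2 at *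
  generalize ∑ q, ∑ i, ∑ j, d.l3 p q i j ^ 2 = L3 at *
  have k1 : ∀ (a b : ℕ) {x : ℝ}, a ≤ 5 → b ≤ 2 → 0 ≤ x →
      (n : ℝ) ^ a * c ^ b * x ≤ m ^ 5 * c ^ 2 * x := fun a b x ha hb hx =>
    (mul_le_mul_of_nonneg_right (mul_le_mul_of_nonneg_right (pow_le_pow_left₀ hn0 hnm a)
      (by positivity)) hx).trans (coeff_le hm1 hc1 a b ha hb hx)
  have z : ∀ {x : ℝ}, x ≤ T ^ 3 → m ^ 5 * c ^ 2 * x ≤ m ^ 5 * c ^ 2 * T ^ 3 := fun hx =>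
    mul_le_mul_of_nonneg_left hx (by positivity)
  have a1 := k1 4 0 (x := σ * l * β) (by norm_num) (by norm_num) (by positivity)
  have a2 := k1 5 0 (x := σ ^ 2 * β ^ 2) (by norm_num) (by norm_num) (by positivity)
  have a3 := k1 4 0 (x := f * β ^ 2) (by norm_num) (by norm_num) (by positivity)
  have a4 := k1 5 2 (x := β * σ ^ 2) (by norm_num) (by norm_num) (by positivity)
  have a5 := k1 4 2 (x := β * f) (by norm_num) (by norm_num) (by positivity)
  have a6 := k1 4 1 (x := σ * β ^ 2) (by norm_num) (by norm_num) (by positivity)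
  have a7 := k1 3 1 (x := β * l) (by norm_num) (by norm_num) (by positivity)
  have a8 := k1 3 0 (x := β ^ 3) (by norm_num) (by norm_num) (by positivity)
  have a9 := k1 2 1 (x := β) (by norm_num) (by norm_num) (by positivity)
  have b4 := z t1
  have b5 := z t2
  have b6 := z t3
  have b7 := z t4
  have b8 := z t5
  have b9 := z t6
  have p1 : 0 ≤ m ^ 5 * c ^ 2 * (σ * l * β) := by positivity
  have p2 : 0 ≤ m ^ 5 * c ^ 2 * (σ ^ 2 * β ^ 2) := by positivity
  have p3 : 0 ≤ m ^ 5 * c ^ 2 * (f * β ^ 2) := by positivity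
  have p4 : 0 ≤ m ^ 5 * c ^ 2 * T ^ 3 := by positivity
  linarith

end Data

end

section

variable {ι : Type} {n : ℕ}

lemma abs_le_sqrt_sum {α : Type} [Fintype α] (f : α → ℝ) (i : α) :
    |f i| ≤ Real.sqrt (∑ i, f i ^ 2) := by
  rw [← Real.sqrt_sq_eq_abs]
  exact Real.sqrt_le_sqrt (Finset.single_le_sum (f := fun i => f i ^ 2)
    (fun _ _ => sq_nonneg _) (Finset.mem_univ i))

lemma abs_le_sqrt_sum2 (f : Fin n → Fin n → ℝ) (i j : Fin n) :
    |f i j| ≤ Real.sqrt (∑ i, ∑ j, f i j ^ 2) := by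
  have := abs_le_sqrt_sum (fun q : Fin n × Fin n => f q.1 q.2) (i, j)
  simpa only [Fintype.sum_prod_type] using this

lemma abs_le_sqrt_sum3 (f : Fin n → Fin n → Fin n → ℝ) (i j k : Fin n) :
    |f i j k| ≤ Real.sqrt (∑ i, ∑ j, ∑ k, f i j k ^ 2) := by
  have := abs_le_sqrt_sum (fun q : Fin n × Fin n × Fin n => f q.1 q.2.1 q.2.2) (i, j, k)
  simpa only [Fintype.sum_prod_type] using this

lemma abs_le_sqrt_sum4 (f : Fin n → Fin n → Fin n → Fin n → ℝ) (i j k l : Fin n) :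
    |f i j k l| ≤ Real.sqrt (∑ i, ∑ j, ∑ k, ∑ l, f i j k l ^ 2) := by
  have := abs_le_sqrt_sum (fun q : Fin n × Fin n × Fin n × Fin n => f q.1 q.2.1 q.2.2.1 q.2.2.2)
    (i, j, k, l)
  simpa only [Fintype.sum_prod_type] using this

lemma quartic_le {t σ β l f : ℝ} (ht2 : t ^ 2 = σ ^ 2 + β ^ 2 + l + f) :
    (1 + t) ^ 4 ≤ 8 + 32 * (l ^ 2 + f ^ 2 + σ ^ 4 + β ^ 4) := by
  have e1 : t ^ 4 = (σ ^ 2 + β ^ 2 + l + f) ^ 2 := by rw [← ht2]; ring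
  have e2 : (1 + t) ^ 4 ≤ 8 * (1 + t ^ 4) := by
    have h3 : (1 + t) ^ 2 ≤ 2 * (1 + t ^ 2) := by linarith [sq_nonneg (1 - t)]
    have h4 := pow_le_pow_left₀ (sq_nonneg _) h3 2
    linarith [sq_nonneg (1 - t ^ 2)]
  have e3 : (σ ^ 2 + β ^ 2 + l + f) ^ 2 ≤ 4 * (l ^ 2 + f ^ 2 + σ ^ 4 + β ^ 4) := by
    linarith [sq_nonneg (σ ^ 2 - β ^ 2), sq_nonneg (σ ^ 2 - l), sq_nonneg (σ ^ 2 - f),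
      sq_nonneg (β ^ 2 - l), sq_nonneg (β ^ 2 - f), sq_nonneg (l - f)]
  linarith

lemma exists_dominating {σ β l f : ℝ} (_hσ : 0 ≤ σ) (_hβ : 0 ≤ β) (hl : 0 ≤ l) (hf : 0 ≤ f) :
    ∃ T : ℝ, 1 ≤ T ∧ σ ≤ T ∧ β ≤ T ∧ l ≤ T ^ 2 ∧ f ≤ T ^ 2 ∧
      T ^ 4 ≤ 8 + 32 * (l ^ 2 + f ^ 2 + σ ^ 4 + β ^ 4) := by
  set t := Real.sqrt (σ ^ 2 + β ^ 2 + l + f) with htd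
  have ht0 : 0 ≤ t := Real.sqrt_nonneg _
  have ht2 : t ^ 2 = σ ^ 2 + β ^ 2 + l + f := Real.sq_sqrt (by positivity)
  have hT2 : t ^ 2 ≤ (1 + t) ^ 2 := pow_le_pow_left₀ ht0 (by linarith) 2
  refine ⟨1 + t, by linarith, ?_, ?_, ?_, ?_, quartic_le ht2⟩
  · have : σ ≤ t := Real.le_sqrt_of_sq_le (by linarith [sq_nonneg β])
    linarith
  · have : β ≤ t := Real.le_sqrt_of_sq_le (by linarith [sq_nonneg σ])
    linarith
  · linarith [sq_nonneg σ, sq_nonneg β]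
  · linarith [sq_nonneg σ, sq_nonneg β]

namespace Data
variable {d : Data ι n} {p : ι × (Fin n → ℝ)}

lemma Normal.abs_N1 {c σ β : ℝ} (hσ : ∀ i j k, |d.j3 p i j k| ≤ σ)
    (hβ : ∀ i j, |d.l2 p i j| ≤ β) (hc : ∀ i, |d.l1 p i| ≤ c) (k : Fin n) :
    |d.N1 p k| ≤ 2 * (n * (β * c)) + n * (n * (σ * c) * c) :=
  abs_sub_le' (abs_two_mul_le (abs_sum_le' fun _ => abs_mul_le' (hβ _ _) (hc _)))
    (abs_sum_le' fun _ => abs_mul_le' (abs_sum_le' fun _ => abs_mul_le' (hσ _ _ _) (hc _)) (hc _))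

set_option maxHeartbeats 400000 in
lemma Normal.second_order (hd : d.Normal p) {m c : ℝ} (hm : m = n + 1) (hc1 : 1 ≤ c)
    {b K D : ℝ}
    (hD : ∀ l f s β T lR lS lN N2 : ℝ, 0 ≤ l → 0 ≤ f → 0 ≤ s → 0 ≤ β →
      1 ≤ T → s ≤ T → β ≤ T → T ^ 4 ≤ 8 + 32 * (l ^ 2 + f ^ 2 + s ^ 4 + β ^ 4) →
      2 * l ^ 2 - (100 * (m ^ 5 * c ^ 4)) * (s * l * β + s ^ 2 * β ^ 2 + f * β ^ 2)
        - (100 * (m ^ 5 * c ^ 4)) * T ^ 3 ≤ lR →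
      f ^ 2 / 10 + 5 / (19 * m) * s ^ 4 - (100 * (m ^ 5 * c ^ 4)) * T ^ 3 ≤ lS →
      β ^ 2 / 2 - (100 * (m ^ 5 * c ^ 4)) * T ≤ lN →
      N2 ≤ (100 * (m ^ 5 * c ^ 4)) * (β ^ 2 + s ^ 2) →
      lR + K * lS + (β ^ 2 + K * s ^ 2) * (b * lN) - (β ^ 2 + K * s ^ 2) * (b ^ 2 * N2) ≤ 0 →
      T ≤ D)
    (hN : ev p (d.gam d.L d.L) ≤ c ^ 2) (hA : ev p (d.gam d.A d.A) ≤ c ^ 2)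
    (hAA : ev p (d.pair d.A d.A) ≤ c ^ 2)
    (hg : ∀ k, ev p (d.D k ((b • d.gam d.L d.L).exp * (d.R + K • d.S))) = 0)
    (hh : ev p (d.lap ((b • d.gam d.L d.L).exp * (d.R + K • d.S))) ≤ 0) :
    ev p d.R ≤ D ^ 2 ∧ ev p d.S ≤ D ^ 2 := by
  have hm1 : (1 : ℝ) ≤ m := by rw [hm]; linarith [Nat.cast_nonneg (α := ℝ) n]
  have hnm : (n : ℝ) ≤ m := by linarith
  have hn0 : (0 : ℝ) ≤ n := Nat.cast_nonneg _
  have hc0 : 0 ≤ c := by linarith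
  obtain ⟨-, h2⟩ := hd.weighted hg hh
  have hS0 : 0 ≤ ev p d.S := by
    rw [hd.ev_S]
    exact Finset.sum_nonneg fun _ _ => Finset.sum_nonneg fun _ _ =>
      Finset.sum_nonneg fun _ _ => sq_nonneg _
  have hR0 : 0 ≤ ev p d.R := by
    rw [hd.ev_R]
    exact Finset.sum_nonneg fun _ _ => Finset.sum_nonneg fun _ _ => sq_nonneg _
  have hl1 : ∀ i, |d.l1 p i| ≤ c := by
    intro i
    refine (abs_le_sqrt_sum (d.l1 p) i).trans ?_
    rw [← hd.N_eq]; exact Real.sqrt_le_iff.2 ⟨hc0, hN⟩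
  have hA1 : ∀ i, |ev p (d.D i d.A)| ≤ c := by
    intro i
    refine (abs_le_sqrt_sum (fun i => ev p (d.D i d.A)) i).trans ?_
    simp only [sq]
    rw [← hd.gam]; exact Real.sqrt_le_iff.2 ⟨hc0, hA⟩
  have hA2 : ∀ i j, |ev p (d.D i (d.D j d.A))| ≤ c := by
    intro i j
    refine (abs_le_sqrt_sum2 (fun i j => ev p (d.D i (d.D j d.A))) i j).trans ?_
    simp only [sq]
    rw [← hd.ev_pair]; exact Real.sqrt_le_iff.2 ⟨hc0, hAA⟩
  set σ := Real.sqrt (ev p d.S) with hσd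
  set β := Real.sqrt (ev p d.R) with hβd
  set l := Real.sqrt (∑ i, ∑ j, ∑ k, d.l3 p i j k ^ 2) with hld
  set f := Real.sqrt (∑ i, ∑ j, ∑ k, ∑ l, d.j4 p i j k l ^ 2) with hfd
  have hσ : ∀ i j k, |d.j3 p i j k| ≤ σ := by
    intro i j k
    rw [hσd, hd.ev_S]; exact abs_le_sqrt_sum3 (d.j3 p) i j k
  have hβ : ∀ i j, |d.l2 p i j| ≤ β := by
    intro i j
    rw [hβd, hd.ev_R]; exact abs_le_sqrt_sum2 (d.l2 p) i j
  have hl : ∀ i j k, |d.l3 p i j k| ≤ l := fun i j k => abs_le_sqrt_sum3 (d.l3 p) i j k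
  have hf : ∀ i j k l, |d.j4 p i j k l| ≤ f := fun i j k l => abs_le_sqrt_sum4 (d.j4 p) i j k l
  have hσ0 : 0 ≤ σ := Real.sqrt_nonneg _
  have hβ0 : 0 ≤ β := Real.sqrt_nonneg _
  have hl0 : 0 ≤ l := Real.sqrt_nonneg _
  have hf0 : 0 ≤ f := Real.sqrt_nonneg _
  have hσ2 : σ ^ 2 = ev p d.S := Real.sq_sqrt hS0
  have hβ2 : β ^ 2 = ev p d.R := Real.sq_sqrt hR0
  have hl2 : l ^ 2 = ∑ i, ∑ j, ∑ k, d.l3 p i j k ^ 2 := Real.sq_sqrt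
    (Finset.sum_nonneg fun _ _ => Finset.sum_nonneg fun _ _ => Finset.sum_nonneg fun _ _ =>
      sq_nonneg _)
  have hf2 : f ^ 2 = ∑ i, ∑ j, ∑ k, ∑ l, d.j4 p i j k l ^ 2 := Real.sq_sqrt
    (Finset.sum_nonneg fun _ _ => Finset.sum_nonneg fun _ _ => Finset.sum_nonneg fun _ _ =>
      Finset.sum_nonneg fun _ _ => sq_nonneg _)
  obtain ⟨T, hT1, hσT, hβT, hlT, hfT, hT4⟩ := exists_dominating hσ0 hβ0 hl0 hf0
  clear_value σ β l f
  have kk : ∀ (a b : ℕ) {x y : ℝ}, a ≤ 5 → b ≤ 4 → 0 ≤ x → x ≤ y →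
      (n : ℝ) ^ a * c ^ b * x ≤ m ^ 5 * c ^ 4 * y := fun a b x y ha hb hx hxy =>
    mul_le_mul (mul_le_mul ((pow_le_pow_left₀ hn0 hnm a).trans (pow_le_pow_right₀ hm1 ha))
      (pow_le_pow_right₀ hc1 hb) (by positivity) (by positivity)) hxy hx (by positivity)
  have hN1 := fun k => Normal.abs_N1 hσ hβ hl1 k
  have key := hD l f σ β T (ev p (d.lap d.R)) (ev p (d.lap d.S))
    (ev p (d.lap (d.gam d.L d.L))) (∑ k, d.N1 p k ^ 2) hl0 hf0 hσ0 hβ0 hT1 hσT hβT hT4 ?_ ?_ ?_ ?_ ?_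
  · rw [← hσ2, ← hβ2]
    exact ⟨pow_le_pow_left₀ hβ0 (hβT.trans key) 2, pow_le_pow_left₀ hσ0 (hσT.trans key) 2⟩
  · have h3 := hd.lap_R_lower hm hc1 hσ hβ hl hf hl1 hA2 hσ0 hβ0 hl0 hf0 hT1 hσT hβT hlT hfT
    rw [← hl2] at h3
    have h4 : m ^ 5 * c ^ 2 ≤ m ^ 5 * c ^ 4 :=
      mul_le_mul_of_nonneg_left (pow_le_pow_right₀ hc1 (by norm_num)) (by positivity)
    have h5 := mul_le_mul_of_nonneg_right h4
      (show 0 ≤ σ * l * β + σ ^ 2 * β ^ 2 + f * β ^ 2 by positivity)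
    have h6 := mul_le_mul_of_nonneg_right h4 (show 0 ≤ T ^ 3 by positivity)
    linarith only [h3, h5, h6]
  · have h3 := hd.lap_S_lower hσ hβ hl
    rw [← hf2, ← hσ2, ← hm] at h3
    have e : 5 / 19 * ((σ ^ 2) ^ 2 / m) = 5 / (19 * m) * σ ^ 4 := by field_simp
    rw [e] at h3
    have t1 : β * σ ^ 2 ≤ T ^ 3 := by
      calc β * σ ^ 2 ≤ T * T ^ 2 :=
            mul_le_mul hβT (pow_le_pow_left₀ hσ0 hσT 2) (by positivity) (by linarith only [hT1])
        _ = T ^ 3 := by ring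
    have t2 : l * σ ≤ T ^ 3 := by
      calc l * σ ≤ T ^ 2 * T := mul_le_mul hlT hσT hσ0 (by positivity)
        _ = T ^ 3 := by ring
    have a1 := kk 4 0 (by norm_num) (by norm_num) (by positivity) t1
    have a2 := kk 3 0 (by norm_num) (by norm_num) (by positivity) t2
    have a3 : 0 ≤ m ^ 5 * c ^ 4 * T ^ 3 := by positivity
    linarith only [h3, a1, a2, a3]
  · rw [hd.lap_N, ← hd.ev_R, ← hβ2]
    have h3 : 0 ≤ ∑ i, ∑ j, d.H p i j ^ 2 :=
      Finset.sum_nonneg fun _ _ => Finset.sum_nonneg fun _ _ => sq_nonneg _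
    have h4 := (abs_le.1 (abs_sum_le' fun i => abs_sum_le' fun j =>
      abs_mul_le' (hβ i j) (abs_mul_le' (hl1 i) (hl1 j)))).2
    have h5 := (abs_le.1 (abs_sum_le' fun k => abs_mul_le' (hl1 k) (hN1 k))).1
    have h6 := (abs_le.1 (abs_sum_le' fun k => abs_mul_le' (hA1 k) (hl1 k))).2
    have a1 := kk 2 2 (by norm_num) (by norm_num) hβ0 hβT
    have a2 := kk 3 3 (by norm_num) (by norm_num) hσ0 hσT
    have a3 := kk 1 2 (by norm_num) (by norm_num) zero_le_one hT1
    have a4 : 0 ≤ β ^ 2 := sq_nonneg _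
    have a5 : 0 ≤ m ^ 5 * c ^ 4 * T := by positivity
    linarith only [h3, h4, h5, h6, a1, a2, a3, a4, a5]
  · have h3 : ∀ k, d.N1 p k ^ 2 ≤ (2 * (n * (β * c)) + n * (n * (σ * c) * c)) ^ 2 := fun k =>
      sq_le_sq' (abs_le.1 (hN1 k)).1 (abs_le.1 (hN1 k)).2
    have h4 := Finset.sum_le_sum fun k (_ : k ∈ Finset.univ) => h3 k
    simp only [Finset.sum_const, Finset.card_univ, Fintype.card_fin, nsmul_eq_mul] at h4
    have a1 := kk 3 2 (by norm_num) (by norm_num) (sq_nonneg β) le_rfl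
    have a2 := kk 5 4 (by norm_num) (by norm_num) (sq_nonneg σ) le_rfl
    have h5 : (n : ℝ) * (2 * (n * (β * c)) + n * (n * (σ * c) * c)) ^ 2
        ≤ 8 * (n ^ 3 * c ^ 2 * β ^ 2) + 2 * (n ^ 5 * c ^ 4 * σ ^ 2) := by
      have : 0 ≤ n * (2 * (n * (β * c)) - n * (n * (σ * c) * c)) ^ 2 := by positivity
      linarith only [this]
    have a3 : 0 ≤ m ^ 5 * c ^ 4 * β ^ 2 := by positivity
    have a4 : 0 ≤ m ^ 5 * c ^ 4 * σ ^ 2 := by positivity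
    linarith only [h4, h5, a1, a2, a3, a4]
  · simp only [lap_add, lap_smul, map_add, map_smul, smul_eq_mul, Derivation.map_smul,
      hd.D_N, mul_pow, ← Finset.mul_sum, ← hσ2, ← hβ2] at h2
    exact h2

variable {C₀ CA A₀ Cφ : ℝ}

lemma Adm.bound_of_max (hd : d.Adm C₀ CA A₀ Cφ) {η X : SF ι n} (hη : η ∈ perAlg ι n)
    (hX : X ∈ perAlg ι n) {Cη B : ℝ} (hB : 0 ≤ B) (hηb : ∀ q, |ev q η| ≤ Cη)
    (H : ∀ p P P' hP, d.MaxAt p (η.exp * X) P P' hP → ev p X ≤ B) (q : ι × (Fin n → ℝ)) :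
    ev q X ≤ Real.exp (2 * Cη) * B := by
  obtain ⟨p, P, P', hP, hp1, hmax⟩ := hd.exists_max (mul_mem (perAlg_exp hη) hX) q.1
  have hXp := H p P P' hP hmax
  have hle := hmax.le q.2
  rw [hp1] at hle
  simp only [map_mul, ev_exp] at hle
  change Real.exp (ev q η) * ev q X ≤ _ at hle
  have h3 : ev q X ≤ Real.exp (ev p η - ev q η) * ev p X := by
    rw [sub_eq_add_neg, Real.exp_add, Real.exp_neg]
    have hpos := Real.exp_pos (ev q η)
    rw [← mul_le_mul_iff_right₀ hpos]
    calc _ ≤ _ := hle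
      _ = _ := by field_simp
  refine h3.trans ?_
  have := abs_le.1 (hηb p)
  have := abs_le.1 (hηb q)
  calc _ ≤ Real.exp (ev p η - ev q η) * B :=
        mul_le_mul_of_nonneg_left hXp (Real.exp_pos _).le
    _ ≤ _ := mul_le_mul_of_nonneg_right (Real.exp_le_exp.2 (by linarith)) hB

lemma Adm.per_pair (hd : d.Adm C₀ CA A₀ Cφ) {f g : SF ι n} (hf : f ∈ perAlg ι n)
    (hg : g ∈ perAlg ι n) : d.pair f g ∈ perAlg ι n := by
  rw [pair_eq]
  have h : ∀ {f : SF ι n}, f ∈ perAlg ι n → ∀ i j, (d.a * d.hes f) i j ∈ perAlg ι n :=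
    fun hf i j => by
      rw [Matrix.mul_apply]
      exact sum_mem fun k _ => mul_mem (hd.pera _ _) (perAlg_dv (perAlg_dv hf _) _)
  exact sum_mem fun i _ => sum_mem fun j _ => mul_mem (h hf _ _) (h hg _ _)

lemma Adm.nonneg (hd : d.Adm C₀ CA A₀ Cφ) (p : ι × (Fin n → ℝ)) :
    0 ≤ ev p (d.gam d.L d.L) ∧ 0 ≤ ev p d.T ∧ 0 ≤ ev p d.R ∧ 0 ≤ ev p d.S := by
  obtain ⟨P, P', hP, hn, -⟩ := d.exists_normal (hd.apos p)
  have h1 : 0 ≤ ev p ((d.frame P P' hP).gam d.L d.L) := by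
    have := hn.N_eq
    change ev p ((d.frame P P' hP).gam d.L d.L) = _ at this
    rw [this]
    exact Finset.sum_nonneg fun _ _ => sq_nonneg _
  have h2 := (hd.toBd.frame P P' hP).T_nonneg hn
  have h3 : 0 ≤ ev p (d.frame P P' hP).R := by
    rw [hn.ev_R]
    exact Finset.sum_nonneg fun _ _ => Finset.sum_nonneg fun _ _ => sq_nonneg _
  have h4 : 0 ≤ ev p (d.frame P P' hP).S := by
    rw [hn.ev_S]
    exact Finset.sum_nonneg fun _ _ => Finset.sum_nonneg fun _ _ =>
      Finset.sum_nonneg fun _ _ => sq_nonneg _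
  rw [frame_T] at h2
  rw [frame_gam] at h1
  rw [frame_R] at h3
  rw [frame_S] at h4
  exact ⟨h1, h2, h3, h4⟩

lemma frame_pair (P P' : Matrix (Fin n) (Fin n) ℝ) (h : P * P' = 1) (f g : SF ι n) :
    (d.frame P P' h).pair f g = d.pair f g := by
  rw [pair, frame_hes, frame_hes]
  show trace (d.fa P' * _ * (d.fa P' * _)) = _
  rw [d.fa_mul h, d.fa_mul h]
  have : cm P' * (d.a * d.hes f) * cm P * (cm P' * (d.a * d.hes g) * cm P)
      = cm P' * (d.a * d.hes f * (cm P * cm P') * (d.a * d.hes g)) * cm P := by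
    simp only [Matrix.mul_assoc]
  rw [this, trace_conj h, cm_mul_cm h, Matrix.mul_one]; rfl

/-- Uniform second order estimate. -/
lemma Adm.second_order (hd : d.Adm C₀ CA A₀ Cφ) {c : ℝ} (hA : ∀ p, ev p (d.gam d.A d.A) ≤ c)
    (hAA : ∀ p, ev p (d.pair d.A d.A) ≤ c) : ∃ C, ∀ p, ev p d.R ≤ C ∧ ev p d.S ≤ C := by
  obtain ⟨C₁, hC₁⟩ := hd.first_order
  set c' := 1 + |c| + |C₁| with hc'
  have hc1 : 1 ≤ c' := by linarith [abs_nonneg c, abs_nonneg C₁]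
  have hc2 : c' ≤ c' ^ 2 := le_self_pow₀ hc1 (by norm_num)
  have hcc : c ≤ c' ^ 2 := by linarith [abs_nonneg C₁, le_abs_self c]
  have hcC : C₁ ≤ c' ^ 2 := by linarith [abs_nonneg c, le_abs_self C₁]
  set m : ℝ := n + 1 with hm
  have hm1 : 1 ≤ m := by linarith [Nat.cast_nonneg (α := ℝ) n]
  obtain ⟨b, K, D, hb, hK, hD⟩ := second_order_scalar (C := 100 * (m ^ 5 * c' ^ 4))
    (c₀ := 5 / (19 * m)) (by
      have : 1 ≤ m ^ 5 * c' ^ 4 := one_le_mul_of_one_le_of_one_le (one_le_pow₀ hm1) (one_le_pow₀ hc1)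
      linarith) (by positivity) (by rw [div_le_one (by positivity)]; linarith)
  have hS : d.S ∈ perAlg ι n := by
    rw [S_eq_pair]
    exact sum_mem fun _ _ => sum_mem fun _ _ => mul_mem (hd.pera _ _)
      (hd.per_pair (perAlg_dv hd.perφ _) (perAlg_dv hd.perφ _))
  have hX : d.R + K • d.S ∈ perAlg ι n :=
    add_mem (hd.per_pair hd.perL hd.perL) (Subalgebra.smul_mem _ hS _)
  have key := hd.bound_of_max (η := b • d.gam d.L d.L) (X := d.R + K • d.S)
    (Subalgebra.smul_mem _ hd.perN _) hX (Cη := b * c' ^ 2) (B := (1 + K) * D ^ 2) (by positivity)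
    (by
      intro q
      rw [map_smul, smul_eq_mul, abs_mul, abs_of_pos hb, abs_of_nonneg (hd.nonneg q).1]
      exact mul_le_mul_of_nonneg_left ((hC₁ q).1.trans hcC) hb.le)
    (by
      intro p P P' hP hmax
      have := hmax.normal.second_order (m := m) (c := c') (b := b) (K := K) (D := D) hm hc1 hD
        (by rw [frame_gam]; exact (hC₁ p).1.trans hcC)
        (by rw [frame_gam]; exact (hA p).trans hcc)
        (by rw [frame_pair]; exact (hAA p).trans hcc)
        (by
          intro k
          have := hmax.grad k
          rw [frame_gam, frame_R, frame_S]; exact this)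
        (by
          have := hmax.hess
          rw [frame_gam, frame_R, frame_S]; exact this)
      rw [frame_R, frame_S] at this
      simp only [map_add, map_smul, smul_eq_mul]
      linarith [mul_le_mul_of_nonneg_left this.2 (show 0 ≤ K by linarith)])
  refine ⟨Real.exp (2 * (b * c' ^ 2)) * ((1 + K) * D ^ 2), fun q => ?_⟩
  obtain ⟨-, -, r, s⟩ := hd.nonneg q
  have := key q
  simp only [map_add, map_smul, smul_eq_mul] at this
  have h1 := le_mul_of_one_le_left s hK
  constructor <;> linarith

end Data

end

section

variable {ι : Type} {n : ℕ}

/-- The algebra of uniformly bounded families. -/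
def bddAlg (ι : Type) (n : ℕ) : Subalgebra ℝ (SF ι n) where
  carrier := {f | ∃ C, ∀ p, |ev p f| ≤ C}
  mul_mem' := by
    rintro f g ⟨C, hC⟩ ⟨C', hC'⟩
    exact ⟨C * C', fun p => by rw [map_mul]; exact abs_mul_le' (hC p) (hC' p)⟩
  add_mem' := by
    rintro f g ⟨C, hC⟩ ⟨C', hC'⟩
    exact ⟨C + C', fun p => by rw [map_add]; exact abs_add_le' (hC p) (hC' p)⟩
  algebraMap_mem' := fun r => ⟨|r|, fun p => by rw [AlgHom.commutes]; exact le_rfl⟩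

lemma _root_.Matrix.PosDef.exists_lower {M : Matrix (Fin n) (Fin n) ℝ} (h : M.PosDef) :
    ∃ c : ℝ, 0 < c ∧ ∀ v : Fin n → ℝ, c * ∑ i, v i ^ 2 ≤ v ⬝ᵥ M *ᵥ v := by
  obtain ⟨B, hB, hM⟩ := h.posSemidef.exists_sq
  have hu : IsUnit B.det := by
    have := h.det_pos
    rw [hM, Matrix.det_mul] at this
    exact isUnit_iff_ne_zero.2 fun h0 => by simp [h0] at this
  set K : ℝ := ∑ i, ∑ j, B⁻¹ i j ^ 2 with hK
  have hK0 : 0 ≤ K := Finset.sum_nonneg fun _ _ => Finset.sum_nonneg fun _ _ => sq_nonneg _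
  refine ⟨(K + 1)⁻¹, by positivity, fun v => ?_⟩
  have hq : v ⬝ᵥ M *ᵥ v = ∑ i, (B *ᵥ v) i ^ 2 := by
    rw [hM, ← Matrix.mulVec_mulVec, Matrix.dotProduct_mulVec, ← Matrix.mulVec_transpose, hB,
      dotProduct]
    exact Finset.sum_congr rfl fun _ _ => (sq _).symm
  have hv : v = B⁻¹ *ᵥ (B *ᵥ v) := by
    rw [Matrix.mulVec_mulVec, Matrix.nonsing_inv_mul _ hu, Matrix.one_mulVec]
  set w := B *ᵥ v with hw
  have h1 : ∑ i, v i ^ 2 ≤ K * ∑ i, w i ^ 2 := by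
    conv_lhs => rw [hv]
    rw [hK, Finset.sum_mul]
    exact Finset.sum_le_sum fun i _ =>
      Finset.sum_mul_sq_le_sq_mul_sq Finset.univ (fun j => B⁻¹ i j) w
  have h0 : 0 ≤ ∑ i, w i ^ 2 := Finset.sum_nonneg fun _ _ => sq_nonneg _
  rw [hq, inv_mul_le_iff₀ (by positivity)]
  linarith

lemma _root_.Matrix.exists_adjugate_le (n : ℕ) (C : ℝ) : ∃ C', ∀ M : Matrix (Fin n) (Fin n) ℝ,
    (∀ i j, |M i j| ≤ C) → ∀ i j, |M.adjugate i j| ≤ C' := by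
  refine ⟨Nat.factorial n • (|C| + 1) ^ n, fun M hM i j => ?_⟩
  rw [adjugate_apply]
  have := Matrix.det_le (A := M.updateRow j (Pi.single i 1))
    (abv := IsAbsoluteValue.toAbsoluteValue (abs : ℝ → ℝ)) (x := |C| + 1) fun k l => ?_
  · simpa using this
  · show |_| ≤ _
    rw [Matrix.updateRow_apply]
    split_ifs
    · rw [Pi.single_apply]; split_ifs <;> simp <;> linarith [abs_nonneg C]
    · linarith [hM k l, le_abs_self C]

namespace Data
variable {d : Data ι n} {C₀ CA A₀ Cφ : ℝ}

lemma D_eq_frame {P P' : Matrix (Fin n) (Fin n) ℝ} (hP : P * P' = 1) (i : Fin n) (f : SF ι n) :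
    d.D i f = ∑ k, P' k i • (d.frame P P' hP).D k f := by
  simp only [frame_D, Finset.smul_sum, smul_smul]
  rw [Finset.sum_comm]
  simp only [← Finset.sum_smul]
  have : ∀ j, ∑ k, P' k i * P j k = (1 : Matrix (Fin n) (Fin n) ℝ) j i := fun j => by
    rw [← hP, Matrix.mul_apply]; exact Finset.sum_congr rfl fun _ _ => mul_comm _ _
  simp [this, Matrix.one_apply]

/-- Uniform bounds for normalising frames. -/
lemma Adm.frame_bdd (hd : d.Adm C₀ CA A₀ Cφ) : ∃ C, 0 ≤ C ∧
    ∀ p P P' (hP : P * P' = 1), (d.frame P P' hP).Normal p → d.a.map (ev p) = P * Pᵀ →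
      (∀ i j, |P i j| ≤ C) ∧ (∀ i j, |P' i j| ≤ C) ∧ ∑ i, ∑ j, P' i j ^ 2 ≤ C := by
  obtain ⟨θ, hθ, hΘ⟩ := hd.toBd.Θpos.exists_lower
  obtain ⟨C₁, hC₁⟩ := hd.first_order
  obtain ⟨C₂, hC₂⟩ := hd.L_lower
  obtain ⟨C₃, hC₃⟩ := Matrix.exists_adjugate_le n (Real.sqrt (C₁ / θ))
  refine ⟨|Real.sqrt (C₁ / θ)| + |C₁ / θ| + (Real.exp C₂ + 1) * |C₃|, by positivity, ?_⟩
  intro p P P' hP hn ha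
  have hS : ∑ i, ∑ j, P' i j ^ 2 ≤ C₁ / θ := by
    have h1 : ev p d.T = ∑ k, P' k ⬝ᵥ d.Θ *ᵥ P' k := by
      rw [← d.frame_T P P' hP, hn.T]
      show (P' * d.Θ * P'ᵀ).trace = _
      rw [Matrix.trace]
      refine Finset.sum_congr rfl fun k _ => ?_
      rw [Matrix.diag_apply, Matrix.mul_assoc, Matrix.mul_apply, dotProduct]
      refine Finset.sum_congr rfl fun j _ => ?_
      rw [Matrix.mul_apply]; rfl
    rw [le_div_iff₀ hθ, mul_comm, Finset.mul_sum]
    calc _ ≤ ∑ k, P' k ⬝ᵥ d.Θ *ᵥ P' k := Finset.sum_le_sum fun k _ => hΘ _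
      _ = ev p d.T := h1.symm
      _ ≤ _ := (hC₁ p).2
  have hP' : ∀ i j, |P' i j| ≤ Real.sqrt (C₁ / θ) := fun i j =>
    (abs_le_sqrt_sum2 (fun i j => P' i j) i j).trans (Real.sqrt_le_sqrt hS)
  have hdet : |P.det| ≤ Real.exp C₂ + 1 := by
    have h1 := hd.det_a p
    rw [ha, det_mul, det_transpose] at h1
    have h2 : Real.exp (-ev p d.L) ≤ Real.exp C₂ := Real.exp_le_exp.2 (by linarith [hC₂ p])
    rw [abs_le]
    constructor <;> nlinarith
  have hPP : P = P.det • P'.adjugate := by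
    have h1 : P.det * P'.det = 1 := by rw [← det_mul, hP, det_one]
    calc P = P.det • (P * (P'.det • (1 : Matrix (Fin n) (Fin n) ℝ))) := by
          rw [Matrix.mul_smul, Matrix.mul_one, smul_smul, h1, one_smul]
      _ = _ := by rw [← Matrix.mul_adjugate, ← Matrix.mul_assoc, hP, Matrix.one_mul]
  refine ⟨fun i j => ?_, fun i j => ?_, ?_⟩
  · have : |P i j| ≤ (Real.exp C₂ + 1) * |C₃| := by
      rw [hPP, Matrix.smul_apply, smul_eq_mul]
      exact abs_mul_le' hdet ((hC₃ _ hP' i j).trans (le_abs_self _))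
    linarith [abs_nonneg (Real.sqrt (C₁ / θ)), abs_nonneg (C₁ / θ)]
  · have : 0 ≤ (Real.exp C₂ + 1) * |C₃| := by positivity
    linarith [hP' i j, le_abs_self (Real.sqrt (C₁ / θ)), abs_nonneg (C₁ / θ)]
  · have : 0 ≤ (Real.exp C₂ + 1) * |C₃| := by positivity
    linarith [le_abs_self (C₁ / θ), abs_nonneg (Real.sqrt (C₁ / θ))]

/-- Uniform ellipticity. -/
lemma Adm.elliptic (hd : d.Adm C₀ CA A₀ Cφ) : ∃ C, 0 < C ∧ ∀ p f,
    ∑ i, ev p (d.D i f) ^ 2 ≤ C * ev p (d.gam f f) := by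
  obtain ⟨C, hC, H⟩ := hd.frame_bdd
  refine ⟨C + 1, by positivity, fun p f => ?_⟩
  obtain ⟨P, P', hP, hn, ha⟩ := d.exists_normal (hd.apos p)
  have hS := (H p P P' hP hn ha).2.2
  have hg : ev p (d.gam f f) = ∑ k, ev p ((d.frame P P' hP).D k f) ^ 2 := by
    rw [← d.frame_gam P P' hP, hn.gam]; exact Finset.sum_congr rfl fun _ _ => (sq _).symm
  have h0 : 0 ≤ ev p (d.gam f f) := by rw [hg]; exact Finset.sum_nonneg fun _ _ => sq_nonneg _
  calc ∑ i, ev p (d.D i f) ^ 2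
      ≤ ∑ i, (∑ k, P' k i ^ 2) * ∑ k, ev p ((d.frame P P' hP).D k f) ^ 2 := by
        refine Finset.sum_le_sum fun i _ => ?_
        rw [D_eq_frame hP i f, map_sum]
        simp only [map_smul, smul_eq_mul]
        exact Finset.sum_mul_sq_le_sq_mul_sq _ _ _
    _ = (∑ i, ∑ j, P' i j ^ 2) * ev p (d.gam f f) := by
        rw [← Finset.sum_mul, ← hg, Finset.sum_comm]
    _ ≤ _ := mul_le_mul_of_nonneg_right (by linarith) h0

lemma Adm.a_bdd (hd : d.Adm C₀ CA A₀ Cφ) (i j : Fin n) : d.a i j ∈ bddAlg ι n := by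
  obtain ⟨C, hC, H⟩ := hd.frame_bdd
  refine ⟨n * (C * C), fun p => ?_⟩
  obtain ⟨P, P', hP, hn, ha⟩ := d.exists_normal (hd.apos p)
  have : ev p (d.a i j) = ∑ k, P i k * P j k := congrFun (congrFun ha i) j
  rw [this]
  exact abs_sum_le' fun k => abs_mul_le' ((H p P P' hP hn ha).1 i k) ((H p P P' hP hn ha).1 j k)

lemma frame_bdd_of (hd : d.Adm C₀ CA A₀ Cφ) (f : SF ι n) (B : ℝ)
    (h : ∀ p P P' (hP : P * P' = 1), (d.frame P P' hP).Normal p →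
      ∀ i, |ev p ((d.frame P P' hP).D i f)| ≤ B) (i : Fin n) : d.D i f ∈ bddAlg ι n := by
  obtain ⟨C, hC, H⟩ := hd.frame_bdd
  refine ⟨n * (C * B), fun p => ?_⟩
  obtain ⟨P, P', hP, hn, ha⟩ := d.exists_normal (hd.apos p)
  rw [D_eq_frame hP, map_sum]
  simp only [map_smul, smul_eq_mul]
  exact abs_sum_le' fun k => abs_mul_le' ((H p P P' hP hn ha).2.1 k i) (h p P P' hP hn k)

lemma Adm.Dφ_bdd (hd : d.Adm C₀ CA A₀ Cφ) (i : Fin n) : d.D i d.φ ∈ bddAlg ι n := by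
  refine ⟨Real.sqrt (C₀ * d.Q i i), fun p => Real.abs_le_sqrt ?_⟩
  have := hd.Hφ p (Pi.single i 1)
  simpa [Pi.single_apply] using this

lemma Adm.L_bdd (hd : d.Adm C₀ CA A₀ Cφ) : d.L ∈ bddAlg ι n := by
  obtain ⟨C, hC⟩ := hd.L_lower
  obtain ⟨C', hC'⟩ := hd.L_upper
  refine ⟨|C| + |C'|, fun p => abs_le.2 ⟨?_, ?_⟩⟩
  · linarith [hC p, le_abs_self C, abs_nonneg C']
  · linarith [hC' p, le_abs_self C', abs_nonneg C]

lemma Adm.DL_bdd (hd : d.Adm C₀ CA A₀ Cφ) (i : Fin n) : d.D i d.L ∈ bddAlg ι n := by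
  obtain ⟨C₁, hC₁⟩ := hd.first_order
  refine frame_bdd_of hd _ (Real.sqrt C₁) (fun p P P' hP hn i => ?_) i
  refine (abs_le_sqrt_sum ((d.frame P P' hP).l1 p) i).trans (Real.sqrt_le_sqrt ?_)
  have := hn.N_eq
  change ev p ((d.frame P P' hP).gam d.L d.L) = _ at this
  rw [frame_gam] at this
  rw [← this]; exact (hC₁ p).1

lemma Adm.G_bdd (hd : d.Adm C₀ CA A₀ Cφ) (i j : Fin n) : d.G i j ∈ bddAlg ι n := by
  obtain ⟨C, hC, H⟩ := hd.frame_bdd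
  refine ⟨n * (C * C), fun p => ?_⟩
  obtain ⟨P, P', hP, hn, ha⟩ := d.exists_normal (hd.apos p)
  have h1 : (d.G * d.a).map (ev p) = (1 : Matrix (Fin n) (Fin n) ℝ) := by
    rw [d.Ga]; exact Matrix.map_one _ (map_zero _) (map_one _)
  rw [Matrix.map_mul, ha] at h1
  have hPP : P' * P = 1 := mul_eq_one_comm.1 hP
  have h2 : d.G.map (ev p) = P'ᵀ * P' := by
    have e : P * Pᵀ * (P'ᵀ * P') = 1 := by
      rw [Matrix.mul_assoc, ← Matrix.mul_assoc Pᵀ, ← Matrix.transpose_mul, hPP,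
        Matrix.transpose_one, Matrix.one_mul, hP]
    calc d.G.map (ev p) = d.G.map (ev p) * (P * Pᵀ * (P'ᵀ * P')) := by rw [e, Matrix.mul_one]
      _ = _ := by rw [← Matrix.mul_assoc, h1, Matrix.one_mul]
  have : ev p (d.G i j) = ∑ k, P' k i * P' k j := congrFun (congrFun h2 i) j
  rw [this]
  exact abs_sum_le' fun k =>
    abs_mul_le' ((H p P P' hP hn ha).2.1 k i) ((H p P P' hP hn ha).2.1 k j)

lemma cm_mem (M : Matrix (Fin n) (Fin n) ℝ) (S : Subalgebra ℝ (SF ι n)) (i j : Fin n) :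
    cm M i j ∈ S := S.algebraMap_mem _

lemma Adm.DDφ_bdd (hd : d.Adm C₀ CA A₀ Cφ) (i j : Fin n) : d.D i (d.D j d.φ) ∈ bddAlg ι n := by
  have : d.D i (d.D j d.φ) = d.G i j - cm d.Q i j := by simp [G, hes]
  rw [this]
  exact sub_mem (hd.G_bdd i j) (cm_mem _ _ _ _)

/-- Bounds on the data `A`. -/
lemma Adm.A_pairings (hd : d.Adm C₀ CA A₀ Cφ) (h1 : ∀ i, d.D i d.A ∈ bddAlg ι n)
    (h2 : ∀ i j, d.D i (d.D j d.A) ∈ bddAlg ι n) :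
    ∃ c, (∀ p, ev p (d.gam d.A d.A) ≤ c) ∧ ∀ p, ev p (d.pair d.A d.A) ≤ c := by
  have e1 : d.gam d.A d.A ∈ bddAlg ι n := sum_mem fun i _ => sum_mem fun j _ =>
    mul_mem (hd.a_bdd i j) (mul_mem (h1 i) (h1 j))
  have e2 : d.pair d.A d.A ∈ bddAlg ι n := by
    have h : ∀ i j, (d.a * d.hes d.A) i j ∈ bddAlg ι n := fun i j => by
      rw [Matrix.mul_apply]
      exact sum_mem fun k _ => mul_mem (hd.a_bdd _ _) (h2 _ _)
    rw [pair_eq]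
    exact sum_mem fun i _ => sum_mem fun j _ => mul_mem (h _ _) (h _ _)
  obtain ⟨C, hC⟩ := e1
  obtain ⟨C', hC'⟩ := e2
  exact ⟨max C C', fun p => (le_abs_self _).trans ((hC p).trans (le_max_left _ _)),
    fun p => (le_abs_self _).trans ((hC' p).trans (le_max_right _ _))⟩

lemma Adm.third_bdd (hd : d.Adm C₀ CA A₀ Cφ) (h1 : ∀ i, d.D i d.A ∈ bddAlg ι n)
    (h2 : ∀ i j, d.D i (d.D j d.A) ∈ bddAlg ι n) :
    (∀ i j, d.D i (d.D j d.L) ∈ bddAlg ι n) ∧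
      ∀ i j k, d.D i (d.D j (d.D k d.φ)) ∈ bddAlg ι n := by
  obtain ⟨c, hc, hc'⟩ := hd.A_pairings h1 h2
  obtain ⟨C₁, hC₁⟩ := hd.second_order hc hc'
  obtain ⟨C, hC, H⟩ := hd.frame_bdd
  constructor
  · refine fun i j => ⟨n * (C * (n * (C * Real.sqrt C₁))), fun p => ?_⟩
    obtain ⟨P, P', hP, hn, ha⟩ := d.exists_normal (hd.apos p)
    have hb : ∀ k l, |ev p ((d.frame P P' hP).D k ((d.frame P P' hP).D l d.L))|
        ≤ Real.sqrt C₁ := fun k l => by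
      refine (abs_le_sqrt_sum2 ((d.frame P P' hP).l2 p) k l).trans (Real.sqrt_le_sqrt ?_)
      rw [← hn.ev_R, frame_R]; exact (hC₁ p).1
    rw [D_eq_frame hP j, map_sum]
    simp only [Derivation.map_smul]
    simp only [D_eq_frame hP i, map_sum, map_smul, smul_eq_mul]
    exact abs_sum_le' fun k => abs_mul_le' ((H p P P' hP hn ha).2.1 k j) <| abs_sum_le' fun l =>
      abs_mul_le' ((H p P P' hP hn ha).2.1 l i) (hb l k)
  · refine fun i j k => ⟨n * (C * (n * (C * (n * (C * Real.sqrt C₁))))), fun p => ?_⟩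
    obtain ⟨P, P', hP, hn, ha⟩ := d.exists_normal (hd.apos p)
    have hb : ∀ k l m, |ev p ((d.frame P P' hP).D k ((d.frame P P' hP).D l
        ((d.frame P P' hP).D m d.φ)))| ≤ Real.sqrt C₁ := fun k l m => by
      refine (abs_le_sqrt_sum3 ((d.frame P P' hP).j3 p) k l m).trans (Real.sqrt_le_sqrt ?_)
      rw [← hn.ev_S, frame_S]; exact (hC₁ p).2
    rw [D_eq_frame hP k, map_sum, map_sum]
    simp only [Derivation.map_smul]
    simp only [D_eq_frame hP j, map_sum, Derivation.map_smul, D_eq_frame hP i, map_smul,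
      smul_eq_mul]
    exact abs_sum_le' fun m => abs_mul_le' ((H p P P' hP hn ha).2.1 m k) <| abs_sum_le' fun l =>
      abs_mul_le' ((H p P P' hP hn ha).2.1 l i) <| abs_sum_le' fun q =>
        abs_mul_le' ((H p P P' hP hn ha).2.1 q j) (hb l q m)

end Data

end

section

open scoped NNReal

variable {ι : Type} {n : ℕ}

namespace Data
variable (d : Data ι n)

/-- Iterated derivatives. -/
def Dl : List (Fin n) → SF ι n →ₗ[ℝ] SF ι n
  | [] => LinearMap.id
  | i :: I => (Dl I).comp (d.D i : SF ι n →ₗ[ℝ] SF ι n)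

lemma Dl_nil (f : SF ι n) : d.Dl [] f = f := rfl

lemma Dl_cons (i : Fin n) (I : List (Fin n)) (f : SF ι n) : d.Dl (i :: I) f = d.Dl I (d.D i f) :=
  rfl

lemma D_Dl (i : Fin n) (I : List (Fin n)) (f : SF ι n) : d.D i (d.Dl I f) = d.Dl I (d.D i f) := by
  induction I generalizing f with
  | nil => rfl
  | cons j I ih => rw [Dl_cons, Dl_cons, ih, d.comm]

variable (r s : ι × (Fin n → ℝ) → ℝ≥0)

/-- Bounded families whose first derivatives grow at most linearly in `r`. -/
def tame : Subalgebra ℝ (SF ι n) where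
  carrier := {f | ∃ C : ℝ≥0, ∀ p, |ev p f| ≤ C ∧ ∀ i, |ev p (d.D i f)| ≤ C * (1 + r p)}
  mul_mem' := by
    rintro f g ⟨C, hC⟩ ⟨C', hC'⟩
    refine ⟨C * C' + C' * C, fun p => ⟨?_, fun i => ?_⟩⟩
    · rw [map_mul]
      push_cast
      have : 0 ≤ (C' : ℝ) * C := by positivity
      linarith [abs_mul_le' (hC p).1 (hC' p).1]
    · rw [Derivation.leibniz, map_add, smul_eq_mul, smul_eq_mul, map_mul, map_mul]
      refine (abs_add_le' (abs_mul_le' (hC p).1 ((hC' p).2 i))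
        (abs_mul_le' (hC' p).1 ((hC p).2 i))).trans (le_of_eq ?_)
      push_cast; ring
  add_mem' := by
    rintro f g ⟨C, hC⟩ ⟨C', hC'⟩
    refine ⟨C + C', fun p => ⟨?_, fun i => ?_⟩⟩
    · rw [map_add]; exact abs_add_le' (hC p).1 (hC' p).1
    · rw [map_add, map_add]
      refine (abs_add_le' ((hC p).2 i) ((hC' p).2 i)).trans (le_of_eq ?_)
      push_cast; ring
  algebraMap_mem' := fun c => ⟨‖c‖₊, fun p => ⟨by rw [AlgHom.commutes]; exact le_rfl, fun i => by
    rw [Derivation.map_algebraMap, map_zero, abs_zero]; positivity⟩⟩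

/-- Families growing at most linearly in `r`, with derivatives of size `r ^ 2 + s`. -/
def semitame : Submodule ℝ (SF ι n) where
  carrier := {f | ∃ C : ℝ≥0, ∀ p, |ev p f| ≤ C * (1 + r p) ∧
    ∀ i, |ev p (d.D i f)| ≤ C * (1 + r p ^ 2 + s p)}
  add_mem' := by
    rintro f g ⟨C, hC⟩ ⟨C', hC'⟩
    refine ⟨C + C', fun p => ⟨?_, fun i => ?_⟩⟩
    · rw [map_add]
      refine (abs_add_le' (hC p).1 (hC' p).1).trans (le_of_eq ?_)
      push_cast; ring
    · rw [map_add, map_add]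
      refine (abs_add_le' ((hC p).2 i) ((hC' p).2 i)).trans (le_of_eq ?_)
      push_cast; ring
  zero_mem' := ⟨0, fun p => ⟨by simp, fun i => by simp⟩⟩
  smul_mem' := by
    rintro c f ⟨C, hC⟩
    refine ⟨‖c‖₊ * C, fun p => ⟨?_, fun i => ?_⟩⟩
    · rw [map_smul, smul_eq_mul, abs_mul]
      push_cast
      rw [mul_assoc]
      exact mul_le_mul_of_nonneg_left (hC p).1 (abs_nonneg _)
    · rw [Derivation.map_smul, map_smul, smul_eq_mul, abs_mul]
      push_cast
      rw [mul_assoc]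
      exact mul_le_mul_of_nonneg_left ((hC p).2 i) (abs_nonneg _)

variable {d r s}

lemma tame_mul_semitame {f g : SF ι n} (hf : f ∈ d.tame r) (hg : g ∈ d.semitame r s) :
    f * g ∈ d.semitame r s := by
  obtain ⟨C, hC⟩ := hf
  obtain ⟨C', hC'⟩ := hg
  refine ⟨3 * (C * C'), fun p => ⟨?_, fun i => ?_⟩⟩
  · rw [map_mul]
    have := abs_mul_le' (hC p).1 (hC' p).1
    have : 0 ≤ (C : ℝ) * C' * (1 + r p) := by positivity
    push_cast
    linarith
  · rw [Derivation.leibniz, map_add, smul_eq_mul, smul_eq_mul, map_mul, map_mul]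
    refine (abs_add_le' (abs_mul_le' (hC p).1 ((hC' p).2 i))
        (abs_mul_le' (hC' p).1 ((hC p).2 i))).trans ?_
    push_cast
    have h1 : 0 ≤ (C : ℝ) * C' * (1 - r p) ^ 2 := by positivity
    have h2 : 0 ≤ (C : ℝ) * C' * s p := by positivity
    linarith

lemma tame_le_semitame {f : SF ι n} (hf : f ∈ d.tame r) : f ∈ d.semitame r s := by
  obtain ⟨C, hC⟩ := hf
  refine ⟨2 * C, fun p => ⟨?_, fun i => ?_⟩⟩
  · have : 0 ≤ (C : ℝ) * r p := by positivity
    push_cast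
    linarith [(hC p).1, C.2]
  · have h1 : 0 ≤ (C : ℝ) * (1 - r p) ^ 2 := by positivity
    have h2 : 0 ≤ (C : ℝ) * s p := by positivity
    have h3 : 0 ≤ (C : ℝ) * r p ^ 2 := by positivity
    push_cast
    linarith [(hC p).2 i, C.2]

variable (d r s)

/-- Families whose first `m` derivatives are tame up to the last one, which is semitame. -/
def cls : ℕ → Submodule ℝ (SF ι n)
  | 0 => d.semitame r s
  | m + 1 => (Subalgebra.toSubmodule (d.tame r)) ⊓
      ⨅ i, (cls m).comap (d.D i : SF ι n →ₗ[ℝ] SF ι n)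

variable {d r s}

lemma mem_cls_succ {m : ℕ} {f : SF ι n} :
    f ∈ d.cls r s (m + 1) ↔ f ∈ d.tame r ∧ ∀ i, d.D i f ∈ d.cls r s m := by
  simp [cls]

lemma cls_succ_le {m : ℕ} {f : SF ι n} (hf : f ∈ d.cls r s (m + 1)) : f ∈ d.cls r s m := by
  induction m generalizing f with
  | zero => exact tame_le_semitame (mem_cls_succ.1 hf).1
  | succ m ih =>
    exact mem_cls_succ.2 ⟨(mem_cls_succ.1 hf).1, fun i => ih ((mem_cls_succ.1 hf).2 i)⟩

lemma cls_le {m k : ℕ} (h : m ≤ k) {f : SF ι n} (hf : f ∈ d.cls r s k) : f ∈ d.cls r s m := by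
  induction h with
  | refl => exact hf
  | step _ ih => exact ih (cls_succ_le hf)

lemma cls_mul_succ {m : ℕ} {f g : SF ι n} (hf : f ∈ d.cls r s (m + 1)) (hg : g ∈ d.cls r s m) :
    f * g ∈ d.cls r s m := by
  induction m generalizing f g with
  | zero => exact tame_mul_semitame (mem_cls_succ.1 hf).1 hg
  | succ m ih =>
    refine mem_cls_succ.2 ⟨mul_mem (mem_cls_succ.1 hf).1 (mem_cls_succ.1 hg).1, fun i => ?_⟩
    rw [Derivation.leibniz, smul_eq_mul, smul_eq_mul]
    exact add_mem (ih (cls_succ_le hf) ((mem_cls_succ.1 hg).2 i))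
      (ih hg (cls_succ_le ((mem_cls_succ.1 hf).2 i)))

lemma cls_mul {m : ℕ} (hm : 1 ≤ m) {f g : SF ι n} (hf : f ∈ d.cls r s m) (hg : g ∈ d.cls r s m) :
    f * g ∈ d.cls r s m := by
  obtain ⟨m, rfl⟩ : ∃ k, m = k + 1 := ⟨m - 1, by omega⟩
  refine mem_cls_succ.2 ⟨mul_mem (mem_cls_succ.1 hf).1 (mem_cls_succ.1 hg).1, fun i => ?_⟩
  rw [Derivation.leibniz, smul_eq_mul, smul_eq_mul]
  exact add_mem (cls_mul_succ hf ((mem_cls_succ.1 hg).2 i))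
    (cls_mul_succ hg ((mem_cls_succ.1 hf).2 i))

lemma tame_mul_cls {m : ℕ} {f g : SF ι n} (hft : f ∈ d.tame r) (hf : f ∈ d.cls r s m)
    (hg : g ∈ d.cls r s m) : f * g ∈ d.cls r s m := by
  rcases Nat.eq_zero_or_pos m with rfl | hm
  · exact tame_mul_semitame hft hg
  · exact cls_mul hm hf hg

lemma cls_Dl {m : ℕ} {f : SF ι n} (I : List (Fin n)) (hf : f ∈ d.cls r s (m + I.length)) :
    d.Dl I f ∈ d.cls r s m := by
  induction I generalizing f with
  | nil => exact hf
  | cons i I ih => exact ih ((mem_cls_succ.1 hf).2 i)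

lemma mem_cls_of {m : ℕ} {f : SF ι n} (h1 : ∀ I : List (Fin n), I.length < m → d.Dl I f ∈ d.tame r)
    (h2 : ∀ I : List (Fin n), I.length = m → d.Dl I f ∈ d.semitame r s) : f ∈ d.cls r s m := by
  induction m generalizing f with
  | zero => exact h2 [] rfl
  | succ m ih =>
    exact mem_cls_succ.2 ⟨h1 [] (Nat.succ_pos m), fun i => ih
      (fun I hI => h1 (i :: I) (Nat.succ_lt_succ hI))
      (fun I hI => h2 (i :: I) (congrArg Nat.succ hI))⟩

lemma Dl_commutator {m t : ℕ} (ht : 1 ≤ t) (hmt : m ≤ t) {a g : SF ι n}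
    (ha : ∀ i, d.D i a ∈ d.cls r s t) (hg : g ∈ d.cls r s m) (I : List (Fin n))
    (hI : I.length = m + 1) : d.Dl I (a * g) - a * d.Dl I g ∈ d.semitame r s := by
  induction m generalizing g I with
  | zero =>
    obtain ⟨i, rfl⟩ := List.length_eq_one_iff.1 hI
    have : d.Dl [i] (a * g) - a * d.Dl [i] g = d.D i a * g := by
      simp only [Dl_cons, Dl_nil, Derivation.leibniz, smul_eq_mul]; ring
    rw [this]
    exact cls_mul_succ (m := 0) (cls_le ht (ha i)) hg
  | succ m ih =>
    obtain ⟨i, I, rfl⟩ := List.exists_cons_of_length_eq_add_one hI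
    have hI' : I.length = m + 1 := by simpa using hI
    have : d.Dl (i :: I) (a * g) - a * d.Dl (i :: I) g
        = d.Dl I (d.D i a * g) + (d.Dl I (a * d.D i g) - a * d.Dl I (d.D i g)) := by
      simp only [Dl_cons, Derivation.leibniz, smul_eq_mul, map_add]
      rw [mul_comm g]; ring
    rw [this]
    refine add_mem (cls_Dl (m := 0) I ?_) (ih (by omega) ((mem_cls_succ.1 hg).2 i) I hI')
    rw [hI', zero_add]
    exact cls_mul (by omega) (cls_le hmt (ha i)) hg

/-- Commuting iterated derivatives with the Laplacian. -/
lemma lap_Dl {m t : ℕ} (ht : 1 ≤ t) (hmt : m ≤ t) {g : SF ι n}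
    (ha : ∀ i j k, d.D i (d.a j k) ∈ d.cls r s t) (hg : ∀ i j, d.D i (d.D j g) ∈ d.cls r s m)
    (I : List (Fin n)) (hI : I.length = m + 1) :
    d.Dl I (d.lap g) - d.lap (d.Dl I g) ∈ d.semitame r s := by
  have : d.Dl I (d.lap g) - d.lap (d.Dl I g) = ∑ i, ∑ j,
      (d.Dl I (d.a i j * d.D i (d.D j g)) - d.a i j * d.Dl I (d.D i (d.D j g))) := by
    simp only [lap_eq, map_sum, Finset.sum_sub_distrib, D_Dl]
  rw [this]
  exact sum_mem fun i _ => sum_mem fun j _ =>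
    Dl_commutator ht hmt (fun k => ha k i j) (hg i j) I hI

end Data

end

section

open scoped NNReal

variable {ι : Type} {n : ℕ}

lemma bernstein_scalar {c C : ℝ} (hc : 0 < c) (hC : 0 ≤ C) : ∃ b B : ℝ, 0 < b ∧ 0 ≤ B ∧
    ∀ r s lW l0 g : ℝ, 0 ≤ r → 0 ≤ s → c * s ^ 2 - C * (r * (1 + r ^ 2 + s)) ≤ lW →
      c * r ^ 2 - C * (1 + r) ≤ l0 → g ≤ C * r ^ 2 →
      lW + r ^ 2 * (b * l0) - r ^ 2 * (b ^ 2 * g) ≤ 0 → r ^ 2 ≤ B := by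
  set b := c / (2 * (C + 1)) with hb
  have hb0 : 0 < b := by positivity
  have hbC : b * C ≤ c / 2 := by
    rw [hb, div_mul_eq_mul_div, div_le_div_iff₀ (by positivity) (by positivity)]
    nlinarith
  set K := 2 * C + C ^ 2 / (4 * c) + 2 * (b * C) with hK
  have hK0 : 0 ≤ K := by positivity
  refine ⟨b, (1 + K / (b * c / 2)) ^ 2, hb0, by positivity, ?_⟩
  intro r s lW l0 g hr hs h1 h2 h3 h4
  refine pow_le_pow_left₀ hr ?_ 2
  by_contra hlt
  push Not at hlt
  have hq : 0 ≤ K / (b * c / 2) := by positivity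
  have hr1 : 1 ≤ r := by linarith
  have hrK : K < r * (b * c / 2) := by
    rw [← div_lt_iff₀ (by positivity)]; linarith
  have e1 : C * (r * s) ≤ c * s ^ 2 + C ^ 2 / (4 * c) * r ^ 2 := by
    have : 0 ≤ (2 * c * s - C * r) ^ 2 / (4 * c) := by positivity
    have e : (2 * c * s - C * r) ^ 2 / (4 * c) = c * s ^ 2 + C ^ 2 / (4 * c) * r ^ 2 - C * (r * s) := by
      field_simp; ring
    linarith
  have r3 : r ≤ r ^ 3 := le_self_pow₀ hr1 (by norm_num)
  have r2 : r ^ 2 ≤ r ^ 3 := pow_le_pow_right₀ hr1 (by norm_num)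
  have e2 := mul_le_mul_of_nonneg_left h2 (show 0 ≤ r ^ 2 * b by positivity)
  have e3 := mul_le_mul_of_nonneg_left h3 (show 0 ≤ r ^ 2 * b ^ 2 by positivity)
  have e4 := mul_le_mul_of_nonneg_left hbC (show 0 ≤ r ^ 4 * b by positivity)
  have e5 := mul_le_mul_of_nonneg_left r3 hC
  have e6 := mul_le_mul_of_nonneg_left r2 (show 0 ≤ C ^ 2 / (4 * c) by positivity)
  have e7 := mul_le_mul_of_nonneg_left r2 (show 0 ≤ b * C by positivity)
  have e8 := mul_lt_mul_of_pos_left hrK (show 0 < r ^ 3 by positivity)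
  rw [hK] at e8
  linarith

namespace Data
variable {d : Data ι n} {C₀ CA A₀ Cφ : ℝ} {r s : ι × (Fin n → ℝ) → ℝ≥0}

lemma MaxAt.weighted {p : ι × (Fin n → ℝ)} {η X : SF ι n} {P P' : Matrix (Fin n) (Fin n) ℝ}
    {hP : P * P' = 1} (h : d.MaxAt p (η.exp * X) P P' hP) :
    ev p (d.lap X) + ev p X * ev p (d.lap η) - ev p X * ev p (d.gam η η) ≤ 0 := by
  have h1 := (h.normal.weighted h.grad h.hess).2
  have h2 := h.normal.gam η η
  rw [frame_gam] at h2
  rw [frame_lap, frame_lap] at h1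
  rw [h2]
  simpa only [sq] using h1

lemma lap_D (i : Fin n) (f : SF ι n) : d.lap (d.D i f)
    = d.D i (d.lap f) - ∑ j, ∑ k, d.D i (d.a j k) * d.D j (d.D k f) := by
  simp only [lap_eq, map_sum, Derivation.leibniz, smul_eq_mul, Finset.sum_add_distrib]
  rw [eq_sub_iff_add_eq]
  congr 1
  · refine Finset.sum_congr rfl fun j _ => Finset.sum_congr rfl fun k _ => ?_
    rw [d.comm i j, d.comm i k]
  · exact Finset.sum_congr rfl fun j _ => Finset.sum_congr rfl fun k _ => mul_comm _ _

lemma lap_sum {α : Type} (t : Finset α) (f : α → SF ι n) :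
    d.lap (∑ i ∈ t, f i) = ∑ i ∈ t, d.lap (f i) := by
  induction t using Finset.cons_induction with
  | empty => simp [lap_eq]
  | cons a t h ih => rw [Finset.sum_cons, Finset.sum_cons, lap_add, ih]

lemma exists_uniform_le {α : Type} [Finite α] (f : α → ℝ) : ∃ C, 0 ≤ C ∧ ∀ a, f a ≤ C := by
  obtain ⟨C, hC⟩ := (Set.finite_range f).bddAbove
  exact ⟨max C 0, le_max_right _ _, fun a => (hC ⟨a, rfl⟩).trans (le_max_left _ _)⟩

lemma abs_le_of_sq_eq_sum {α : Type} [Fintype α] {r : ℝ} (hr : 0 ≤ r) {f : α → ℝ}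
    (h : r ^ 2 = ∑ i, f i ^ 2) (i : α) : |f i| ≤ r := by
  refine abs_le_of_sq_le_sq ?_ hr
  rw [h]
  exact Finset.single_le_sum (f := fun i => f i ^ 2) (fun _ _ => sq_nonneg _) (Finset.mem_univ i)

/-- Interior gradient estimate for solutions of a system with quadratic gradient growth. -/
lemma Adm.bernstein (hd : d.Adm C₀ CA A₀ Cφ) {α : Type} [Fintype α] {v : α → SF ι n}
    (hper : ∀ a, v a ∈ perAlg ι n) (hv : ∀ a, v a ∈ bddAlg ι n)
    (ha : ∀ i j k, d.D i (d.a j k) ∈ bddAlg ι n)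
    (hr : ∀ p, (r p : ℝ) ^ 2 = ∑ q : α × Fin n, ev p (d.D q.2 (v q.1)) ^ 2)
    (hs : ∀ p, (s p : ℝ) ^ 2 =
      ∑ q : (α × Fin n) × Fin n, ev p (d.D q.2 (d.D q.1.2 (v q.1.1))) ^ 2)
    (hF : ∀ a, d.lap (v a) ∈ d.semitame r s) : ∃ C : ℝ, ∀ p, r p ≤ C := by
  choose Cv hCv using hv
  choose Ca hCa using ha
  choose CF hCF using hF
  choose Cg hCg using hd.a_bdd
  obtain ⟨Λ, hΛ, hell⟩ := hd.elliptic
  obtain ⟨V, hV0, hV⟩ := exists_uniform_le Cv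
  obtain ⟨K, hK0, hK⟩ := exists_uniform_le fun q : Fin n × Fin n × Fin n => Ca q.1 q.2.1 q.2.2
  obtain ⟨F, hF0, hF⟩ := exists_uniform_le fun q => (CF q : ℝ)
  obtain ⟨g, hg0, hg⟩ := exists_uniform_le fun q : Fin n × Fin n => Cg q.1 q.2
  set N : ℝ := ((Fintype.card α : ℕ) : ℝ) with hN
  set C : ℝ := N * n * (2 * (F + n * (n * K))) + N * (2 * V * F)
    + n * (n * (g * (N * (2 * V)) ^ 2)) with hC
  have hN0 : 0 ≤ N := Nat.cast_nonneg _
  have hC0 : 0 ≤ C := by positivity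
  obtain ⟨b, B, hb, hB, hsc⟩ := bernstein_scalar (c := 2 / Λ) (by positivity) hC0
  have hvb : ∀ p a, |ev p (v a)| ≤ V := fun p a => (hCv a p).trans (hV a)
  have hDv : ∀ p a i, |ev p (d.D i (v a))| ≤ r p := fun p a i =>
    abs_le_of_sq_eq_sum (r p).2 (hr p) (a, i)
  have hDDv : ∀ p a i j, |ev p (d.D j (d.D i (v a)))| ≤ s p := fun p a i j =>
    abs_le_of_sq_eq_sum (s p).2 (hs p) ((a, i), j)
  have hLv : ∀ p a, |ev p (d.lap (v a))| ≤ F * (1 + r p) := fun p a =>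
    ((hCF a p).1).trans (mul_le_mul_of_nonneg_right (hF a) (by positivity))
  have hLDv : ∀ p a i, |ev p (d.lap (d.D i (v a)))|
      ≤ (F + n * (n * K)) * (1 + r p ^ 2 + s p) := fun p a i => by
    rw [lap_D, map_sub]
    have h1 : |ev p (d.D i (d.lap (v a)))| ≤ F * (1 + r p ^ 2 + s p) :=
      ((hCF a p).2 i).trans (mul_le_mul_of_nonneg_right (hF a) (by positivity))
    have h2 : |ev p (∑ j, ∑ k, d.D i (d.a j k) * d.D j (d.D k (v a)))| ≤ n * (n * (K * s p)) := by
      simp only [map_sum, map_mul]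
      exact abs_sum_le' fun j => abs_sum_le' fun k =>
        abs_mul_le' ((hCa i j k p).trans (hK (i, j, k))) (hDDv _ _ _ _)
    refine (abs_sub_le' h1 h2).trans ?_
    have : 0 ≤ (n : ℝ) * (n * (K * (1 + r p ^ 2))) := by positivity
    linarith
  have hell' : ∀ p f, 2 / Λ * ∑ i, ev p (d.D i f) ^ 2 ≤ 2 * ev p (d.gam f f) := fun p f => by
    rw [div_mul_eq_mul_div, div_le_iff₀ hΛ]
    linarith [hell p f]
  set W₀ := ∑ a, v a * v a with hW₀
  set W := ∑ q : α × Fin n, d.D q.2 (v q.1) * d.D q.2 (v q.1) with hW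
  have hevW : ∀ p, ev p W = (r p : ℝ) ^ 2 := fun p => by
    rw [hr, hW, map_sum]; simp only [map_mul, sq]
  have hevW₀ : ∀ p, |ev p W₀| ≤ N * (V * V) := fun p => by
    rw [hW₀, map_sum, hN, ← nsmul_eq_mul]
    refine (Finset.abs_sum_le_sum_abs _ _).trans (Finset.sum_le_card_nsmul _ _ _ fun a _ => ?_)
    rw [map_mul]; exact abs_mul_le' (hvb p a) (hvb p a)
  have hW₀per : W₀ ∈ perAlg ι n := sum_mem fun a _ => mul_mem (hper a) (hper a)
  have hWper : W ∈ perAlg ι n :=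
    sum_mem fun q _ =>
      mul_mem (perAlg_dv (hper q.1) (d.vec q.2)) (perAlg_dv (hper q.1) (d.vec q.2))
  have key := hd.bound_of_max (η := b • W₀) (X := W) (Subalgebra.smul_mem _ hW₀per _) hWper
    (Cη := b * (N * (V * V))) (B := B) hB
    (fun q => by
      rw [map_smul, smul_eq_mul, abs_mul, abs_of_pos hb]
      exact mul_le_mul_of_nonneg_left (hevW₀ q) hb.le)
    (fun p P P' hP hmax => by
      rw [hevW]
      have hm := hmax.weighted
      rw [lap_smul, gam_smul, gam_comm, gam_smul, hevW] at hm
      simp only [map_smul, smul_eq_mul] at hm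
      have hrs : 0 ≤ (r p : ℝ) ^ 2 := by positivity
      refine hsc (r p) (s p) (ev p (d.lap W)) (ev p (d.lap W₀)) (ev p (d.gam W₀ W₀)) (r p).2 (s p).2
        ?_ ?_ ?_ (by linarith only [hm])
      · have h1 : ∀ q : α × Fin n, 2 / Λ * ∑ j, ev p (d.D j (d.D q.2 (v q.1))) ^ 2
            - 2 * (r p * ((F + n * (n * K)) * (1 + r p ^ 2 + s p)))
            ≤ ev p (d.lap (d.D q.2 (v q.1) * d.D q.2 (v q.1))) := fun q => by
          rw [lap_mul]
          simp only [map_add, map_mul, map_ofNat]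
          have := (abs_le.1 (abs_mul_le' (hDv p q.1 q.2) (hLDv p q.1 q.2))).1
          linarith only [this, hell' p (d.D q.2 (v q.1))]
        have h2 := Finset.sum_le_sum fun q (_ : q ∈ Finset.univ) => h1 q
        rw [Finset.sum_sub_distrib, ← Finset.mul_sum, ← Fintype.sum_prod_type'
          (f := fun (q : α × Fin n) j => ev p (d.D j (d.D q.2 (v q.1))) ^ 2), ← hs p,
          ← map_sum, ← lap_sum, Finset.sum_const, Finset.card_univ, Fintype.card_prod,
          Fintype.card_fin, nsmul_eq_mul, Nat.cast_mul, ← hN] at h2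
        have h3 : 0 ≤ (N * (2 * V * F) + n * (n * (g * (N * (2 * V)) ^ 2)))
            * ((r p : ℝ) * (1 + r p ^ 2 + s p)) := by positivity
        rw [hC]
        linarith only [h2, h3]
      · have h1 : ∀ a, 2 / Λ * ∑ j, ev p (d.D j (v a)) ^ 2 - 2 * (V * (F * (1 + r p)))
            ≤ ev p (d.lap (v a * v a)) := fun a => by
          rw [lap_mul]
          simp only [map_add, map_mul, map_ofNat]
          have := (abs_le.1 (abs_mul_le' (hvb p a) (hLv p a))).1
          linarith only [this, hell' p (v a)]
        have h2 := Finset.sum_le_sum fun q (_ : q ∈ Finset.univ) => h1 q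
        rw [Finset.sum_sub_distrib, ← Finset.mul_sum, ← Fintype.sum_prod_type'
          (f := fun a j => ev p (d.D j (v a)) ^ 2), ← hr p,
          ← map_sum, ← lap_sum, Finset.sum_const, Finset.card_univ, nsmul_eq_mul, ← hN] at h2
        have h3 : 0 ≤ (N * n * (2 * (F + n * (n * K))) + n * (n * (g * (N * (2 * V)) ^ 2)))
            * (1 + (r p : ℝ)) := by positivity
        rw [hC]
        linarith only [h2, h3]
      · have h1 : ∀ i, |ev p (d.D i W₀)| ≤ N * (2 * V) * r p := fun i => by
          rw [hW₀, map_sum, map_sum, mul_assoc, hN, ← nsmul_eq_mul]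
          refine (Finset.abs_sum_le_sum_abs _ _).trans
            (Finset.sum_le_card_nsmul _ _ _ fun a _ => ?_)
          rw [Derivation.leibniz, smul_eq_mul, map_add, map_mul]
          have := abs_mul_le' (hvb p a) (hDv p a i)
          exact (abs_add_le' this this).trans (by linarith only)
        have h2 : ev p (d.gam W₀ W₀) ≤ n * (n * (g * ((N * (2 * V) * r p) * (N * (2 * V) * r p)))) := by
          simp only [gam, map_sum, map_mul]
          exact (le_abs_self _).trans <| abs_sum_le' fun i => abs_sum_le' fun j =>
            abs_mul_le' ((hCg i j p).trans (hg (i, j))) (abs_mul_le' (h1 i) (h1 j))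
        have h3 : 0 ≤ (N * n * (2 * (F + n * (n * K))) + N * (2 * V * F)) * (r p : ℝ) ^ 2 := by
          positivity
        rw [hC]
        linarith only [h2, h3])
  refine ⟨1 + Real.exp (2 * (b * (N * (V * V)))) * B, fun p => ?_⟩
  have := key p
  rw [hevW] at this
  nlinarith only [this, sq_nonneg ((r p : ℝ) - 1), (r p).2]

end Data

end

section

open scoped NNReal

variable {ι : Type} {n : ℕ}

namespace Data
variable {d : Data ι n} {C₀ CA A₀ Cφ : ℝ} {r s : ι × (Fin n → ℝ) → ℝ≥0}

lemma tame_of_bdd {f : SF ι n} (hf : f ∈ bddAlg ι n) (hf' : ∀ i, d.D i f ∈ bddAlg ι n) :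
    f ∈ d.tame r := by
  obtain ⟨C, hC⟩ := hf
  choose C' hC' using hf'
  obtain ⟨K, hK0, hK⟩ := exists_uniform_le C'
  refine ⟨⟨|C| + K, by positivity⟩, fun p => ⟨?_, fun i => ?_⟩⟩
  · exact (hC p).trans ((le_abs_self C).trans (le_add_of_nonneg_right hK0))
  · refine ((hC' i p).trans (hK i)).trans ?_
    show K ≤ (|C| + K) * (1 + r p)
    have : 0 ≤ |C| * (1 + (r p : ℝ)) + K * r p := by positivity
    linarith

lemma tame_of_le {f : SF ι n} (hf : f ∈ bddAlg ι n) (hf' : ∀ p i, |ev p (d.D i f)| ≤ r p) :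
    f ∈ d.tame r := by
  obtain ⟨C, hC⟩ := hf
  refine ⟨⟨|C| + 1, by positivity⟩, fun p => ⟨?_, fun i => (hf' p i).trans ?_⟩⟩
  · show _ ≤ |C| + 1
    linarith [hC p, le_abs_self C]
  · show (r p : ℝ) ≤ (|C| + 1) * (1 + r p)
    have : 0 ≤ |C| * (1 + (r p : ℝ)) := by positivity
    linarith

lemma semitame_of_le {f : SF ι n} (hf : ∀ p, |ev p f| ≤ r p)
    (hf' : ∀ p i, |ev p (d.D i f)| ≤ s p) : f ∈ d.semitame r s := by
  refine ⟨1, fun p => ⟨(hf p).trans ?_, fun i => (hf' p i).trans ?_⟩⟩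
  · push_cast; linarith
  · have : 0 ≤ (r p : ℝ) ^ 2 := by positivity
    push_cast; linarith

lemma mem_cls_of_bdd {m : ℕ} {f : SF ι n}
    (h : ∀ I : List (Fin n), I.length ≤ m → d.Dl I f ∈ bddAlg ι n)
    (h1 : ∀ I : List (Fin n), I.length = m → ∀ p i, |ev p (d.D i (d.Dl I f))| ≤ r p)
    (h2 : ∀ I : List (Fin n), I.length = m → ∀ p i j, |ev p (d.D j (d.D i (d.Dl I f)))| ≤ s p) :
    f ∈ d.cls r s (m + 1) := by
  refine mem_cls_of (fun I hI => ?_) (fun I hI => ?_)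
  · rcases Nat.lt_or_ge I.length m with hm | hm
    · refine tame_of_bdd (h I hm.le) fun i => ?_
      rw [D_Dl, ← Dl_cons]
      exact h _ (by simpa using hm)
    · exact tame_of_le (h I (by omega)) (h1 I (by omega))
  · obtain ⟨i, I, rfl⟩ := List.exists_cons_of_length_eq_add_one hI
    have hI' : I.length = m := by simpa using hI
    rw [Dl_cons, ← D_Dl]
    exact semitame_of_le (fun p => h1 I hI' p i) (fun p j => h2 I hI' p i j)

lemma mem_cls_of_forall_bdd (m : ℕ) {f : SF ι n} (h : ∀ I, d.Dl I f ∈ bddAlg ι n) :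
    f ∈ d.cls r s m := by
  have (I : List (Fin n)) : d.Dl I f ∈ d.tame r := tame_of_bdd (h I) fun i => by
    rw [D_Dl, ← Dl_cons]; exact h _
  exact mem_cls_of (fun I _ => this I) fun I _ => tame_le_semitame (this I)

lemma Adm.D_a_bdd (hd : d.Adm C₀ CA A₀ Cφ)
    (h3 : ∀ i j k, d.D i (d.D j (d.D k d.φ)) ∈ bddAlg ι n) (i j k : Fin n) :
    d.D i (d.a j k) ∈ bddAlg ι n := by
  rw [D_a]
  exact neg_mem (sum_mem fun p _ => sum_mem fun q _ =>
    mul_mem (mul_mem (hd.a_bdd j p) (h3 i p q)) (hd.a_bdd q k))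

lemma Adm.a_cls (hd : d.Adm C₀ CA A₀ Cφ)
    (h3 : ∀ i j k, d.D i (d.D j (d.D k d.φ)) ∈ bddAlg ι n) {t : ℕ}
    (h : d.φ ∈ d.cls r s (t + 3)) {m : ℕ} (hm : m ≤ t + 1) (i j : Fin n) :
    d.a i j ∈ d.cls r s m := by
  have hat : ∀ i j, d.a i j ∈ d.tame r := fun i j =>
    tame_of_bdd (hd.a_bdd _ _) fun k => hd.D_a_bdd h3 _ _ _
  induction m generalizing i j with
  | zero => exact tame_le_semitame (hat i j)
  | succ m ih =>
    refine mem_cls_succ.2 ⟨hat i j, fun k => ?_⟩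
    rw [D_a]
    refine neg_mem (sum_mem fun p _ => sum_mem fun q _ => ?_)
    rw [mul_comm]
    exact tame_mul_cls (hat _ _) (ih (by omega) _ _) (tame_mul_cls (hat _ _) (ih (by omega) _ _)
      (cls_le (show m ≤ t by omega)
        ((mem_cls_succ.1 ((mem_cls_succ.1 ((mem_cls_succ.1 h).2 q)).2 p)).2 k)))

lemma Dl_perAlg {f : SF ι n} (hf : f ∈ perAlg ι n) (I : List (Fin n)) :
    d.Dl I f ∈ perAlg ι n := by
  induction I generalizing f with
  | nil => exact hf
  | cons i I ih => exact ih (perAlg_dv hf _)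

lemma exists_ofFn_eq {α : Type} {m : ℕ} {I : List α} (h : I.length = m) :
    ∃ J : Fin m → α, List.ofFn J = I := by
  subst h; exact ⟨I.get, List.ofFn_get I⟩

lemma Adm.step (hd : d.Adm C₀ CA A₀ Cφ) (hA : ∀ I, d.Dl I d.A ∈ bddAlg ι n) {t : ℕ} (ht : 1 ≤ t)
    (hφ : ∀ I : List (Fin n), I.length ≤ t + 2 → d.Dl I d.φ ∈ bddAlg ι n)
    (hL : ∀ I : List (Fin n), I.length ≤ t + 1 → d.Dl I d.L ∈ bddAlg ι n) :
    (∀ I : List (Fin n), I.length ≤ t + 3 → d.Dl I d.φ ∈ bddAlg ι n) ∧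
    ∀ I : List (Fin n), I.length ≤ t + 2 → d.Dl I d.L ∈ bddAlg ι n := by
  set v : (Fin (t + 2) → Fin n) ⊕ (Fin (t + 1) → Fin n) → SF ι n :=
    Sum.elim (fun J => d.Dl (List.ofFn J) d.φ) (fun J => d.Dl (List.ofFn J) d.L) with hv
  set r : ι × (Fin n → ℝ) → ℝ≥0 := fun p =>
    ⟨√(∑ q : (_ ⊕ _) × Fin n, ev p (d.D q.2 (v q.1)) ^ 2), Real.sqrt_nonneg _⟩ with hr
  set s : ι × (Fin n → ℝ) → ℝ≥0 := fun p =>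
    ⟨√(∑ q : ((_ ⊕ _) × Fin n) × Fin n, ev p (d.D q.2 (d.D q.1.2 (v q.1.1))) ^ 2),
      Real.sqrt_nonneg _⟩ with hs
  have hr2 : ∀ p, (r p : ℝ) ^ 2 = ∑ q : (_ ⊕ _) × Fin n, ev p (d.D q.2 (v q.1)) ^ 2 := fun p =>
    Real.sq_sqrt (Finset.sum_nonneg fun _ _ => sq_nonneg _)
  have hs2 : ∀ p, (s p : ℝ) ^ 2 =
      ∑ q : ((_ ⊕ _) × Fin n) × Fin n, ev p (d.D q.2 (d.D q.1.2 (v q.1.1))) ^ 2 := fun p =>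
    Real.sq_sqrt (Finset.sum_nonneg fun _ _ => sq_nonneg _)
  clear_value r s
  have hDv : ∀ p a i, |ev p (d.D i (v a))| ≤ r p := fun p a i =>
    abs_le_of_sq_eq_sum (r p).2 (hr2 p) (a, i)
  have hDDv : ∀ p a i j, |ev p (d.D j (d.D i (v a)))| ≤ s p := fun p a i j =>
    abs_le_of_sq_eq_sum (s p).2 (hs2 p) ((a, i), j)
  have hvφ : ∀ I : List (Fin n), I.length = t + 2 → ∃ a, v a = d.Dl I d.φ := by
    rintro I hI
    obtain ⟨J, rfl⟩ := exists_ofFn_eq hI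
    exact ⟨Sum.inl J, rfl⟩
  have hvL : ∀ I : List (Fin n), I.length = t + 1 → ∃ a, v a = d.Dl I d.L := by
    rintro I hI
    obtain ⟨J, rfl⟩ := exists_ofFn_eq hI
    exact ⟨Sum.inr J, rfl⟩
  have cφ : d.φ ∈ d.cls r s (t + 3) := by
    refine mem_cls_of_bdd hφ (fun I hI => ?_) (fun I hI => ?_) <;>
      obtain ⟨a, ha⟩ := hvφ I hI <;> rw [← ha]
    · exact fun p i => hDv p a i
    · exact fun p i j => hDDv p a i j
  have cL : d.L ∈ d.cls r s (t + 2) := by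
    refine mem_cls_of_bdd hL (fun I hI => ?_) (fun I hI => ?_) <;>
      obtain ⟨a, ha⟩ := hvL I hI <;> rw [← ha]
    · exact fun p i => hDv p a i
    · exact fun p i j => hDDv p a i j
  have cA : d.A ∈ d.cls r s (t + 1) := mem_cls_of_forall_bdd _ hA
  have h3 : ∀ i j k, d.D i (d.D j (d.D k d.φ)) ∈ bddAlg ι n := fun i j k =>
    hφ [k, j, i] (by simp only [List.length_cons, List.length_nil]; omega)
  have ca := fun i j => hd.a_cls h3 cφ le_rfl i j
  have cDa : ∀ i j k, d.D i (d.a j k) ∈ d.cls r s t := fun i j k =>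
    (mem_cls_succ.1 (ca j k)).2 i
  have cGam : d.gam d.L d.L - d.A ∈ d.cls r s (t + 1) :=
    sub_mem (sum_mem fun i _ => sum_mem fun j _ => cls_mul (by omega) (ca i j)
      (cls_mul (by omega) ((mem_cls_succ.1 cL).2 i) ((mem_cls_succ.1 cL).2 j))) cA
  obtain ⟨C, hC⟩ := hd.bernstein (v := v) (r := r) (s := s)
    (by rintro (J | J)
        · exact Dl_perAlg hd.perφ _
        · exact Dl_perAlg hd.perL _)
    (by rintro (J | J)
        · exact hφ _ (by simp)
        · exact hL _ (by simp))
    (fun i j k => hd.D_a_bdd h3 i j k) hr2 hs2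
    (by rintro (J | J)
        · have hJ : (List.ofFn J).length = t + 1 + 1 := by simp
          simp only [hv, Sum.elim_inl]
          obtain ⟨e, I, hI⟩ := List.exists_cons_of_length_eq_add_one hJ
          rw [hI, Dl_cons]
          rw [hI] at hJ
          have hI' : I.length = t + 1 := by simpa using hJ
          have h1 := lap_Dl (r := r) (s := s) ht le_rfl (g := d.D e d.φ) cDa (fun i j =>
            (mem_cls_succ.1 ((mem_cls_succ.1 ((mem_cls_succ.1 cφ).2 _)).2 _)).2 _) I hI'
          have h2 : d.Dl I (d.lap (d.D e d.φ)) ∈ d.semitame r s := by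
            rw [lap_D_phi]
            exact cls_Dl (m := 0) I (by
              rw [hI', zero_add]; exact (mem_cls_succ.1 cL).2 e)
          simpa using sub_mem h2 h1
        · have hJ : (List.ofFn J).length = t + 1 := by simp
          simp only [hv, Sum.elim_inr]
          have h1 := lap_Dl (r := r) (s := s) ht le_rfl (g := d.L) cDa (fun i j =>
            (mem_cls_succ.1 ((mem_cls_succ.1 cL).2 _)).2 _) _ hJ
          have h2 : d.Dl (List.ofFn J) (d.lap d.L) ∈ d.semitame r s := by
            rw [lap_L]
            exact cls_Dl (m := 0) _ (by rw [hJ, zero_add]; exact cGam)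
          simpa using sub_mem h2 h1)
  constructor
  · intro I hI
    rcases Nat.lt_or_ge I.length (t + 3) with h | h
    · exact hφ I (by omega)
    · obtain ⟨i, I, rfl⟩ := List.exists_cons_of_length_eq_add_one (le_antisymm hI h)
      obtain ⟨a, ha⟩ := hvφ I (by simp at hI h; omega)
      rw [Dl_cons, ← D_Dl, ← ha]
      exact ⟨C, fun p => (hDv p a i).trans (hC p)⟩
  · intro I hI
    rcases Nat.lt_or_ge I.length (t + 2) with h | h
    · exact hL I (by omega)
    · obtain ⟨i, I, rfl⟩ := List.exists_cons_of_length_eq_add_one (le_antisymm hI h)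
      obtain ⟨a, ha⟩ := hvL I (by simp at hI h; omega)
      rw [Dl_cons, ← D_Dl, ← ha]
      exact ⟨C, fun p => (hDv p a i).trans (hC p)⟩

/-- Uniform bounds on all derivatives of the potentials. -/
theorem Adm.Dl_bdd (hd : d.Adm C₀ CA A₀ Cφ) (hA : ∀ I, d.Dl I d.A ∈ bddAlg ι n)
    (I : List (Fin n)) : d.Dl I d.φ ∈ bddAlg ι n := by
  have h3 := hd.third_bdd (fun i => hA [i]) (fun i j => hA [j, i])
  have H : ∀ t : ℕ, 1 ≤ t →
      (∀ I : List (Fin n), I.length ≤ t + 2 → d.Dl I d.φ ∈ bddAlg ι n) ∧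
      ∀ I : List (Fin n), I.length ≤ t + 1 → d.Dl I d.L ∈ bddAlg ι n := by
    intro t ht
    induction t, ht using Nat.le_induction with
    | base =>
      constructor
      · rintro (_ | ⟨i, _ | ⟨j, _ | ⟨k, _ | ⟨l, I⟩⟩⟩⟩) h
        · exact ⟨Cφ, hd.hφ⟩
        · exact hd.Dφ_bdd i
        · exact hd.DDφ_bdd j i
        · exact h3.2 k j i
        · simp only [List.length_cons] at h; omega
      · rintro (_ | ⟨i, _ | ⟨j, _ | ⟨k, I⟩⟩⟩) h
        · exact hd.L_bdd
        · exact hd.DL_bdd i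
        · exact h3.1 j i
        · simp only [List.length_cons] at h; omega
    | succ t ht ih => exact hd.step hA ht ih.1 ih.2
  exact (H (I.length + 1) (by omega)).1 I (by omega)

end Data

end

section

open scoped NNReal

variable {ι : Type} {n : ℕ}

/-- Abreu's operator as a function of the Hessian. -/
def abr (H : (Fin n → ℝ) → Matrix (Fin n) (Fin n) ℝ) (x : Fin n → ℝ) : ℝ :=
  ∑ i, ∑ j, pd i (pd j (fun z => (H z)⁻¹ i j)) x

/-- Pointwise logarithm. -/
def SF.log (f : SF ι n) (hf : ∀ p, 0 < ev p f) : SF ι n :=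
  ⟨fun i x => Real.log (f.fn i x), fun i => (f.smooth i).log fun x => (hf (i, x)).ne'⟩

lemma ev_log (f : SF ι n) (hf : ∀ p, 0 < ev p f) (p : ι × (Fin n → ℝ)) :
    ev p (f.log hf) = Real.log (ev p f) := rfl

/-- The Hessians of `q + φ` for the quadratic form `q` with matrix `Q`. -/
def famG (Q : Matrix (Fin n) (Fin n) ℝ) (φ : SF ι n) : Matrix (Fin n) (Fin n) (SF ι n) :=
  cm Q + Matrix.of fun i j => dd i (dd j φ)

lemma map_famG (Q : Matrix (Fin n) (Fin n) ℝ) (φ : SF ι n) (p : ι × (Fin n → ℝ)) :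
    (famG Q φ).map (ev p) = Q + hess (φ.fn p.1) p.2 := by
  ext i j
  simp only [famG, cm, Matrix.map_apply, Matrix.add_apply, map_add, AlgHom.commutes]
  rfl

lemma ev_det {p : ι × (Fin n → ℝ)} (M : Matrix (Fin n) (Fin n) (SF ι n)) :
    ev p M.det = (M.map (ev p)).det := by
  exact (ev p).map_det M

variable {Q : Matrix (Fin n) (Fin n) ℝ} {φ A : SF ι n}

lemma famG_det_pos (h : ∀ p, ((famG Q φ).map (ev p)).PosDef) (p : ι × (Fin n → ℝ)) :
    0 < ev p (famG Q φ).det := by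
  rw [ev_det]; exact (h p).det_pos

/-- Logarithm of the Hessian determinant. -/
def famL (h : ∀ p, ((famG Q φ).map (ev p)).PosDef) : SF ι n := (famG Q φ).det.log (famG_det_pos h)

/-- Inverse Hessians. -/
def fama (h : ∀ p, ((famG Q φ).map (ev p)).PosDef) : Matrix (Fin n) (Fin n) (SF ι n) :=
  (-famL h).exp • (famG Q φ).adjugate

variable (h : ∀ p, ((famG Q φ).map (ev p)).PosDef)

lemma famL_exp : (famL h).exp = (famG Q φ).det :=
  SF.ext_ev fun p => by rw [ev_exp, famL, ev_log, Real.exp_log (famG_det_pos h p)]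

lemma famL_exp_neg : (-famL h).exp * (famG Q φ).det = 1 := by
  rw [← famL_exp h]
  exact SF.ext_ev fun p => by
    rw [map_mul, ev_exp, ev_exp, map_neg, ← Real.exp_add, neg_add_cancel, Real.exp_zero, map_one]

lemma fama_mul : fama h * famG Q φ = 1 := by
  rw [fama, Matrix.smul_mul, adjugate_mul, smul_smul, famL_exp_neg, one_smul]

lemma map_fama (p : ι × (Fin n → ℝ)) :
    (fama h).map (ev p) = (Q + hess (φ.fn p.1) p.2)⁻¹ := by
  refine (Matrix.inv_eq_left_inv ?_).symm
  rw [← map_famG, ← Matrix.map_mul, fama_mul]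
  exact Matrix.map_one _ (map_zero _) (map_one _)

lemma ev_abr (p : ι × (Fin n → ℝ)) :
    ev p (∑ i, ∑ j, dd i (dd j (fama h i j))) = abr (fun z => Q + hess (φ.fn p.1) z) p.2 := by
  simp only [map_sum]
  refine Finset.sum_congr rfl fun i _ => Finset.sum_congr rfl fun j _ => ?_
  show pd i (pd j ((fama h i j).fn p.1)) p.2 = _
  congr 2
  funext z
  exact congrFun (congrFun (map_fama h (p.1, z)) i) j

lemma fama_E1 (k : Fin n) : dd k (famL h)
    = ∑ i, ∑ j, fama h i j * dd k (dd i (dd j φ)) := by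
  have h1 : dd k (famG Q φ).det = (famG Q φ).det * dd k (famL h) := by
    conv_lhs => rw [← famL_exp h]
    rw [← famL_exp h]; exact dv_exp _ _
  rw [deriv_det] at h1
  have h2 : dd k (famL h) = (-famL h).exp * ((famG Q φ).det * dd k (famL h)) := by
    rw [← mul_assoc, famL_exp_neg, one_mul]
  rw [h2, ← h1, ← smul_eq_mul, ← Matrix.trace_smul, ← Matrix.smul_mul]
  show trace (fama h * _) = _
  simp only [Matrix.trace, Matrix.diag_apply, Matrix.mul_apply]
  refine Finset.sum_congr rfl fun i _ => Finset.sum_congr rfl fun j _ => ?_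
  rw [dd_comm i j]
  congr 1
  simp [famG, cm]

lemma fama_deriv (k i j : Fin n) : dd k (fama h i j)
    = -∑ p, ∑ q, fama h i p * dd k (dd p (dd q φ)) * fama h q j := by
  have := congrFun (congrFun (map_deriv_inv (dd k) (fama_mul h)) i) j
  rw [Matrix.map_apply] at this
  rw [this, Matrix.neg_apply, Matrix.mul_apply]
  simp only [Matrix.mul_apply, Finset.sum_mul]
  rw [Finset.sum_comm]
  simp [famG, cm]

lemma fama_symm (hQ : Qᵀ = Q) (i j : Fin n) : fama h i j = fama h j i := by
  have hG : (famG Q φ)ᵀ = famG Q φ := by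
    rw [famG, Matrix.transpose_add, ← cm_transpose, hQ]
    congr 1
    ext1 i j
    exact dd_comm _ _ _
  have : (fama h)ᵀ = fama h := by
    rw [fama, Matrix.transpose_smul, adjugate_transpose, hG]
  exact (congrFun (congrFun this j) i)

lemma fama_div (hQ : Qᵀ = Q) (i : Fin n) :
    ∑ j, dd j (fama h i j) = -∑ p, fama h i p * dd p (famL h) := by
  simp only [fama_deriv h, fama_E1 h, Finset.sum_neg_distrib, neg_inj, Finset.mul_sum]
  rw [Finset.sum_comm]
  refine Finset.sum_congr rfl fun p _ => ?_
  rw [Finset.sum_comm]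
  refine Finset.sum_congr rfl fun q _ => Finset.sum_congr rfl fun j _ => ?_
  rw [fama_symm h hQ q j, dd_comm j p, dd_comm j q, mul_assoc, fama_symm h hQ j q]
  ring

lemma fama_E2 (hQ : Qᵀ = Q) : ∑ i, ∑ j, fama h i j * dd i (dd j (famL h))
    = ∑ i, ∑ j, fama h i j * (dd i (famL h) * dd j (famL h))
      - ∑ i, ∑ j, dd i (dd j (fama h i j)) := by
  have h1 : ∑ i, ∑ j, dd i (dd j (fama h i j))
      = -∑ i, ∑ p, fama h i p * dd i (dd p (famL h))
        - ∑ p, (∑ i, dd i (fama h p i)) * dd p (famL h) := by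
    have e : ∀ i, ∑ j, dd i (dd j (fama h i j)) = -∑ p, (fama h i p * dd i (dd p (famL h))
        + dd p (famL h) * dd i (fama h i p)) := fun i => by
      rw [← map_sum, fama_div h hQ, map_neg, map_sum]
      simp only [Derivation.leibniz, smul_eq_mul]
    simp only [e, Finset.sum_neg_distrib, Finset.sum_add_distrib, neg_add]
    rw [sub_eq_add_neg]
    congr 2
    rw [Finset.sum_comm]
    refine Finset.sum_congr rfl fun p _ => ?_
    rw [Finset.sum_mul]
    exact Finset.sum_congr rfl fun i _ => by rw [fama_symm h hQ i p, mul_comm]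
  have h2 : ∑ p, (∑ i, dd i (fama h p i)) * dd p (famL h)
      = -∑ i, ∑ j, fama h i j * (dd i (famL h) * dd j (famL h)) := by
    rw [← Finset.sum_neg_distrib]
    refine Finset.sum_congr rfl fun p _ => ?_
    rw [fama_div h hQ, neg_mul, Finset.sum_mul]
    congr 1
    exact Finset.sum_congr rfl fun i _ => by ring
  rw [h1, h2]; ring

/-- The data attached to a family of solutions of Abreu's equation. -/
def mkData (hQ : Qᵀ = Q) (hQd : Q.det ≠ 0)
    (hA : ∑ i, ∑ j, dd i (dd j (fama h i j)) = A) : Data ι n where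
  vec i := Pi.single i 1
  φ := φ
  A := A
  L := famL h
  a := fama h
  Q := Q
  Θ := Q⁻¹
  Qsymm := hQ
  QΘ := Matrix.mul_nonsing_inv Q (isUnit_iff_ne_zero.2 hQd)
  inv := fama_mul h
  E1 := fama_E1 h
  E2 := by rw [← hA]; exact fama_E2 h hQ

end

section

open scoped NNReal

variable {ι : Type} {n : ℕ}

/-- Iterated partial derivatives. -/
def pdl : List (Fin n) → ((Fin n → ℝ) → ℝ) → (Fin n → ℝ) → ℝ
  | [], f => f
  | i :: I, f => pdl I (pd i f)

lemma Data.fn_Dl (d : Data ι n) (hv : d.vec = fun i => Pi.single i 1) (I : List (Fin n))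
    (f : SF ι n) (k : ι) : (d.Dl I f).fn k = pdl I (f.fn k) := by
  induction I generalizing f with
  | nil => rfl
  | cons i I ih =>
    rw [Data.Dl_cons, ih, pdl, Data.D, hv]; rfl

lemma contDiff_pd {f : (Fin n → ℝ) → ℝ} (hf : ContDiff ℝ (⊤ : ℕ∞) f) (i : Fin n) :
    ContDiff ℝ (⊤ : ℕ∞) (pd i f) := contDiff_dir hf _

lemma zper_pd {f : (Fin n → ℝ) → ℝ} (hf : ZPer f) (i : Fin n) : ZPer (pd i f) := by
  intro x k
  have : f = fun y => f (y + fun j => (k j : ℝ)) := by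
    funext y; exact (hf y k).symm
  show fderiv ℝ f (x + _) _ = fderiv ℝ f x _
  conv_rhs => rw [this]
  rw [fderiv_comp_add_right]

lemma contDiff_pdl {f : (Fin n → ℝ) → ℝ} (hf : ContDiff ℝ (⊤ : ℕ∞) f) (I : List (Fin n)) :
    ContDiff ℝ (⊤ : ℕ∞) (pdl I f) := by
  induction I generalizing f with
  | nil => exact hf
  | cons i I ih => exact ih (contDiff_pd hf i)

lemma zper_pdl {f : (Fin n → ℝ) → ℝ} (hf : ZPer f) (I : List (Fin n)) : ZPer (pdl I f) := by
  induction I generalizing f with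
  | nil => exact hf
  | cons i I ih => exact ih (zper_pd hf i)

lemma pd_const_mul {f : (Fin n → ℝ) → ℝ} (hf : ContDiff ℝ (⊤ : ℕ∞) f) (t : ℝ) (i : Fin n) :
    pd i (fun x => t * f x) = fun x => t * pd i f x := by
  funext x
  rw [pd, fderiv_const_mul (hf.differentiable (by simp) x)]
  rfl

lemma pdl_const_mul {f : (Fin n → ℝ) → ℝ} (hf : ContDiff ℝ (⊤ : ℕ∞) f) (t : ℝ)
    (I : List (Fin n)) : pdl I (fun x => t * f x) = fun x => t * pdl I f x := by
  induction I generalizing f with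
  | nil => rfl
  | cons i I ih => rw [pdl, pd_const_mul hf, ih (contDiff_pd hf i)]; rfl

lemma _root_.ZPer.bounded {f : (Fin n → ℝ) → ℝ} (hf : ZPer f) (hc : Continuous f) :
    ∃ C, 0 ≤ C ∧ ∀ x, |f x| ≤ C := by
  have hp : ZPer fun x => |f x| := fun x k => by
    show |f _| = |f _|
    rw [hf x k]
  obtain ⟨x₀, h⟩ := Abreu.ZPer.exists_max hp hc.abs
  exact ⟨_, abs_nonneg _, h⟩

lemma hasDerivAt_line {f : (Fin n → ℝ) → ℝ} (hf : Differentiable ℝ f) (x v : Fin n → ℝ) (s : ℝ) :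
    HasDerivAt (fun s : ℝ => f (x + s • v)) (fderiv ℝ f (x + s • v) v) s := by
  have h : HasDerivAt (fun s : ℝ => x + s • v) v s := by
    simpa using ((hasDerivAt_id s).smul_const v).const_add x
  exact (hf _).hasFDerivAt.comp_hasDerivAt s h

lemma fderiv_eq_sum (f : (Fin n → ℝ) → ℝ) (x v : Fin n → ℝ) :
    fderiv ℝ f x v = ∑ i, v i * pd i f x := by
  conv_lhs => rw [pi_eq_sum_univ' v]
  rw [map_sum]
  refine Finset.sum_congr rfl fun i _ => ?_
  rw [map_smul, smul_eq_mul, pd]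

lemma abs_deriv_le_of_periodic {h h' h'' : ℝ → ℝ} {q : ℝ} (hq : 0 ≤ q)
    (h1 : ∀ s, HasDerivAt h (h' s) s) (h2 : ∀ s, HasDerivAt h' (h'' s) s)
    (hp : ∀ s, h (s + 1) = h s) (hb : ∀ s, -q ≤ h'' s) (s : ℝ) : |h' s| ≤ q := by
  have hm : Monotone fun s => h' s + q * s := by
    refine monotone_of_hasDerivAt_nonneg (f' := fun s => h'' s + q * 1)
      (fun s => (h2 s).add ((hasDerivAt_id s).const_mul q)) fun s => ?_
    have := hb s
    simp only [Pi.zero_apply]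
    linarith
  have hr : ∀ s, ∃ c ∈ Set.Ioo s (s + 1), h' c = 0 := fun s =>
    exists_hasDerivAt_eq_zero (by linarith)
      (fun x _ => (h1 x).continuousAt.continuousWithinAt) (hp s).symm fun x _ => h1 x
  obtain ⟨c, hc, hc0⟩ := hr s
  obtain ⟨c', hc', hc0'⟩ := hr (s - 1)
  have e1 := hm hc.1.le
  have e2 := hm (show c' ≤ s by linarith [hc'.2])
  simp only [hc0, hc0'] at e1 e2
  have := hc.2
  have := hc'.1
  exact abs_le.2 ⟨by nlinarith, by nlinarith⟩

/-- Normalized solutions `φ` of the periodic Abreu equation for the background form `Q`. -/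
structure Sol (Q : Matrix (Fin n) (Fin n) ℝ) (B φ : (Fin n → ℝ) → ℝ) : Prop where
  smooth : ContDiff ℝ (⊤ : ℕ∞) φ
  per : ZPer φ
  zero : φ 0 = 0
  pos : ∀ x, (Q + hess φ x).PosDef
  eq : ∀ x, abr (fun z => Q + hess φ z) x = B x

variable {Q : Matrix (Fin n) (Fin n) ℝ} {B φ : (Fin n → ℝ) → ℝ}

lemma Sol.grad_le (hQ : Q.PosDef) (hs : Sol Q B φ) (i : Fin n) (x : Fin n → ℝ) :
    |pd i φ x| ≤ Q i i := by
  have h := abs_deriv_le_of_periodic (h := fun s : ℝ => φ (x + s • Pi.single i 1))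
    (h' := fun s : ℝ => pd i φ (x + s • Pi.single i 1))
    (h'' := fun s : ℝ => pd i (pd i φ) (x + s • Pi.single i 1)) (q := Q i i)
    hQ.diag_pos.le
    (fun s => hasDerivAt_line (hs.smooth.differentiable (by simp)) x _ s)
    (fun s => hasDerivAt_line ((contDiff_pd hs.smooth i).differentiable (by simp)) x _ s)
    (fun s => by
      rw [← hs.per (x + s • Pi.single i 1) (Pi.single i 1)]
      congr 1
      ext j
      by_cases hj : j = i
      · subst hj; simp [add_assoc]
      · simp [hj])
    (fun s => by
      have := (hs.pos (x + s • Pi.single i 1)).diag_pos (i := i)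
      rw [Matrix.add_apply] at this
      have e : hess φ (x + s • Pi.single i 1) i i = pd i (pd i φ) (x + s • Pi.single i 1) := rfl
      rw [← e]
      linarith) 0
  simpa using h

lemma Sol.abs_le (hQ : Q.PosDef) (hs : Sol Q B φ) (x : Fin n → ℝ) : |φ x| ≤ ∑ i, Q i i := by
  have h1 : φ x = φ (fun i => Int.fract (x i)) := by
    rw [← hs.per x (fun i => -⌊x i⌋)]
    congr 1
    ext i
    simp [Int.fract, sub_eq_add_neg]
  set y : Fin n → ℝ := fun i => Int.fract (x i) with hy
  obtain ⟨c, -, hc⟩ := exists_hasDerivAt_eq_slope (fun s : ℝ => φ (0 + s • y)) _ zero_lt_one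
    (fun s _ => (hasDerivAt_line (hs.smooth.differentiable (by simp)) 0 y s).continuousAt
      |>.continuousWithinAt)
    (fun s _ => hasDerivAt_line (hs.smooth.differentiable (by simp)) 0 y s)
  simp only [one_smul, zero_smul, zero_add, hs.zero, sub_zero, div_one] at hc
  rw [h1, ← hc, fderiv_eq_sum]
  refine (Finset.abs_sum_le_sum_abs _ _).trans (Finset.sum_le_sum fun i _ => ?_)
  rw [abs_mul]
  have h2 : |y i| ≤ 1 := by
    rw [abs_of_nonneg (Int.fract_nonneg _)]; exact (Int.fract_lt_one _).le
  calc |y i| * |pd i φ (c • y)| ≤ 1 * Q i i :=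
        mul_le_mul h2 (hs.grad_le hQ i _) (abs_nonneg _) zero_le_one
    _ = Q i i := one_mul _

lemma sq_sum_le_of_lower {c : ℝ} (hc : 0 < c)
    (hQ : ∀ v : Fin n → ℝ, c * ∑ i, v i ^ 2 ≤ v ⬝ᵥ Q *ᵥ v) {g M : Fin n → ℝ}
    (hg : ∀ i, |g i| ≤ M i) (v : Fin n → ℝ) :
    (∑ i, v i * g i) ^ 2 ≤ ((∑ i, M i ^ 2) / c) * (v ⬝ᵥ Q *ᵥ v) := by
  have h1 := Finset.sum_mul_sq_le_sq_mul_sq Finset.univ v g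
  have h2 : ∑ i, g i ^ 2 ≤ ∑ i, M i ^ 2 := Finset.sum_le_sum fun i _ =>
    sq_le_sq.2 ((hg i).trans (le_abs_self _))
  have h0 : 0 ≤ ∑ i, v i ^ 2 := Finset.sum_nonneg fun _ _ => sq_nonneg _
  have hM : 0 ≤ ∑ i, M i ^ 2 := Finset.sum_nonneg fun _ _ => sq_nonneg _
  calc (∑ i, v i * g i) ^ 2 ≤ (∑ i, v i ^ 2) * ∑ i, M i ^ 2 :=
        h1.trans (mul_le_mul_of_nonneg_left h2 h0)
    _ = ((∑ i, M i ^ 2) / c) * (c * ∑ i, v i ^ 2) := by field_simp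
    _ ≤ _ := mul_le_mul_of_nonneg_left (hQ v) (div_nonneg hM hc.le)

variable {A : (Fin n → ℝ) → ℝ}

/-- All normalized solutions along the continuity path. -/
def SolFam (Q : Matrix (Fin n) (Fin n) ℝ) (A : (Fin n → ℝ) → ℝ) : Type :=
  {p : ℝ × ((Fin n → ℝ) → ℝ) // |p.1| ≤ 1 ∧ Sol Q (fun x => p.1 * A x) p.2}

/-- The tautological family of solutions. -/
def solφ (Q : Matrix (Fin n) (Fin n) ℝ) (A : (Fin n → ℝ) → ℝ) : SF (SolFam Q A) n :=
  ⟨fun p => p.1.2, fun p => p.2.2.smooth⟩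

/-- The tautological family of right-hand sides. -/
def solA (Q : Matrix (Fin n) (Fin n) ℝ) (hA : ContDiff ℝ (⊤ : ℕ∞) A) : SF (SolFam Q A) n :=
  ⟨fun p x => p.1.1 * A x, fun _ => contDiff_const.mul hA⟩

lemma sol_pos (p : SolFam Q A × (Fin n → ℝ)) : ((famG Q (solφ Q A)).map (ev p)).PosDef := by
  rw [map_famG]; exact p.1.2.2.pos p.2

lemma sol_eq (hA : ContDiff ℝ (⊤ : ℕ∞) A) :
    ∑ i, ∑ j, dd i (dd j (fama (sol_pos (Q := Q) (A := A)) i j)) = solA Q hA :=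
  SF.ext_ev fun p => by rw [ev_abr]; exact p.1.2.2.eq p.2

/-- The data of the tautological family. -/
def solData (hQ : Q.PosDef) (hA : ContDiff ℝ (⊤ : ℕ∞) A) : Data (SolFam Q A) n :=
  mkData sol_pos (by simpa using hQ.isHermitian.eq) hQ.det_pos.ne' (sol_eq hA)

lemma solData_bdd (hQ : Q.PosDef) (hA : ContDiff ℝ (⊤ : ℕ∞) A) (hAp : ZPer A)
    (I : List (Fin n)) : ∃ C, 0 ≤ C ∧ ∀ p, |ev p ((solData hQ hA).Dl I (solData hQ hA).A)| ≤ C := by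
  obtain ⟨C, hC, h⟩ := (zper_pdl hAp I).bounded (contDiff_pdl hA I).continuous
  refine ⟨C, hC, fun p => ?_⟩
  rw [ev_eq, Data.fn_Dl _ rfl]
  show |pdl I (fun x => p.1.1.1 * A x) p.2| ≤ C
  rw [pdl_const_mul hA]
  show |_ * _| ≤ C
  rw [abs_mul]
  calc _ ≤ 1 * C := mul_le_mul p.1.2.1 (h _) (abs_nonneg _) zero_le_one
    _ = C := one_mul _

lemma sol_hess_per (p : SolFam Q A × (Fin n → ℝ)) (k : Fin n → ℤ) :
    hess p.1.1.2 (p.2 + fun i => (k i : ℝ)) = hess p.1.1.2 p.2 := by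
  ext i j
  exact zper_pd (zper_pd p.1.2.2.per j) i p.2 k

lemma sol_adm (hQ : Q.PosDef) (hA : ContDiff ℝ (⊤ : ℕ∞) A) (hAp : ZPer A) :
    ∃ C₀ CA A₀ Cφ, (solData hQ hA).Adm C₀ CA A₀ Cφ := by
  obtain ⟨c, hc, hcQ⟩ := hQ.exists_lower
  choose M hM0 hM using fun i => solData_bdd hQ hA hAp [i]
  obtain ⟨A₀, hA₀, hA₀'⟩ := solData_bdd hQ hA hAp []
  have hS : ∀ N : Fin n → ℝ, 0 ≤ (∑ i, N i ^ 2) / c := fun N =>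
    div_nonneg (Finset.sum_nonneg fun _ _ => sq_nonneg _) hc.le
  refine ⟨(∑ i, (Q i i) ^ 2) / c + 1, (∑ i, M i ^ 2) / c, A₀, ∑ i, Q i i, ⟨hQ, ?_, ?_⟩, ?_, hS _,
    hA₀, ?_, ?_, ?_, ?_, ?_, ?_, hA₀', ?_⟩
  · intro p v
    have h := sq_sum_le_of_lower hc hcQ (fun i => p.1.2.2.grad_le hQ i p.2) v
    have h' : 0 ≤ v ⬝ᵥ Q *ᵥ v := (mul_nonneg hc.le
      (Finset.sum_nonneg fun _ _ => sq_nonneg _)).trans (hcQ v)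
    refine h.trans ?_
    show _ ≤ _ * (v ⬝ᵥ Q *ᵥ v)
    nlinarith
  · exact fun p v => sq_sum_le_of_lower hc hcQ (fun i => hM i p) v
  · have := hS fun i => Q i i
    linarith
  · exact fun p => p.2.2.per
  · intro p x k
    show _ * _ = _ * _
    rw [hAp]
  · intro p x k
    show ev (p, _) (famL sol_pos) = ev (p, x) (famL sol_pos)
    rw [famL, ev_log, ev_log, ev_det, ev_det, map_famG, map_famG]
    have := sol_hess_per (p, x) k
    exact congrArg (fun H => Real.log (Q + H).det) this
  · intro i j p x k
    have h1 := congrFun (congrFun (map_fama (sol_pos (Q := Q) (A := A)) (p, x)) i) j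
    have h2 := congrFun (congrFun (map_fama (sol_pos (Q := Q) (A := A))
      (p, x + fun i => (k i : ℝ))) i) j
    have := sol_hess_per (p, x) k
    refine h2.trans (Eq.trans ?_ h1.symm)
    exact congrArg (fun H => (Q + H)⁻¹ i j) this
  · intro p
    show ((fama sol_pos).map (ev p)).PosDef
    rw [map_fama]
    exact (p.1.2.2.pos p.2).inv
  · intro p
    show Real.exp (ev p (famL sol_pos)) = ((famG _ _).map (ev p)).det
    rw [famL, ev_log, Real.exp_log (famG_det_pos sol_pos p), ev_det]
    rfl
  · exact fun p => p.1.2.2.abs_le hQ p.2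

/-- Uniform bounds for all derivatives of normalized solutions. -/
theorem sol_bounds (hQ : Q.PosDef) (hA : ContDiff ℝ (⊤ : ℕ∞) A) (hAp : ZPer A)
    (I : List (Fin n)) : ∃ C, ∀ t : ℝ, |t| ≤ 1 → ∀ φ, Sol Q (fun x => t * A x) φ →
      ∀ x, |pdl I φ x| ≤ C := by
  obtain ⟨C₀, CA, A₀, Cφ, hd⟩ := sol_adm hQ hA hAp
  obtain ⟨C, hC⟩ := hd.Dl_bdd (fun I => by
    obtain ⟨C, -, h⟩ := solData_bdd hQ hA hAp I
    exact ⟨C, h⟩) I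
  refine ⟨C, fun t ht φ hφ x => ?_⟩
  have := hC (⟨(t, φ), ht, hφ⟩, x)
  rwa [ev_eq, Data.fn_Dl _ rfl] at this

/-- Uniform positivity of the Hessian determinant of normalized solutions. -/
theorem sol_det (hQ : Q.PosDef) (hA : ContDiff ℝ (⊤ : ℕ∞) A) (hAp : ZPer A) :
    ∃ δ : ℝ, 0 < δ ∧ ∀ t : ℝ, |t| ≤ 1 → ∀ φ, Sol Q (fun x => t * A x) φ →
      ∀ x, δ ≤ (Q + hess φ x).det := by
  obtain ⟨C₀, CA, A₀, Cφ, hd⟩ := sol_adm hQ hA hAp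
  obtain ⟨C, hC⟩ := hd.L_bdd
  refine ⟨Real.exp (-C), Real.exp_pos _, fun t ht φ hφ x => ?_⟩
  have h1 := hC (⟨(t, φ), ht, hφ⟩, x)
  have h2 : Real.exp (ev _ (famL sol_pos)) = ((famG _ _).map (ev _)).det :=
    hd.hL (⟨(t, φ), ht, hφ⟩, x)
  rw [map_famG] at h2
  show _ ≤ (Q + hess _ x).det
  refine le_trans ?_ h2.le
  exact Real.exp_le_exp.2 (abs_le.1 h1).1

end

section

open Filter Topology
open scoped NNReal

variable {ι : Type} {n : ℕ}

lemma pdl_append (I J : List (Fin n)) (f : (Fin n → ℝ) → ℝ) :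
    pdl (I ++ J) f = pdl J (pdl I f) := by
  induction I generalizing f with
  | nil => rfl
  | cons i I ih => exact ih _

lemma taylor_two {h : (Fin n → ℝ) → ℝ} (hh : ContDiff ℝ (⊤ : ℕ∞) h) {C : ℝ}
    (hC : ∀ i j x, |pd i (pd j h) x| ≤ C) (x y : Fin n → ℝ) :
    |h y - h x - ∑ i, (y - x) i * pd i h x| ≤ n * (n * C) * ‖y - x‖ ^ 2 := by
  have mv : ∀ {g : (Fin n → ℝ) → ℝ}, ContDiff ℝ (⊤ : ℕ∞) g → ∀ v : Fin n → ℝ,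
      ∃ c : ℝ, 0 < c ∧ c < 1 ∧ g (x + v) - g x = ∑ i, v i * pd i g (x + c • v) := by
    intro g hg v
    have hd := hg.differentiable (by simp : ((⊤ : ℕ∞) : WithTop ℕ∞) ≠ 0)
    obtain ⟨c, hc, h⟩ := exists_hasDerivAt_eq_slope (fun s : ℝ => g (x + s • v)) _ zero_lt_one
      (fun s _ => (hasDerivAt_line hd x v s).continuousAt.continuousWithinAt)
      (fun s _ => hasDerivAt_line hd x v s)
    simp only [one_smul, zero_smul, add_zero, sub_zero, div_one] at h
    exact ⟨c, hc.1, hc.2, by rw [← h, fderiv_eq_sum]⟩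
  set v := y - x with hv
  have hy : y = x + v := by simp [hv]
  obtain ⟨c, hc0, hc1, hc⟩ := mv hh v
  rw [hy, hc, ← Finset.sum_sub_distrib]
  have hvi : ∀ i, |v i| ≤ ‖v‖ := fun i => norm_le_pi_norm v i
  have h1 : ∀ i, |v i * pd i h (x + c • v) - v i * pd i h x| ≤ n * C * ‖v‖ ^ 2 := by
    intro i
    obtain ⟨c', h0', h1', hc'⟩ := mv (contDiff_pd hh i) (c • v)
    rw [← mul_sub, hc', abs_mul]
    have h2 : |∑ j, (c • v) j * pd j (pd i h) (x + c' • c • v)| ≤ n * C * ‖v‖ := by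
      refine (Finset.abs_sum_le_sum_abs _ _).trans ?_
      refine (Finset.sum_le_sum (g := fun _ => ‖v‖ * C) fun j _ => ?_).trans
        (by rw [Finset.sum_const, Finset.card_univ, Fintype.card_fin, nsmul_eq_mul]
            exact le_of_eq (by ring))
      rw [abs_mul]
      refine mul_le_mul ?_ (hC _ _ _) (abs_nonneg _) (norm_nonneg _)
      rw [Pi.smul_apply, smul_eq_mul, abs_mul, abs_of_pos hc0]
      nlinarith [hvi j, abs_nonneg (v j)]
    calc _ ≤ ‖v‖ * (n * C * ‖v‖) := mul_le_mul (hvi i) h2 (abs_nonneg _) (norm_nonneg _)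
      _ = _ := by ring
  refine (Finset.abs_sum_le_sum_abs _ _).trans ((Finset.sum_le_sum fun i _ => h1 i).trans ?_)
  rw [Finset.sum_const, Finset.card_univ, Fintype.card_fin, nsmul_eq_mul]
  exact le_of_eq (by ring)

lemma exists_tendsto_of_bdd (l : Ultrafilter ℕ) {a : ℕ → ℝ} {C : ℝ} (h : ∀ k, |a k| ≤ C) :
    ∃ b, Tendsto a l (𝓝 b) := by
  obtain ⟨b, -, hb⟩ := (isCompact_Icc (a := -C) (b := C)).ultrafilter_le_nhds' (l.map a)
    (by
      show ∀ᶠ k in (l : Filter ℕ), a k ∈ Set.Icc (-C) C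
      exact Eventually.of_forall fun k => abs_le.1 (h k))
  exact ⟨b, hb⟩

/-- Compactness of families of smooth functions with uniformly bounded derivatives. -/
theorem exists_smooth_limit (l : Ultrafilter ℕ) {f : ℕ → (Fin n → ℝ) → ℝ}
    (hf : ∀ k, ContDiff ℝ (⊤ : ℕ∞) (f k)) (hb : ∀ I, ∃ C, ∀ k x, |pdl I (f k) x| ≤ C) :
    ∃ g : (Fin n → ℝ) → ℝ, ContDiff ℝ (⊤ : ℕ∞) g ∧
      ∀ I x, Tendsto (fun k => pdl I (f k) x) l (𝓝 (pdl I g x)) := by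
  choose B hB using hb
  choose g hg using fun I x => exists_tendsto_of_bdd l (fun k => hB I k x)
  have hd : ∀ I x, HasFDerivAt (g I)
      (∑ i, g (I ++ [i]) x • (ContinuousLinearMap.proj i : (Fin n → ℝ) →L[ℝ] ℝ)) x := by
    intro I x
    obtain ⟨C, -, hC⟩ := Data.exists_uniform_le (α := Fin n × Fin n)
      (fun q => B (I ++ [q.2, q.1]))
    have ht : ∀ y, |g I y - g I x - ∑ i, (y - x) i * g (I ++ [i]) x|
        ≤ n * (n * C) * ‖y - x‖ ^ 2 := by
      intro y
      refine le_of_tendsto (((hg I y).sub (hg I x)).sub (tendsto_finsetSum _ fun i _ =>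
        (hg (I ++ [i]) x).const_mul ((y - x) i))).abs (Eventually.of_forall fun k => ?_)
      have := taylor_two (contDiff_pdl (hf k) I) (C := C) (fun i j x => by
        have := hB (I ++ [j, i]) k x
        rw [pdl_append] at this
        exact this.trans (hC (i, j))) x y
      refine le_trans (le_of_eq ?_) this
      simp only [pdl_append]
      rfl
    have h2 : HasFDerivAt (fun y => g I y - g I x - ∑ i, (y - x) i * g (I ++ [i]) x)
        (0 : (Fin n → ℝ) →L[ℝ] ℝ) x := by
      refine Asymptotics.IsBigO.hasFDerivAt (n := 2) ?_ (by norm_num)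
      refine Asymptotics.IsBigO.of_bound (n * (n * C)) (Eventually.of_forall fun y => ?_)
      rw [Real.norm_of_nonneg (by positivity : 0 ≤ ‖y - x‖ ^ 2)]
      exact ht y
    have h3 : HasFDerivAt (fun y : Fin n → ℝ => ∑ i, (y - x) i * g (I ++ [i]) x)
        (∑ i, g (I ++ [i]) x • (ContinuousLinearMap.proj i : (Fin n → ℝ) →L[ℝ] ℝ)) x := by
      refine HasFDerivAt.fun_sum fun i _ => ?_
      have := ((ContinuousLinearMap.proj (R := ℝ) (φ := fun _ : Fin n => ℝ) i).hasFDerivAt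
        (x := x)).sub_const (x i)
      exact this.mul_const _
    have h4 := (h2.add h3).add_const (g I x)
    rw [zero_add] at h4
    refine h4.congr_of_eventuallyEq (Eventually.of_forall fun y => ?_)
    simp
  have hcd : ∀ m : ℕ, ∀ I, ContDiff ℝ m (g I) := by
    intro m
    induction m with
    | zero =>
      intro I
      exact contDiff_zero.2 (continuous_iff_continuousAt.2 fun x => (hd I x).continuousAt)
    | succ m ih =>
      intro I
      rw [Nat.cast_succ, contDiff_succ_iff_hasFDerivAt]
      exact ⟨_, ContDiff.sum fun i _ => (ih _).smul contDiff_const, hd I⟩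
  have hp : ∀ J I, pdl J (g I) = g (I ++ J) := by
    intro J
    induction J with
    | nil => intro I; rw [List.append_nil]; rfl
    | cons i J ih =>
      intro I
      have h1 : pd i (g I) = g (I ++ [i]) := by
        funext x
        rw [pd, (hd I x).fderiv]
        simp [Pi.single_apply]
      rw [pdl, h1, ih]
      simp
  refine ⟨g [], contDiff_infty.2 fun m => hcd m [], fun I x => ?_⟩
  rw [hp]
  exact hg I x

/-- Families converging pointwise, along a filter, to their member at infinity. -/
def convAlg (l : Filter ℕ) (n : ℕ) : Subalgebra ℝ (SF (Option ℕ) n) where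
  carrier := {f | ∀ x, Tendsto (fun k => ev (some k, x) f) l (𝓝 (ev (none, x) f))}
  mul_mem' {f g} hf hg x := by simpa only [map_mul] using (hf x).mul (hg x)
  add_mem' {f g} hf hg x := by simpa only [map_add] using (hf x).add (hg x)
  algebraMap_mem' c x := by simpa only [AlgHom.commutes] using tendsto_const_nhds

lemma posDef_of_tendsto {l : Filter ℕ} [l.NeBot] {M : ℕ → Matrix (Fin n) (Fin n) ℝ}
    {M₀ : Matrix (Fin n) (Fin n) ℝ} (h : ∀ i j, Tendsto (fun k => M k i j) l (𝓝 (M₀ i j)))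
    (hM : ∀ k, (M k).PosDef) {δ : ℝ} (hδ : 0 < δ) (hd : ∀ k, δ ≤ (M k).det) : M₀.PosDef := by
  have hs : M₀.IsHermitian := by
    ext i j
    refine tendsto_nhds_unique ?_ (h i j)
    rw [Matrix.conjTranspose_apply, star_trivial]
    refine (h j i).congr fun k => ?_
    simpa using (hM k).isHermitian.apply i j
  have hp : M₀.PosSemidef := by
    refine Matrix.PosSemidef.of_dotProduct_mulVec_nonneg hs fun v => ?_
    have : Tendsto (fun k => star v ⬝ᵥ M k *ᵥ v) l (𝓝 (star v ⬝ᵥ M₀ *ᵥ v)) := by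
      simp only [dotProduct, Matrix.mulVec]
      exact tendsto_finsetSum _ fun i _ => (tendsto_finsetSum _ fun j _ =>
        (h i j).mul_const _).const_mul _
    exact ge_of_tendsto' this fun k => (hM k).posSemidef.dotProduct_mulVec_nonneg v
  have hdet : Tendsto (fun k => (M k).det) l (𝓝 M₀.det) := by
    have hc : Continuous fun N : Matrix (Fin n) (Fin n) ℝ => N.det := continuous_id.matrix_det
    exact (hc.tendsto M₀).comp (tendsto_pi_nhds.2 fun i => tendsto_pi_nhds.2 (h i))
  have hpos : 0 < M₀.det := hδ.trans_le (ge_of_tendsto' hdet hd)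
  exact hp.posDef_iff_isUnit.2 ((Matrix.isUnit_iff_isUnit_det _).2 hpos.ne'.isUnit)

variable {Q : Matrix (Fin n) (Fin n) ℝ} {A : (Fin n → ℝ) → ℝ}

lemma mem_convAlg_det {l : Filter ℕ} {M : Matrix (Fin n) (Fin n) (SF (Option ℕ) n)}
    (h : ∀ i j, M i j ∈ convAlg l n) : M.det ∈ convAlg l n := by
  rw [Matrix.det_apply]
  exact sum_mem fun σ _ => Subalgebra.zsmul_mem _ (prod_mem fun i _ => h _ _) _

lemma tendsto_abr {l : Filter ℕ} {φ : SF (Option ℕ) n} (h : ∀ p, ((famG Q φ).map (ev p)).PosDef)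
    (h2 : ∀ i j, dd i (dd j φ) ∈ convAlg l n) (h3 : ∀ i j k, dd i (dd j (dd k φ)) ∈ convAlg l n)
    (h4 : ∀ i j k m, dd i (dd j (dd k (dd m φ))) ∈ convAlg l n) (x : Fin n → ℝ) :
    Tendsto (fun k => abr (fun z => Q + hess (φ.fn (some k)) z) x) l
      (𝓝 (abr (fun z => Q + hess (φ.fn none) z) x)) := by
  have hG : ∀ i j, famG Q φ i j ∈ convAlg l n := fun i j =>
    add_mem (Subalgebra.algebraMap_mem _ _) (h2 i j)
  have he : (-famL h).exp ∈ convAlg l n := fun x => by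
    have e : ∀ p, ev p (-famL h).exp = (ev p (famG Q φ).det)⁻¹ := fun p =>
      eq_inv_of_mul_eq_one_left (by rw [← map_mul, famL_exp_neg, map_one])
    simp only [e]
    exact (mem_convAlg_det hG x).inv₀ (famG_det_pos h _).ne'
  have ha : ∀ i j, fama h i j ∈ convAlg l n := fun i j => by
    refine mul_mem he ?_
    rw [Matrix.adjugate_apply]
    refine mem_convAlg_det fun p q => ?_
    rw [Matrix.updateRow_apply]
    split_ifs
    · rw [Pi.single_apply]; split_ifs
      · exact one_mem _
      · exact zero_mem _
    · exact hG _ _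
  have hda : ∀ k i j, dd k (fama h i j) ∈ convAlg l n := fun k i j => by
    rw [fama_deriv]
    exact neg_mem (sum_mem fun p _ => sum_mem fun q _ => mul_mem (mul_mem (ha _ _) (h3 _ _ _))
      (ha _ _))
  have hdda : ∀ m k i j, dd m (dd k (fama h i j)) ∈ convAlg l n := fun m k i j => by
    rw [fama_deriv]
    simp only [map_neg, map_sum, Derivation.leibniz, smul_eq_mul]
    exact neg_mem (sum_mem fun p _ => sum_mem fun q _ => add_mem (mul_mem (mul_mem (ha _ _)
      (h3 _ _ _)) (hda _ _ _)) (mul_mem (ha _ _) (add_mem (mul_mem (ha _ _) (h4 _ _ _ _))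
      (mul_mem (h3 _ _ _) (hda _ _ _)))))
  have := (sum_mem (S := convAlg l n) fun i (_ : i ∈ Finset.univ) => sum_mem
    fun j (_ : j ∈ Finset.univ) => hdda i j i j) x
  simpa only [ev_abr] using this

/-- The set of parameters with a solution is closed. -/
theorem sol_closed (hQ : Q.PosDef) (hA : ContDiff ℝ (⊤ : ℕ∞) A) (hAp : ZPer A) {t : ℕ → ℝ}
    {t₀ : ℝ} (ht : Tendsto t atTop (𝓝 t₀)) (h1 : ∀ k, |t k| ≤ 1)
    (hs : ∀ k, ∃ φ, Sol Q (fun x => t k * A x) φ) : ∃ φ, Sol Q (fun x => t₀ * A x) φ := by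
  choose φ hφ using hs
  obtain ⟨δ, hδ, hdet⟩ := sol_det hQ hA hAp
  let l : Ultrafilter ℕ := hyperfilter ℕ
  have hl : (l : Filter ℕ) ≤ atTop := Nat.hyperfilter_le_atTop
  obtain ⟨g, hg, hlim⟩ := exists_smooth_limit l (fun k => (hφ k).smooth) fun I => by
    obtain ⟨C, hC⟩ := sol_bounds hQ hA hAp I
    exact ⟨C, fun k x => hC _ (h1 k) _ (hφ k) x⟩
  have hpos : ∀ x, (Q + hess g x).PosDef := fun x =>
    posDef_of_tendsto (l := (l : Filter ℕ)) (M := fun k => Q + hess (φ k) x)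
      (fun i j => (hlim [j, i] x).const_add (Q i j)) (fun k => (hφ k).pos x) hδ
      fun k => hdet _ (h1 k) _ (hφ k) x
  refine ⟨g, hg, fun x k => ?_, ?_, hpos, fun x => ?_⟩
  · exact tendsto_nhds_unique (hlim [] _) ((hlim [] x).congr fun m => ((hφ m).per x k).symm)
  · exact tendsto_nhds_unique (hlim [] 0) (tendsto_const_nhds.congr fun m => (hφ m).zero.symm)
  · let Φ : SF (Option ℕ) n := ⟨fun o => o.elim g φ, fun o => by
      cases o with
      | none => exact hg
      | some k => exact (hφ k).smooth⟩
    have hΦ : ∀ p, ((famG Q Φ).map (ev p)).PosDef := by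
      rintro ⟨o, x⟩
      rw [map_famG]
      cases o with
      | none => exact hpos x
      | some k => exact (hφ k).pos x
    have := tendsto_abr (l := (l : Filter ℕ)) hΦ (fun i j x => hlim [j, i] x)
      (fun i j k x => hlim [k, j, i] x) (fun i j k m x => hlim [m, k, j, i] x) x
    refine tendsto_nhds_unique this ?_
    refine ((ht.mono_left hl).mul_const (A x)).congr fun k => ?_
    exact ((hφ k).eq x).symm

end

section

open Filter Topology ComplexConjugate
open scoped NNReal

variable {ι : Type} {n : ℕ}

/-- The covering map of the torus. -/
def tor (x : Fin n → ℝ) : UnitAddTorus (Fin n) := fun i => (x i : UnitAddCircle)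

lemma tor_quot : IsOpenQuotientMap (tor : (Fin n → ℝ) → UnitAddTorus (Fin n)) :=
  IsOpenQuotientMap.piMap fun _ => QuotientAddGroup.isOpenQuotientMap_mk

lemma ZPer.eq_of_tor {f : (Fin n → ℝ) → ℝ} (hf : ZPer f) {x y : Fin n → ℝ}
    (h : tor x = tor y) : f x = f y := by
  have h1 : ∀ i, ∃ m : ℤ, x i = y i + m := by
    intro i
    have h2 : (x i : UnitAddCircle) = (y i : UnitAddCircle) := congrFun h i
    have h3 : ((x i - y i : ℝ) : UnitAddCircle) = 0 := by
      rw [AddCircle.coe_sub, h2, sub_self]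
    obtain ⟨m, hm⟩ := AddCircle.coe_eq_zero_iff _ |>.1 h3
    refine ⟨m, ?_⟩
    rw [zsmul_one] at hm
    linarith
  choose m hm using h1
  rw [← hf y m]
  congr 1
  funext i
  exact hm i

/-- Absolutely summable families indexed by the lattice. -/
abbrev Ell (n : ℕ) : Type := lp (fun _ : Fin n → ℤ => ℂ) 1

lemma Ell.summable (c : Ell n) : Summable fun k => ‖c k‖ := by
  simpa using c.2.summable

lemma Ell.norm_eq (c : Ell n) : ‖c‖ = ∑' k, ‖c k‖ := by
  have := lp.norm_eq_tsum_rpow (p := 1) (by simp) c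
  simpa only [ENNReal.toReal_one, Real.rpow_one, div_one] using this

section ell
variable {X : Type*} [NormedAddCommGroup X] [NormedSpace ℂ X] [CompleteSpace X]

/-- Synthesis of a bounded family. -/
def ell (g : (Fin n → ℤ) → X) (C : ℝ≥0) (hg : ∀ k, ‖g k‖ ≤ C) : Ell n →L[ℂ] X :=
  have hs : ∀ c : Ell n, Summable fun k => ‖c k • g k‖ := fun c =>
    Summable.of_nonneg_of_le (fun _ => norm_nonneg _)
      (fun k => by rw [norm_smul]; exact mul_le_mul_of_nonneg_left (hg k) (norm_nonneg _))
      (c.summable.mul_right (C : ℝ))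
  LinearMap.mkContinuous
    { toFun := fun c => ∑' k, c k • g k
      map_add' := fun c d => by
        rw [← Summable.tsum_add (hs c).of_norm (hs d).of_norm]
        simp only [← add_smul]; rfl
      map_smul' := fun r c => by
        rw [RingHom.id_apply, ← Summable.tsum_const_smul r (hs c).of_norm]
        simp only [smul_smul]; rfl }
    C (fun c => by
      refine (norm_tsum_le_tsum_norm (hs c)).trans ?_
      rw [c.norm_eq, mul_comm, ← tsum_mul_right]
      refine (hs c).tsum_le_tsum (fun k => ?_) (c.summable.mul_right (C : ℝ))
      rw [norm_smul]; exact mul_le_mul_of_nonneg_left (hg k) (norm_nonneg _))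

lemma ell_apply (g : (Fin n → ℤ) → X) (C : ℝ≥0) (hg : ∀ k, ‖g k‖ ≤ C) (c : Ell n) :
    ell g C hg c = ∑' k, c k • g k := rfl

lemma hasSum_ell (g : (Fin n → ℤ) → X) (C : ℝ≥0) (hg : ∀ k, ‖g k‖ ≤ C) (c : Ell n) :
    HasSum (fun k => c k • g k) (ell g C hg c) := by
  have : Summable fun k => ‖c k • g k‖ :=
    Summable.of_nonneg_of_le (fun _ => norm_nonneg _)
      (fun k => by rw [norm_smul]; exact mul_le_mul_of_nonneg_left (hg k) (norm_nonneg _))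
      (c.summable.mul_right (C : ℝ))
  exact this.of_norm.hasSum

lemma ell_single (g : (Fin n → ℤ) → X) (C : ℝ≥0) (hg : ∀ k, ‖g k‖ ≤ C) (k : Fin n → ℤ) (z : ℂ) :
    ell g C hg (lp.single 1 k z) = z • g k := by
  rw [ell_apply, tsum_eq_single k]
  · rw [lp.single_apply_self]
  · intro m hm
    rw [lp.single_apply_ne _ _ _ hm, zero_smul]

end ell

/-- The continuous function on the torus with given Fourier coefficients. -/
def hat : Ell n →L[ℂ] C(UnitAddTorus (Fin n), ℂ) :=
  ell UnitAddTorus.mFourier 1 fun _ => UnitAddTorus.mFourier_norm.le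

lemma hasSum_hat (c : Ell n) : HasSum (fun k => c k • UnitAddTorus.mFourier k) (hat c) :=
  hasSum_ell _ _ _ c

lemma hat_single (k : Fin n → ℤ) (z : ℂ) :
    hat (lp.single 1 k z) = z • UnitAddTorus.mFourier k := ell_single _ _ _ _ _

/-- Normalised Haar measure of the torus. -/
def torMeas (n : ℕ) : Measure (UnitAddTorus (Fin n)) := Measure.pi fun _ => AddCircle.haarAddCircle

instance : IsProbabilityMeasure (torMeas n) :=
  inferInstanceAs (IsProbabilityMeasure (Measure.pi fun _ => AddCircle.haarAddCircle))

instance : (torMeas n).IsAddHaarMeasure :=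
  inferInstanceAs (Measure.IsAddHaarMeasure (Measure.pi fun _ => AddCircle.haarAddCircle))

lemma integrable_tor (f : C(UnitAddTorus (Fin n), ℂ)) : Integrable f (torMeas n) :=
  (BoundedContinuousFunction.mkOfCompact f).integrable _

/-- The mean over the torus. -/
def mean : C(UnitAddTorus (Fin n), ℂ) →L[ℂ] ℂ :=
  LinearMap.mkContinuous
    { toFun := fun f => ∫ t, f t ∂torMeas n
      map_add' := fun f g => integral_add (integrable_tor f) (integrable_tor g)
      map_smul' := fun r f => integral_const_mul r _ }
    1 (fun f => by
      have := norm_integral_le_of_norm_le_const (μ := torMeas n) (f := f) (C := ‖f‖)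
        (Eventually.of_forall fun t => f.norm_coe_le_norm t)
      simpa using this)

lemma mean_apply (f : C(UnitAddTorus (Fin n), ℂ)) : mean f = ∫ t, f t ∂torMeas n := rfl

lemma mean_mFourier (k : Fin n → ℤ) :
    mean (UnitAddTorus.mFourier k) = if k = 0 then 1 else 0 := by
  have h := (orthonormal_iff_ite.1 (UnitAddTorus.orthonormal_mFourier (d := Fin n))) 0 k
  rw [ContinuousMap.inner_toLp] at h
  have h2 : mean (UnitAddTorus.mFourier k) = if (0 : Fin n → ℤ) = k then 1 else 0 := by
    rw [← h, mean_apply]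
    refine integral_congr_ae (Eventually.of_forall fun t => ?_)
    simp [UnitAddTorus.mFourier_zero]
  rw [h2]
  simp only [eq_comm]

lemma mFourier_mul (k m : Fin n → ℤ) :
    UnitAddTorus.mFourier k * UnitAddTorus.mFourier m = UnitAddTorus.mFourier (k + m) := by
  ext t
  exact UnitAddTorus.mFourier_add.symm

lemma star_mFourier (k : Fin n → ℤ) :
    star (UnitAddTorus.mFourier k) = UnitAddTorus.mFourier (-k) := by
  ext t
  exact UnitAddTorus.mFourier_neg.symm

lemma mean_mul_hat (c : Ell n) (k : Fin n → ℤ) :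
    mean (UnitAddTorus.mFourier (-k) * hat c) = c k := by
  have h : mean.comp ((ContinuousLinearMap.mul ℂ C(UnitAddTorus (Fin n), ℂ)
      (UnitAddTorus.mFourier (-k))).comp hat) = lp.evalCLM ℂ (fun _ => ℂ) 1 k := by
    refine lp.ext_continuousLinearMap (by simp) fun m => ?_
    ext
    show mean (UnitAddTorus.mFourier (-k) * hat (lp.single 1 m 1)) =
      (lp.single 1 m (1 : ℂ) : Ell n) k
    rw [hat_single, one_smul, mFourier_mul, mean_mFourier]
    by_cases h : k = m
    · subst h; simp
    · rw [lp.single_apply_ne _ _ _ h, if_neg]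
      intro h'
      apply h
      rw [← add_right_inj (-k), h', neg_add_cancel]
  exact DFunLike.congr_fun h c

lemma hat_injective : Function.Injective (hat : Ell n → _) := by
  intro c d h
  ext k
  rw [← mean_mul_hat, h, mean_mul_hat]

lemma hasSum_parseval (c d : Ell n) :
    HasSum (fun k => conj (c k) * d k) (mean (star (hat c) * hat d)) := by
  have h : HasSum (fun k => star (c k • UnitAddTorus.mFourier k)) (star (hat c)) :=
    (hasSum_hat c).star
  have h2 := (mean.comp ((ContinuousLinearMap.mul ℂ C(UnitAddTorus (Fin n), ℂ)).flip
      (hat d))).hasSum h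
  refine h2.congr_fun fun k => ?_
  show _ = mean (star (c k • UnitAddTorus.mFourier k) * hat d)
  rw [star_smul, star_mFourier, smul_mul_assoc, map_smul, mean_mul_hat]
  rfl

section lift
variable {f : (Fin n → ℝ) → ℝ} (hf : ZPer f) (hc : Continuous f)

/-- A continuous periodic function as a function on the torus. -/
def lift (hf : ZPer f) (hc : Continuous f) : C(UnitAddTorus (Fin n), ℂ) where
  toFun t := (f (Function.surjInv tor_quot.surjective t) : ℂ)
  continuous_toFun := by
    rw [tor_quot.isQuotientMap.continuous_iff]
    have : (fun t => (f (Function.surjInv tor_quot.surjective t) : ℂ)) ∘ tor =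
        fun x => (f x : ℂ) := by
      funext x
      show ((f _ : ℝ) : ℂ) = f x
      rw [ZPer.eq_of_tor hf (Function.surjInv_eq tor_quot.surjective (tor x))]
    rw [this]
    exact Complex.continuous_ofReal.comp hc

lemma lift_tor (x : Fin n → ℝ) : lift hf hc (tor x) = (f x : ℂ) := by
  show ((f _ : ℝ) : ℂ) = f x
  rw [ZPer.eq_of_tor hf (Function.surjInv_eq tor_quot.surjective (tor x))]

end lift

lemma mean_translate (F : C(UnitAddTorus (Fin n), ℂ)) (s : UnitAddTorus (Fin n)) :
    ∫ t, F (t + s) ∂torMeas n = mean F := by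
  rw [mean_apply, integral_add_right_eq_self (μ := torMeas n) F s]

/-- Frequency as a linear form. -/
def frq (k : Fin n → ℤ) (x : Fin n → ℝ) : ℂ := 2 * Real.pi * Complex.I * ∑ i, (k i : ℂ) * x i

lemma mFourier_tor (k : Fin n → ℤ) (x : Fin n → ℝ) :
    UnitAddTorus.mFourier k (tor x) = Complex.exp (frq k x) := by
  show ∏ i, fourier (k i) (x i : UnitAddCircle) = _
  rw [frq, Finset.mul_sum, Complex.exp_sum]
  refine Finset.prod_congr rfl fun i _ => ?_
  rw [fourier_coe_apply]
  congr 1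
  simp
  ring

lemma mFourier_add_arg (k : Fin n → ℤ) (s t : UnitAddTorus (Fin n)) :
    UnitAddTorus.mFourier k (s + t) = UnitAddTorus.mFourier k s * UnitAddTorus.mFourier k t := by
  show ∏ i, fourier (k i) (s i + t i) = (∏ i, fourier (k i) (s i)) * ∏ i, fourier (k i) (t i)
  rw [← Finset.prod_mul_distrib]
  refine Finset.prod_congr rfl fun i _ => ?_
  simp [fourier_apply, smul_add, AddCircle.toCircle_add]

/-- Fourier coefficient of a continuous periodic function. -/
def coef (F : C(UnitAddTorus (Fin n), ℂ)) (k : Fin n → ℤ) : ℂ :=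
  mean (UnitAddTorus.mFourier (-k) * F)

lemma norm_coef_le (F : C(UnitAddTorus (Fin n), ℂ)) (k : Fin n → ℤ) : ‖coef F k‖ ≤ ‖F‖ := by
  rw [coef, mean_apply]
  have := norm_integral_le_of_norm_le_const (μ := torMeas n)
    (f := (UnitAddTorus.mFourier (-k) * F)) (C := ‖F‖)
    (Eventually.of_forall fun t => by
      refine (ContinuousMap.norm_coe_le_norm _ t).trans ((norm_mul_le _ _).trans ?_)
      rw [UnitAddTorus.mFourier_norm, one_mul])
  simpa using this

lemma coef_pd {f : (Fin n → ℝ) → ℝ} (hf : ZPer f) (hs : ContDiff ℝ (⊤ : ℕ∞) f) (i : Fin n)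
    (k : Fin n → ℤ) :
    coef (lift (zper_pd hf i) (contDiff_pd hs i).continuous) k =
      2 * Real.pi * Complex.I * k i * coef (lift hf hs.continuous) k := by
  set F := lift hf hs.continuous
  set F' := lift (zper_pd hf i) (contDiff_pd hs i).continuous
  set e := fun s : ℝ => tor (s • (Pi.single i 1 : Fin n → ℝ))
  set c : ℂ := 2 * Real.pi * Complex.I * k i
  have he0 : e 0 = 0 := by simp only [e, zero_smul]; rfl
  have h1 : ∀ s : ℝ, ∫ t, UnitAddTorus.mFourier (-k) t * F (t + e s) ∂torMeas n =
      Complex.exp (c * s) * coef F k := by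
    intro s
    rw [coef, ← mean_translate _ (e s), ← integral_const_mul]
    refine integral_congr_ae (Eventually.of_forall fun t => ?_)
    show _ = _ * (UnitAddTorus.mFourier (-k) (t + e s) * F (t + e s))
    have : UnitAddTorus.mFourier (-k) (e s) = Complex.exp (-(c * s)) := by
      rw [mFourier_tor]
      congr 1
      simp [frq, c, Pi.single_apply, apply_ite Complex.ofReal]
      ring
    rw [mFourier_add_arg, this, Complex.exp_neg]
    field_simp [Complex.exp_ne_zero]
  have h2 : ∀ (t : UnitAddTorus (Fin n)) (s : ℝ),
      HasDerivAt (fun s => UnitAddTorus.mFourier (-k) t * F (t + e s))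
        (UnitAddTorus.mFourier (-k) t * F' (t + e s)) s := by
    intro t s
    obtain ⟨x, rfl⟩ := tor_quot.surjective t
    refine HasDerivAt.const_mul _ ?_
    have h3 := (hasDerivAt_line (hs.differentiable (by simp)) x (Pi.single i 1) s).ofReal_comp
    convert! h3 using 1
    · funext s
      show F (tor (x + s • Pi.single i 1)) = _
      rw [lift_tor]
    · show F' (tor (x + s • Pi.single i 1)) = _
      rw [lift_tor]
      rfl
  have h3 := (hasDerivAt_integral_of_dominated_loc_of_deriv_le (μ := torMeas n)
    (F := fun (s : ℝ) t => UnitAddTorus.mFourier (-k) t * F (t + e s))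
    (F' := fun (s : ℝ) t => UnitAddTorus.mFourier (-k) t * F' (t + e s)) (x₀ := 0)
    (bound := fun _ => ‖F'‖) (s := Set.univ) Filter.univ_mem
    (Eventually.of_forall fun s => by
      exact (Continuous.aestronglyMeasurable (by fun_prop)))
    (by
      simp only [he0, add_zero]
      exact integrable_tor (UnitAddTorus.mFourier (-k) * F))
    (Continuous.aestronglyMeasurable (by fun_prop))
    (Eventually.of_forall fun t s _ => by
      rw [norm_mul]
      have h4 := (UnitAddTorus.mFourier (-k)).norm_coe_le_norm t
      rw [UnitAddTorus.mFourier_norm] at h4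
      exact (mul_le_of_le_one_left (norm_nonneg _) h4).trans (F'.norm_coe_le_norm _))
    (integrable_const _)
    (Eventually.of_forall fun t s _ => h2 t s)).2
  simp only [h1, he0, add_zero] at h3
  have h4 : HasDerivAt (fun s : ℝ => Complex.exp (c * s) * coef F k) (c * coef F k) 0 := by
    have h5 : HasDerivAt (fun s : ℝ => c * (s : ℂ)) c 0 := by
      simpa using (HasDerivAt.ofReal_comp (hasDerivAt_id (0 : ℝ))).const_mul c
    have := (h5.cexp).mul_const (coef F k)
    simpa using this
  exact h3.unique h4

end

section

open Filter Topology ComplexConjugate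
open scoped NNReal ENNReal

variable {ι : Type} {n : ℕ}

/-- Rapid decay in every frequency. -/
def Rap (c : (Fin n → ℤ) → ℂ) : Prop :=
  (∃ C : ℝ, ∀ k, ‖c k‖ ≤ C) ∧ ∀ (j : Fin n) (N : ℕ), ∃ C : ℝ, ∀ k, |(k j : ℝ)| ^ N * ‖c k‖ ≤ C

/-- A summable weight on the lattice. -/
def wt (k : Fin n → ℤ) : ℝ := ∏ i, ((1 + |(k i : ℝ)|) ^ 2)⁻¹

lemma wt_pos (k : Fin n → ℤ) : 0 < wt k := Finset.prod_pos fun i _ => by positivity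

lemma summable_int_weight : Summable fun m : ℤ => ((1 + |(m : ℝ)|) ^ 2)⁻¹ := by
  have h : Summable fun m : ℕ => ((1 + (m : ℝ)) ^ 2)⁻¹ := by
    have := (summable_nat_add_iff 1).2 (Real.summable_nat_pow_inv.2 (one_lt_two : 1 < 2))
    refine this.congr fun m => ?_
    push_cast
    rw [add_comm]
  refine Summable.of_nat_of_neg ?_ ?_
  · refine h.congr fun m => ?_
    simp
  · refine h.congr fun m => ?_
    simp

lemma summable_wt : Summable (wt : (Fin n → ℤ) → ℝ) := by
  refine summable_of_sum_le (c := (∑' m : ℤ, ((1 + |(m : ℝ)|) ^ 2)⁻¹) ^ n)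
    (fun k => (wt_pos k).le) fun s => ?_
  have h1 : s ⊆ Fintype.piFinset fun i => s.image fun k => k i := by
    intro k hk
    rw [Fintype.mem_piFinset]
    exact fun i => Finset.mem_image_of_mem _ hk
  refine (Finset.sum_le_sum_of_subset_of_nonneg h1 fun k _ _ => (wt_pos k).le).trans ?_
  simp only [wt]
  rw [← Finset.prod_univ_sum (fun i => s.image fun k => k i)
    (fun _ (m : ℤ) => ((1 + |(m : ℝ)|) ^ 2)⁻¹)]
  refine (Finset.prod_le_prod (fun i _ => Finset.sum_nonneg fun m _ => by positivity)
    (fun i _ => summable_int_weight.sum_le_tsum _ (fun m _ => by positivity))).trans ?_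
  simp

lemma le_wt_of_bounds (z C : ℝ) (hz : 0 ≤ z) (k : Fin n → ℤ) (h0 : z ≤ C)
    (h : ∀ j, |(k j : ℝ)| ^ (2 * n) * z ≤ C) : z ≤ 4 ^ n * C * wt k := by
  have hw : wt k * ∏ i, (1 + |(k i : ℝ)|) ^ 2 = 1 := by
    rw [wt, ← Finset.prod_mul_distrib]
    exact Finset.prod_eq_one fun i _ => inv_mul_cancel₀ (by positivity)
  suffices h2 : (∏ i, (1 + |(k i : ℝ)|) ^ 2) * z ≤ 4 ^ n * C by
    calc z = wt k * ((∏ i, (1 + |(k i : ℝ)|) ^ 2) * z) := by rw [← mul_assoc, hw, one_mul]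
      _ ≤ wt k * (4 ^ n * C) := mul_le_mul_of_nonneg_left h2 (wt_pos k).le
      _ = _ := by ring
  by_cases hk : ∀ i, |(k i : ℝ)| ≤ 1
  · have : ∏ i, (1 + |(k i : ℝ)|) ^ 2 ≤ ∏ _i : Fin n, (4 : ℝ) :=
      Finset.prod_le_prod (fun i _ => by positivity) fun i _ => by
        nlinarith only [hk i, abs_nonneg (k i : ℝ)]
    rw [Finset.prod_const, Finset.card_univ, Fintype.card_fin] at this
    exact mul_le_mul this h0 hz (by positivity)
  · push Not at hk
    obtain ⟨i₀, hi₀⟩ := hk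
    obtain ⟨j, -, hj⟩ := Finset.exists_max_image Finset.univ (fun i => |(k i : ℝ)|) ⟨i₀, by simp⟩
    have hj1 : 1 ≤ |(k j : ℝ)| := hi₀.le.trans (hj i₀ (by simp))
    have : ∏ i, (1 + |(k i : ℝ)|) ^ 2 ≤ ∏ _i : Fin n, (4 * |(k j : ℝ)| ^ 2) :=
      Finset.prod_le_prod (fun i _ => by positivity) fun i _ => by
        have := hj i (by simp)
        calc (1 + |(k i : ℝ)|) ^ 2 ≤ (2 * |(k j : ℝ)|) ^ 2 := by gcongr; linarith
          _ = _ := by ring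
    rw [Finset.prod_const, Finset.card_univ, Fintype.card_fin, mul_pow, ← pow_mul] at this
    calc _ ≤ 4 ^ n * |(k j : ℝ)| ^ (2 * n) * z := mul_le_mul_of_nonneg_right this hz
      _ = 4 ^ n * (|(k j : ℝ)| ^ (2 * n) * z) := by ring
      _ ≤ _ := mul_le_mul_of_nonneg_left (h j) (by positivity)

lemma Rap.exists_wt {c : (Fin n → ℤ) → ℂ} (h : Rap c) : ∃ C : ℝ, 0 ≤ C ∧ ∀ k, ‖c k‖ ≤ C * wt k := by
  obtain ⟨C₀, h0⟩ := h.1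
  choose C hC using fun j => h.2 j (2 * n)
  obtain ⟨D, hD, hCD⟩ := Data.exists_uniform_le C
  have hC0 : 0 ≤ C₀ := (norm_nonneg _).trans (h0 0)
  refine ⟨4 ^ n * (C₀ + D), by positivity, fun k => ?_⟩
  refine le_wt_of_bounds _ _ (norm_nonneg _) k (by linarith only [h0 k, hD]) fun j => ?_
  linarith only [hC j k, hCD j, hC0]

lemma Rap.summable {c : (Fin n → ℤ) → ℂ} (h : Rap c) : Summable fun k => ‖c k‖ := by
  obtain ⟨C, _, hC⟩ := h.exists_wt
  exact Summable.of_nonneg_of_le (fun _ => norm_nonneg _) hC (summable_wt.mul_left C)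

lemma Rap.mono {c d : (Fin n → ℤ) → ℂ} (h : Rap c) (C : ℝ) (hC : 0 ≤ C)
    (hd : ∀ k, ‖d k‖ ≤ C * ‖c k‖) : Rap d := by
  obtain ⟨C₀, h0⟩ := h.1
  refine ⟨⟨C * C₀, fun k => (hd k).trans (mul_le_mul_of_nonneg_left (h0 k) hC)⟩, fun j N => ?_⟩
  obtain ⟨D, hD⟩ := h.2 j N
  refine ⟨C * D, fun k => ?_⟩
  calc _ ≤ |(k j : ℝ)| ^ N * (C * ‖c k‖) := mul_le_mul_of_nonneg_left (hd k) (by positivity)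
    _ = C * (|(k j : ℝ)| ^ N * ‖c k‖) := by ring
    _ ≤ _ := mul_le_mul_of_nonneg_left (hD k) hC

lemma Rap.freq {c : (Fin n → ℤ) → ℂ} (h : Rap c) (i : Fin n) :
    Rap fun k => 2 * Real.pi * Complex.I * k i * c k := by
  suffices h2 : Rap fun k => (k i : ℂ) * c k by
    refine h2.mono (2 * Real.pi) (by positivity) fun k => ?_
    simp [abs_of_pos Real.pi_pos, mul_assoc]
  refine ⟨?_, fun j N => ?_⟩
  · obtain ⟨C, hC⟩ := h.2 i 1
    refine ⟨C, fun k => ?_⟩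
    simpa using hC k
  · obtain ⟨C, hC⟩ := h.2 i (N + 1)
    obtain ⟨D, hD⟩ := h.2 j (N + 1)
    refine ⟨C + D, fun k => ?_⟩
    have h3 : |(k j : ℝ)| ^ N * |(k i : ℝ)| ≤ |(k i : ℝ)| ^ (N + 1) + |(k j : ℝ)| ^ (N + 1) := by
      rcases le_total |(k j : ℝ)| |(k i : ℝ)| with h' | h'
      · have : |(k j : ℝ)| ^ N * |(k i : ℝ)| ≤ |(k i : ℝ)| ^ (N + 1) := by
          rw [pow_succ]; gcongr
        have h5 : 0 ≤ |(k j : ℝ)| ^ (N + 1) := by positivity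
        linarith only [this, h5]
      · have : |(k j : ℝ)| ^ N * |(k i : ℝ)| ≤ |(k j : ℝ)| ^ (N + 1) := by
          rw [pow_succ]; gcongr
        have h5 : 0 ≤ |(k i : ℝ)| ^ (N + 1) := by positivity
        linarith only [this, h5]
    have h4 := mul_le_mul_of_nonneg_right h3 (norm_nonneg (c k))
    rw [norm_mul, Complex.norm_intCast, ← mul_assoc]
    linarith only [h4, hC k, hD k, add_mul (|(k i : ℝ)| ^ (N + 1)) (|(k j : ℝ)| ^ (N + 1)) ‖c k‖]

/-- A rapidly decaying family as a summable one. -/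
def Rap.toEll {c : (Fin n → ℤ) → ℂ} (h : Rap c) : Ell n :=
  ⟨c, memℓp_gen (by simpa using h.summable)⟩

lemma Rap.toEll_apply {c : (Fin n → ℤ) → ℂ} (h : Rap c) (k : Fin n → ℤ) : h.toEll k = c k := rfl

lemma rap_coef {f : (Fin n → ℝ) → ℝ} (hf : ZPer f) (hs : ContDiff ℝ (⊤ : ℕ∞) f) :
    Rap (coef (lift hf hs.continuous)) := by
  refine ⟨⟨_, norm_coef_le _⟩, fun j N => ?_⟩
  induction N generalizing f with
  | zero => exact ⟨_, fun k => by rw [pow_zero, one_mul]; exact norm_coef_le _ k⟩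
  | succ N ih =>
    obtain ⟨C, hC⟩ := ih (zper_pd hf j) (contDiff_pd hs j)
    refine ⟨C, fun k => le_trans ?_ (hC k)⟩
    rw [coef_pd hf hs]
    have h1 : ‖2 * (Real.pi : ℂ) * Complex.I * k j * coef (lift hf hs.continuous) k‖ =
        2 * Real.pi * (|(k j : ℝ)| * ‖coef (lift hf hs.continuous) k‖) := by
      simp [abs_of_pos Real.pi_pos, mul_assoc]
    rw [h1, pow_succ, mul_assoc]
    refine mul_le_mul_of_nonneg_left ?_ (by positivity)
    refine le_mul_of_one_le_left (by positivity) ?_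
    linarith only [Real.pi_gt_three]

section cE
variable {f : (Fin n → ℝ) → ℝ} (hf : ZPer f) (hs : ContDiff ℝ (⊤ : ℕ∞) f)

/-- The Fourier coefficients of a smooth periodic function. -/
def cE (hf : ZPer f) (hs : ContDiff ℝ (⊤ : ℕ∞) f) : Ell n := (rap_coef hf hs).toEll

lemma rap_cE : Rap (cE hf hs) := rap_coef hf hs

lemma hat_cE : hat (cE hf hs) = lift hf hs.continuous := by
  have := UnitAddTorus.hasSum_mFourier_series_of_summable (f := lift hf hs.continuous)
    (rap_coef hf hs).summable.of_norm
  exact (hasSum_hat (cE hf hs)).unique this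

lemma hat_cE_tor (x : Fin n → ℝ) : hat (cE hf hs) (tor x) = f x := by
  rw [hat_cE, lift_tor]

lemma cE_pd (i : Fin n) (k : Fin n → ℤ) :
    cE (zper_pd hf i) (contDiff_pd hs i) k = 2 * Real.pi * Complex.I * k i * cE hf hs k :=
  coef_pd hf hs i k

lemma cE_zero (h0 : ∫ x in Set.Icc (0 : Fin n → ℝ) 1, f x = 0) : cE hf hs 0 = 0 := by
  have h1 := UnitAddTorus.mFourierCoeff_eq_integral (lift hf hs.continuous) 0 0
  have h2 : cE hf hs 0 = UnitAddTorus.mFourierCoeff (lift hf hs.continuous) 0 := rfl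
  rw [h2, h1]
  have h3 : {x : Fin n → ℝ | ∀ i, x i ∈ Set.Ioc ((0 : Fin n → ℝ) i) ((0 : Fin n → ℝ) i + 1)} =
      Set.univ.pi fun i => Set.Ioc ((0 : Fin n → ℝ) i) ((1 : Fin n → ℝ) i) := by
    ext x; simp [Set.mem_pi]
  have h5 : (Set.univ.pi fun i => Set.Ioc ((0 : Fin n → ℝ) i) ((1 : Fin n → ℝ) i)) =ᵐ[volume]
      Set.Icc (0 : Fin n → ℝ) 1 := Measure.univ_pi_Ioc_ae_eq_Icc
  rw [h3, setIntegral_congr_set h5]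
  have h4 : ∀ x : Fin n → ℝ, UnitAddTorus.mFourier (-0) (fun i => (x i : UnitAddCircle)) •
      lift hf hs.continuous (fun i => (x i : UnitAddCircle)) = (f x : ℂ) := by
    intro x
    rw [neg_zero, UnitAddTorus.mFourier_zero]
    show (1 : ℂ) • lift hf hs.continuous (tor x) = _
    rw [lift_tor, one_smul]
  simp only [h4]
  rw [integral_complex_ofReal, h0, Complex.ofReal_zero]

end cE

end

section

open Filter Topology ComplexConjugate
open scoped NNReal ENNReal

variable {ι : Type} {n : ℕ}

/-- Coefficient families with `p`-summable norms. -/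
abbrev Lq (n : ℕ) (p : ℝ≥0∞) : Type := lp (fun _ : Fin n → ℤ => ℂ) p

section op
variable {p : ℝ≥0∞} [Fact (1 ≤ p)]

lemma toReal_pos_of_fact (hp : p ≠ ⊤) : 0 < p.toReal :=
  ENNReal.toReal_pos (zero_lt_one.trans_le Fact.out).ne' hp

lemma op_summable (hp : p ≠ ⊤) (r : (Fin n → ℤ) → ℂ) (hr : ∀ k, ‖r k‖ ≤ 1) (m : Fin n → ℤ)
    (v : Lq n p) : (Summable fun k => ‖r k * v (k - m)‖ ^ p.toReal) ∧
      ∑' k, ‖r k * v (k - m)‖ ^ p.toReal ≤ ‖v‖ ^ p.toReal := by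
  have hq := toReal_pos_of_fact hp
  have h1 := v.2.summable hq
  have h2 : Summable fun k => ‖v (k - m)‖ ^ p.toReal := (Equiv.subRight m).summable_iff.2 h1
  have h3 : ∀ k, ‖r k * v (k - m)‖ ^ p.toReal ≤ ‖v (k - m)‖ ^ p.toReal := fun k => by
    refine Real.rpow_le_rpow (norm_nonneg _) ?_ hq.le
    rw [norm_mul]
    exact mul_le_of_le_one_left (norm_nonneg _) (hr k)
  have h4 := Summable.of_nonneg_of_le (fun k => by positivity) h3 h2
  refine ⟨h4, (h4.tsum_le_tsum h3 h2).trans ?_⟩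
  rw [lp.norm_rpow_eq_tsum hq v, ← (Equiv.subRight m).tsum_eq fun k => ‖v k‖ ^ p.toReal]
  rfl

/-- The weighted shift `v ↦ (r k * v (k - m))_k`. -/
def op (hp : p ≠ ⊤) (r : (Fin n → ℤ) → ℂ) (hr : ∀ k, ‖r k‖ ≤ 1) (m : Fin n → ℤ) :
    Lq n p →L[ℂ] Lq n p :=
  LinearMap.mkContinuous
    { toFun := fun v => ⟨fun k => r k * v (k - m), memℓp_gen (op_summable hp r hr m v).1⟩
      map_add' := fun v w => by
        ext k
        exact mul_add _ _ _
      map_smul' := fun c v => by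
        ext k
        exact mul_left_comm _ _ _ }
    1 (fun v => by
      rw [one_mul]
      exact lp.norm_le_of_tsum_le (toReal_pos_of_fact hp) (norm_nonneg _)
        (op_summable hp r hr m v).2)

lemma op_apply (hp : p ≠ ⊤) (r : (Fin n → ℤ) → ℂ) (hr : ∀ k, ‖r k‖ ≤ 1) (m : Fin n → ℤ)
    (v : Lq n p) (k : Fin n → ℤ) : op hp r hr m v k = r k * v (k - m) := rfl

lemma norm_op_le (hp : p ≠ ⊤) (r : (Fin n → ℤ) → ℂ) (hr : ∀ k, ‖r k‖ ≤ 1) (m : Fin n → ℤ) :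
    ‖op hp r hr m‖ ≤ 1 := LinearMap.mkContinuous_norm_le _ zero_le_one _

/-- Multiplication by a bounded family. -/
def mul (hp : p ≠ ⊤) (r : (Fin n → ℤ) → ℂ) (hr : ∀ k, ‖r k‖ ≤ 1) : Lq n p →L[ℂ] Lq n p :=
  op hp r hr 0

lemma mul_apply (hp : p ≠ ⊤) (r : (Fin n → ℤ) → ℂ) (hr : ∀ k, ‖r k‖ ≤ 1)
    (v : Lq n p) (k : Fin n → ℤ) : mul hp r hr v k = r k * v k := by
  rw [mul, op_apply, sub_zero]

/-- The symbol of the translation by `x`. -/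
def chr (x : Fin n → ℝ) (k : Fin n → ℤ) : ℂ := Complex.exp (frq k x)

lemma norm_chr (x : Fin n → ℝ) (k : Fin n → ℤ) : ‖chr x k‖ = 1 := by
  have : frq k x = ((2 * Real.pi * ∑ i, (k i : ℝ) * x i : ℝ) : ℂ) * Complex.I := by
    simp only [frq]; push_cast; ring
  rw [chr, this, Complex.norm_exp_ofReal_mul_I]

lemma chr_zero (k : Fin n → ℤ) : chr 0 k = 1 := by simp [chr, frq]

lemma chr_mul_neg (x : Fin n → ℝ) (k : Fin n → ℤ) : chr x k * chr (-x) k = 1 := by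
  rw [chr, chr, ← Complex.exp_add]
  simp [frq]

lemma chr_sub (x : Fin n → ℝ) (k m : Fin n → ℤ) : chr x (k - m) * chr x m = chr x k := by
  rw [chr, chr, chr, ← Complex.exp_add]
  congr 1
  simp only [frq, Pi.sub_apply, Int.cast_sub, sub_mul, Finset.sum_sub_distrib]
  ring

/-- Translation on the Fourier side. -/
def tau (hp : p ≠ ⊤) (x : Fin n → ℝ) : Lq n p →L[ℂ] Lq n p :=
  mul hp (chr x) fun k => (norm_chr x k).le

lemma tau_apply (hp : p ≠ ⊤) (x : Fin n → ℝ) (v : Lq n p) (k : Fin n → ℤ) :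
    tau hp x v k = chr x k * v k := mul_apply _ _ _ _ _

lemma tau_zero (hp : p ≠ ⊤) (v : Lq n p) : tau hp 0 v = v := by
  ext k; rw [tau_apply, chr_zero, one_mul]

lemma tau_neg_tau (hp : p ≠ ⊤) (x : Fin n → ℝ) (v : Lq n p) : tau hp (-x) (tau hp x v) = v := by
  ext k; rw [tau_apply, tau_apply, ← mul_assoc, mul_comm (chr (-x) k), chr_mul_neg, one_mul]

lemma norm_tau_le (hp : p ≠ ⊤) (x : Fin n → ℝ) (v : Lq n p) : ‖tau hp x v‖ ≤ ‖v‖ := by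
  have := (tau hp x).le_opNorm v
  exact this.trans (mul_le_of_le_one_left (norm_nonneg _) (norm_op_le hp (chr x)
    (fun k => (norm_chr x k).le) 0))

end op

lemma tau_hasSum (x : Fin n → ℝ) (c : Ell n) :
    HasSum (fun k => (chr x k * c k) • (lp.single 1 k 1 : Ell n)) (tau ENNReal.one_ne_top x c) := by
  convert! lp.hasSum_single ENNReal.one_ne_top (tau ENNReal.one_ne_top x c) using 1
  funext k
  rw [tau_apply, ← lp.single_smul, smul_eq_mul, mul_one]

/-- The frequency as a continuous linear form. -/
def frqL (k : Fin n → ℤ) : (Fin n → ℝ) →L[ℝ] ℂ :=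
  ∑ j, (ContinuousLinearMap.proj (R := ℝ) (φ := fun _ : Fin n => ℝ) j).smulRight
    (2 * Real.pi * Complex.I * k j : ℂ)

lemma frqL_apply (k : Fin n → ℤ) (x : Fin n → ℝ) : frqL k x = frq k x := by
  simp only [frqL, frq, _root_.sum_apply, ContinuousLinearMap.smulRight_apply,
    ContinuousLinearMap.proj_apply, Complex.real_smul, Finset.mul_sum]
  exact Finset.sum_congr rfl fun j _ => by ring

lemma real_smul_ell (y : ℝ) (v : Ell n) : y • v = (y : ℂ) • v := by
  ext k
  exact Complex.real_smul

lemma hasFDerivAt_tau {c : Ell n} (hc : Rap c) (x : Fin n → ℝ) :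
    HasFDerivAt (fun x => tau ENNReal.one_ne_top x c)
      (∑ j, (ContinuousLinearMap.proj (R := ℝ) (φ := fun _ : Fin n => ℝ) j).smulRight
        (tau ENNReal.one_ne_top x (hc.freq j).toEll)) x := by
  set e : (Fin n → ℤ) → Ell n := fun k => lp.single 1 k 1
  set g' : (Fin n → ℤ) → (Fin n → ℝ) → ((Fin n → ℝ) →L[ℝ] Ell n) := fun k x =>
    ∑ j, (ContinuousLinearMap.proj (R := ℝ) (φ := fun _ : Fin n => ℝ) j).smulRight
      ((chr x k * (hc.freq j).toEll k) • e k)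
  have h1 : ∀ k x, HasFDerivAt (fun x => (chr x k * c k) • e k) (g' k x) x := by
    intro k x
    have h2 : HasFDerivAt (fun x => chr x k) (chr x k • frqL k) x := by
      have := ((frqL k).hasFDerivAt (x := x)).cexp
      simp only [frqL_apply] at this
      exact this
    have h3 := (h2.mul_const (c k)).smul_const (e k)
    convert! h3 using 1
    ext1 y
    simp only [g', _root_.sum_apply, ContinuousLinearMap.smulRight_apply,
      ContinuousLinearMap.proj_apply, _root_.smul_apply, frqL_apply, frq, Rap.toEll_apply,
      real_smul_ell, smul_smul, smul_eq_mul]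
    rw [← Finset.sum_smul]
    congr 1
    simp only [Finset.mul_sum]
    exact Finset.sum_congr rfl fun j _ => by ring
  set u : (Fin n → ℤ) → ℝ := fun k => ∑ j, ‖(hc.freq j).toEll k‖
  have hu : Summable u := summable_sum fun j _ => (hc.freq j).summable
  have h2 : ∀ k x, ‖g' k x‖ ≤ u k := by
    intro k x
    refine (norm_sum_le _ _).trans (Finset.sum_le_sum fun j _ => ?_)
    rw [ContinuousLinearMap.norm_smulRight_apply]
    refine (mul_le_of_le_one_left (norm_nonneg _) ?_).trans ?_
    · refine ContinuousLinearMap.opNorm_le_bound _ zero_le_one fun y => ?_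
      rw [one_mul]; exact norm_le_pi_norm y j
    · rw [norm_smul, norm_mul, norm_chr, one_mul]
      simp only [e]
      rw [lp.norm_single (by simp), norm_one, mul_one]
  have h3 := hasFDerivAt_tsum hu h1 h2 (x₀ := x) (tau_hasSum x c).summable x
  have h4 : HasSum (fun k => g' k x) (∑ j,
      (ContinuousLinearMap.proj (R := ℝ) (φ := fun _ : Fin n => ℝ) j).smulRight
        (tau ENNReal.one_ne_top x (hc.freq j).toEll)) :=
    hasSum_sum fun j _ => (ContinuousLinearMap.smulRightL ℝ (Fin n → ℝ) (Ell n)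
      (ContinuousLinearMap.proj (R := ℝ) (φ := fun _ : Fin n => ℝ) j)).hasSum
        (tau_hasSum x (hc.freq j).toEll)
  rw [h4.tsum_eq] at h3
  convert! h3 using 1
  funext y
  exact (tau_hasSum y c).tsum_eq.symm

lemma contDiff_tau {c : Ell n} (hc : Rap c) :
    ContDiff ℝ (⊤ : ℕ∞) (fun x => tau ENNReal.one_ne_top x c) := by
  rw [contDiff_infty]
  intro N
  induction N generalizing c with
  | zero =>
    rw [Nat.cast_zero, contDiff_zero]
    exact continuous_iff_continuousAt.2 fun x => (hasFDerivAt_tau hc x).continuousAt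
  | succ N ih =>
    rw [Nat.cast_succ, contDiff_succ_iff_hasFDerivAt]
    refine ⟨_, ?_, hasFDerivAt_tau hc⟩
    refine ContDiff.sum fun j _ => ?_
    exact (ContinuousLinearMap.smulRightL ℝ (Fin n → ℝ) (Ell n)
      (ContinuousLinearMap.proj (R := ℝ) (φ := fun _ : Fin n => ℝ) j)).contDiff.comp
        (ih (c := (hc.freq j).toEll) (hc.freq j))

lemma hat_tau (x : Fin n → ℝ) (c : Ell n) (t : UnitAddTorus (Fin n)) :
    hat (tau ENNReal.one_ne_top x c) t = hat c (t + tor x) := by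
  have h1 := (ContinuousMap.evalCLM ℂ t).hasSum (hasSum_hat (tau ENNReal.one_ne_top x c))
  have h2 := (ContinuousMap.evalCLM ℂ (t + tor x)).hasSum (hasSum_hat c)
  refine h1.unique ?_
  convert! h2 using 1
  funext k
  show tau ENNReal.one_ne_top x c k • UnitAddTorus.mFourier k t =
    c k • UnitAddTorus.mFourier k (t + tor x)
  rw [tau_apply, mFourier_add_arg, mFourier_tor, chr]
  simp only [smul_eq_mul]
  ring

/-- The real function with given Fourier coefficients. -/
def syn (c : Ell n) (x : Fin n → ℝ) : ℝ := (hat c (tor x)).re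

lemma zper_syn (c : Ell n) : ZPer (syn c) := by
  intro x k
  have : tor (x + fun i => (k i : ℝ)) = tor x := by
    funext i
    show ((x i + k i : ℝ) : UnitAddCircle) = x i
    have h : ((k i : ℝ) : UnitAddCircle) = 0 := by
      rw [AddCircle.coe_eq_zero_iff]
      exact ⟨k i, by simp⟩
    rw [AddCircle.coe_add, h, add_zero]
  rw [syn, syn, this]

lemma contDiff_syn {c : Ell n} (hc : Rap c) : ContDiff ℝ (⊤ : ℕ∞) (syn c) := by
  have h : syn c = fun x => (hat (tau ENNReal.one_ne_top x c) 0).re := by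
    funext x
    rw [hat_tau, zero_add, syn]
  rw [h]
  have h1 : ContDiff ℝ (⊤ : ℕ∞) fun x => (((Complex.reCLM.comp
      ((ContinuousMap.evalCLM ℂ (0 : UnitAddTorus (Fin n))).restrictScalars ℝ)).comp
        (hat.restrictScalars ℝ))) (tau ENNReal.one_ne_top x c) :=
    (ContinuousLinearMap.contDiff _).comp (contDiff_tau hc)
  exact h1

lemma cE_syn {c : Ell n} (hc : Rap c) (hr : star (hat c) = hat c) :
    cE (zper_syn c) (contDiff_syn hc) = c := by
  apply hat_injective
  ext t
  obtain ⟨x, rfl⟩ := tor_quot.surjective t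
  rw [hat_cE_tor, syn]
  have : conj (hat c (tor x)) = hat c (tor x) := DFunLike.congr_fun hr (tor x)
  exact Complex.conj_eq_iff_re.1 this

end

section

open Filter Topology ComplexConjugate
open scoped NNReal ENNReal

variable {ι : Type} {n : ℕ}

lemma iteratedDeriv_exp_mul (c z : ℂ) (N : ℕ) :
    iteratedDeriv N (fun h : ℝ => Complex.exp (c * h) * z) =
      fun h : ℝ => c ^ N * (Complex.exp (c * h) * z) := by
  induction N with
  | zero => simp
  | succ N ih =>
    rw [iteratedDeriv_succ, ih]
    funext h
    have h5 : HasDerivAt (fun s : ℝ => c * (s : ℂ)) c h := by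
      simpa using (HasDerivAt.ofReal_comp (hasDerivAt_id h)).const_mul c
    rw [((h5.cexp.mul_const z).const_mul (c ^ N)).deriv]
    ring

/-- Components of a smooth curve that oscillate with frequency `m` decay rapidly in `m`. -/
lemma decay_of_contDiffAt {X : Type*} [NormedAddCommGroup X] [NormedSpace ℝ X] {f : ℝ → X}
    (hf : ContDiffAt ℝ (⊤ : ℕ∞) f 0) (N : ℕ) :
    ∃ C : ℝ, 0 ≤ C ∧ ∀ T : X →L[ℝ] ℂ, ‖T‖ ≤ 1 → ∀ (m : ℤ) (z : ℂ),
      (∀ᶠ h in 𝓝 (0 : ℝ), T (f h) = Complex.exp (2 * Real.pi * Complex.I * m * h) * z) →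
        |(m : ℝ)| ^ N * ‖z‖ ≤ C := by
  refine ⟨‖iteratedFDeriv ℝ N f 0‖, norm_nonneg _, fun T hT m z h => ?_⟩
  have h1 := T.norm_iteratedFDeriv_comp_left (hf.of_le (m := (N : ℕ∞)) (by exact_mod_cast le_top))
    (n := N) le_rfl
  rw [norm_iteratedFDeriv_eq_norm_iteratedDeriv] at h1
  have h2 : iteratedDeriv N (T ∘ f) 0 = _ := Filter.EventuallyEq.iteratedDeriv_eq N h
  rw [h2, iteratedDeriv_exp_mul] at h1
  have h3 : ‖(2 * (Real.pi : ℂ) * Complex.I * m) ^ N *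
      (Complex.exp (2 * Real.pi * Complex.I * m * (0 : ℝ)) * z)‖ =
      (2 * Real.pi) ^ N * (|(m : ℝ)| ^ N * ‖z‖) := by
    simp [abs_of_pos Real.pi_pos, mul_pow]
    ring
  rw [h3] at h1
  have h4 : |(m : ℝ)| ^ N * ‖z‖ ≤ (2 * Real.pi) ^ N * (|(m : ℝ)| ^ N * ‖z‖) :=
    le_mul_of_one_le_left (by positivity)
      (one_le_pow₀ (by linarith only [Real.pi_gt_three]))
  exact h4.trans (h1.trans (mul_le_of_le_one_left (norm_nonneg _) hT))

section cnv
variable {p : ℝ≥0∞} [Fact (1 ≤ p)] (hp : p ≠ ⊤)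

/-- Convolution of a summable family with a `p`-summable one. -/
def cnv (hp : p ≠ ⊤) : Ell n →L[ℂ] Lq n p →L[ℂ] Lq n p :=
  ell (fun m => op hp (fun _ => 1) (fun _ => norm_one.le) m) 1 fun _ => norm_op_le _ _ _ _

lemma hasSum_cnv (c : Ell n) (v : Lq n p) (k : Fin n → ℤ) :
    HasSum (fun m => c m * v (k - m)) (cnv hp c v k) := by
  have h1 := hasSum_ell (fun m => op hp (fun _ => 1) (fun _ => norm_one.le) m) 1
    (fun _ => norm_op_le _ _ _ _) c
  have h2 := ((lp.evalCLM ℂ (fun _ => ℂ) p k).comp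
    (ContinuousLinearMap.apply ℂ (Lq n p) v)).hasSum h1
  convert! h2 using 1
  funext m
  show c m * v (k - m) = c m * (op hp (fun _ => 1) (fun _ => norm_one.le) m v k)
  rw [op_apply, one_mul]

lemma tau_cnv (x : Fin n → ℝ) (c : Ell n) (v : Lq n p) :
    tau hp x (cnv hp c v) = cnv hp (tau ENNReal.one_ne_top x c) (tau hp x v) := by
  ext k
  refine HasSum.unique ?_ (hasSum_cnv hp _ _ k)
  rw [tau_apply]
  convert! (hasSum_cnv hp c v k).mul_left (chr x k) using 1
  funext m
  rw [tau_apply, tau_apply, ← chr_sub x k m]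
  ring

lemma tau_mul (x : Fin n → ℝ) (r : (Fin n → ℤ) → ℂ) (hr : ∀ k, ‖r k‖ ≤ 1) (v : Lq n p) :
    tau hp x (mul hp r hr v) = mul hp r hr (tau hp x v) := by
  ext k
  simp only [tau_apply, mul_apply]
  ring

end cnv

lemma hat_cnv (c v : Ell n) : hat (cnv ENNReal.one_ne_top c v) = hat c * hat v := by
  have h1 : ∀ m, (hat : Ell n →L[ℂ] _).comp
      (op ENNReal.one_ne_top (fun _ => 1) (fun _ => norm_one.le) m) =
      (ContinuousLinearMap.mul ℂ C(UnitAddTorus (Fin n), ℂ) (UnitAddTorus.mFourier m)).comp hat := by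
    intro m
    refine lp.ext_continuousLinearMap ENNReal.one_ne_top fun k => ?_
    ext1
    show hat (op ENNReal.one_ne_top (fun _ => 1) (fun _ => norm_one.le) m (lp.single 1 k 1)) =
      UnitAddTorus.mFourier m * hat (lp.single 1 k 1)
    rw [hat_single, one_smul, mFourier_mul, ← one_smul ℂ (UnitAddTorus.mFourier (m + k)),
      ← hat_single]
    congr 1
    ext l
    rw [op_apply, one_mul, lp.single_apply, lp.single_apply, Pi.single_apply, Pi.single_apply]
    exact if_congr ⟨fun h => by rw [← h, add_sub_cancel], fun h => by rw [h, add_sub_cancel_left]⟩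
      rfl rfl
  have h2 := hasSum_ell (fun m => op (n := n) ENNReal.one_ne_top (fun _ => 1)
    (fun _ => norm_one.le) m) 1 (fun _ => norm_op_le _ _ _ _) c
  have h3 := (hat.comp (ContinuousLinearMap.apply ℂ (Ell n) v)).hasSum h2
  have h4 := ((ContinuousLinearMap.mul ℂ C(UnitAddTorus (Fin n), ℂ)).flip (hat v)).hasSum
    (hasSum_hat c)
  refine h3.unique ?_
  convert! h4 using 1
  funext m
  have := DFunLike.congr_fun (h1 m) v
  show hat (c m • op ENNReal.one_ne_top (fun _ => 1) (fun _ => norm_one.le) m v) =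
    (c m • UnitAddTorus.mFourier m) * hat v
  rw [map_smul, smul_mul_assoc]
  congr 1

/-- The inclusion of summable into square summable families. -/
def inc : Ell n →ₗ[ℂ] Lq n 2 := lp.linearMapOfLE ℂ (fun _ => ℂ) (by norm_num)

lemma inc_apply (c : Ell n) (k : Fin n → ℤ) : inc c k = c k := rfl

lemma inc_injective : Function.Injective (inc : Ell n → Lq n 2) := by
  intro c d h
  ext k
  rw [← inc_apply, h, inc_apply]

lemma inc_cnv (c v : Ell n) :
    inc (cnv ENNReal.one_ne_top c v) = cnv ENNReal.ofNat_ne_top c (inc v) := by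
  ext k
  exact (hasSum_cnv ENNReal.one_ne_top c v k).unique (hasSum_cnv ENNReal.ofNat_ne_top c (inc v) k)

lemma inc_mul (r : (Fin n → ℤ) → ℂ) (hr : ∀ k, ‖r k‖ ≤ 1) (v : Ell n) :
    inc (mul ENNReal.one_ne_top r hr v) = mul ENNReal.ofNat_ne_top r hr (inc v) := by
  ext k
  rw [inc_apply, mul_apply, mul_apply, inc_apply]

lemma dense_inc (v : Lq n 2) : v ∈ closure (Set.range (inc : Ell n → Lq n 2)) := by
  refine mem_closure_of_tendsto (lp.hasSum_single ENNReal.ofNat_ne_top v) (Eventually.of_forall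
    fun s => ⟨∑ k ∈ s, lp.single 1 k (v k), ?_⟩)
  rw [map_sum]
  refine Finset.sum_congr rfl fun k _ => ?_
  ext m
  rw [inc_apply, lp.single_apply, lp.single_apply]

/-- The squared length of a frequency. -/
def nsq (k : Fin n → ℤ) : ℝ := ∑ i, (k i : ℝ) ^ 2

lemma nsq_pos {k : Fin n → ℤ} (hk : k ≠ 0) : 0 < nsq k := by
  obtain ⟨i, hi⟩ := Function.ne_iff.1 hk
  refine Finset.sum_pos' (fun i _ => sq_nonneg _) ⟨i, Finset.mem_univ _, ?_⟩
  have : (k i : ℝ) ≠ 0 := by exact_mod_cast hi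
  positivity

/-- The symbol of the second order Riesz transforms. -/
def rsy (i j : Fin n) (k : Fin n → ℤ) : ℝ := k i * k j / nsq k

lemma sum_rsy_sq {k : Fin n → ℤ} (hk : k ≠ 0) : ∑ i, ∑ j, rsy i j k ^ 2 = 1 := by
  have h := (nsq_pos hk).ne'
  simp only [rsy, div_pow, mul_pow, ← Finset.sum_div, ← Finset.mul_sum, ← Finset.sum_mul]
  rw [div_eq_one_iff_eq (by positivity)]
  simp only [nsq]; ring

lemma rsy_zero (i j : Fin n) : rsy i j (0 : Fin n → ℤ) = 0 := by simp [rsy]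

lemma norm_rsy_le (i j : Fin n) (k : Fin n → ℤ) : ‖(rsy i j k : ℂ)‖ ≤ 1 := by
  rw [Complex.norm_real]
  by_cases hk : k = 0
  · subst hk; rw [rsy_zero, norm_zero]; exact zero_le_one
  · rw [Real.norm_eq_abs, ← sq_le_one_iff_abs_le_one, ← sum_rsy_sq hk]
    refine (Finset.single_le_sum (f := fun j => rsy i j k ^ 2) (fun _ _ => sq_nonneg _)
      (Finset.mem_univ j)).trans ?_
    exact Finset.single_le_sum (f := fun i => ∑ j, rsy i j k ^ 2)
      (fun _ _ => Finset.sum_nonneg fun _ _ => sq_nonneg _) (Finset.mem_univ i)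

section K
variable {p : ℝ≥0∞} [Fact (1 ≤ p)] (hp : p ≠ ⊤)

/-- The second order Riesz transform. -/
def Rz (hp : p ≠ ⊤) (i j : Fin n) : Lq n p →L[ℂ] Lq n p :=
  mul hp (fun k => (rsy i j k : ℂ)) (norm_rsy_le i j)

/-- The projection to the constant mode. -/
def Pz (hp : p ≠ ⊤) : Lq n p →L[ℂ] Lq n p :=
  mul hp (fun k => if k = 0 then 1 else 0) fun k => by split_ifs <;> simp

lemma Rz_apply (i j : Fin n) (v : Lq n p) (k : Fin n → ℤ) :
    Rz hp i j v k = (rsy i j k : ℂ) * v k := mul_apply _ _ _ _ _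

lemma Pz_apply (v : Lq n p) (k : Fin n → ℤ) :
    Pz hp v k = if k = 0 then v k else 0 := by
  rw [Pz, mul_apply]; split_ifs <;> simp

/-- The linearisation of Abreu's operator in Fourier variables. -/
def Kop (hp : p ≠ ⊤) (a : Fin n → Fin n → Ell n) : Lq n p →L[ℂ] Lq n p :=
  (∑ i, ∑ j, ∑ s, ∑ r, Rz hp i j ∘L cnv hp (a i s) ∘L cnv hp (a j r) ∘L Rz hp s r) + Pz hp

lemma Kop_apply (a : Fin n → Fin n → Ell n) (v : Lq n p) : Kop hp a v =
    (∑ i, ∑ j, ∑ s, ∑ r, Rz hp i j (cnv hp (a i s) (cnv hp (a j r) (Rz hp s r v)))) + Pz hp v := by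
  simp only [Kop, _root_.add_apply, _root_.sum_apply, ContinuousLinearMap.comp_apply]

lemma tau_Kop (x : Fin n → ℝ) (a : Fin n → Fin n → Ell n) (v : Lq n p) :
    tau hp x (Kop hp a v) =
      Kop hp (fun i j => tau ENNReal.one_ne_top x (a i j)) (tau hp x v) := by
  simp only [Kop_apply, map_add, map_sum, Rz, Pz, tau_mul, tau_cnv]

end K

lemma inc_Kop (a : Fin n → Fin n → Ell n) (v : Ell n) :
    inc (Kop ENNReal.one_ne_top a v) = Kop ENNReal.ofNat_ne_top a (inc v) := by
  simp only [Kop_apply, map_add, map_sum, Rz, Pz, inc_mul, inc_cnv]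

end

section

open Filter Topology ComplexConjugate
open scoped NNReal ENNReal

variable {ι : Type} {n : ℕ}

lemma inner_inc (c d : Ell n) : inner ℂ (inc c) (inc d) = mean (star (hat c) * hat d) := by
  refine (lp.hasSum_inner (inc c) (inc d)).unique ?_
  convert! hasSum_parseval c d using 1
  funext k
  rw [inc_apply, inc_apply, RCLike.inner_apply, mul_comm]

lemma mean_Rz (i j : Fin n) (c d : Ell n) :
    mean (star (hat c) * hat (Rz ENNReal.one_ne_top i j d)) =
      mean (star (hat (Rz ENNReal.one_ne_top i j c)) * hat d) := by
  refine (hasSum_parseval _ _).unique ?_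
  convert! hasSum_parseval (Rz ENNReal.one_ne_top i j c) d using 1
  funext k
  rw [Rz_apply, Rz_apply, map_mul, Complex.conj_ofReal]
  ring

lemma mean_re_le (E F : C(UnitAddTorus (Fin n), ℂ)) (h : ∀ t, (E t).re ≤ (F t).re) :
    (mean E).re ≤ (mean F).re := by
  have h1 : ∀ G : C(UnitAddTorus (Fin n), ℂ), (mean G).re = ∫ t, (G t).re ∂torMeas n := fun G => by
    rw [mean_apply]
    exact (Complex.reCLM.integral_comp_comm (integrable_tor G)).symm
  rw [h1, h1]
  exact integral_mono (Complex.reCLM.integrable_comp (integrable_tor E))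
    (Complex.reCLM.integrable_comp (integrable_tor F)) h

/-- Uniform positivity of the symbol `Z ↦ a Z a`. -/
def Coer (γ : ℝ) (a : Fin n → Fin n → Ell n) : Prop :=
  ∀ (t : UnitAddTorus (Fin n)) (Z : Fin n → Fin n → ℂ),
    γ * ∑ i, ∑ j, (conj (Z i j) * Z i j).re ≤
      (∑ i, ∑ j, ∑ s, ∑ r, conj (Z i j) * (hat (a i s) t * (hat (a j r) t * Z s r))).re

lemma re_conj_mul (z : ℂ) : (conj z * z).re = ‖z‖ ^ 2 := by
  rw [mul_comm, Complex.mul_conj, Complex.ofReal_re, Complex.normSq_eq_norm_sq]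

section coercive
variable {γ : ℝ} {a : Fin n → Fin n → Ell n}

lemma coercive_inc (h0 : 0 ≤ γ) (h1 : γ ≤ 1) (ha : Coer γ a) (x : Ell n) :
    γ * ‖inc x‖ ^ 2 ≤ (inner ℂ (inc x) (Kop ENNReal.ofNat_ne_top a (inc x))).re := by
  set Z : Fin n → Fin n → Ell n := fun i j => Rz ENNReal.one_ne_top i j x
  set F : C(UnitAddTorus (Fin n), ℂ) := ∑ i, ∑ j, ∑ s, ∑ r,
    star (hat (Z i j)) * (hat (a i s) * (hat (a j r) * hat (Z s r)))
  set E : C(UnitAddTorus (Fin n), ℂ) := ∑ i, ∑ j, star (hat (Z i j)) * hat (Z i j)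
  set p := mean (star (hat x) * hat (Pz ENNReal.one_ne_top x))
  have h2 : inner ℂ (inc x) (Kop ENNReal.ofNat_ne_top a (inc x)) = mean F + p := by
    rw [← inc_Kop, inner_inc, Kop_apply]
    simp only [F, p, Z, map_add, map_sum, mul_add, Finset.mul_sum, mean_Rz, hat_cnv]
  have h3 : γ * (mean E).re ≤ (mean F).re := by
    have := mean_re_le ((γ : ℂ) • E) F fun t => by
      rw [ContinuousMap.smul_apply, smul_eq_mul, Complex.re_ofReal_mul]
      have := ha t fun i j => hat (Z i j) t
      simp only [E, F, ContinuousMap.coe_sum, Finset.sum_apply, ContinuousMap.mul_apply,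
        ContinuousMap.star_apply, Complex.re_sum] at this ⊢
      exact this
    rwa [map_smul, smul_eq_mul, Complex.re_ofReal_mul] at this
  have h4 : ‖inc x‖ ^ 2 = (mean (star (hat x) * hat x)).re := by
    rw [← inner_inc]; exact (inner_self_eq_norm_sq (𝕜 := ℂ) (inc x)).symm
  have h5 : HasSum (fun k => γ * (∑ i, ∑ j, (conj (Z i j k) * Z i j k)).re +
      (conj (x k) * Pz ENNReal.one_ne_top x k).re - γ * (conj (x k) * x k).re)
      (γ * (mean E).re + p.re - γ * (mean (star (hat x) * hat x)).re) := by
    have e1 : HasSum (fun k => ∑ i, ∑ j, (conj (Z i j k) * Z i j k)) (mean E) := by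
      simp only [E, map_sum]
      exact hasSum_sum fun i _ => hasSum_sum fun j _ => hasSum_parseval _ _
    exact (((Complex.hasSum_re e1).mul_left γ).add (Complex.hasSum_re (hasSum_parseval _ _))).sub
      ((Complex.hasSum_re (hasSum_parseval x x)).mul_left γ)
  have h6 := h5.nonneg fun k => by
    simp only [Complex.re_sum, re_conj_mul]
    by_cases hk : k = 0
    · have e1 : (conj (x k) * Pz ENNReal.one_ne_top x k).re = ‖x k‖ ^ 2 := by
        rw [Pz_apply, if_pos hk, re_conj_mul]
      have e2 : 0 ≤ γ * ∑ i, ∑ j, ‖Z i j k‖ ^ 2 :=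
        mul_nonneg h0 (Finset.sum_nonneg fun i _ => Finset.sum_nonneg fun j _ => by positivity)
      have e3 : γ * ‖x k‖ ^ 2 ≤ ‖x k‖ ^ 2 := mul_le_of_le_one_left (by positivity) h1
      rw [e1]
      linarith only [e2, e3]
    · have e2 : ∑ i, ∑ j, ‖Z i j k‖ ^ 2 = ‖x k‖ ^ 2 := by
        rw [← one_mul (‖x k‖ ^ 2), ← sum_rsy_sq hk, Finset.sum_mul]
        refine Finset.sum_congr rfl fun i _ => ?_
        rw [Finset.sum_mul]
        refine Finset.sum_congr rfl fun j _ => ?_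
        simp only [Z]
        rw [Rz_apply, norm_mul, mul_pow, Complex.norm_real, Real.norm_eq_abs, sq_abs]
      rw [e2, Pz_apply, if_neg hk, mul_zero, Complex.zero_re]
      linarith only
  rw [h2, Complex.add_re, h4]
  linarith only [h3, h6]

lemma coercive_Kop (h0 : 0 ≤ γ) (h1 : γ ≤ 1) (ha : Coer γ a) (v : Lq n 2) :
    γ * ‖v‖ ^ 2 ≤ (inner ℂ v (Kop ENNReal.ofNat_ne_top a v)).re := by
  have hc : IsClosed {v : Lq n 2 | γ * ‖v‖ ^ 2 ≤
      (inner ℂ v (Kop ENNReal.ofNat_ne_top a v)).re} :=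
    isClosed_le (by fun_prop) (Complex.continuous_re.comp (by fun_prop))
  refine hc.closure_subset_iff.2 ?_ (dense_inc v)
  rintro _ ⟨x, rfl⟩
  exact coercive_inc h0 h1 ha x

lemma isUnit_Kop (h0 : 0 < γ) (h1 : γ ≤ 1) (ha : Coer γ a) :
    IsUnit (Kop (n := n) (p := 2) ENNReal.ofNat_ne_top a) := by
  refine ContinuousLinearMap.isUnit_of_forall_le_norm_inner_map _ (c := ⟨γ, h0.le⟩) h0 fun v => ?_
  rw [← norm_inner_symm, mul_comm]
  exact (coercive_Kop h0.le h1 ha v).trans (Complex.re_le_norm _)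

end coercive

section tau
variable {p : ℝ≥0∞} [Fact (1 ≤ p)] (hp : p ≠ ⊤)

/-- Translations are invertible. -/
def tauU (hp : p ≠ ⊤) (x : Fin n → ℝ) : (Lq n p →L[ℂ] Lq n p)ˣ where
  val := tau hp x
  inv := tau hp (-x)
  val_inv := by
    ext1 v
    have := tau_neg_tau hp (-x) v
    rw [neg_neg] at this
    exact this
  inv_val := by
    ext1 v
    exact tau_neg_tau hp x v

lemma inverse_Kop_tau (x : Fin n → ℝ) {a : Fin n → Fin n → Ell n} (hu : IsUnit (Kop hp a)) :
    Ring.inverse (Kop hp (fun i j => tau ENNReal.one_ne_top x (a i j))) =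
      tau hp x * Ring.inverse (Kop hp a) * tau hp (-x) := by
  obtain ⟨u, hu⟩ := hu
  have h1 : Kop hp (fun i j => tau ENNReal.one_ne_top x (a i j)) =
      ((tauU hp x * u * (tauU hp x)⁻¹ : (Lq n p →L[ℂ] Lq n p)ˣ) : Lq n p →L[ℂ] Lq n p) := by
    rw [Units.val_mul, Units.eq_mul_inv_iff_mul_eq, Units.val_mul, hu]
    ext1 v
    exact (tau_Kop hp x a v).symm
  rw [h1, ← hu, Ring.inverse_unit, Ring.inverse_unit, _root_.mul_inv_rev, inv_inv,
    _root_.mul_inv_rev, Units.val_mul, Units.val_mul, ← mul_assoc]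
  rfl

lemma contDiff_Kop_tau {a : Fin n → Fin n → Ell n} (ha : ∀ i j, Rap (a i j)) :
    ContDiff ℝ (⊤ : ℕ∞) fun x : Fin n → ℝ => Kop hp
      (fun i j => tau ENNReal.one_ne_top x (a i j)) := by
  have h1 : ∀ i j, ContDiff ℝ (⊤ : ℕ∞) fun x : Fin n → ℝ =>
      cnv hp (tau ENNReal.one_ne_top x (a i j)) := fun i j =>
    ((cnv hp).restrictScalars ℝ).contDiff.comp (contDiff_tau (ha i j))
  unfold Kop
  refine ContDiff.add (ContDiff.sum fun i _ => ContDiff.sum fun j _ => ContDiff.sum fun s _ =>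
    ContDiff.sum fun r _ => ?_) contDiff_const
  exact contDiff_const.mul ((h1 i s).mul ((h1 j r).mul contDiff_const))

end tau

section inverse
variable {a : Fin n → Fin n → Ell n} (ha : ∀ i j, Rap (a i j))
  (hu : IsUnit (Kop (n := n) (p := 2) ENNReal.ofNat_ne_top a))

lemma chr_single (j : Fin n) (h : ℝ) (k : Fin n → ℤ) :
    chr (Pi.single j h) k = Complex.exp (2 * Real.pi * Complex.I * k j * h) := by
  rw [chr, frq]
  congr 1
  rw [Finset.sum_eq_single j (fun i _ hi => by rw [Pi.single_eq_of_ne hi]; simp) (by simp),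
    Pi.single_eq_same, ← mul_assoc]

lemma chr_neg (x : Fin n → ℝ) (k : Fin n → ℤ) : chr (-x) k = chr x (-k) := by
  simp [chr, frq]

lemma chr_mul (x : Fin n → ℝ) (k m : Fin n → ℤ) : chr x k * chr x m = chr x (k + m) := by
  rw [← chr_sub x (k + m) m, add_sub_cancel_right]

include ha hu in
lemma inverse_decay_one (j : Fin n) (N : ℕ) : ∃ C : ℝ, 0 ≤ C ∧ ∀ k m : Fin n → ℤ,
    |((k - m) j : ℝ)| ^ N * ‖Ring.inverse (Kop (p := 2) ENNReal.ofNat_ne_top a)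
      (lp.single 2 m 1) k‖ ≤ C := by
  set J := Ring.inverse (Kop (p := 2) ENNReal.ofNat_ne_top a)
  have h1 : ContDiff ℝ (⊤ : ℕ∞) fun h : ℝ => Kop (p := 2) ENNReal.ofNat_ne_top
      (fun i s => tau ENNReal.one_ne_top (Pi.single j h) (a i s)) :=
    (contDiff_Kop_tau _ ha).comp (ContinuousLinearMap.single ℝ (fun _ : Fin n => ℝ) j).contDiff
  have h2 : ContDiffAt ℝ (⊤ : ℕ∞) (fun h : ℝ => Ring.inverse (Kop (p := 2) ENNReal.ofNat_ne_top
      (fun i s => tau ENNReal.one_ne_top (Pi.single j h) (a i s)))) 0 := by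
    refine ContDiffAt.comp (g := (Ring.inverse : (Lq n 2 →L[ℂ] Lq n 2) → _)) (0 : ℝ) ?_
      h1.contDiffAt
    have e : (fun i s => tau ENNReal.one_ne_top (Pi.single j (0 : ℝ)) (a i s)) = a := by
      funext i s
      rw [Pi.single_zero, tau_zero]
    rw [e]
    obtain ⟨u, hu⟩ := hu
    rw [← hu]
    exact (contDiffAt_ringInverse ℂ u).restrict_scalars ℝ
  obtain ⟨C, hC, h3⟩ := decay_of_contDiffAt h2 N
  refine ⟨C, hC, fun k m => ?_⟩
  set T : (Lq n 2 →L[ℂ] Lq n 2) →L[ℂ] ℂ := (lp.evalCLM ℂ (fun _ => ℂ) 2 k).comp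
    (ContinuousLinearMap.apply ℂ (Lq n 2) (lp.single 2 m 1))
  refine h3 (T.restrictScalars ℝ) ?_ ((k - m) j) (J (lp.single 2 m 1) k)
    (Eventually.of_forall fun h => ?_)
  · refine ContinuousLinearMap.opNorm_le_bound _ zero_le_one fun B => ?_
    rw [one_mul]
    refine (lp.norm_apply_le_norm (by norm_num) (B (lp.single 2 m 1)) k).trans
      ((B.le_opNorm _).trans ?_)
    rw [lp.norm_single (by norm_num), norm_one, mul_one]
  · rw [inverse_Kop_tau ENNReal.ofNat_ne_top _ hu]
    show tau ENNReal.ofNat_ne_top _ (J (tau ENNReal.ofNat_ne_top (-(Pi.single j h)) (lp.single 2 m 1))) k = _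
    have e : tau ENNReal.ofNat_ne_top (-(Pi.single j h)) (lp.single 2 m 1) =
        chr (-(Pi.single j h)) m • (lp.single 2 m 1 : Lq n 2) := by
      ext l
      rw [tau_apply, lp.coeFn_smul, Pi.smul_apply, smul_eq_mul, lp.single_apply, Pi.single_apply]
      split_ifs with hl
      · rw [hl]
      · simp
    rw [e, map_smul, tau_apply, lp.coeFn_smul, Pi.smul_apply, smul_eq_mul, ← mul_assoc, chr_neg,
      chr_mul, ← sub_eq_add_neg, chr_single]

include ha hu in
lemma inverse_decay : ∃ C : ℝ, 0 ≤ C ∧ ∀ k m : Fin n → ℤ,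
    ‖Ring.inverse (Kop (p := 2) ENNReal.ofNat_ne_top a) (lp.single 2 m 1) k‖ ≤ C * wt (k - m) := by
  set J := Ring.inverse (Kop (p := 2) ENNReal.ofNat_ne_top a)
  choose C hC h using fun j => inverse_decay_one ha hu j (2 * n)
  refine ⟨4 ^ n * (‖J‖ + ∑ j, C j), mul_nonneg (by positivity)
    (add_nonneg (norm_nonneg _) (Finset.sum_nonneg fun j _ => hC j)), fun k m => ?_⟩
  refine le_wt_of_bounds _ _ (norm_nonneg _) _ ?_ fun j => ?_
  · refine ((lp.norm_apply_le_norm (by norm_num) (J (lp.single 2 m 1)) k).trans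
      (J.le_opNorm _)).trans ?_
    rw [lp.norm_single (by norm_num), norm_one, mul_one]
    exact le_add_of_nonneg_right (Finset.sum_nonneg fun j _ => hC j)
  · exact (h j k m).trans ((Finset.single_le_sum (fun j _ => hC j) (Finset.mem_univ j)).trans
      (le_add_of_nonneg_left (norm_nonneg _)))

include ha hu in
lemma Kop_bijective : Function.Bijective (Kop (n := n) (p := 1) ENNReal.one_ne_top a) := by
  obtain ⟨C, hC, h⟩ := inverse_decay ha hu
  set J := Ring.inverse (Kop (p := 2) ENNReal.ofNat_ne_top a)
  have hJ : ∀ v, J (Kop (p := 2) ENNReal.ofNat_ne_top a v) = v := fun v =>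
    DFunLike.congr_fun (Ring.inverse_mul_cancel _ hu) v
  have hJ' : ∀ v, Kop (p := 2) ENNReal.ofNat_ne_top a (J v) = v := fun v =>
    DFunLike.congr_fun (Ring.mul_inverse_cancel _ hu) v
  refine ⟨fun x y hxy => inc_injective ?_, fun y => ?_⟩
  · rw [← hJ (inc x), ← hJ (inc y), ← inc_Kop, ← inc_Kop, hxy]
  · have hs : ∀ m : Fin n → ℤ, Summable fun k => C * wt (k - m) := fun m =>
      ((Equiv.subRight m).summable_iff.2 summable_wt).mul_left C
    have hg : ∀ m : Fin n → ℤ, Summable fun k => ‖J (lp.single 2 m 1) k‖ := fun m =>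
      Summable.of_nonneg_of_le (fun _ => norm_nonneg _) (fun k => h k m) (hs m)
    set g : (Fin n → ℤ) → Ell n := fun m =>
      ⟨J (lp.single 2 m 1), memℓp_gen (by simpa using hg m)⟩
    have hgb : ∀ m, ‖g m‖ ≤ (⟨C * ∑' k : Fin n → ℤ, wt k,
        mul_nonneg hC (tsum_nonneg fun k => (wt_pos k).le)⟩ : ℝ≥0) := fun m => by
      rw [Ell.norm_eq]
      refine ((hg m).tsum_le_tsum (fun k => h k m) (hs m)).trans_eq ?_
      rw [tsum_mul_left]
      exact congrArg (C * ·) ((Equiv.subRight m).tsum_eq wt)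
    refine ⟨ell g _ hgb y, inc_injective ?_⟩
    rw [inc_Kop, ← hJ' (inc y)]
    congr 1
    ext k
    have h1 := (lp.evalCLM ℂ (fun _ => ℂ) 1 k).hasSum (hasSum_ell g _ hgb y)
    have h2 := ((lp.evalCLM ℂ (fun _ => ℂ) 2 k).comp J).hasSum
      (lp.hasSum_single ENNReal.ofNat_ne_top (inc y))
    refine h1.unique ?_
    convert! h2 using 1
    funext m
    have e : (lp.single 2 m (inc y m) : Lq n 2) = y m • lp.single 2 m 1 := by
      rw [← lp.single_smul, smul_eq_mul, mul_one, inc_apply]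
    show _ = (J (lp.single 2 m (inc y m))) k
    rw [e, map_smul, map_smul]
    rfl

end inverse

end

section

open Filter Topology ComplexConjugate
open scoped NNReal ENNReal

variable {ι : Type} {n : ℕ}

/-- Convolution of summable families. -/
def cv : Ell n →L[ℂ] Ell n →L[ℂ] Ell n := cnv ENNReal.one_ne_top

/-- The unit for the convolution. -/
def dl : Ell n := lp.single 1 0 1

/-- The Riesz transform of a summable family. -/
abbrev Re (i j : Fin n) : Ell n →L[ℂ] Ell n := Rz ENNReal.one_ne_top i j

/-- The mean of a summable family. -/
abbrev Pe : Ell n →L[ℂ] Ell n := Pz ENNReal.one_ne_top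

lemma hat_cv (c d : Ell n) : hat (cv c d) = hat c * hat d := hat_cnv c d

lemma hat_dl : hat (dl : Ell n) = 1 := by
  rw [dl, hat_single, one_smul]
  exact UnitAddTorus.mFourier_zero

/-- Matrices of summable families. -/
abbrev EM (n : ℕ) : Type := Fin n → Fin n → Ell n

/-- Matrix multiplication. -/
def mm (c d : EM n) : EM n := fun i l => ∑ j, cv (c i j) (d j l)

/-- The unit matrix. -/
def em1 : EM n := fun i l => if i = l then dl else 0

/-- The matrix of functions with given Fourier coefficients. -/
def hm (c : EM n) : Matrix (Fin n) (Fin n) C(UnitAddTorus (Fin n), ℂ) :=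
  Matrix.of fun i j => hat (c i j)

lemma hm_mm (c d : EM n) : hm (mm c d) = hm c * hm d := by
  ext1 i l
  rw [Matrix.mul_apply, hm, Matrix.of_apply, mm, map_sum]
  exact Finset.sum_congr rfl fun j _ => hat_cv _ _

lemma hm_em1 : hm (em1 : EM n) = 1 := by
  ext1 i l
  rw [hm, Matrix.of_apply, em1, Matrix.one_apply]
  split_ifs
  · exact hat_dl
  · exact map_zero _

lemma hm_injective : Function.Injective (hm : EM n → _) := fun c d h => by
  funext i j
  exact hat_injective (congrFun (congrFun h i) j)

lemma hm_add (c d : EM n) : hm (c + d) = hm c + hm d := by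
  ext1 i j
  exact map_add hat _ _

/-- Fourier coefficients of `Q + D²φ`, in terms of those of the Laplacian of `φ`. -/
def gm (Q : Matrix (Fin n) (Fin n) ℝ) (ξ : Ell n) : EM n := fun i j => (Q i j : ℂ) • dl + Re i j ξ

/-- The Riesz transforms of a family. -/
def rm (ξ : Ell n) : EM n := fun i j => Re i j ξ

/-- The pairs (Laplacian of `φ`, inverse of `Q + D²φ`). -/
abbrev W (n : ℕ) : Type := Ell n × EM n

/-- Abreu's equation as a quadratic map. -/
def Phi (Q : Matrix (Fin n) (Fin n) ℝ) (w : W n) : W n :=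
  (∑ i, ∑ j, Re i j (w.2 i j) - Pe w.1, mm (gm Q w.1) w.2 - em1)

lemma contDiff_Phi (Q : Matrix (Fin n) (Fin n) ℝ) {N : WithTop ℕ∞} : ContDiff ℂ N (Phi Q) := by
  have h1 : ∀ i j, ContDiff ℂ N fun w : W n => w.2 i j := fun i j => by fun_prop
  refine ContDiff.prodMk ?_ ?_
  · exact (ContDiff.sum fun i _ => ContDiff.sum fun j _ =>
      (Re i j).contDiff.comp (h1 i j)).sub (Pe.contDiff.comp contDiff_fst)
  · refine ContDiff.sub (contDiff_pi.2 fun i => contDiff_pi.2 fun l => ?_) contDiff_const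
    refine ContDiff.sum fun j _ => ContDiff.clm_apply (cv.contDiff.comp ?_) (h1 j l)
    exact contDiff_const.add ((Re i j).contDiff.comp contDiff_fst)

/-- The derivative of `Phi`. -/
def dPhi (Q : Matrix (Fin n) (Fin n) ℝ) (w : W n) : W n →L[ℂ] W n := fderiv ℂ (Phi Q) w

lemma hasFDerivAt_Phi (Q : Matrix (Fin n) (Fin n) ℝ) (w : W n) :
    HasFDerivAt (Phi Q) (dPhi Q w) w :=
  ((contDiff_Phi (N := 1) Q).differentiable one_ne_zero w).hasFDerivAt

lemma dPhi_apply (Q : Matrix (Fin n) (Fin n) ℝ) (w u : W n) : dPhi Q w u =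
    (∑ i, ∑ j, Re i j (u.2 i j) - Pe u.1, mm (gm Q w.1) u.2 + mm (rm u.1) w.2) := by
  have h1 : ∀ s : ℂ, Phi Q (w + s • u) = Phi Q w + s • ((∑ i, ∑ j, Re i j (u.2 i j) - Pe u.1,
      mm (gm Q w.1) u.2 + mm (rm u.1) w.2) : W n) + s ^ 2 • ((0, mm (rm u.1) u.2) : W n) := by
    intro s
    ext1
    · simp only [Phi, Prod.fst_add, Prod.smul_fst, Prod.snd_add, Prod.smul_snd, Pi.add_apply,
        Pi.smul_apply, map_add, map_smul, Finset.sum_add_distrib, ← Finset.smul_sum]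
      module
    · funext i l
      simp only [Phi, gm, rm, mm, Prod.fst_add, Prod.smul_fst, Prod.snd_add, Prod.smul_snd,
        Pi.add_apply, Pi.sub_apply, Pi.smul_apply, map_add, map_smul, Finset.sum_add_distrib,
        ← Finset.smul_sum, _root_.add_apply, _root_.smul_apply]
      module
  have h2 : HasDerivAt (fun s : ℂ => Phi Q (w + s • u)) (dPhi Q w u) 0 := by
    have e : HasDerivAt (fun s : ℂ => w + s • u) u 0 := by
      simpa using ((hasDerivAt_id (0 : ℂ)).smul_const u).const_add w
    exact (hasFDerivAt_Phi Q w).comp_hasDerivAt_of_eq (0 : ℂ) e (by simp)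
  refine h2.unique ?_
  simp only [h1]
  have e1 := ((hasDerivAt_id (0 : ℂ)).smul_const ((∑ i, ∑ j, Re i j (u.2 i j) - Pe u.1,
      mm (gm Q w.1) u.2 + mm (rm u.1) w.2) : W n)).const_add (Phi Q w)
  have e2 := ((hasDerivAt_id (0 : ℂ)).pow 2).smul_const ((0, mm (rm u.1) u.2) : W n)
  convert! e1.add e2 using 1
  simp

lemma Kop_eq_mm {a : EM n} (hs : ∀ i j, a i j = a j i) (ξ : Ell n) :
    Kop ENNReal.one_ne_top a ξ = ∑ i, ∑ j, Re i j (mm a (mm (rm ξ) a) i j) + Pe ξ := by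
  rw [Kop_apply]
  congr 1
  refine Finset.sum_congr rfl fun i _ => Finset.sum_congr rfl fun j _ => ?_
  simp only [mm, map_sum]
  refine Finset.sum_congr rfl fun s _ => Finset.sum_congr rfl fun r _ => ?_
  congr 2
  apply hat_injective
  rw [hat_cnv, hat_cv, hs j r, mul_comm]
  rfl

lemma dPhi_bijective {Q : Matrix (Fin n) (Fin n) ℝ} {w : W n} (hs : ∀ i j, w.2 i j = w.2 j i)
    (h1 : mm (gm Q w.1) w.2 = em1) (hK : Function.Bijective (Kop ENNReal.one_ne_top w.2)) :
    Function.Bijective (dPhi Q w) := by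
  obtain ⟨ξ, a⟩ := w
  dsimp only at hs h1 hK
  have g1 : hm (gm Q ξ) * hm a = 1 := by rw [← hm_mm, h1, hm_em1]
  have g2 : hm a * hm (gm Q ξ) = 1 := mul_eq_one_comm.1 g1
  constructor
  · rw [injective_iff_map_eq_zero]
    rintro ⟨η, v⟩ h
    rw [dPhi_apply, Prod.mk_eq_zero] at h
    obtain ⟨ha, hb⟩ := h
    dsimp only at ha hb
    have e1 : v = -mm a (mm (rm η) a) := by
      rw [eq_neg_iff_add_eq_zero]
      apply hm_injective
      have := congrArg (hm a * hm ·) hb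
      simp only [hm_add, hm_mm, mul_add, ← mul_assoc, g2, one_mul] at this ⊢
      rw [this, show hm (0 : EM n) = 0 from by ext1 i j; exact map_zero hat, mul_zero]
    have e2 : Kop ENNReal.one_ne_top a η = Kop ENNReal.one_ne_top a 0 := by
      rw [map_zero, Kop_eq_mm hs, ← neg_eq_zero, ← ha, e1]
      simp only [Pi.neg_apply, map_neg, Finset.sum_neg_distrib]
      abel
    have e3 := hK.1 e2
    subst e3
    rw [e1, Prod.mk_eq_zero]
    refine ⟨rfl, ?_⟩
    funext i l
    simp [mm, rm]
  · rintro ⟨β, y⟩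
    obtain ⟨η, hη⟩ := hK.2 (∑ i, ∑ j, Re i j (mm a y i j) - β)
    refine ⟨(η, mm a y - mm a (mm (rm η) a)), ?_⟩
    rw [dPhi_apply]
    ext1
    · rw [Kop_eq_mm hs] at hη
      simp only [Pi.sub_apply, map_sub, Finset.sum_sub_distrib]
      rw [sub_sub, hη, sub_sub_cancel]
    · apply hm_injective
      have e : hm (mm a y - mm a (mm (rm η) a)) = hm a * hm y - hm a * (hm (rm η) * hm a) := by
        rw [eq_sub_iff_add_eq, ← hm_mm, ← hm_mm, ← hm_mm, ← hm_add, sub_add_cancel]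
      simp only [hm_add, hm_mm, e, mul_sub, ← mul_assoc, g1, one_mul, sub_add_cancel]

/-- Symmetries of `Phi`. -/
structure IsSym (T : Ell n →+ Ell n) : Prop where
  norm_le : ∀ c, ‖T c‖ ≤ ‖c‖
  cv : ∀ c d, T (cv c d) = Abreu.cv (T c) (T d)
  rz : ∀ i j c, T (Re i j c) = Re i j (T c)
  pz : ∀ c, T (Pe c) = Pe (T c)
  one : ∀ r : ℝ, T ((r : ℂ) • dl) = (r : ℂ) • dl

/-- The action of a symmetry on the unknowns. -/
def symW (T : Ell n →+ Ell n) (w : W n) : W n := (T w.1, fun i j => T (w.2 i j))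

lemma IsSym.Phi {T : Ell n →+ Ell n} (h : IsSym T) (Q : Matrix (Fin n) (Fin n) ℝ) (w : W n) :
    Phi Q (symW T w) = symW T (Phi Q w) := by
  have h1 := h.one 1
  rw [Complex.ofReal_one, one_smul] at h1
  ext1
  · simp only [Abreu.Phi, symW, map_sub, map_sum, h.rz, h.pz]
  · funext i l
    have h2 : ∀ i j, T (gm Q w.1 i j) = gm Q (T w.1) i j := fun i j => by
      rw [gm, map_add, h.one, h.rz, gm]
    simp only [Abreu.Phi, symW, Pi.sub_apply, mm, em1, map_sub, map_sum, h.cv, h2, apply_ite T, h1,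
      map_zero]

lemma IsSym.norm_symW_sub_le {T : Ell n →+ Ell n} (h : IsSym T) (w w' : W n) :
    ‖symW T w - symW T w'‖ ≤ ‖w - w'‖ := by
  have e : symW T w - symW T w' = symW T (w - w') := by
    ext1
    · exact (map_sub T _ _).symm
    · funext i j
      exact (map_sub T _ _).symm
  rw [e]
  refine (Prod.norm_def _).trans_le (max_le ((h.norm_le _).trans (norm_fst_le _)) ?_)
  refine (pi_norm_le_iff_of_nonneg (norm_nonneg _)).2 fun i =>
    (pi_norm_le_iff_of_nonneg (norm_nonneg _)).2 fun j => (h.norm_le _).trans ?_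
  exact (norm_le_pi_norm _ j).trans ((norm_le_pi_norm _ i).trans (norm_snd_le (w - w')))

lemma exists_local_inverse {Q : Matrix (Fin n) (Fin n) ℝ} {w : W n}
    (hb : Function.Bijective (dPhi Q w)) : ∃ Ψ : W n → W n, Ψ (Phi Q w) = w ∧
      ContinuousAt Ψ (Phi Q w) ∧ ∃ ε > 0, ∀ᶠ y in 𝓝 (Phi Q w), ContDiffAt ℝ (⊤ : ℕ∞) Ψ y ∧
        Phi Q (Ψ y) = y ∧
        ∀ T, IsSym T → ‖symW T w - w‖ < ε → Ψ (symW T y) = symW T (Ψ y) := by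
  have hD : HasFDerivAt (Phi Q) ((ContinuousLinearEquiv.ofBijective (dPhi Q w)
      (LinearMap.ker_eq_bot.2 hb.1) (LinearMap.range_eq_top.2 hb.2) : W n ≃L[ℂ] W n) :
        W n →L[ℂ] W n) w := by
    rw [ContinuousLinearEquiv.coe_ofBijective]
    exact hasFDerivAt_Phi Q w
  have hC : ContDiffAt ℂ ⊤ (Phi Q) w := (contDiff_Phi Q).contDiffAt
  have hS := hC.hasStrictFDerivAt' hD (by simp)
  set Ψ := hC.localInverse hD (by simp)
  have h0 : Ψ (Phi Q w) = w := hC.localInverse_apply_image hD (by simp)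
  have h1 : ContDiffAt ℂ ⊤ Ψ (Phi Q w) := hC.to_localInverse hD (by simp)
  have h2 : ∀ᶠ x in 𝓝 w, Ψ (Phi Q x) = x := hS.eventually_left_inverse
  have h3 : ∀ᶠ y in 𝓝 (Phi Q w), Phi Q (Ψ y) = y := hS.eventually_right_inverse
  obtain ⟨δ, hδ, h4⟩ := Metric.eventually_nhds_iff.1 h2
  have h5 : ∀ᶠ y in 𝓝 (Phi Q w), dist (Ψ y) w < δ / 2 := by
    have := h1.continuousAt
    rw [ContinuousAt, h0] at this
    exact this.eventually (Metric.ball_mem_nhds _ (by positivity))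
  refine ⟨Ψ, h0, h1.continuousAt, δ / 2, by positivity, ?_⟩
  filter_upwards [h1.eventually (by simp), h3, h5] with y e1 e2 e3
  refine ⟨(e1.restrict_scalars ℝ).of_le le_top, e2, fun T hT hTw => ?_⟩
  have e4 : dist (symW T (Ψ y)) w < δ := by
    rw [dist_eq_norm] at e3 ⊢
    have e5 := hT.norm_symW_sub_le (Ψ y) w
    have e6 := norm_add_le (symW T (Ψ y) - symW T w) (symW T w - w)
    rw [sub_add_sub_cancel] at e6
    linarith only [e3, e5, e6, hTw]
  have e5 := h4 e4
  rwa [hT.Phi, e2] at e5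

end

section

open Filter Topology ComplexConjugate
open scoped NNReal ENNReal

variable {ι : Type} {n : ℕ}

/-- Translation of summable families. -/
def tr (x : Fin n → ℝ) : Ell n →+ Ell n := AddMonoidHomClass.toAddMonoidHom (tau ENNReal.one_ne_top x)

lemma tr_apply (x : Fin n → ℝ) (c : Ell n) (k : Fin n → ℤ) : tr x c k = chr x k * c k :=
  tau_apply ENNReal.one_ne_top _ _ _

lemma isSym_tr (x : Fin n → ℝ) : IsSym (tr x : Ell n →+ Ell n) where
  norm_le c := norm_tau_le ENNReal.one_ne_top _ _
  cv c d := tau_cnv _ _ _ _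
  rz i j c := tau_mul _ _ _ _ _
  pz c := tau_mul _ _ _ _ _
  one r := by
    ext k
    rw [tr_apply, dl, lp.coeFn_smul, Pi.smul_apply, smul_eq_mul, lp.single_apply, Pi.single_apply]
    split_ifs with h
    · have : chr x (0 : Fin n → ℤ) = 1 := by simp [chr, frq]
      rw [h, this, one_mul]
    · simp

/-- The Fourier coefficients of the complex conjugate. -/
def cj : Ell n →+ Ell n where
  toFun c := ⟨fun k => conj (c (-k)), memℓp_gen (by
    have := (Equiv.neg (Fin n → ℤ)).summable_iff.2 c.summable
    refine this.congr fun k => ?_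
    simp)⟩
  map_zero' := by
    ext k
    exact map_zero _
  map_add' c d := by
    ext k
    exact map_add _ _ _

lemma cj_apply (c : Ell n) (k : Fin n → ℤ) : cj c k = conj (c (-k)) := rfl

lemma hat_cj (c : Ell n) : hat (cj c) = star (hat c) := by
  have h : HasSum (fun k => star (c k • UnitAddTorus.mFourier k)) (star (hat c)) :=
    (hasSum_hat c).star
  rw [← (Equiv.neg (Fin n → ℤ)).hasSum_iff] at h
  refine (hasSum_hat (cj c)).unique (h.congr_fun fun k => ?_)
  simp only [Function.comp, Equiv.neg_apply, star_smul, star_mFourier, neg_neg, cj_apply]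
  rfl

lemma rsy_neg (i j : Fin n) (k : Fin n → ℤ) : rsy i j (-k) = rsy i j k := by
  simp [rsy, nsq]

lemma isSym_cj : IsSym (cj : Ell n →+ Ell n) where
  norm_le c := by
    rw [Ell.norm_eq, Ell.norm_eq, ← (Equiv.neg (Fin n → ℤ)).tsum_eq fun k => ‖c k‖]
    exact (tsum_congr fun k => by simp [cj_apply]).le
  cv c d := hat_injective (by simp only [hat_cj, hat_cv, star_mul'])
  rz i j c := by
    ext k
    rw [cj_apply, Rz_apply, Rz_apply, cj_apply, rsy_neg, map_mul, Complex.conj_ofReal]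
  pz c := by
    ext k
    rw [cj_apply, Pz_apply, Pz_apply, cj_apply]
    simp only [neg_eq_zero]
    split_ifs <;> simp
  one r := hat_injective (by
    rw [hat_cj, map_smul, hat_dl, star_smul, star_one]
    congr 1
    exact Complex.conj_ofReal r)

lemma contDiff_symW_tr {w : W n} (h1 : Rap w.1) (h2 : ∀ i j, Rap (w.2 i j)) :
    ContDiff ℝ (⊤ : ℕ∞) fun x => symW (tr x) w :=
  ContDiff.prodMk (contDiff_tau h1) (contDiff_pi.2 fun i => contDiff_pi.2 fun j =>
    contDiff_tau (h2 i j))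

lemma symW_tr_zero (w : W n) : symW (tr 0) w = w := by
  ext1
  · exact tau_zero ENNReal.one_ne_top _
  · funext i j
    exact tau_zero ENNReal.one_ne_top _

lemma rap_of_local {Ψ : W n → W n} {w y : W n} {ε : ℝ} (hε : 0 < ε) (h1 : Rap w.1)
    (h2 : ∀ i j, Rap (w.2 i j)) (hy : Rap y.1) (hy2 : y.2 = 0) (hΨ : ContDiffAt ℝ (⊤ : ℕ∞) Ψ y)
    (hs : ∀ T, IsSym T → ‖symW T w - w‖ < ε → Ψ (symW T y) = symW T (Ψ y))
    (L : W n →L[ℝ] Ell n) (hL : ∀ u, ‖L u‖ ≤ ‖u‖) (hLs : ∀ x u, L (symW (tr x) u) = tr x (L u)) :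
    Rap (L (Ψ y)) := by
  have hz : Rap (0 : Ell n) := hy.mono 0 le_rfl fun k => by simp
  refine ⟨⟨‖L (Ψ y)‖, fun k => lp.norm_apply_le_norm (by norm_num) _ k⟩, fun j N => ?_⟩
  have hsm : ∀ u : W n, Rap u.1 → (∀ i j, Rap (u.2 i j)) → ContDiff ℝ (⊤ : ℕ∞)
      fun h : ℝ => symW (tr (Pi.single j h)) u := fun u h1 h2 => (contDiff_symW_tr h1 h2).comp
    (ContinuousLinearMap.single ℝ (fun _ : Fin n => ℝ) j).contDiff
  have h3 : ContDiffAt ℝ (⊤ : ℕ∞) (fun h : ℝ => Ψ (symW (tr (Pi.single j h)) y)) 0 := by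
    refine ContDiffAt.comp (0 : ℝ) ?_ (hsm y hy fun i j => by rw [hy2]; exact hz).contDiffAt
    rwa [Pi.single_zero, symW_tr_zero]
  have h4 : ∀ᶠ h : ℝ in 𝓝 0, ‖symW (tr (Pi.single j h)) w - w‖ < ε := by
    have : Continuous fun h : ℝ => ‖symW (tr (Pi.single j h)) w - w‖ :=
      ((hsm w h1 h2).continuous.sub continuous_const).norm
    have := this.tendsto 0
    rw [Pi.single_zero, symW_tr_zero, sub_self, norm_zero] at this
    exact this.eventually (gt_mem_nhds hε)
  obtain ⟨C, -, h5⟩ := decay_of_contDiffAt h3 N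
  refine ⟨C, fun k => ?_⟩
  refine h5 (((lp.evalCLM ℂ (fun _ => ℂ) 1 k).restrictScalars ℝ).comp L) ?_ (k j) _ ?_
  · refine ContinuousLinearMap.opNorm_le_bound _ zero_le_one fun u => ?_
    rw [one_mul]
    exact (lp.norm_apply_le_norm (by norm_num) (L u) k).trans (hL u)
  · filter_upwards [h4] with h hh
    rw [hs _ (isSym_tr _) hh]
    show L _ k = _
    rw [hLs, tr_apply, chr_single]

theorem exists_branch {Q : Matrix (Fin n) (Fin n) ℝ} {w : W n} (hb : Function.Bijective (dPhi Q w))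
    (h1 : Rap w.1) (h2 : ∀ i j, Rap (w.2 i j)) (hc : symW cj w = w) :
    ∃ Ψ : W n → W n, Ψ (Phi Q w) = w ∧ ContinuousAt Ψ (Phi Q w) ∧ ∀ᶠ y in 𝓝 (Phi Q w),
      Phi Q (Ψ y) = y ∧ (Rap y.1 → y.2 = 0 → cj y.1 = y.1 →
        symW cj (Ψ y) = Ψ y ∧ Rap (Ψ y).1 ∧ ∀ i j, Rap ((Ψ y).2 i j)) := by
  obtain ⟨Ψ, h0, hcn, ε, hε, h3⟩ := exists_local_inverse hb
  refine ⟨Ψ, h0, hcn, ?_⟩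
  filter_upwards [h3] with y ⟨hd, hP, hs⟩
  refine ⟨hP, fun hy hy2 hyc => ⟨?_, ?_, fun i j => ?_⟩⟩
  · rw [← hs cj isSym_cj (by rwa [hc, sub_self, norm_zero])]
    congr 1
    ext1
    · exact hyc
    · funext i j
      show cj (y.2 i j) = y.2 i j
      rw [hy2]
      exact map_zero cj
  · exact rap_of_local hε h1 h2 hy hy2 hd hs (ContinuousLinearMap.fst ℝ _ _) norm_fst_le
      fun x u => rfl
  · exact rap_of_local hε h1 h2 hy hy2 hd hs
      (((ContinuousLinearMap.proj (R := ℝ) (φ := fun _ : Fin n => Ell n) j).comp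
        (ContinuousLinearMap.proj (R := ℝ) (φ := fun _ : Fin n => Fin n → Ell n) i)).comp
        (ContinuousLinearMap.snd ℝ _ _))
      (fun u => (norm_le_pi_norm _ j).trans ((norm_le_pi_norm _ i).trans (norm_snd_le u)))
      fun x u => rfl

end

section

open Filter Topology ComplexConjugate
open scoped NNReal ENNReal

variable {ι : Type} {n : ℕ}

lemma _root_.Matrix.PosDef.sum_sq_le_trace_inv {G : Matrix (Fin n) (Fin n) ℝ} (h : G.PosDef)
    (v : Fin n → ℝ) : ∑ i, v i ^ 2 ≤ G⁻¹.trace * (v ⬝ᵥ G *ᵥ v) := by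
  obtain ⟨B, hB, hG⟩ := h.posSemidef.exists_sq
  have hd : IsUnit B.det := by
    have := h.isUnit.map Matrix.detMonoidHom
    rw [hG, map_mul] at this
    exact isUnit_of_mul_isUnit_left this
  have e1 : B⁻¹ *ᵥ (B *ᵥ v) = v := by
    rw [Matrix.mulVec_mulVec, Matrix.nonsing_inv_mul _ hd, Matrix.one_mulVec]
  have e2 : G⁻¹ = B⁻¹ * B⁻¹ᵀ := by
    rw [hG, Matrix.mul_inv_rev, Matrix.transpose_nonsing_inv, hB]
  have e3 : v ⬝ᵥ G *ᵥ v = ∑ j, (B *ᵥ v) j ^ 2 := by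
    rw [hG, ← Matrix.mulVec_mulVec, Matrix.dotProduct_mulVec, ← Matrix.mulVec_transpose, hB]
    exact Finset.sum_congr rfl fun j _ => (sq _).symm
  rw [e3, e2, Matrix.trace, Finset.sum_mul]
  refine Finset.sum_le_sum fun i _ => ?_
  conv_lhs => rw [← e1]
  refine (Finset.sum_mul_sq_le_sq_mul_sq Finset.univ (B⁻¹ i) (B *ᵥ v)).trans_eq ?_
  congr 1
  rw [Matrix.diag_apply, Matrix.mul_apply]
  exact Finset.sum_congr rfl fun j _ => sq _

lemma exists_uniform_lower {G : (Fin n → ℝ) → Matrix (Fin n) (Fin n) ℝ} (hG : ∀ x, (G x).PosDef)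
    (hp : ∀ i, ZPer fun x => (G x)⁻¹ i i) (hc : ∀ i, Continuous fun x => (G x)⁻¹ i i) :
    ∃ c > 0, c ≤ 1 ∧ ∀ x v, c * ∑ i, v i ^ 2 ≤ v ⬝ᵥ G x *ᵥ v := by
  have h1 : ZPer fun x => ((G x)⁻¹).trace := fun x k => Finset.sum_congr rfl fun i _ => hp i x k
  obtain ⟨C, hC, h2⟩ := h1.bounded (continuous_finsetSum _ fun i _ => hc i)
  refine ⟨(1 + C)⁻¹, by positivity, inv_le_one_of_one_le₀ (by linarith only [hC]), fun x v => ?_⟩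
  rw [inv_mul_le_iff₀ (by positivity)]
  have h3 : 0 ≤ v ⬝ᵥ G x *ᵥ v := by simpa using (hG x).posSemidef.dotProduct_mulVec_nonneg v
  refine ((hG x).sum_sq_le_trace_inv v).trans (mul_le_mul_of_nonneg_right ?_ h3)
  linarith only [(abs_le.1 (h2 x)).2]

lemma trace_lower {M : Matrix (Fin n) (Fin n) ℝ} {c : ℝ}
    (h : ∀ v : Fin n → ℝ, c * ∑ i, v i ^ 2 ≤ v ⬝ᵥ M *ᵥ v) (Y : Matrix (Fin n) (Fin n) ℝ) :
    c * (Yᵀ * Y).trace ≤ (Yᵀ * M * Y).trace := by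
  rw [Matrix.trace, Matrix.trace, Finset.mul_sum]
  refine Finset.sum_le_sum fun p _ => ?_
  have e1 : (Yᵀ * Y).diag p = ∑ i, Y i p ^ 2 :=
    (Matrix.mul_apply).trans (Finset.sum_congr rfl fun i _ => (sq _).symm)
  have e2 : (Yᵀ * M * Y).diag p = (fun i => Y i p) ⬝ᵥ M *ᵥ (fun i => Y i p) := by
    rw [Matrix.diag_apply, Matrix.mul_assoc]
    rfl
  rw [e1, e2]
  exact h _

lemma tensor_lower {M : Matrix (Fin n) (Fin n) ℝ} (hM : M.PosDef) {c : ℝ} (hc : 0 ≤ c)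
    (h : ∀ v : Fin n → ℝ, c * ∑ i, v i ^ 2 ≤ v ⬝ᵥ M *ᵥ v) (Z : Fin n → Fin n → ℝ) :
    c ^ 2 * ∑ i, ∑ j, Z i j ^ 2 ≤ ∑ i, ∑ j, ∑ s, ∑ r, Z i j * (M i s * (M j r * Z s r)) := by
  obtain ⟨B, hB, hG⟩ := hM.posSemidef.exists_sq
  have hs : ∀ i j, M i j = M j i := fun i j => by
    simpa using (hM.isHermitian.apply i j).symm
  have e1 : ∑ i, ∑ j, ∑ s, ∑ r, Z i j * (M i s * (M j r * Z s r)) =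
      ((of Z)ᵀ * M * of Z * M).trace := by
    simp only [Matrix.trace, Matrix.diag_apply, Matrix.mul_apply, Finset.sum_mul]
    rw [Finset.sum_comm]
    refine Finset.sum_congr rfl fun j _ => ?_
    refine Eq.trans (Finset.sum_comm.trans ?_) Finset.sum_comm
    rw [Finset.sum_comm]
    conv_rhs => 
      arg 2; ext s; rw [Finset.sum_comm]
    rw [Finset.sum_comm (γ := Fin n)]
    refine Finset.sum_congr rfl fun i _ => Finset.sum_congr rfl fun s _ =>
      Finset.sum_congr rfl fun r _ => ?_
    rw [hs j r]
    simp only [Matrix.transpose_apply, Matrix.of_apply]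
    ring
  have e2 : ((of Z)ᵀ * M * of Z * M).trace = ((of Z * B)ᵀ * M * (of Z * B)).trace := by
    conv_lhs => rw [hG, ← Matrix.mul_assoc, Matrix.trace_mul_comm, ← hG]
    rw [Matrix.transpose_mul, hB]
    simp only [Matrix.mul_assoc]
  have e3 : ((of Z * B)ᵀ * (of Z * B)).trace = ((of Z)ᵀᵀ * M * (of Z)ᵀ).trace := by
    rw [Matrix.trace_mul_comm, Matrix.transpose_mul, hB, hG, Matrix.transpose_transpose]
    simp only [Matrix.mul_assoc]
  have e4 : ((of Z)ᵀᵀ * (of Z)ᵀ).trace = ∑ i, ∑ j, Z i j ^ 2 := by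
    simp only [Matrix.trace, Matrix.diag_apply, Matrix.mul_apply, Matrix.transpose_apply,
      Matrix.of_apply, ← sq]
  have e5 := trace_lower h (of Z * B)
  have e6 := mul_le_mul_of_nonneg_left (trace_lower h (of Z)ᵀ) hc
  rw [e4, ← e3, ← mul_assoc, ← sq] at e6
  rw [e1, e2]
  exact e6.trans e5

lemma coer_of_lower {a : EM n} {M : UnitAddTorus (Fin n) → Matrix (Fin n) (Fin n) ℝ}
    (ha : ∀ i j t, hat (a i j) t = M t i j) (hM : ∀ t, (M t).PosDef) {c : ℝ} (hc : 0 ≤ c)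
    (h : ∀ t v, c * ∑ i, v i ^ 2 ≤ v ⬝ᵥ M t *ᵥ v) : Coer (c ^ 2) a := by
  intro t Z
  have h1 := tensor_lower (hM t) hc (h t) fun i j => (Z i j).re
  have h2 := tensor_lower (hM t) hc (h t) fun i j => (Z i j).im
  have e1 : ∀ i j s r, (conj (Z i j) * (hat (a i s) t * (hat (a j r) t * Z s r))).re =
      (Z i j).re * (M t i s * (M t j r * (Z s r).re)) +
        (Z i j).im * (M t i s * (M t j r * (Z s r).im)) := fun i j s r => by
    simp [ha]
  have e2 : ∀ i j, (conj (Z i j) * Z i j).re = (Z i j).re ^ 2 + (Z i j).im ^ 2 := fun i j => by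
    simp [sq]
  simp only [Complex.re_sum, e1, e2, Finset.sum_add_distrib, mul_add]
  exact add_le_add h1 h2

end

section

open Filter Topology ComplexConjugate
open scoped NNReal ENNReal

variable {ι : Type} {n : ℕ}

lemma ell_ext {c d : Ell n} (h : ∀ x, hat c (tor x) = hat d (tor x)) : c = d := by
  refine hat_injective (ContinuousMap.ext fun t => ?_)
  obtain ⟨x, rfl⟩ := tor_quot.surjective t
  exact h x

lemma cE_pd_pd {f : (Fin n → ℝ) → ℝ} (hf : ZPer f) (hs : ContDiff ℝ (⊤ : ℕ∞) f) (i j : Fin n)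
    (k : Fin n → ℤ) : cE (zper_pd (zper_pd hf j) i) (contDiff_pd (contDiff_pd hs j) i) k =
      -(4 * Real.pi ^ 2) * (k i * k j) * cE hf hs k := by
  rw [cE_pd (zper_pd hf j) (contDiff_pd hs j), cE_pd hf hs]
  linear_combination (4 * Real.pi ^ 2 * k i * k j * cE hf hs k : ℂ) * Complex.I_sq

lemma cj_cE {f : (Fin n → ℝ) → ℝ} (hf : ZPer f) (hs : ContDiff ℝ (⊤ : ℕ∞) f) :
    cj (cE hf hs) = cE hf hs := by
  refine ell_ext fun x => ?_
  rw [hat_cj, ContinuousMap.star_apply, hat_cE_tor]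
  exact Complex.conj_ofReal _

lemma one_le_nsq {k : Fin n → ℤ} (hk : k ≠ 0) : 1 ≤ nsq k := by
  have h := nsq_pos hk
  have e : nsq k = ((∑ i, k i ^ 2 : ℤ) : ℝ) := by simp [nsq]
  rw [e] at h ⊢
  exact_mod_cast Int.add_one_le_iff.2 (Int.cast_pos.1 h)

/-- The symbol of the inverse Laplacian. -/
def ils (k : Fin n → ℤ) : ℝ := -(4 * Real.pi ^ 2 * nsq k)⁻¹

lemma ils_zero : ils (0 : Fin n → ℤ) = 0 := by simp [ils, nsq]

lemma ils_neg (k : Fin n → ℤ) : ils (-k) = ils k := by simp [ils, nsq]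

lemma rsy_eq_ils (i j : Fin n) (k : Fin n → ℤ) :
    rsy i j k = -(4 * Real.pi ^ 2) * (k i * k j) * ils k := by
  have h : (4 * Real.pi ^ 2) ≠ 0 := by positivity
  rw [rsy, ils, mul_inv]
  field_simp

lemma norm_ils_le (k : Fin n → ℤ) : ‖(ils k : ℂ)‖ ≤ 1 := by
  by_cases hk : k = 0
  · simp [hk, ils_zero]
  have h1 := one_le_nsq hk
  have h2 : 1 ≤ 4 * Real.pi ^ 2 := by nlinarith only [Real.pi_gt_three]
  rw [Complex.norm_real, ils, norm_neg, Real.norm_of_nonneg (by positivity)]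
  exact inv_le_one_of_one_le₀ (one_le_mul_of_one_le_of_one_le h2 h1)

/-- The inverse Laplacian. -/
def il : Ell n →L[ℂ] Ell n := mul ENNReal.one_ne_top (fun k => (ils k : ℂ)) norm_ils_le

lemma il_apply (c : Ell n) (k : Fin n → ℤ) : il c k = ils k * c k := mul_apply _ _ _ _ _

lemma rap_il {c : Ell n} (h : Rap c) : Rap (il c) := h.mono 1 zero_le_one fun k => by
  rw [il_apply, norm_mul]
  exact mul_le_mul_of_nonneg_right (norm_ils_le k) (norm_nonneg _)

lemma cj_il (c : Ell n) : cj (il c) = il (cj c) := by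
  ext k
  rw [cj_apply, il_apply, il_apply, cj_apply, ils_neg, map_mul, Complex.conj_ofReal]

lemma pd_sub_const (f : (Fin n → ℝ) → ℝ) (c : ℝ) (i : Fin n) :
    pd i (fun x => f x - c) = pd i f := by
  funext x
  rw [pd, fderiv_sub_const]
  rfl

lemma hat_sum_cE {f : Fin n → Fin n → (Fin n → ℝ) → ℝ} (hf : ∀ i j, ZPer (f i j))
    (hs : ∀ i j, ContDiff ℝ (⊤ : ℕ∞) (f i j)) (x : Fin n → ℝ) :
    hat (∑ i, ∑ j, cE (hf i j) (hs i j)) (tor x) = (∑ i, ∑ j, f i j x : ℝ) := by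
  simp only [map_sum, ContinuousMap.sum_apply, hat_cE_tor, Complex.ofReal_sum]

lemma hat_gm {Q : Matrix (Fin n) (Fin n) ℝ} {ξ : Ell n} {φ : (Fin n → ℝ) → ℝ} (hp : ZPer φ)
    (hs : ContDiff ℝ (⊤ : ℕ∞) φ) (h : ∀ k, ils k * ξ k = if k = 0 then 0 else cE hp hs k) 
    (i j : Fin n) (x : Fin n → ℝ) : hat (gm Q ξ i j) (tor x) = ((Q + hess φ x) i j : ℝ) := by
  have e : Re i j ξ = cE (zper_pd (zper_pd hp j) i) (contDiff_pd (contDiff_pd hs j) i) := by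
    ext k
    rw [Rz_apply, cE_pd_pd, rsy_eq_ils]
    push_cast
    rw [mul_assoc _ (ils k : ℂ), h]
    split_ifs with hk
    · simp [hk]
    · rfl
  rw [gm, map_add, map_smul, hat_dl, e, ContinuousMap.add_apply, hat_cE_tor,
    ContinuousMap.smul_apply, ContinuousMap.one_apply, smul_eq_mul, mul_one, Matrix.add_apply,
    Complex.ofReal_add]
  rfl

variable {Q : Matrix (Fin n) (Fin n) ℝ} {A : (Fin n → ℝ) → ℝ}

/-- The right-hand side for `Phi`. -/
def rhs (hA : ContDiff ℝ (⊤ : ℕ∞) A) (hAp : ZPer A) (t : ℝ) : W n :=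
  ((t : ℂ) • il (cE hAp hA), 0)

/-- Fourier coefficients of the two expressions for Abreu's operator. -/
lemma sum_Re_eq_iff (hA : ContDiff ℝ (⊤ : ℕ∞) A) (hAp : ZPer A)
    (hA0 : ∫ x in Set.Icc (0 : Fin n → ℝ) 1, A x = 0) (t : ℝ)
    {f : Fin n → Fin n → (Fin n → ℝ) → ℝ} (hf : ∀ i j, ZPer (f i j))
    (hs : ∀ i j, ContDiff ℝ (⊤ : ℕ∞) (f i j)) (ξ : Ell n) :
    (∑ i, ∑ j, Re i j (cE (hf i j) (hs i j)) - Pe ξ = (t : ℂ) • il (cE hAp hA)) ↔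
      ξ 0 = 0 ∧ ∀ x, ∑ i, ∑ j, pd i (pd j (f i j)) x = t * A x := by
  have h1 : ∀ k, (∑ i, ∑ j, Re i j (cE (hf i j) (hs i j)) - Pe ξ : Ell n) k =
      ils k * (∑ i, ∑ j, cE (zper_pd (zper_pd (hf i j) j) i)
        (contDiff_pd (contDiff_pd (hs i j) j) i) : Ell n) k - if k = 0 then ξ k else 0 := by
    intro k
    simp only [lp.coeFn_sub, lp.coeFn_sum, Pi.sub_apply, Finset.sum_apply, Rz_apply, Pz_apply,
      Finset.mul_sum, rsy_eq_ils]
    congr 1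
    refine Finset.sum_congr rfl fun i _ => Finset.sum_congr rfl fun j _ => ?_
    rw [cE_pd_pd (hf i j) (hs i j)]
    push_cast
    ring
  have h2 : (∀ x, ∑ i, ∑ j, pd i (pd j (f i j)) x = t * A x) ↔
      (∑ i, ∑ j, cE (zper_pd (zper_pd (hf i j) j) i)
        (contDiff_pd (contDiff_pd (hs i j) j) i) : Ell n) = (t : ℂ) • cE hAp hA := by
    constructor
    · intro h
      refine ell_ext fun x => ?_
      rw [hat_sum_cE (fun i j => zper_pd (zper_pd (hf i j) j) i)
        (fun i j => contDiff_pd (contDiff_pd (hs i j) j) i), h, map_smul,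
        ContinuousMap.smul_apply, hat_cE_tor, smul_eq_mul, Complex.ofReal_mul]
    · intro h x
      have := congrArg (fun c => hat c (tor x)) h
      rw [hat_sum_cE (fun i j => zper_pd (zper_pd (hf i j) j) i)
        (fun i j => contDiff_pd (contDiff_pd (hs i j) j) i), map_smul,
        ContinuousMap.smul_apply, hat_cE_tor, smul_eq_mul, ← Complex.ofReal_mul] at this
      exact Complex.ofReal_injective this
  have h3 : ∀ k, ((t : ℂ) • il (cE hAp hA) : Ell n) k = ils k * ((t : ℂ) • cE hAp hA : Ell n) k := by
    intro k
    rw [lp.coeFn_smul, lp.coeFn_smul, Pi.smul_apply, Pi.smul_apply, il_apply, smul_eq_mul,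
      smul_eq_mul]
    ring
  have h4 : (∑ i, ∑ j, cE (zper_pd (zper_pd (hf i j) j) i)
        (contDiff_pd (contDiff_pd (hs i j) j) i) : Ell n) 0 = ((t : ℂ) • cE hAp hA : Ell n) 0 := by
    simp only [lp.coeFn_sum, lp.coeFn_smul, Finset.sum_apply, Pi.smul_apply, cE_zero hAp hA hA0,
      smul_zero]
    refine Finset.sum_eq_zero fun i _ => Finset.sum_eq_zero fun j _ => ?_
    rw [cE_pd_pd (hf i j) (hs i j)]
    simp
  rw [h2]
  constructor
  · intro h
    have h5 : ∀ k, _ = _ := fun k => (h1 k).symm.trans ((congrArg (fun c : Ell n => c k) h).trans (h3 k))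
    have h6 := h5 0
    rw [ils_zero] at h6
    refine ⟨by simpa using h6, ?_⟩
    ext k
    by_cases hk : k = 0
    · rw [hk, h4]
    · have h7 := h5 k
      rw [if_neg hk, sub_zero] at h7
      refine mul_left_cancel₀ ?_ h7
      have := nsq_pos hk
      have h8 : ils k ≠ 0 := neg_ne_zero.2 (inv_ne_zero (by positivity))
      exact_mod_cast h8
  · rintro ⟨h0, h⟩
    ext k
    rw [h1, h, h3]
    split_ifs with hk
    · rw [hk, h0, sub_zero]
    · rw [sub_zero]

end

section

open Filter Topology ComplexConjugate
open scoped NNReal ENNReal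

variable {ι : Type} {n : ℕ}

lemma pd_comm {f : (Fin n → ℝ) → ℝ} (hf : ContDiff ℝ (⊤ : ℕ∞) f) (i j : Fin n) :
    pd i (pd j f) = pd j (pd i f) :=
  congrArg (fun g : SF Unit n => g.fn ()) (dd_comm i j (⟨fun _ => f, fun _ => hf⟩ : SF Unit n))

lemma hess_transpose {f : (Fin n → ℝ) → ℝ} (hf : ContDiff ℝ (⊤ : ℕ∞) f) (x : Fin n → ℝ) :
    (hess f x)ᵀ = hess f x := by
  ext i j
  exact congrFun (pd_comm hf j i) x

variable {Q : Matrix (Fin n) (Fin n) ℝ} {A : (Fin n → ℝ) → ℝ}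

theorem sol_of_Phi (hQ : Qᵀ = Q) (hA : ContDiff ℝ (⊤ : ℕ∞) A) (hAp : ZPer A)
    (hA0 : ∫ x in Set.Icc (0 : Fin n → ℝ) 1, A x = 0) {t : ℝ} {w : W n}
    (hw : Phi Q w = rhs hA hAp t) (hc : symW cj w = w) (h1 : Rap w.1) (h2 : ∀ i j, Rap (w.2 i j))
    (hpos : ∀ x (M : Matrix (Fin n) (Fin n) ℝ), Mᵀ = M →
      (∀ i j, hat (gm Q w.1 i j) (tor x) = (M i j : ℂ)) → M.PosDef) :
    ∃ φ, Sol Q (fun x => t * A x) φ := by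
  have hr : star (hat (il w.1)) = hat (il w.1) := by
    rw [← hat_cj, cj_il, show cj w.1 = w.1 from congrArg Prod.fst hc]
  have hr2 : ∀ i j, star (hat (w.2 i j)) = hat (w.2 i j) := fun i j => by
    rw [← hat_cj, show cj (w.2 i j) = w.2 i j from congrFun (congrFun (congrArg Prod.snd hc) i) j]
  have hs : ContDiff ℝ (⊤ : ℕ∞) (syn (il w.1)) := contDiff_syn (rap_il h1)
  have hp : ZPer (syn (il w.1)) := zper_syn _
  have hg : ∀ i j x, hat (gm Q w.1 i j) (tor x) = ((Q + hess (syn (il w.1)) x) i j : ℝ) :=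
    hat_gm hp hs fun k => by
      rw [cE_syn (rap_il h1) hr, il_apply]
      split_ifs with hk
      · rw [hk, ils_zero, Complex.ofReal_zero, zero_mul]
      · rfl
  have hh : ∀ x, hess (fun x => syn (il w.1) x - syn (il w.1) 0) x = hess (syn (il w.1)) x := by
    intro x
    ext i j
    show pd i (pd j _) x = pd i (pd j _) x
    rw [pd_sub_const]
  have hv : ∀ i j, w.2 i j = cE (zper_syn (w.2 i j)) (contDiff_syn (h2 i j)) := fun i j =>
    (cE_syn (h2 i j) (hr2 i j)).symm
  obtain ⟨e1, e2⟩ := Prod.ext_iff.1 hw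
  have hinv : ∀ x, (Q + hess (syn (il w.1)) x)⁻¹ = Matrix.of fun i j => syn (w.2 i j) x := by
    intro x
    refine Matrix.inv_eq_right_inv ?_
    ext i l
    have e3 : mm (gm Q w.1) w.2 = em1 := sub_eq_zero.1 e2
    have e4 := congrArg (fun c => hm c i l (tor x)) e3
    simp only [hm_mm, hm_em1, Matrix.mul_apply, ContinuousMap.sum_apply, ContinuousMap.mul_apply] at e4
    apply Complex.ofReal_injective
    rw [Matrix.mul_apply, Complex.ofReal_sum]
    refine Eq.trans (Finset.sum_congr rfl fun j _ => ?_) (e4.trans ?_)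
    · rw [Complex.ofReal_mul]
      show _ = hat (gm Q w.1 i j) (tor x) * hat (w.2 j l) (tor x)
      rw [hg, hv j l, hat_cE_tor]
      rfl
    · rw [Matrix.one_apply, Matrix.one_apply]
      split_ifs <;> simp
  refine ⟨fun x => syn (il w.1) x - syn (il w.1) 0, hs.sub contDiff_const, fun x k => ?_,
    sub_self _, fun x => ?_, fun x => ?_⟩
  · show syn _ _ - _ = syn _ _ - _
    rw [hp]
  · rw [hh]
    refine hpos x _ ?_ fun i j => hg i j x
    rw [Matrix.transpose_add, hQ, hess_transpose hs]
  · have e5 : ∑ i, ∑ j, Re i j (cE (zper_syn (w.2 i j)) (contDiff_syn (h2 i j))) - Pe w.1 =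
        (t : ℂ) • il (cE hAp hA) := by
      simp only [← hv]
      exact e1
    have e6 := ((sum_Re_eq_iff hA hAp hA0 t _ _ _).1 e5).2 x
    rw [← e6, abr]
    simp only [hh, hinv, Matrix.of_apply]

theorem exists_Phi_of_sol (hQ : Qᵀ = Q) (hA : ContDiff ℝ (⊤ : ℕ∞) A) (hAp : ZPer A)
    (hA0 : ∫ x in Set.Icc (0 : Fin n → ℝ) 1, A x = 0) {t : ℝ} {φ : (Fin n → ℝ) → ℝ}
    (hφ : Sol Q (fun x => t * A x) φ) : ∃ w : W n, Phi Q w = rhs hA hAp t ∧ symW cj w = w ∧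
      Rap w.1 ∧ (∀ i j, Rap (w.2 i j)) ∧ Function.Bijective (dPhi Q w) ∧
      (∀ i j x, hat (gm Q w.1 i j) (tor x) = ((Q + hess φ x) i j : ℝ)) ∧
      ∃ c > 0, ∀ x v, c * ∑ i, v i ^ 2 ≤ v ⬝ᵥ (Q + hess φ x) *ᵥ v := by
  have hs := hφ.smooth
  have hp := hφ.per
  set Φ : SF Unit n := ⟨fun _ => φ, fun _ => hs⟩
  have hpd : ∀ p, ((famG Q Φ).map (ev p)).PosDef := fun p => by
    rw [map_famG]
    exact hφ.pos p.2
  have hm1 : ∀ i j, (fun x => (Q + hess φ x)⁻¹ i j) = (fama hpd i j).fn () := fun i j => by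
    funext x
    exact (congrFun (congrFun (map_fama hpd ((), x)) i) j).symm
  have hms : ∀ i j, ContDiff ℝ (⊤ : ℕ∞) fun x => (Q + hess φ x)⁻¹ i j := fun i j => by
    rw [hm1]
    exact SF.smooth _ _
  have hhp : ∀ i j, ZPer fun x => hess φ x i j := fun i j => zper_pd (zper_pd hp j) i
  have hhp2 : ∀ x (k : Fin n → ℤ), hess φ (x + fun i => (k i : ℝ)) = hess φ x := fun x k => by
    ext i j
    exact hhp i j x k
  have hmp : ∀ i j, ZPer fun x => (Q + hess φ x)⁻¹ i j := fun i j x k => by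
    show (Q + hess φ _)⁻¹ i j = (Q + hess φ x)⁻¹ i j
    rw [hhp2]
  have hgp : ∀ i j, ZPer fun x => (Q + hess φ x) i j := fun i j x k => by
    show (Q + hess φ _) i j = (Q + hess φ x) i j
    rw [hhp2]
  have hgc : ∀ i j, Continuous fun x => (Q + hess φ x) i j := fun i j =>
    continuous_const.add (contDiff_pd (contDiff_pd hs j) i).continuous
  have hΔp : ZPer fun x => ∑ i, pd i (pd i φ) x := fun x k =>
    Finset.sum_congr rfl fun i _ => zper_pd (zper_pd hp i) i x k
  have hΔs : ContDiff ℝ (⊤ : ℕ∞) fun x => ∑ i, pd i (pd i φ) x :=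
    ContDiff.sum fun i _ => contDiff_pd (contDiff_pd hs i) i
  have e : cE hΔp hΔs = ∑ i, cE (zper_pd (zper_pd hp i) i) (contDiff_pd (contDiff_pd hs i) i) := by
    refine ell_ext fun x => ?_
    simp only [map_sum, ContinuousMap.sum_apply, hat_cE_tor, Complex.ofReal_sum]
  have hΔ : ∀ k, ils k * cE hΔp hΔs k = if k = 0 then 0 else cE hp hs k := by
    intro k
    rw [e, lp.coeFn_sum, Finset.sum_apply]
    simp only [cE_pd_pd hp hs]
    split_ifs with hk
    · rw [hk, ils_zero, Complex.ofReal_zero, zero_mul]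
    · have h1 := (nsq_pos hk).ne'
      have h2 : (4 * Real.pi ^ 2) ≠ 0 := by positivity
      have h3 : ils k * (-(4 * Real.pi ^ 2) * nsq k) = 1 := by
        rw [ils]
        field_simp
      rw [← Finset.sum_mul, ← Finset.mul_sum, ← mul_assoc]
      have h4 : ∑ i, ((k i : ℂ) * k i) = (nsq k : ℂ) := by
        simp [nsq, sq]
      rw [h4]
      have h5 := congrArg (Complex.ofReal) h3
      push_cast at h5
      rw [h5, one_mul]
  have hg := hat_gm (Q := Q) hp hs hΔ
  have hsym : ∀ x, (Q + hess φ x)ᵀ = Q + hess φ x := fun x => by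
    rw [Matrix.transpose_add, hQ, hess_transpose hs]
  have hdet : ∀ x, IsUnit (Q + hess φ x).det := fun x => (hφ.pos x).det_pos.ne'.isUnit
  obtain ⟨c, hc, -, hlow⟩ := exists_uniform_lower hφ.pos (fun i => hmp i i)
    fun i => (hms i i).continuous
  obtain ⟨c', hc', hc1, hlow'⟩ := exists_uniform_lower (fun x => (hφ.pos x).inv)
    (by simpa only [Matrix.nonsing_inv_nonsing_inv _ (hdet _)] using fun i => hgp i i)
    (by simpa only [Matrix.nonsing_inv_nonsing_inv _ (hdet _)] using fun i => hgc i i)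
  set v : EM n := fun i j => cE (hmp i j) (hms i j)
  have hv : ∀ i j x, hat (v i j) (tor x) = ((Q + hess φ x)⁻¹ i j : ℝ) := fun i j x =>
    hat_cE_tor _ _ _
  have hmm : mm (gm Q (cE hΔp hΔs)) v = em1 := by
    apply hm_injective
    ext i l t
    obtain ⟨x, rfl⟩ := tor_quot.surjective t
    rw [hm_mm, hm_em1, Matrix.mul_apply, ContinuousMap.sum_apply]
    simp only [hm, ContinuousMap.mul_apply, Matrix.of_apply, hg, hv, ← Complex.ofReal_mul,
      ← Complex.ofReal_sum]
    rw [← Matrix.mul_apply, Matrix.mul_nonsing_inv _ (hdet x), Matrix.one_apply, Matrix.one_apply]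
    split_ifs <;> simp
  have hvs : ∀ i j, v i j = v j i := fun i j => by
    refine ell_ext fun x => ?_
    rw [hv, hv]
    have : ((Q + hess φ x)⁻¹)ᵀ = (Q + hess φ x)⁻¹ := by
      rw [Matrix.transpose_nonsing_inv, hsym]
    rw [← congrFun (congrFun this j) i, Matrix.transpose_apply]
  have hcoer : Coer (c' ^ 2) v := by
    refine coer_of_lower (M := fun t => (Q + hess φ (Function.surjInv tor_quot.surjective t))⁻¹)
      (fun i j t => ?_) (fun t => (hφ.pos _).inv) hc'.le fun t => hlow' _
    rw [← hv, Function.surjInv_eq tor_quot.surjective t]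
  refine ⟨(cE hΔp hΔs, v), ?_, ?_, rap_cE hΔp hΔs,
    fun i j => rap_cE (hmp i j) (hms i j),
    dPhi_bijective hvs hmm (Kop_bijective (fun i j => rap_cE (hmp i j) (hms i j))
      (isUnit_Kop (by positivity) (pow_le_one₀ hc'.le hc1) hcoer)), hg, c, hc, hlow⟩
  · ext1
    · refine (sum_Re_eq_iff hA hAp hA0 t hmp hms _).2 ⟨?_, hφ.eq⟩
      rw [e, lp.coeFn_sum, Finset.sum_apply]
      simp [cE_pd_pd hp hs]
    · exact sub_eq_zero.2 hmm
  · ext1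
    · exact cj_cE hΔp hΔs
    · funext i j
      exact cj_cE (hmp i j) (hms i j)

end

section

open Filter Topology ComplexConjugate
open scoped NNReal ENNReal

variable {n : ℕ} {Q : Matrix (Fin n) (Fin n) ℝ} {A : (Fin n → ℝ) → ℝ}

lemma _root_.Matrix.PosDef.of_close {M N : Matrix (Fin n) (Fin n) ℝ} {c : ℝ} (hc : 0 < c)
    (hN : ∀ v : Fin n → ℝ, c * ∑ i, v i ^ 2 ≤ v ⬝ᵥ N *ᵥ v) (hM : Mᵀ = M)
    (h : ∀ i j, |M i j - N i j| ≤ c / (n + 1)) : M.PosDef := by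
  refine Matrix.PosDef.of_dotProduct_mulVec_pos (by rw [Matrix.IsHermitian, ← hM]; simp [hM])
    fun v hv => ?_
  rw [star_trivial]
  have hn : (0 : ℝ) < n + 1 := by positivity
  have h0 : 0 < ∑ i, v i ^ 2 := by
    obtain ⟨i, hi⟩ := Function.ne_iff.1 hv
    exact Finset.sum_pos' (fun i _ => sq_nonneg _) ⟨i, Finset.mem_univ _, sq_pos_of_ne_zero hi⟩
  have h1 : v ⬝ᵥ M *ᵥ v = v ⬝ᵥ N *ᵥ v + ∑ i, ∑ j, v i * ((M i j - N i j) * v j) := by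
    simp only [dotProduct, Matrix.mulVec, Finset.mul_sum, ← Finset.sum_add_distrib]
    exact Finset.sum_congr rfl fun i _ => Finset.sum_congr rfl fun j _ => by ring
  have h2 : ∀ i j, -(c / (n + 1) * ((v i ^ 2 + v j ^ 2) / 2)) ≤ v i * ((M i j - N i j) * v j) := by
    intro i j
    have h3 : |v i * ((M i j - N i j) * v j)| ≤ c / (n + 1) * ((v i ^ 2 + v j ^ 2) / 2) := by
      rw [abs_mul, abs_mul, mul_left_comm]
      refine mul_le_mul (h i j) ?_ (by positivity) (by positivity)
      nlinarith only [sq_nonneg (|v i| - |v j|), sq_abs (v i), sq_abs (v j)]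
    exact (abs_le.1 h3).1
  have h4 : -(c / (n + 1) * (n * ∑ i, v i ^ 2)) ≤ ∑ i, ∑ j, v i * ((M i j - N i j) * v j) := by
    refine le_trans (le_of_eq ?_)
      (Finset.sum_le_sum fun i _ => Finset.sum_le_sum fun j _ => h2 i j)
    simp only [Finset.sum_neg_distrib, ← Finset.mul_sum, ← Finset.sum_div, Finset.sum_add_distrib,
      Finset.sum_const, Finset.card_univ, Fintype.card_fin, nsmul_eq_mul]
    ring
  have h5 := hN v
  have h6 : c / (n + 1) * (n * ∑ i, v i ^ 2) < c * ∑ i, v i ^ 2 := by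
    rw [div_mul_eq_mul_div, div_lt_iff₀ hn]
    nlinarith only [mul_pos hc h0]
  linarith only [h1, h4, h5, h6]

lemma continuous_hat_gm (i j : Fin n) : Continuous fun w : W n => hat (gm Q w.1 i j) :=
  (hat.continuous.comp (continuous_const.add ((Re i j).continuous.comp continuous_fst)))

/-- The set of parameters for which the equation is solvable is open. -/
theorem sol_open (hQ : Qᵀ = Q) (hA : ContDiff ℝ (⊤ : ℕ∞) A) (hAp : ZPer A)
    (hA0 : ∫ x in Set.Icc (0 : Fin n → ℝ) 1, A x = 0) {t₀ : ℝ} {φ₀ : (Fin n → ℝ) → ℝ}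
    (h : Sol Q (fun x => t₀ * A x) φ₀) : ∀ᶠ t in 𝓝 t₀, ∃ φ, Sol Q (fun x => t * A x) φ := by
  obtain ⟨w, hw, hc, h1, h2, hb, hg, c, hc0, hlow⟩ := exists_Phi_of_sol hQ hA hAp hA0 h
  obtain ⟨Ψ, hΨ, hΨc, hev⟩ := exists_branch hb h1 h2 hc
  rw [hw] at hΨ hΨc hev
  have hr : Continuous fun t => rhs hA hAp t :=
    (Complex.continuous_ofReal.smul continuous_const).prodMk continuous_const
  have hδ : 0 < c / (n + 1) := by positivity
  have hcl : ∀ᶠ t in 𝓝 t₀, ∀ i j,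
      dist (hat (gm Q (Ψ (rhs hA hAp t)).1 i j)) (hat (gm Q w.1 i j)) < c / (n + 1) := by
    rw [eventually_all]
    intro i
    rw [eventually_all]
    intro j
    have := (continuous_hat_gm (Q := Q) i j).continuousAt.comp (hΨc.comp hr.continuousAt)
    have := Metric.tendsto_nhds.1 this _ hδ
    simpa only [Function.comp, hΨ] using this
  filter_upwards [hcl, hr.continuousAt.eventually hev] with t ht ⟨e, hsym⟩
  obtain ⟨s1, s2, s3⟩ := hsym
    ((rap_il (rap_cE hAp hA)).mono |t| (abs_nonneg _) fun k => by
      show ‖(t : ℂ) * il (cE hAp hA) k‖ ≤ _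
      rw [norm_mul, Complex.norm_real, Real.norm_eq_abs]) rfl
    (by
      ext k
      have e2 : conj (il (cE hAp hA) (-k)) = il (cE hAp hA) k := by
        rw [← cj_apply, cj_il, cj_cE]
      show conj ((t : ℂ) * il (cE hAp hA) (-k)) = (t : ℂ) * il (cE hAp hA) k
      rw [map_mul, Complex.conj_ofReal, e2])
  refine sol_of_Phi hQ hA hAp hA0 e s1 s2 s3 fun x M hM hMx => .of_close hc0 (hlow x) hM fun i j => ?_
  have h3 := (ContinuousMap.dist_apply_le_dist (tor x)).trans (ht i j).le
  rwa [hMx, hg, Complex.dist_eq, ← Complex.ofReal_sub, Complex.norm_real, Real.norm_eq_abs] at h3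

end

section

open Filter Topology ComplexConjugate
open scoped NNReal ENNReal

variable {n : ℕ}

lemma eq_of_pd_const {g : (Fin n → ℝ) → ℝ} (hg : Differentiable ℝ g) {a : Fin n → ℝ}
    (h : ∀ i x, pd i g x = a i) (x : Fin n → ℝ) : g x = g 0 + ∑ i, a i * x i := by
  have h1 : ∀ s : ℝ, HasDerivAt (fun s : ℝ => g (0 + s • x) - s * ∑ i, a i * x i) 0 s := fun s => by
    have h2 := (hasDerivAt_line hg 0 x s).sub ((hasDerivAt_id s).mul_const (∑ i, a i * x i))
    have h3 : fderiv ℝ g (0 + s • x) x = ∑ i, a i * x i := by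
      rw [fderiv_eq_sum]
      exact Finset.sum_congr rfl fun i _ => by rw [h, mul_comm]
    rw [h3, one_mul, sub_self] at h2
    exact h2
  have h4 := is_const_of_deriv_eq_zero (fun s => (h1 s).differentiableAt) (fun s => (h1 s).deriv) 1 0
  simp only [one_smul, zero_smul, zero_add, one_mul, zero_mul, sub_zero] at h4
  linarith only [h4]

lemma pd_shift_sub {g : (Fin n → ℝ) → ℝ} (hg : Differentiable ℝ g) (v : Fin n → ℝ) (i : Fin n)
    (x : Fin n → ℝ) : pd i (fun x => g (x + v) - g x) x = pd i g (x + v) - pd i g x := by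
  have h : DifferentiableAt ℝ (fun x => g (x + v)) x := (hg _).comp x (differentiableAt_id.add_const v)
  simp only [pd]
  rw [fderiv_fun_sub h (hg x), fderiv_comp_add_right]
  rfl

lemma zper_of_single {g : (Fin n → ℝ) → ℝ} (h : ∀ i x, g (x + Pi.single i 1) = g x) : ZPer g := by
  let S : AddSubgroup (Fin n → ℝ) :=
    { carrier := {v | ∀ x, g (x + v) = g x}
      zero_mem' := fun x => by rw [add_zero]
      add_mem' := fun {v w} hv hw x => by rw [← add_assoc, hw, hv]
      neg_mem' := fun {v} hv x => by rw [← hv (x + -v), neg_add_cancel_right] }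
  intro x k
  have hk : (fun i => (k i : ℝ)) = ∑ i, k i • (Pi.single i 1 : Fin n → ℝ) := by
    ext j
    simp [Finset.sum_apply, Pi.single_apply]
  have : (fun i => (k i : ℝ)) ∈ S := by
    rw [hk]
    exact sum_mem fun i _ => zsmul_mem (show Pi.single i 1 ∈ S from h i) _
  exact this x

lemma pd_eq_of_expansion {g : (Fin n → ℝ) → ℝ} (hg : Differentiable ℝ g) {i : Fin n}
    {x : Fin n → ℝ} {b c : ℝ} (h : ∀ s : ℝ, g (x + s • Pi.single i 1) = g x + s * b + s ^ 2 * c) :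
    pd i g x = b := by
  have h1 := hasDerivAt_line hg x (Pi.single i 1) 0
  rw [zero_smul, add_zero, funext h] at h1
  have h2 := (((hasDerivAt_id (0 : ℝ)).mul_const b).const_add (g x)).add
    (((hasDerivAt_id (0 : ℝ)).pow 2).mul_const c)
  have h3 := h1.unique h2
  simpa [pd] using h3

lemma hess_add {f g : (Fin n → ℝ) → ℝ} (hf : ContDiff ℝ (⊤ : ℕ∞) f) (hg : ContDiff ℝ (⊤ : ℕ∞) g)
    (x : Fin n → ℝ) : hess (fun y => f y + g y) x = hess f x + hess g x := by
  have h : ∀ {f g : (Fin n → ℝ) → ℝ}, ContDiff ℝ (⊤ : ℕ∞) f → ContDiff ℝ (⊤ : ℕ∞) g → ∀ i,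
      pd i (fun y => f y + g y) = fun y => pd i f y + pd i g y := fun hf hg i => by
    funext y
    simp only [pd]
    rw [fderiv_fun_add (hf.differentiable (by simp) y) (hg.differentiable (by simp) y)]
    rfl
  ext i j
  show pd i (pd j _) x = pd i (pd j f) x + pd i (pd j g) x
  rw [h hf hg, h (contDiff_pd hf j) (contDiff_pd hg j)]

/-- A function with periodic Hessian is the sum of a quadratic and a periodic function. -/
lemma exists_quadratic_add_periodic {f : (Fin n → ℝ) → ℝ} (hf : ContDiff ℝ (⊤ : ℕ∞) f)
    (hfper : ∀ (x : Fin n → ℝ) (k : Fin n → ℤ), hess f (x + fun i => (k i : ℝ)) = hess f x) :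
    ∃ (Q : Matrix (Fin n) (Fin n) ℝ) (q p : (Fin n → ℝ) → ℝ), ContDiff ℝ (⊤ : ℕ∞) q ∧
      ContDiff ℝ (⊤ : ℕ∞) p ∧ ZPer p ∧ (∀ x, hess q x = Q) ∧ f = fun x => q x + p x := by
  have hd := hf.differentiable (by simp : ((⊤ : ℕ∞) : WithTop ℕ∞) ≠ 0)
  have hdp := fun i => (contDiff_pd hf i).differentiable (by simp : ((⊤ : ℕ∞) : WithTop ℕ∞) ≠ 0)
  let Q : Matrix (Fin n) (Fin n) ℝ := fun i j => pd i f (0 + Pi.single j 1) - pd i f 0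
  have hshift : ∀ {g : (Fin n → ℝ) → ℝ}, Differentiable ℝ g → ∀ v : Fin n → ℝ,
      Differentiable ℝ fun x => g (x + v) - g x := fun hg v =>
    (hg.comp (differentiable_id.add_const v)).sub hg
  have h1 : ∀ i j x, pd i f (x + Pi.single j 1) - pd i f x = Q i j := fun i j x => by
    refine (eq_of_pd_const (a := 0) (hshift (hdp i) (Pi.single j 1)) (fun l y => ?_) x).trans ?_
    · rw [pd_shift_sub (hdp i)]
      have h2 := congrFun (congrFun (hfper y (Pi.single j 1)) l) i
      have h3 : (fun i => ((Pi.single j 1 : Fin n → ℤ) i : ℝ)) = Pi.single j 1 := by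
        ext l
        simp [Pi.single_apply]
      rw [h3] at h2
      exact sub_eq_zero.2 h2
    · simp [Q]
  have h2 : ∀ j x, f (x + Pi.single j 1) - f x = f (Pi.single j 1) - f 0 + ∑ i, Q i j * x i :=
    fun j x => by
      have := eq_of_pd_const (a := fun i => Q i j) (hshift hd (Pi.single j 1))
        (fun i x => by rw [pd_shift_sub hd, h1]) x
      rwa [zero_add] at this
  have hQ : ∀ i j, Q i j = Q j i := fun i j => by
    have e1 := h2 j (Pi.single i 1)
    have e2 := h2 i (Pi.single j 1)
    rw [add_comm] at e2
    simp only [Pi.single_apply, mul_ite, mul_one, mul_zero, Finset.sum_ite_eq', Finset.mem_univ,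
      if_true] at e1 e2
    linarith only [e1, e2]
  let l : Fin n → ℝ := fun j => f (Pi.single j 1) - f 0 - Q j j / 2
  let q : (Fin n → ℝ) → ℝ := fun x => (∑ i, ∑ j, Q i j * x i * x j) / 2 + ∑ j, l j * x j
  have hq : ContDiff ℝ (⊤ : ℕ∞) q := by fun_prop
  have hlin : ∀ (a : Fin n → ℝ) (x : Fin n → ℝ) (i : Fin n) (s : ℝ),
      ∑ j, a j * (x + s • Pi.single i 1 : Fin n → ℝ) j = ∑ j, a j * x j + s * a i := by
    intro a x i s
    simp only [Pi.add_apply, Pi.smul_apply, Pi.single_apply, smul_eq_mul, mul_add,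
      Finset.sum_add_distrib, mul_ite, mul_one, mul_zero, Finset.sum_ite_eq', Finset.mem_univ,
      if_true]
    rw [mul_comm]
  have hexp : ∀ x i (s : ℝ), q (x + s • Pi.single i 1) =
      q x + s * (∑ j, Q i j * x j + l i) + s ^ 2 * (Q i i / 2) := by
    intro x i s
    have e : ∀ y : Fin n → ℝ, ∑ i, ∑ j, Q i j * y i * y j = ∑ i, (∑ j, Q i j * y j) * y i :=
      fun y => Finset.sum_congr rfl fun i _ => by
        rw [Finset.sum_mul]
        exact Finset.sum_congr rfl fun j _ => by ring
    have e2 : ∑ j, (∑ k, Q j k * x k + s * Q j i) * x j =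
        ∑ j, (∑ k, Q j k * x k) * x j + s * ∑ j, Q i j * x j := by
      rw [Finset.mul_sum, ← Finset.sum_add_distrib]
      exact Finset.sum_congr rfl fun j _ => by rw [hQ i j]; ring
    simp only [q, e, hlin, e2]
    ring
  have hpq : ∀ i, pd i q = fun x => ∑ j, Q i j * x j + l i := fun i =>
    funext fun x => pd_eq_of_expansion (hq.differentiable (by simp)) fun s => hexp x i s
  refine ⟨Q, q, fun x => f x - q x, hq, hf.sub hq, zper_of_single fun i x => ?_, fun x => ?_,
    funext fun x => by ring⟩
  · have e1 := hexp x i 1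
    have e2 := h2 i x
    rw [one_smul] at e1
    simp only [hQ _ i] at e2
    simp only [e1, l]
    linarith only [e2]
  · ext i j
    show pd i (pd j q) x = Q i j
    rw [hpq, hQ i j]
    refine pd_eq_of_expansion (c := 0) (by fun_prop) fun s => ?_
    rw [hlin]
    ring

lemma posDef_of_add_hess {Q : Matrix (Fin n) (Fin n) ℝ} {p : (Fin n → ℝ) → ℝ} (hQ : Qᵀ = Q)
    (hp : ContDiff ℝ (⊤ : ℕ∞) p) (hper : ZPer p) (h : ∀ x, (Q + hess p x).PosDef) : Q.PosDef := by
  obtain ⟨x₀, hx⟩ := Abreu.ZPer.exists_max hper hp.continuous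
  let P : SF Unit n := ⟨fun _ => p, fun _ => hp⟩
  refine Matrix.PosDef.of_dotProduct_mulVec_pos (by rw [Matrix.IsHermitian, ← hQ]; simp [hQ])
    fun v hv => ?_
  have h1 := (max_principle (f := P) (i := ()) hx v).2
  have h2 : ev ((), x₀) (dv v (dv v P)) = v ⬝ᵥ hess p x₀ *ᵥ v := by
    rw [dv_eq_sum v P, map_sum, map_sum]
    simp only [dv_eq_sum v, Derivation.map_smul, map_sum, map_smul, dotProduct, Matrix.mulVec,
      Finset.mul_sum, smul_eq_mul]
    rw [Finset.sum_comm]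
    refine Finset.sum_congr rfl fun i _ => Finset.sum_congr rfl fun j _ => ?_
    show _ = v i * (ev ((), x₀) (dd i (dd j P)) * v j)
    ring
  have h3 := (h x₀).dotProduct_mulVec_pos hv
  rw [star_trivial, Matrix.add_mulVec, dotProduct_add, ← h2] at h3
  rw [star_trivial]
  linarith only [h1, h3]

lemma sol_zero {Q : Matrix (Fin n) (Fin n) ℝ} (hQ : Q.PosDef) : Sol Q (fun _ => 0) fun _ => 0 := by
  have h : ∀ (c : ℝ) (i : Fin n), pd i (fun _ => c) = fun _ => 0 := fun c i => by
    funext x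
    simp [pd]
  have h2 : ∀ x : Fin n → ℝ, hess (fun _ => 0) x = 0 := fun x => by
    ext i j
    simp [hess, h]
  refine ⟨contDiff_const, fun x k => rfl, rfl, fun x => by rwa [h2, add_zero], fun x => ?_⟩
  simp [abr, h2, h]

theorem exists_sol {Q : Matrix (Fin n) (Fin n) ℝ} {A : (Fin n → ℝ) → ℝ} (hQ : Q.PosDef)
    (hs : Qᵀ = Q) (hA : ContDiff ℝ (⊤ : ℕ∞) A) (hAp : ZPer A)
    (hA0 : ∫ x in Set.Icc (0 : Fin n → ℝ) 1, A x = 0) : ∃ φ, Sol Q A φ := by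
  have h : Set.Icc (0 : ℝ) 1 ⊆ {t | ∃ φ, Sol Q (fun x => t * A x) φ} := by
    refine IsClosed.Icc_subset_of_forall_mem_nhdsWithin ?_ ?_ ?_
    · refine IsSeqClosed.isClosed fun t t₀ ht hlim => ⟨sol_closed hQ hA hAp hlim (fun k => ?_)
        fun k => (ht k).1, isClosed_Icc.mem_of_tendsto hlim (.of_forall fun k => (ht k).2)⟩
      rw [abs_of_nonneg (ht k).2.1]
      exact (ht k).2.2
    · simp only [Set.mem_ofPred_eq, zero_mul]
      exact ⟨_, sol_zero hQ⟩
    · rintro t ⟨⟨φ, hφ⟩, -⟩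
      exact mem_nhdsWithin_of_mem_nhds (sol_open hs hA hAp hA0 hφ)
  obtain ⟨φ, hφ⟩ := h (Set.right_mem_Icc.2 zero_le_one)
  exact ⟨φ, by simpa only [one_mul] using hφ⟩

end

end
end Abreu

theorem abreu_periodic_existence_general {n : ℕ} (f A : (Fin n → ℝ) → ℝ)
    (hf : ContDiff ℝ (⊤ : ℕ∞) f) (hfconv : StrictConvexOn ℝ Set.univ f)
    (hfpos : ∀ x, (hess f x).PosDef)
    (hfper : ∀ (x : Fin n → ℝ) (k : Fin n → ℤ),
      hess f (x + fun i => (k i : ℝ)) = hess f x)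
    (hA : ContDiff ℝ (⊤ : ℕ∞) A) (hAper : ZPer A)
    (hAmean : ∫ x in Set.Icc (0 : Fin n → ℝ) 1, A x = 0) :
    ∃ φ : (Fin n → ℝ) → ℝ, ContDiff ℝ (⊤ : ℕ∞) φ ∧ ZPer φ ∧
      (∀ x, (hess (fun y => f y + φ y) x).PosDef) ∧
      (∀ x, abreuOp (fun y => f y + φ y) x = A x) := by
  obtain ⟨Q, q, p, hq, hp, hper, hqQ, rfl⟩ := Abreu.exists_quadratic_add_periodic hf hfper
  have hQ : Qᵀ = Q := by rw [← hqQ 0, Abreu.hess_transpose hq]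
  obtain ⟨φ, hφ⟩ := Abreu.exists_sol (Abreu.posDef_of_add_hess hQ hp hper fun x => by
    rw [← hqQ x, ← Abreu.hess_add hq hp]
    exact hfpos x) hQ hA hAper hAmean
  have e : (fun y => q y + p y + (φ y - p y)) = fun y => q y + φ y := by
    funext y
    ring
  have h : ∀ x, hess (fun y => q y + φ y) x = Q + hess φ x := fun x => by
    rw [Abreu.hess_add hq hφ.smooth, hqQ]
  refine ⟨fun x => φ x - p x, hφ.smooth.sub hp, fun x k => ?_, fun x => ?_, fun x => ?_⟩
  · show φ _ - p _ = φ x - p x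
    rw [hφ.per, hper]
  · rw [e, h]
    exact hφ.pos x
  · rw [e]
    show Abreu.abr (hess fun y => q y + φ y) x = A x
    rw [funext h]
    exact hφ.eq x
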